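/- There exist constants c > 0 and f ∈ (0,1) such that for each δ ∈ (0,1) and each prime p sufficiently large depending on δ, there exists a set A ⊆ 𝔽_p with p^{fδ} < |A| < p^{δ} and max(|A+A|, |AA|) ≤ |A|^{2−c}. -/

import Mathlib

open Pointwise

section GolodShafarevich

variable {G : Type} [Group G]

/-- The submodule generated by the differences `g • m - m` with `m ∈ N`. -/
noncomputable def augMul {M : Type} [AddCommGroup M]
    [Module (MonoidAlgebra (ZMod 2) G) M] (N : Submodule (MonoidAlgebra (ZMod 2) G) M) :
    Submodule (MonoidAlgebra (ZMod 2) G) M :=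
  Submodule.span _ {x | ∃ (g : G), ∃ m ∈ N, x = MonoidAlgebra.of (ZMod 2) G g • m - m}

theorem exists_invariant_functional [Finite G] (hG : IsPGroup 2 G) {M : Type} [AddCommGroup M]
    [Module (MonoidAlgebra (ZMod 2) G) M] [Finite M] [Nontrivial M] :
    ∃ f : M →+ ZMod 2, f ≠ 0 ∧ ∀ (g : G) (m : M), f (MonoidAlgebra.of (ZMod 2) G g • m) = f m := by
  classical
  let _ : Module (ZMod 2) M := Module.compHom M (algebraMap (ZMod 2) (MonoidAlgebra (ZMod 2) G))
  let _ : MulAction G (Module.Dual (ZMod 2) M) :=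
    { smul := fun g f => AddMonoidHom.toZModLinearMap 2
        (f.toAddMonoidHom.comp (DistribSMul.toAddMonoidHom M (MonoidAlgebra.of (ZMod 2) G g⁻¹)))
      one_smul := fun f => by
        ext m
        change f (MonoidAlgebra.of (ZMod 2) G 1⁻¹ • m) = f m
        rw [inv_one, map_one, one_smul]
      mul_smul := fun g h f => by
        ext m
        change f (MonoidAlgebra.of (ZMod 2) G (g * h)⁻¹ • m) =
          f (MonoidAlgebra.of (ZMod 2) G h⁻¹ • MonoidAlgebra.of (ZMod 2) G g⁻¹ • m)
        rw [smul_smul, ← map_mul, mul_inv_rev] }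
  have : Finite (Module.Dual (ZMod 2) M) := Finite.of_injective (fun f => (f : M → ZMod 2))
    DFunLike.coe_injective
  have h2 : 2 ∣ Nat.card (Module.Dual (ZMod 2) M) := by
    rw [Module.natCard_eq_pow_finrank (K := ZMod 2), Subspace.dual_finrank_eq, Nat.card_zmod]
    exact dvd_pow_self _ Module.finrank_pos.ne'
  have : Fact (Nat.Prime 2) := ⟨Nat.prime_two⟩
  obtain ⟨f, hf, hf0⟩ := hG.exists_fixed_point_of_prime_dvd_card_of_fixed_point
    (Module.Dual (ZMod 2) M) h2 (a := 0) (fun g => by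
      ext m; rfl)
  refine ⟨f.toAddMonoidHom, fun h => hf0 ?_, fun g m => ?_⟩
  · ext m
    exact (DFunLike.congr_fun h m).symm
  · have := DFunLike.congr_fun (hf g⁻¹) m
    change f (MonoidAlgebra.of (ZMod 2) G (g⁻¹)⁻¹ • m) = f m at this
    rwa [inv_inv] at this

theorem zmod_two_eq (r : ZMod 2) : r = 0 ∨ r = 1 := by
  revert r
  decide

theorem invariant_functional_augMul {M : Type} [AddCommGroup M]
    [Module (MonoidAlgebra (ZMod 2) G) M] (f : M →+ ZMod 2)
    (hf : ∀ (g : G) (m : M), f (MonoidAlgebra.of (ZMod 2) G g • m) = f m)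
    {N : Submodule (MonoidAlgebra (ZMod 2) G) M} {x : M}
    (hx : x ∈ augMul N) : f x = 0 := by
  have key : ∀ (a : MonoidAlgebra (ZMod 2) G) (y : M), f y = 0 → f (a • y) = 0 := by
    intro a y hy
    induction a using MonoidAlgebra.induction_on with
    | of g => rw [hf, hy]
    | add a b ha hb => rw [add_smul, map_add, ha, hb, add_zero]
    | smul r a ha =>
      rcases zmod_two_eq r with rfl | rfl
      · simp
      · rwa [one_smul]
  unfold augMul at hx
  induction hx using Submodule.span_induction with
  | mem x h =>
    obtain ⟨g, m, _, rfl⟩ := h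
    rw [map_sub, hf, sub_self]
  | zero => exact map_zero f
  | add x y _ _ hx hy => rw [map_add, hx, hy, add_zero]
  | smul a x _ hx => exact key a x hx

theorem map_augMul {M M' : Type} [AddCommGroup M] [AddCommGroup M']
    [Module (MonoidAlgebra (ZMod 2) G) M] [Module (MonoidAlgebra (ZMod 2) G) M']
    (φ : M →ₗ[MonoidAlgebra (ZMod 2) G] M') (N : Submodule (MonoidAlgebra (ZMod 2) G) M) :
    (augMul N).map φ = augMul (N.map φ) := by
  unfold augMul
  rw [Submodule.map_span]
  congr 1
  ext y
  constructor
  · rintro ⟨_, ⟨g, m, hm, rfl⟩, rfl⟩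
    exact ⟨g, φ m, Submodule.mem_map_of_mem hm, by rw [map_sub, map_smul]⟩
  · rintro ⟨g, _, ⟨m, hm, rfl⟩, rfl⟩
    exact ⟨_, ⟨g, m, hm, rfl⟩, by rw [map_sub, map_smul]⟩

theorem augMul_mono {M : Type} [AddCommGroup M] [Module (MonoidAlgebra (ZMod 2) G) M]
    {N P : Submodule (MonoidAlgebra (ZMod 2) G) M} (h : N ≤ P) : augMul N ≤ augMul P :=
  Submodule.span_mono fun _ ⟨g, m, hm, hx⟩ => ⟨g, m, h hm, hx⟩

theorem augMul_le {M : Type} [AddCommGroup M] [Module (MonoidAlgebra (ZMod 2) G) M]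
    (N : Submodule (MonoidAlgebra (ZMod 2) G) M) : augMul N ≤ N :=
  Submodule.span_le.2 fun _ ⟨_, _, hm, hx⟩ => hx ▸ N.sub_mem (N.smul_mem _ hm) hm

theorem eq_bot_of_augMul_eq [Finite G] (hG : IsPGroup 2 G) {M : Type} [AddCommGroup M]
    [Module (MonoidAlgebra (ZMod 2) G) M] [Finite M] {P : Submodule (MonoidAlgebra (ZMod 2) G) M}
    (h : P ≤ augMul P) : P = ⊥ := by
  by_contra hP
  have : Nontrivial P := Submodule.nontrivial_iff_ne_bot.2 hP
  obtain ⟨f, hf0, hf⟩ := exists_invariant_functional hG (M := P)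
  apply hf0
  ext x
  have hx : (x : M) ∈ (augMul (⊤ : Submodule _ P)).map P.subtype := by
    rw [map_augMul, Submodule.map_subtype_top]
    exact h x.2
  obtain ⟨y, hy, hyx⟩ := hx
  rw [← Subtype.ext hyx]
  exact invariant_functional_augMul f hf hy

theorem le_of_le_sup_augMul [Finite G] (hG : IsPGroup 2 G) {M : Type} [AddCommGroup M]
    [Module (MonoidAlgebra (ZMod 2) G) M] [Finite M]
    {N P : Submodule (MonoidAlgebra (ZMod 2) G) M}
    (h : P ≤ N ⊔ augMul P) : P ≤ N := by
  have : Finite (M ⧸ N) := Finite.of_surjective _ (Submodule.mkQ_surjective N)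
  have h1 : P.map N.mkQ ≤ augMul (P.map N.mkQ) := by
    rw [← map_augMul]
    refine (Submodule.map_mono h).trans ?_
    rw [Submodule.map_sup]
    refine sup_le ?_ le_rfl
    rw [Submodule.map_le_iff_le_comap]
    intro x hx
    simpa using Submodule.mem_sup_left hx
  have h2 := eq_bot_of_augMul_eq hG h1
  intro x hx
  have : N.mkQ x ∈ P.map N.mkQ := Submodule.mem_map_of_mem hx
  rw [h2, Submodule.mem_bot] at this
  exact (Submodule.Quotient.mk_eq_zero N).1 this

theorem golodShafarevich_unbounded (d r : ℕ) (hd : 2 ≤ d) (hr : 4 * r ≤ d ^ 2) (a : ℕ → ℕ)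
    (h1 : a 1 = 1) (h0 : a 0 = 0)
    (h : ∀ n, 1 + d * a (n + 1) ≤ a (n + 2) + r * a n) (n : ℕ) : n ≤ a n := by
  have hd0 : (0 : ℝ) < d := by exact_mod_cast (by omega : 0 < d)
  have key : ∀ n : ℕ, (n : ℝ) ≤ a n ∧ (d : ℝ) / 2 * a n + 1 ≤ a (n + 1) := by
    intro n
    induction n with
    | zero => simp [h0, h1]
    | succ n ih =>
      obtain ⟨ih1, ih2⟩ := ih
      have hn : (1 : ℝ) + d * a (n + 1) ≤ a (n + 2) + r * a n := by exact_mod_cast h n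
      have hr' : (4 : ℝ) * r ≤ d ^ 2 := by exact_mod_cast hr
      have hd' : (2 : ℝ) ≤ d := by exact_mod_cast hd
      have ha : (0 : ℝ) ≤ a n := Nat.cast_nonneg _
      refine ⟨?_, ?_⟩
      · push_cast
        nlinarith
      · have : (r : ℝ) * a n ≤ d ^ 2 / 4 * a n := by nlinarith
        have : (d : ℝ) / 2 * ((d : ℝ) / 2 * a n + 1) ≤ d / 2 * a (n + 1) := by gcongr
        nlinarith
  exact_mod_cast (key n).1

theorem finrank_map_add_finrank_inf_ker {M M' : Type} [AddCommGroup M] [AddCommGroup M']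
    [Module (MonoidAlgebra (ZMod 2) G) M] [Module (MonoidAlgebra (ZMod 2) G) M']
    [Module (ZMod 2) M] [Module (ZMod 2) M'] [IsScalarTower (ZMod 2) (MonoidAlgebra (ZMod 2) G) M]
    [IsScalarTower (ZMod 2) (MonoidAlgebra (ZMod 2) G) M'] [Finite M]
    (φ : M →ₗ[MonoidAlgebra (ZMod 2) G] M') (N : Submodule (MonoidAlgebra (ZMod 2) G) M) :
    Module.finrank (ZMod 2) (N.map φ) +
      Module.finrank (ZMod 2) (N ⊓ LinearMap.ker φ : Submodule _ M) =
      Module.finrank (ZMod 2) N := by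
  let ψ : N →ₗ[ZMod 2] M' := (φ.comp N.subtype).restrictScalars (ZMod 2)
  rw [← LinearMap.finrank_range_add_finrank_ker ψ]
  congr 1
  · refine LinearEquiv.finrank_eq (LinearEquiv.ofEq (R := ZMod 2)
      ((N.map φ).restrictScalars (ZMod 2)) _ ?_)
    ext x
    simp [ψ]
  · refine LinearEquiv.finrank_eq ?_
    refine LinearEquiv.symm (LinearEquiv.ofBijective
        ({ toFun := fun x => ⟨x.1.1, x.1.2, x.2⟩, map_add' := fun _ _ => rfl,
           map_smul' := fun _ _ => rfl } :
          ψ.ker →ₗ[ZMod 2] (N ⊓ LinearMap.ker φ : Submodule _ M)) ⟨?_, ?_⟩)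
    · intro x y h
      exact Subtype.ext (Subtype.ext (congrArg (fun z => z.1) h))
    · rintro ⟨x, hx1, hx2⟩
      exact ⟨⟨⟨x, hx1⟩, hx2⟩, rfl⟩

theorem augMul_pi {r : ℕ} (N : Submodule (MonoidAlgebra (ZMod 2) G) (MonoidAlgebra (ZMod 2) G)) :
    augMul (Submodule.pi Set.univ fun _ : Fin r => N) =
      Submodule.pi Set.univ fun _ : Fin r => augMul N := by
  classical
  apply le_antisymm
  · refine Submodule.span_le.2 ?_
    rintro _ ⟨g, m, hm, rfl⟩ i hi
    exact Submodule.subset_span ⟨g, m i, hm i hi, rfl⟩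
  · intro x hx
    rw [← Finset.univ_sum_single x]
    refine Submodule.sum_mem _ fun i _ => ?_
    have h1 : (augMul N).map (LinearMap.single (MonoidAlgebra (ZMod 2) G)
        (fun _ : Fin r => MonoidAlgebra (ZMod 2) G) i) ≤
        augMul (Submodule.pi Set.univ fun _ : Fin r => N) := by
      rw [map_augMul]
      apply augMul_mono
      rintro _ ⟨y, hy, rfl⟩ j _
      by_cases hj : j = i
      · subst hj; simpa using hy
      · simp [hj]
    exact h1 (Submodule.mem_map_of_mem (hx i trivial))

theorem finrank_pi_const [Finite G] {r : ℕ}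
    (N : Submodule (MonoidAlgebra (ZMod 2) G) (MonoidAlgebra (ZMod 2) G)) :
    Module.finrank (ZMod 2) (Submodule.pi Set.univ fun _ : Fin r => N :
      Submodule _ (Fin r → MonoidAlgebra (ZMod 2) G)) = r * Module.finrank (ZMod 2) N := by
  have : Finite (MonoidAlgebra (ZMod 2) G) := Module.finite_of_finite (ZMod 2)
  let e : (Submodule.pi Set.univ fun _ : Fin r => N :
      Submodule _ (Fin r → MonoidAlgebra (ZMod 2) G)) ≃ₗ[ZMod 2] (Fin r → N) :=
    { toFun := fun x i => ⟨x.1 i, x.2 i trivial⟩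
      invFun := fun x => ⟨fun i => x i, fun i _ => (x i).2⟩
      map_add' := fun _ _ => rfl
      map_smul' := fun _ _ => rfl
      left_inv := fun _ => rfl
      right_inv := fun _ => rfl }
  rw [e.finrank_eq, Module.finrank_pi_fintype]
  simp

/-- The sum of the coefficients. -/
noncomputable def augMap (G : Type) [Group G] : MonoidAlgebra (ZMod 2) G →+ ZMod 2 :=
  (MonoidAlgebra.lift (ZMod 2) (ZMod 2) G (1 : G →* ZMod 2)).toAddMonoidHom

theorem augMap_of (g : G) : augMap G (MonoidAlgebra.of (ZMod 2) G g) = 1 := by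
  simp [augMap]

theorem augMap_of_smul (g : G) (m : MonoidAlgebra (ZMod 2) G) :
    augMap G (MonoidAlgebra.of (ZMod 2) G g • m) = augMap G m := by
  change (MonoidAlgebra.lift (ZMod 2) (ZMod 2) G (1 : G →* ZMod 2)) (_ * _) = _
  rw [map_mul]
  change augMap G _ * augMap G _ = _
  rw [augMap_of, one_mul]

theorem mem_augMul_top_iff (x : MonoidAlgebra (ZMod 2) G) :
    x ∈ augMul (⊤ : Submodule (MonoidAlgebra (ZMod 2) G) (MonoidAlgebra (ZMod 2) G)) ↔
      augMap G x = 0 := by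
  refine ⟨fun hx => invariant_functional_augMul _ augMap_of_smul hx, fun hx => ?_⟩
  have key : ∀ x : MonoidAlgebra (ZMod 2) G, x - algebraMap (ZMod 2) _ (augMap G x) ∈
      augMul (⊤ : Submodule (MonoidAlgebra (ZMod 2) G) (MonoidAlgebra (ZMod 2) G)) := by
    intro x
    induction x using MonoidAlgebra.induction_on with
    | of g =>
      rw [augMap_of, map_one]
      exact Submodule.subset_span ⟨g, 1, trivial, by simp⟩
    | add a b ha hb =>
      rw [map_add, map_add, add_sub_add_comm]
      exact Submodule.add_mem _ ha hb
    | smul r a ha =>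
      rcases zmod_two_eq r with rfl | rfl
      · simp
      · rwa [one_smul]
  simpa [hx] using key x

theorem finrank_augMul_top [Finite G] :
    Module.finrank (ZMod 2)
      (augMul (⊤ : Submodule (MonoidAlgebra (ZMod 2) G) (MonoidAlgebra (ZMod 2) G))) + 1 =
    Module.finrank (ZMod 2) (MonoidAlgebra (ZMod 2) G) := by
  have : Finite (MonoidAlgebra (ZMod 2) G) := Module.finite_of_finite (ZMod 2)
  let ε : MonoidAlgebra (ZMod 2) G →ₗ[ZMod 2] ZMod 2 := AddMonoidHom.toZModLinearMap 2 (augMap G)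
  rw [← LinearMap.finrank_range_add_finrank_ker ε, add_comm]
  congr 1
  · rw [LinearMap.range_eq_top.2, finrank_top, Module.finrank_self]
    intro r
    refine ⟨r • 1, ?_⟩
    rw [map_smul]
    change r • augMap G 1 = r
    rw [← map_one (MonoidAlgebra.of (ZMod 2) G), augMap_of]
    simp
  · refine LinearEquiv.finrank_eq (LinearEquiv.ofEq (R := ZMod 2)
      ((augMul ⊤).restrictScalars (ZMod 2)) _ ?_)
    ext x
    exact mem_augMul_top_iff x

theorem exists_minimal_generators [Finite G] (hG : IsPGroup 2 G) :
    ∃ (d : ℕ) (g : Fin d → G),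
      Submodule.span (MonoidAlgebra (ZMod 2) G)
        (Set.range fun i => MonoidAlgebra.of (ZMod 2) G (g i) - 1) = augMul ⊤ ∧
      LinearMap.ker (Fintype.linearCombination (MonoidAlgebra (ZMod 2) G)
        fun i => MonoidAlgebra.of (ZMod 2) G (g i) - 1) ≤ augMul ⊤ := by
  classical
  have := Fintype.ofFinite G
  have : Finite (MonoidAlgebra (ZMod 2) G) := Module.finite_of_finite (ZMod 2)
  let b : G → MonoidAlgebra (ZMod 2) G := fun g => MonoidAlgebra.of (ZMod 2) G g - 1
  have hb : ∀ g, b g ∈ augMul (⊤ : Submodule (MonoidAlgebra (ZMod 2) G) _) := fun g =>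
    Submodule.subset_span ⟨g, 1, trivial, by simp [b]⟩
  have hex : ∃ n, ∃ S : Finset G, S.card = n ∧
      Submodule.span (MonoidAlgebra (ZMod 2) G) (b '' S) = augMul ⊤ := by
    refine ⟨_, Finset.univ, rfl, le_antisymm ?_ ?_⟩
    · rw [Submodule.span_le]
      rintro _ ⟨g, _, rfl⟩
      exact hb g
    · refine Submodule.span_le.2 ?_
      rintro _ ⟨g, m, -, rfl⟩
      induction m using MonoidAlgebra.induction_on with
      | of h =>
        have : MonoidAlgebra.of (ZMod 2) G g • MonoidAlgebra.of (ZMod 2) G h -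
          MonoidAlgebra.of (ZMod 2) G h = b (g * h) - b h := by simp [b]
        rw [this]
        exact Submodule.sub_mem _ (Submodule.subset_span ⟨_, by simp, rfl⟩)
          (Submodule.subset_span ⟨_, by simp, rfl⟩)
      | add x y hx hy =>
        rw [smul_add, add_sub_add_comm]
        exact Submodule.add_mem _ hx hy
      | smul r a ha =>
        rcases zmod_two_eq r with rfl | rfl
        · simp
        · rwa [one_smul]
  obtain ⟨S, hS, hspan⟩ := Nat.find_spec hex
  have hmin : ∀ T : Finset G, Submodule.span (MonoidAlgebra (ZMod 2) G) (b '' T) = augMul ⊤ →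
      S.card ≤ T.card := fun T hT => hS ▸ Nat.find_min' hex ⟨T, rfl, hT⟩
  refine ⟨S.card, fun i => (S.equivFin.symm i : G), ?_, ?_⟩
  · rw [← hspan]
    congr 1
    ext x
    constructor
    · rintro ⟨i, rfl⟩
      exact ⟨_, (S.equivFin.symm i).2, rfl⟩
    · rintro ⟨g, hg, rfl⟩
      exact ⟨S.equivFin ⟨g, hg⟩, by simp [b]⟩
  · intro x hx
    have htop : (augMul ⊤ : Submodule (MonoidAlgebra (ZMod 2) G)
        (Fin S.card → MonoidAlgebra (ZMod 2) G)) =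
        Submodule.pi Set.univ fun _ => augMul ⊤ := by
      rw [← augMul_pi]
      congr 1
      ext; simp
    rw [htop]
    intro i _
    change x i ∈ augMul ⊤
    rw [mem_augMul_top_iff]
    by_contra hne
    have h1 : augMap G (x i) = 1 := (zmod_two_eq _).resolve_left hne
    set gi : G := ((S.equivFin.symm i : S) : G) with hgi
    have hgiS : gi ∈ S := (S.equivFin.symm i).2
    have hle : augMul ⊤ ≤ Submodule.span (MonoidAlgebra (ZMod 2) G) (b '' (S.erase gi)) := by
      apply le_of_le_sup_augMul hG
      conv_lhs => rw [← hspan]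
      rw [Submodule.span_le]
      rintro _ ⟨g, hg, rfl⟩
      by_cases hgg : g = gi
      · subst hgg
        have hsum : ∑ j, x j • b (S.equivFin.symm j) = 0 := by
          have := LinearMap.mem_ker.1 hx
          rwa [Fintype.linearCombination_apply] at this
        rw [← Finset.add_sum_erase _ _ (Finset.mem_univ i)] at hsum
        have hxi : x i - 1 ∈ augMul (⊤ : Submodule (MonoidAlgebra (ZMod 2) G) _) := by
          rw [mem_augMul_top_iff, map_sub, h1, ← map_one (MonoidAlgebra.of (ZMod 2) G), augMap_of,
            sub_self]
        have hbi : (x i - 1) • b gi ∈ augMul (augMul (⊤ : Submodule (MonoidAlgebra (ZMod 2) G)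
            (MonoidAlgebra (ZMod 2) G))) := by
          have : (augMul ⊤).map (LinearMap.toSpanSingleton (MonoidAlgebra (ZMod 2) G)
            (MonoidAlgebra (ZMod 2) G) (b gi)) ≤ augMul (augMul ⊤) := by
            rw [map_augMul]
            apply augMul_mono
            rintro _ ⟨y, _, rfl⟩
            exact Submodule.smul_mem _ _ (hb gi)
          exact this ⟨_, hxi, rfl⟩
        have heq : b gi = -(∑ j ∈ Finset.univ.erase i, x j • b (S.equivFin.symm j)) -
            (x i - 1) • b gi := by
          rw [sub_smul, one_smul, ← eq_neg_of_add_eq_zero_left hsum]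
          abel
        rw [heq]
        refine Submodule.sub_mem _ (Submodule.mem_sup_left (Submodule.neg_mem _
          (Submodule.sum_mem _ fun j hj => Submodule.smul_mem _ _ (Submodule.subset_span
            ⟨_, ?_, rfl⟩)))) (Submodule.mem_sup_right hbi)
        rw [Finset.mem_coe, Finset.mem_erase]
        refine ⟨fun h => (Finset.mem_erase.1 hj).1 ?_, (S.equivFin.symm j).2⟩
        exact S.equivFin.symm.injective (Subtype.ext h)
      · exact Submodule.mem_sup_left (Submodule.subset_span
          ⟨g, Finset.mem_coe.2 (Finset.mem_erase.2 ⟨hgg, hg⟩), rfl⟩)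
    have := hmin (S.erase gi) (le_antisymm ((Submodule.span_mono (Set.image_mono
      (Finset.coe_subset.2 (Finset.erase_subset _ _)))).trans hspan.le) hle)
    exact absurd this (not_le.2 (Finset.card_erase_lt_of_mem hgiS))

theorem le_of_span_eq_augMul_top {t d : ℕ} (θ : G →* Multiplicative (Fin t → ZMod 2))
    (hθ : Function.Surjective θ) (g : Fin d → G)
    (hg : Submodule.span (MonoidAlgebra (ZMod 2) G)
        (Set.range fun i => MonoidAlgebra.of (ZMod 2) G (g i) - 1) = augMul ⊤) : t ≤ d := by
  by_contra! hlt
  obtain ⟨l, hl0, hl⟩ : ∃ l : (Fin t → ZMod 2) →ₗ[ZMod 2] ZMod 2, l ≠ 0 ∧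
      ∀ i, l (θ (g i)).toAdd = 0 := by
    have hne : Submodule.span (ZMod 2) (Set.range fun i => (θ (g i)).toAdd) < ⊤ := by
      refine Submodule.lt_top_of_finrank_lt_finrank ?_
      refine (finrank_range_le_card _).trans_lt ?_
      simpa using hlt
    obtain ⟨l, hl0, hl⟩ := Submodule.exists_le_ker_of_lt_top _ hne
    exact ⟨l, hl0, fun i => hl (Submodule.subset_span ⟨i, rfl⟩)⟩
  let χ : G → ZMod 2 := fun x => l (θ x).toAdd
  have hχ : ∀ x y, χ (x * y) = χ x + χ y := fun x y => by simp [χ]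
  let L : MonoidAlgebra (ZMod 2) G →+ ZMod 2 := Finsupp.liftAddHom
    (fun x => (AddMonoidHom.mulRight (χ x))) |>.comp (MonoidAlgebra.coeffAddEquiv).toAddMonoidHom
  have hL : ∀ x, L (MonoidAlgebra.of (ZMod 2) G x) = χ x := fun x => by simp [L]
  have hχ1 : χ 1 = 0 := by simp [χ]
  have hkill : ∀ y ∈ augMul (⊤ : Submodule (MonoidAlgebra (ZMod 2) G) (MonoidAlgebra (ZMod 2) G)),
      L y = 0 := by
    intro y hy
    rw [← hg] at hy
    obtain ⟨c, rfl⟩ := Submodule.mem_span_range_iff_exists_fun _ |>.1 hy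
    rw [map_sum]
    refine Finset.sum_eq_zero fun i _ => ?_
    generalize c i = a
    induction a using MonoidAlgebra.induction_on with
    | of h =>
      rw [smul_eq_mul, mul_sub, mul_one, ← map_mul, map_sub, hL, hL, hχ]
      simp [χ, hl]
    | add a b ha hb => rw [add_smul, map_add, ha, hb, add_zero]
    | smul r a ha =>
      rcases zmod_two_eq r with rfl | rfl
      · simp
      · rwa [one_smul]
  apply hl0
  refine LinearMap.ext fun x => ?_
  obtain ⟨y, hy⟩ := hθ (Multiplicative.ofAdd x)
  have := hkill (MonoidAlgebra.of (ZMod 2) G y - 1) (Submodule.subset_span ⟨y, 1, trivial, by simp⟩)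
  rw [map_sub, hL, ← map_one (MonoidAlgebra.of (ZMod 2) G), hL, hχ1, sub_zero] at this
  simpa [χ, hy] using this

theorem finrank_augMul_iterate_ineq [Finite G] {d r : ℕ}
    (D : (Fin d → MonoidAlgebra (ZMod 2) G) →ₗ[MonoidAlgebra (ZMod 2) G] MonoidAlgebra (ZMod 2) G)
    (hD : LinearMap.range D = augMul ⊤) (hker : LinearMap.ker D ≤ augMul ⊤)
    (ρ : (Fin r → MonoidAlgebra (ZMod 2) G) →ₗ[MonoidAlgebra (ZMod 2) G]
      (Fin d → MonoidAlgebra (ZMod 2) G)) (hρ : LinearMap.range ρ = LinearMap.ker D) (n : ℕ) :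
    Module.finrank (ZMod 2) (augMul^[n + 2] (⊤ : Submodule (MonoidAlgebra (ZMod 2) G)
      (MonoidAlgebra (ZMod 2) G))) + r * Module.finrank (ZMod 2) (augMul^[n]
      (⊤ : Submodule (MonoidAlgebra (ZMod 2) G) (MonoidAlgebra (ZMod 2) G))) + 1 +
      d * Module.finrank (ZMod 2) (MonoidAlgebra (ZMod 2) G) ≤
    d * Module.finrank (ZMod 2) (augMul^[n + 1] (⊤ : Submodule (MonoidAlgebra (ZMod 2) G)
      (MonoidAlgebra (ZMod 2) G))) + r * Module.finrank (ZMod 2) (MonoidAlgebra (ZMod 2) G) +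
      Module.finrank (ZMod 2) (MonoidAlgebra (ZMod 2) G) := by
  have hfin : Finite (MonoidAlgebra (ZMod 2) G) := Module.finite_of_finite (ZMod 2)
  have hmap : ∀ {M M' : Type} [AddCommGroup M] [AddCommGroup M']
    [Module (MonoidAlgebra (ZMod 2) G) M] [Module (MonoidAlgebra (ZMod 2) G) M']
    (φ : M →ₗ[MonoidAlgebra (ZMod 2) G] M') (N : Submodule (MonoidAlgebra (ZMod 2) G) M) (n : ℕ),
      (augMul^[n] N).map φ = augMul^[n] (N.map φ) := by
    intro M M' _ _ _ _ φ N n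
    induction n generalizing N with
    | zero => rfl
    | succ n ih => rw [Function.iterate_succ_apply, Function.iterate_succ_apply, ih, map_augMul]
  have hmono : ∀ {M : Type} [AddCommGroup M] [Module (MonoidAlgebra (ZMod 2) G) M]
    (N P : Submodule (MonoidAlgebra (ZMod 2) G) M) (n : ℕ), N ≤ P →
      augMul^[n] N ≤ augMul^[n] P := by
    intro M _ _ N P n h
    induction n generalizing N P with
    | zero => exact h
    | succ n ih => exact ih _ _ (augMul_mono h)
  have hle : ∀ {M : Type} [AddCommGroup M] [Module (MonoidAlgebra (ZMod 2) G) M]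
    (N : Submodule (MonoidAlgebra (ZMod 2) G) M) (n : ℕ), augMul^[n] N ≤ N := by
    intro M _ _ N n
    induction n generalizing N with
    | zero => exact le_rfl
    | succ n ih => exact (ih _).trans (augMul_le N)
  have hpi : ∀ (s n : ℕ), Module.finrank (ZMod 2) (augMul^[n] (⊤ : Submodule
      (MonoidAlgebra (ZMod 2) G) (Fin s → MonoidAlgebra (ZMod 2) G))) =
      s * Module.finrank (ZMod 2) (augMul^[n]
      (⊤ : Submodule (MonoidAlgebra (ZMod 2) G) (MonoidAlgebra (ZMod 2) G))) := by
    intro s n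
    rw [← finrank_pi_const]
    have : augMul^[n] (⊤ : Submodule (MonoidAlgebra (ZMod 2) G) (Fin s → MonoidAlgebra (ZMod 2) G))
        = Submodule.pi Set.univ fun _ => augMul^[n] ⊤ := by
      induction n with
      | zero => ext; simp
      | succ n ih =>
        rw [Function.iterate_succ_apply', ih, augMul_pi]
        congr 1
        ext1 i
        rw [Function.iterate_succ_apply']
    rw [this]
  have hpi0 : ∀ s : ℕ, Module.finrank (ZMod 2) (⊤ : Submodule (MonoidAlgebra (ZMod 2) G)
      (Fin s → MonoidAlgebra (ZMod 2) G)) =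
      s * Module.finrank (ZMod 2) (MonoidAlgebra (ZMod 2) G) := fun s =>
    (finrank_top (ZMod 2) (Fin s → MonoidAlgebra (ZMod 2) G)).trans
      (by rw [Module.finrank_pi_fintype]; simp)
  have e1 := finrank_map_add_finrank_inf_ker D (augMul^[n + 1] ⊤)
  rw [hmap, Submodule.map_top, hD, ← Function.iterate_succ_apply, hpi] at e1
  have e2 := finrank_map_add_finrank_inf_ker ρ (augMul^[n] ⊤)
  rw [hmap, Submodule.map_top, hρ, hpi] at e2
  have e3 := finrank_map_add_finrank_inf_ker ρ ⊤
  rw [Submodule.map_top, hρ, top_inf_eq] at e3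
  replace e3 := e3.trans (hpi0 r)
  have e4 := finrank_map_add_finrank_inf_ker D ⊤
  rw [Submodule.map_top, hD, top_inf_eq] at e4
  replace e4 := e4.trans (hpi0 d)
  have e5 := finrank_augMul_top (G := G)
  have i1 : Module.finrank (ZMod 2) (augMul^[n] (LinearMap.ker D)) ≤
      Module.finrank (ZMod 2)
        (augMul^[n + 1] ⊤ ⊓ LinearMap.ker D : Submodule _ (Fin d → MonoidAlgebra (ZMod 2) G)) := by
    have : augMul^[n] (LinearMap.ker D) ≤ augMul^[n + 1] ⊤ ⊓ LinearMap.ker D := by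
      refine le_inf ?_ (hle _ _)
      rw [Function.iterate_succ_apply]
      exact hmono _ _ _ hker
    exact Submodule.finrank_mono (R := ZMod 2)
      (s := (augMul^[n] (LinearMap.ker D)).restrictScalars (ZMod 2))
      (t := (augMul^[n + 1] ⊤ ⊓ LinearMap.ker D : Submodule _ _).restrictScalars (ZMod 2)) this
  have i2 : Module.finrank (ZMod 2)
        (augMul^[n] ⊤ ⊓ LinearMap.ker ρ : Submodule _ (Fin r → MonoidAlgebra (ZMod 2) G)) ≤
      Module.finrank (ZMod 2) (LinearMap.ker ρ) := by
    have : augMul^[n] ⊤ ⊓ LinearMap.ker ρ ≤ LinearMap.ker ρ := inf_le_right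
    exact Submodule.finrank_mono (R := ZMod 2)
      (s := (augMul^[n] ⊤ ⊓ LinearMap.ker ρ : Submodule _ _).restrictScalars (ZMod 2))
      (t := (LinearMap.ker ρ).restrictScalars (ZMod 2)) this
  have key : ∀ F2 I dF Kn J rF Kd Kr rA F1 dA A : ℕ, F2 + I = dF → Kn + J = rF → Kd + Kr = rA →
      F1 + Kd = dA → F1 + 1 = A → Kn ≤ I → J ≤ Kr → F2 + rF + 1 + dA ≤ dF + rA + A := by
    intros
    omega
  exact key _ _ _ _ _ _ _ _ _ _ _ _ e1 e2 e3 e4 e5 i1 i2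

theorem golodShafarevich_inequality [Finite G] {d r : ℕ} (hd : 2 ≤ d)
    (D : (Fin d → MonoidAlgebra (ZMod 2) G) →ₗ[MonoidAlgebra (ZMod 2) G] MonoidAlgebra (ZMod 2) G)
    (hD : LinearMap.range D = augMul ⊤) (hker : LinearMap.ker D ≤ augMul ⊤)
    (ρ : (Fin r → MonoidAlgebra (ZMod 2) G) →ₗ[MonoidAlgebra (ZMod 2) G]
      (Fin d → MonoidAlgebra (ZMod 2) G)) (hρ : LinearMap.range ρ = LinearMap.ker D) :
    d ^ 2 < 4 * r := by
  by_contra! hr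
  have hfin : Finite (MonoidAlgebra (ZMod 2) G) := Module.finite_of_finite (ZMod 2)
  set A := Module.finrank (ZMod 2) (MonoidAlgebra (ZMod 2) G) with hA
  let a : ℕ → ℕ := fun n => A - Module.finrank (ZMod 2) (augMul^[n]
      (⊤ : Submodule (MonoidAlgebra (ZMod 2) G) (MonoidAlgebra (ZMod 2) G)))
  have hle : ∀ n, Module.finrank (ZMod 2) (augMul^[n]
      (⊤ : Submodule (MonoidAlgebra (ZMod 2) G) (MonoidAlgebra (ZMod 2) G))) ≤ A := fun n =>
    Submodule.finrank_le ((augMul^[n] (⊤ : Submodule (MonoidAlgebra (ZMod 2) G)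
      (MonoidAlgebra (ZMod 2) G))).restrictScalars (ZMod 2))
  have h0 : Module.finrank (ZMod 2) (⊤ : Submodule (MonoidAlgebra (ZMod 2) G)
      (MonoidAlgebra (ZMod 2) G)) = A :=
    finrank_top (ZMod 2) (MonoidAlgebra (ZMod 2) G)
  have key := golodShafarevich_unbounded d r hd hr a ?_ ?_ ?_ (A + 1)
  · have : a (A + 1) ≤ A := Nat.sub_le _ _
    omega
  · have := finrank_augMul_top (G := G)
    change A - Module.finrank (ZMod 2) (augMul (⊤ : Submodule (MonoidAlgebra (ZMod 2) G)
      (MonoidAlgebra (ZMod 2) G))) = 1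
    omega
  · change A - Module.finrank (ZMod 2) (⊤ : Submodule (MonoidAlgebra (ZMod 2) G)
      (MonoidAlgebra (ZMod 2) G)) = 0
    rw [h0, Nat.sub_self]
  · intro n
    have := finrank_augMul_iterate_ineq D hD hker ρ hρ n
    have h2 := hle (n + 2)
    have h3 := hle (n + 1)
    have h4 := hle n
    rw [← hA] at this
    simp only [a]
    zify [h2, h3, h4] at this ⊢
    linarith

/-- The extension of `G` classified by a crossed module map `∂ : M → 𝔽₂[G]`. -/
structure FoxExt (G : Type) [Group G] {M : Type} [AddCommGroup M]
    [Module (MonoidAlgebra (ZMod 2) G) M]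
    (D : M →ₗ[MonoidAlgebra (ZMod 2) G] MonoidAlgebra (ZMod 2) G) where
  /-- The module component. -/
  vec : M
  /-- The group component. -/
  elt : G
  map_vec : D vec = MonoidAlgebra.of (ZMod 2) G elt - 1

namespace FoxExt

variable {M : Type} [AddCommGroup M] [Module (MonoidAlgebra (ZMod 2) G) M]
  {D : M →ₗ[MonoidAlgebra (ZMod 2) G] MonoidAlgebra (ZMod 2) G}

theorem ext' {x y : FoxExt G D} (h1 : x.vec = y.vec) (h2 : x.elt = y.elt) : x = y := by
  cases x; cases y; cases h1; cases h2; rfl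

noncomputable instance : Group (FoxExt G D) :=
  let _ : Mul (FoxExt G D) := ⟨fun x y => ⟨x.vec + MonoidAlgebra.of (ZMod 2) G x.elt • y.vec,
    x.elt * y.elt, by
      rw [map_add, map_smul, x.map_vec, y.map_vec, map_mul, smul_eq_mul, mul_sub, mul_one]
      abel⟩⟩
  let _ : One (FoxExt G D) := ⟨⟨0, 1, by rw [map_zero, map_one, sub_self]⟩⟩
  let _ : Inv (FoxExt G D) := ⟨fun x => ⟨-(MonoidAlgebra.of (ZMod 2) G x.elt⁻¹ • x.vec), x.elt⁻¹, by
    rw [map_neg, map_smul, x.map_vec, smul_eq_mul, mul_sub, ← map_mul,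
      inv_mul_cancel, map_one, mul_one, neg_sub]⟩⟩
  Group.ofLeftAxioms
    (fun x y z => ext' (by
      change (x.vec + MonoidAlgebra.of (ZMod 2) G x.elt • y.vec) +
        MonoidAlgebra.of (ZMod 2) G (x.elt * y.elt) • z.vec = x.vec +
        MonoidAlgebra.of (ZMod 2) G x.elt • (y.vec + MonoidAlgebra.of (ZMod 2) G y.elt • z.vec)
      rw [map_mul, smul_add, smul_smul, add_assoc]) (mul_assoc _ _ _))
    (fun x => ext' (by
      change 0 + MonoidAlgebra.of (ZMod 2) G 1 • x.vec = x.vec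
      rw [map_one, one_smul, zero_add]) (one_mul _))
    (fun x => ext' (by
      change -(MonoidAlgebra.of (ZMod 2) G x.elt⁻¹ • x.vec) +
        MonoidAlgebra.of (ZMod 2) G x.elt⁻¹ • x.vec = 0
      exact neg_add_cancel _) (inv_mul_cancel _))

theorem mul_vec (x y : FoxExt G D) :
    (x * y).vec = x.vec + MonoidAlgebra.of (ZMod 2) G x.elt • y.vec := rfl

/-- The projection to `G`. -/
noncomputable def proj : FoxExt G D →* G where
  toFun := elt
  map_one' := rfl
  map_mul' _ _ := rfl

theorem mem_ker_proj {x : FoxExt G D} : x ∈ proj.ker ↔ x.elt = 1 := Iff.rfl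

theorem map_vec_of_mem_ker {x : FoxExt G D} (hx : x ∈ proj.ker) : D x.vec = 0 := by
  rw [x.map_vec, mem_ker_proj.1 hx, map_one, sub_self]

instance [Finite M] [Finite G] : Finite (FoxExt G D) :=
  Finite.of_injective (fun x => (x.vec, x.elt)) fun _ _ h =>
    ext' (congrArg Prod.fst h) (congrArg Prod.snd h)

theorem proj_surjective (hD : augMul ⊤ ≤ LinearMap.range D) :
    Function.Surjective (proj (D := D)) := by
  intro g
  have hg : MonoidAlgebra.of (ZMod 2) G g - 1 ∈
      augMul (⊤ : Submodule (MonoidAlgebra (ZMod 2) G) (MonoidAlgebra (ZMod 2) G)) :=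
    Submodule.subset_span ⟨g, 1, trivial, by simp⟩
  obtain ⟨m, hm⟩ := hD hg
  exact ⟨⟨m, g, hm⟩, rfl⟩

theorem hom_eq_zero_of_mem_ker (hD : LinearMap.range D = augMul ⊤)
    (hker : LinearMap.ker D ≤ augMul ⊤)
    (htriv : ∀ (g : G) (m : M), D m = 0 → MonoidAlgebra.of (ZMod 2) G g • m = m)
    (h : FoxExt G D →* Multiplicative (ZMod 2)) (v : FoxExt G D) (hv : v ∈ proj.ker) :
    h v = 1 := by
  let _ : Module (ZMod 2) M := Module.compHom M (algebraMap (ZMod 2) (MonoidAlgebra (ZMod 2) G))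
  have hst : IsScalarTower (ZMod 2) (MonoidAlgebra (ZMod 2) G) M :=
    ⟨fun r a m => by
      change (r • a) • m = (algebraMap (ZMod 2) (MonoidAlgebra (ZMod 2) G) r) • (a • m)
      rw [Algebra.smul_def, mul_smul]⟩
  let D' : M →ₗ[ZMod 2] (augMul ⊤ : Submodule (MonoidAlgebra (ZMod 2) G)
      (MonoidAlgebra (ZMod 2) G)) :=
    (D.codRestrict (augMul ⊤) (fun m => hD ▸ LinearMap.mem_range_self D m)).restrictScalars (ZMod 2)
  obtain ⟨s, hs⟩ := LinearMap.exists_rightInverse_of_surjective D' (LinearMap.range_eq_top.2 (by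
    rintro ⟨y, hy⟩
    rw [← hD] at hy
    obtain ⟨m, rfl⟩ := hy
    exact ⟨m, rfl⟩))
  have hs' : ∀ y, D (s y) = y := fun y => congrArg Subtype.val (DFunLike.congr_fun hs y)
  have hmem : ∀ g : G, MonoidAlgebra.of (ZMod 2) G g - 1 ∈
      augMul (⊤ : Submodule (MonoidAlgebra (ZMod 2) G) (MonoidAlgebra (ZMod 2) G)) := fun g =>
    Submodule.subset_span ⟨g, 1, trivial, by simp⟩
  let σ : G → FoxExt G D := fun g => ⟨s ⟨_, hmem g⟩, g, hs' _⟩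
  let f : ∀ m : M, D m = 0 → ZMod 2 := fun m hm => (h ⟨m, 1, by rw [hm, map_one, sub_self]⟩).toAdd
  let L : MonoidAlgebra (ZMod 2) G →+ ZMod 2 := Finsupp.liftAddHom
    (fun x => (AddMonoidHom.mulRight (h (σ x)).toAdd)) |>.comp
      (MonoidAlgebra.coeffAddEquiv).toAddMonoidHom
  have hL : ∀ x, L (MonoidAlgebra.of (ZMod 2) G x) = (h (σ x)).toAdd := fun x => by simp [L]
  have hσ1 : σ 1 = 1 := ext' (by
    change s _ = 0
    have : (⟨_, hmem 1⟩ : (augMul ⊤ : Submodule (MonoidAlgebra (ZMod 2) G)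
      (MonoidAlgebra (ZMod 2) G))) = 0 := Subtype.ext (by
        change MonoidAlgebra.of (ZMod 2) G 1 - 1 = 0
        rw [map_one, sub_self])
    rw [this, map_zero]) rfl
  have hDs : ∀ m, D (m - s (D' m)) = 0 := fun m => by
    rw [map_sub, hs']; exact sub_self _
  let φ : M →+ ZMod 2 :=
    { toFun := fun m => f (m - s (D' m)) (hDs m) + L (D m)
      map_zero' := by
        have : f (0 - s (D' 0)) (hDs 0) = 0 := by
          change (h _).toAdd = 0
          rw [show (⟨0 - s (D' 0), 1, _⟩ : FoxExt G D) = 1 from ext' (by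
            change (0 : M) - s (D' 0) = 0
            simp) rfl]
          simp
        rw [this]; simp
      map_add' := fun m n => by
        have : f (m + n - s (D' (m + n))) (hDs _) =
            f (m - s (D' m)) (hDs _) + f (n - s (D' n)) (hDs _) := by
          change (h _).toAdd = (h _).toAdd + (h _).toAdd
          rw [← toAdd_mul, ← map_mul]
          congr 2
          refine ext' ?_ (one_mul _).symm
          change m + n - s (D' (m + n)) = (m - s (D' m)) +
            MonoidAlgebra.of (ZMod 2) G 1 • (n - s (D' n))
          rw [map_one, one_smul, map_add, map_add]
          abel
        rw [this, map_add, map_add]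
        abel }
  have hφ : ∀ x : FoxExt G D, φ x.vec = (h x).toAdd := by
    intro x
    change (h _).toAdd + L (D x.vec) = _
    have hLx : L (D x.vec) = (h (σ x.elt)).toAdd := by
      rw [x.map_vec, map_sub, hL, ← map_one (MonoidAlgebra.of (ZMod 2) G), hL, hσ1]
      simp only [map_one, toAdd_one, sub_zero]
    rw [hLx, ← toAdd_mul, ← map_mul]
    congr 2
    refine ext' ?_ (one_mul _)
    change x.vec - s (D' x.vec) + MonoidAlgebra.of (ZMod 2) G 1 • s _ = x.vec
    rw [map_one, one_smul]
    have : D' x.vec = ⟨_, hmem x.elt⟩ := Subtype.ext x.map_vec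
    rw [this]
    abel
  have hφinv : ∀ (g : G) (m : M), φ (MonoidAlgebra.of (ZMod 2) G g • m) = φ m := by
    intro g m
    have hσ : ∀ k : G, φ (MonoidAlgebra.of (ZMod 2) G g • (σ k).vec) = φ (σ k).vec := by
      intro k
      have h1 := hφ (σ g * σ k)
      rw [mul_vec, map_add, map_mul, toAdd_mul, hφ] at h1
      rw [hφ]
      exact add_left_cancel h1
    have hker' : ∀ m : M, D m = 0 → φ (MonoidAlgebra.of (ZMod 2) G g • m) = φ m := fun m hm => by
      rw [htriv g m hm]
    have hsy : ∀ y, φ (MonoidAlgebra.of (ZMod 2) G g • (s y)) = φ (s y) := by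
      have : ∀ y : MonoidAlgebra (ZMod 2) G,
          φ (MonoidAlgebra.of (ZMod 2) G g • (s ⟨y - algebraMap (ZMod 2) _ (augMap G y), by
            rw [mem_augMul_top_iff, map_sub, Algebra.algebraMap_eq_smul_one]
            rcases zmod_two_eq (augMap G y) with h | h <;> rw [h]
            · simp
            · rw [one_smul, ← map_one (MonoidAlgebra.of (ZMod 2) G), augMap_of, sub_self]⟩)) =
          φ (s ⟨y - algebraMap (ZMod 2) _ (augMap G y), by
            rw [mem_augMul_top_iff, map_sub, Algebra.algebraMap_eq_smul_one]
            rcases zmod_two_eq (augMap G y) with h | h <;> rw [h]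
            · simp
            · rw [one_smul, ← map_one (MonoidAlgebra.of (ZMod 2) G), augMap_of, sub_self]⟩) := by
        intro y
        induction y using MonoidAlgebra.induction_on with
        | of k =>
          simp only [augMap_of, map_one]
          exact hσ k
        | add a b ha hb =>
          have hsplit : ∀ (p q r : (augMul ⊤ : Submodule (MonoidAlgebra (ZMod 2) G)
              (MonoidAlgebra (ZMod 2) G))), (r : MonoidAlgebra (ZMod 2) G) = p + q →
              φ (MonoidAlgebra.of (ZMod 2) G g • s p) = φ (s p) →
              φ (MonoidAlgebra.of (ZMod 2) G g • s q) = φ (s q) →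
              φ (MonoidAlgebra.of (ZMod 2) G g • s r) = φ (s r) := by
            intro p q r hr hp hq
            have : r = p + q := Subtype.ext hr
            rw [this, map_add, smul_add, map_add, hp, hq, map_add]
          refine hsplit _ _ _ ?_ ha hb
          simp only [map_add]
          abel
        | smul r a ha =>
          rcases zmod_two_eq r with rfl | rfl
          · have hz : ∀ z : (augMul ⊤ : Submodule (MonoidAlgebra (ZMod 2) G)
              (MonoidAlgebra (ZMod 2) G)), (z : MonoidAlgebra (ZMod 2) G) = 0 →
              φ (MonoidAlgebra.of (ZMod 2) G g • s z) = φ (s z) := by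
              intro z hz
              have : z = 0 := Subtype.ext hz
              rw [this, map_zero, smul_zero]
            exact hz _ (by simp)
          · simp only [one_smul]
            exact ha
      intro y
      have h0 := this y
      have hy0 := (mem_augMul_top_iff _).1 y.2
      simp only [hy0, map_zero, sub_zero] at h0
      exact h0
    have hm : m = (m - s (D' m)) + s (D' m) := by abel
    rw [hm, smul_add, map_add, map_add, hker' _ (hDs m), hsy]
  have h1 := invariant_functional_augMul φ hφinv (hker (map_vec_of_mem_ker hv))
  rw [hφ] at h1
  exact h1

end FoxExt

/-- The two-element group in additive and in multiplicative guise. -/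
def zmodTwoEquivUnits : Multiplicative (ZMod 2) ≃* ℤˣ where
  toFun x := if x = 1 then 1 else -1
  invFun x := if x = 1 then 1 else Multiplicative.ofAdd 1
  left_inv := by decide
  right_inv := by decide
  map_mul' := by decide

theorem exists_central_extension {t : ℕ} (ht : 2 ≤ t) [Finite G] (hG : IsPGroup 2 G)
    (θ : G →* Multiplicative (Fin t → ZMod 2)) (hθ : Function.Surjective θ) :
    ∃ (Γ : Type) (_ : Group Γ) (_ : Finite Γ) (π : Γ →* G) (r : ℕ), Function.Surjective π ∧
      (∀ v ∈ π.ker, ∀ γ, v * γ = γ * v) ∧ t ^ 2 < 4 * r ∧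
      2 ^ r ≤ Nat.card (π.ker →* ℤˣ) ∧ ∀ (h : Γ →* ℤˣ), ∀ v ∈ π.ker, h v = 1 := by
  have hfin : Finite (MonoidAlgebra (ZMod 2) G) := Module.finite_of_finite (ZMod 2)
  obtain ⟨d, g, hspan, hker0⟩ := exists_minimal_generators hG
  have htd := le_of_span_eq_augMul_top θ hθ g hspan
  set D₀ := Fintype.linearCombination (MonoidAlgebra (ZMod 2) G)
    fun i => MonoidAlgebra.of (ZMod 2) G (g i) - 1 with hD₀
  have hD₀r : LinearMap.range D₀ = augMul ⊤ := by
    rw [hD₀, Fintype.range_linearCombination, hspan]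
  let R := LinearMap.ker D₀
  let D := (augMul R).liftQ D₀ (augMul_le R)
  have hDr : LinearMap.range D = augMul ⊤ := by
    rw [Submodule.range_liftQ, hD₀r]
  have hDk : LinearMap.ker D ≤ augMul ⊤ := by
    rw [Submodule.ker_liftQ]
    refine (Submodule.map_mono hker0).trans ?_
    rw [map_augMul]
    exact augMul_mono le_top
  have htriv : ∀ (g : G) (m : (Fin d → MonoidAlgebra (ZMod 2) G) ⧸ augMul R), D m = 0 →
      MonoidAlgebra.of (ZMod 2) G g • m = m := by
    intro g m hm
    obtain ⟨x, rfl⟩ := Submodule.Quotient.mk_surjective _ m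
    rw [← Submodule.Quotient.mk_smul, Submodule.Quotient.eq]
    exact Submodule.subset_span ⟨g, x, hm, rfl⟩
  have hfinM : Finite ((Fin d → MonoidAlgebra (ZMod 2) G) ⧸ augMul R) :=
    Finite.of_surjective _ (Submodule.mkQ_surjective (augMul R))
  have hfink : Module.Finite (ZMod 2) (LinearMap.ker D) := Module.Finite.of_finite
  let b := Module.finBasis (ZMod 2) (LinearMap.ker D)
  set r := Module.finrank (ZMod 2) (LinearMap.ker D) with hr
  have hx : ∀ i, ∃ x ∈ R, (augMul R).mkQ x = b i := by
    intro i
    obtain ⟨x, hx⟩ := Submodule.Quotient.mk_surjective _ (b i : _ ⧸ augMul R)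
    refine ⟨x, ?_, hx⟩
    have := (b i).2
    rw [← hx] at this
    exact this
  choose x hxR hxb using hx
  have hρ : LinearMap.range (Fintype.linearCombination (MonoidAlgebra (ZMod 2) G) x) = R := by
    rw [Fintype.range_linearCombination]
    apply le_antisymm
    · rw [Submodule.span_le]
      rintro _ ⟨i, rfl⟩
      exact hxR i
    · apply le_of_le_sup_augMul hG
      intro y hy
      let yk : LinearMap.ker D := ⟨(augMul R).mkQ y, hy⟩
      have hsum : (augMul R).mkQ y = (augMul R).mkQ (∑ i, b.repr yk i • x i) := by
        have := congrArg Subtype.val (b.sum_repr yk)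
        rw [map_sum]
        refine this.symm.trans ?_
        rw [AddSubmonoidClass.coe_finsetSum]
        refine Finset.sum_congr rfl fun i _ => ?_
        rw [LinearMap.map_smul_of_tower, hxb]
        rfl
      have hmem : y - ∑ i, b.repr yk i • x i ∈ augMul R := by
        rw [← Submodule.Quotient.eq]
        exact hsum
      have hy' : y = (∑ i, b.repr yk i • x i) + (y - ∑ i, b.repr yk i • x i) := by abel
      rw [hy']
      refine Submodule.add_mem_sup (Submodule.sum_mem _ fun i _ => ?_) hmem
      rcases zmod_two_eq (b.repr yk i) with h | h <;> rw [h]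
      · simp
      · rw [one_smul]
        exact Submodule.subset_span ⟨i, rfl⟩
  have hgs := golodShafarevich_inequality (ht.trans htd) D₀ hD₀r hker0 _ hρ
  refine ⟨FoxExt G D, inferInstance, inferInstance, FoxExt.proj, r,
    FoxExt.proj_surjective hDr.ge, ?_, ?_, ?_, ?_⟩
  · intro v hv γ
    have h1 : v.elt = 1 := FoxExt.mem_ker_proj.1 hv
    refine FoxExt.ext' ?_ ?_
    · rw [FoxExt.mul_vec, FoxExt.mul_vec, htriv _ _ (FoxExt.map_vec_of_mem_ker hv), h1,
        map_one, one_smul, add_comm]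
    · change v.elt * γ.elt = γ.elt * v.elt
      rw [h1, one_mul, mul_one]
  · exact (Nat.pow_le_pow_left htd 2).trans_lt hgs
  · let F : (Fin r → ZMod 2) → ((FoxExt.proj (D := D)).ker →* ℤˣ) := fun c =>
      { toFun := fun v => zmodTwoEquivUnits (Multiplicative.ofAdd
          (∑ i, c i * b.repr ⟨v.1.vec, FoxExt.map_vec_of_mem_ker v.2⟩ i))
        map_one' := by
          have : (⟨(1 : (FoxExt.proj (D := D)).ker).1.vec,
            FoxExt.map_vec_of_mem_ker (1 : (FoxExt.proj (D := D)).ker).2⟩ : LinearMap.ker D) = 0 :=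
            rfl
          rw [this]
          simp
        map_mul' := fun v w => by
          have : (⟨(v * w).1.vec, FoxExt.map_vec_of_mem_ker (v * w).2⟩ : LinearMap.ker D) =
            ⟨v.1.vec, FoxExt.map_vec_of_mem_ker v.2⟩ +
              ⟨w.1.vec, FoxExt.map_vec_of_mem_ker w.2⟩ := Subtype.ext (by
            change v.1.vec + MonoidAlgebra.of (ZMod 2) G v.1.elt • w.1.vec = v.1.vec + w.1.vec
            rw [FoxExt.mem_ker_proj.1 v.2, map_one, one_smul])
          rw [this, ← map_mul, ← ofAdd_add, ← Finset.sum_add_distrib]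
          simp [mul_add] }
    have hF : Function.Injective F := by
      intro c c' h
      ext1 i
      have hi := DFunLike.congr_fun h ⟨⟨b i, 1, by
        rw [map_one, sub_self]; exact (b i).2⟩, rfl⟩
      have hi' := congrArg Multiplicative.toAdd (zmodTwoEquivUnits.injective hi)
      have hb : (⟨(b i : _ ⧸ augMul R), (b i).2⟩ : LinearMap.ker D) = b i := rfl
      simp only [toAdd_ofAdd] at hi'
      rw [hb] at hi'
      simpa [Finsupp.single_apply] using hi'
    have : Finite ((FoxExt.proj (D := D)).ker →* ℤˣ) :=
      Finite.of_injective (fun f => (f : (FoxExt.proj (D := D)).ker → ℤˣ)) DFunLike.coe_injective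
    calc 2 ^ r = Nat.card (Fin r → ZMod 2) := by simp
      _ ≤ _ := Nat.card_le_card_of_injective F hF
  · intro h v hv
    have := FoxExt.hom_eq_zero_of_mem_ker hDr hDk htriv
      (zmodTwoEquivUnits.symm.toMonoidHom.comp h) v hv
    exact zmodTwoEquivUnits.symm.injective (this.trans (map_one _).symm)

end GolodShafarevich

section Herbrand

variable {A B : Type*} [CommGroup A] [CommGroup B]

theorem relIndex_eq_map_mul_inf_ker (f : A →* B) {H K : Subgroup A} (h : H ≤ K) :
    H.relIndex K = (H.map f).relIndex (K.map f) * (H ⊓ f.ker).relIndex (K ⊓ f.ker) := by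
  rw [Subgroup.relIndex_map_map]
  have h1 : (H ⊓ f.ker).relIndex (K ⊓ f.ker) = H.relIndex (K ⊓ f.ker) := by
    rw [← Subgroup.inf_relIndex_right H (K ⊓ f.ker), ← inf_assoc, inf_eq_left.2 h]
  have h2 : (H ⊔ f.ker).relIndex (K ⊔ f.ker) = (H ⊔ (K ⊓ f.ker)).relIndex K := by
    have e1 : K ⊔ f.ker = K ⊔ (H ⊔ f.ker) := by rw [← sup_assoc, sup_eq_left.2 h]
    rw [e1, Subgroup.relIndex_sup_right, ← Subgroup.inf_relIndex_right, sup_inf_assoc_of_le _ h,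
      inf_comm K]
  rw [h1, h2, mul_comm]
  conv_rhs => rw [← Subgroup.relIndex_sup_left (K := H) (H := K ⊓ f.ker)]
  rw [Subgroup.relIndex_mul_relIndex _ _ _ le_sup_left (sup_le h inf_le_left)]

theorem relIndex_eq_map_of_ker_le (f : A →* B) {H K : Subgroup A} (h : H ≤ K) (hk : f.ker ≤ H) :
    H.relIndex K = (H.map f).relIndex (K.map f) := by
  rw [relIndex_eq_map_mul_inf_ker f h, inf_eq_right.2 hk, inf_eq_right.2 (hk.trans h),
    Subgroup.relIndex_self, mul_one]

/-- The norm map of an involution. -/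
def invNorm (σ : A →* A) : A →* A := MonoidHom.id A * σ

/-- The map `a ↦ a / σ a`. -/
def invDiff (σ : A →* A) : A →* A := MonoidHom.id A / σ

theorem invNorm_apply (σ : A →* A) (a : A) : invNorm σ a = a * σ a := rfl

theorem invDiff_apply (σ : A →* A) (a : A) : invDiff σ a = a / σ a := rfl

theorem mem_ker_invNorm {σ : A →* A} {a : A} : a ∈ (invNorm σ).ker ↔ a * σ a = 1 := Iff.rfl

theorem mem_ker_invDiff {σ : A →* A} {a : A} : a ∈ (invDiff σ).ker ↔ σ a = a := by
  rw [MonoidHom.mem_ker, invDiff_apply, div_eq_one, eq_comm]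

theorem range_invNorm_le {σ : A →* A} (hσ : ∀ a, σ (σ a) = a) :
    (invNorm σ).range ≤ (invDiff σ).ker := by
  rintro _ ⟨a, rfl⟩
  rw [mem_ker_invDiff, invNorm_apply, map_mul, hσ, mul_comm]

theorem range_invDiff_le {σ : A →* A} (hσ : ∀ a, σ (σ a) = a) :
    (invDiff σ).range ≤ (invNorm σ).ker := by
  rintro _ ⟨a, rfl⟩
  rw [mem_ker_invNorm, invDiff_apply, map_div, hσ]
  simp

/-- The index form of the multiplicativity of Herbrand quotients: obstruction to the Hasse norm
principle for an involution acting on an "ideal" map `π`. -/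
theorem relIndex_norm_mul_relIndex_diff {X I : Type*} [CommGroup X] [CommGroup I] (π : X →* I)
    (σ : X →* X) (τ : I →* I) (hσ : ∀ x, σ (σ x) = x) (hτ : ∀ x, τ (τ x) = x)
    (hπ : ∀ x, π (σ x) = τ (π x)) (h90X : (invNorm σ).ker ≤ (invDiff σ).range)
    (h90I : (invNorm τ).ker ≤ (invDiff τ).range) (hCl : π.range.index ≠ 0) :
    (invNorm σ).range.relIndex ((invDiff σ).ker ⊓ (invNorm τ).range.comap π) *
      (π.ker.map (invDiff σ)).relIndex (π.ker ⊓ (invNorm σ).ker) =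
    (π.ker.map (invNorm σ)).relIndex (π.ker ⊓ (invDiff σ).ker) *
      ((invDiff σ).ker.map π ⊔ (invNorm τ).range).relIndex (invDiff τ).ker := by
  have hXK : (invDiff σ).range = (invNorm σ).ker := le_antisymm (range_invDiff_le hσ) h90X
  have hIK : (invDiff τ).range = (invNorm τ).ker := le_antisymm (range_invDiff_le hτ) h90I
  have hπn : ∀ x, π (invNorm σ x) = invNorm τ (π x) := fun x => by
    simp [invNorm_apply, hπ]
  have hπd : ∀ x, π (invDiff σ x) = invDiff τ (π x) := fun x => by
    simp [invDiff_apply, hπ]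
  have hXN := range_invNorm_le hσ
  have hIN := range_invNorm_le hτ
  set P := π.range with hP
  set E := π.ker with hE
  set XF := (invDiff σ).ker with hXF
  set IF := (invDiff τ).ker with hIF
  set XN := (invNorm σ).range with hXN'
  set IN := (invNorm τ).range with hIN'
  set XK := (invNorm σ).ker with hXK'
  set IK := (invNorm τ).ker with hIK'
  have hPn : P.map (invNorm τ) = XN.map π := by
    rw [hP, hXN', MonoidHom.map_range, MonoidHom.map_range]
    congr 1; ext x; exact (hπn x).symm
  have hPd : P.map (invDiff τ) = XK.map π := by
    rw [hP, ← hXK, MonoidHom.map_range, MonoidHom.map_range]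
    congr 1; ext x; exact (hπd x).symm
  have hXFI : XF.map π ≤ IF := by
    rintro _ ⟨x, hx, rfl⟩
    rw [SetLike.mem_coe, MonoidHom.mem_ker] at hx
    rw [MonoidHom.mem_ker, ← hπd, hx, map_one]
  have hXNI : XN.map π ≤ IN := by
    rw [← hPn]; exact Subgroup.map_le_range _ _
  -- the eight index computations
  have e1 : XN.relIndex (XF ⊓ IN.comap π) =
      (XN.map π).relIndex (XF.map π ⊓ IN) * (XN ⊓ E).relIndex (XF ⊓ E) := by
    have h : XN ≤ XF ⊓ IN.comap π := le_inf hXN (Subgroup.map_le_iff_le_comap.1 hXNI)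
    have hm : (XF ⊓ IN.comap π).map π = XF.map π ⊓ IN := by
      ext y
      constructor
      · rintro ⟨x, ⟨h1, h2⟩, rfl⟩
        exact ⟨⟨x, h1, rfl⟩, h2⟩
      · rintro ⟨⟨x, h1, rfl⟩, h2⟩
        exact ⟨x, ⟨h1, h2⟩, rfl⟩
    rw [relIndex_eq_map_mul_inf_ker π h, hm]
    congr 2
    have hk : E ≤ IN.comap π := MonoidHom.ker_le_comap _ _
    rw [inf_assoc, inf_eq_right.2 hk]
  have hEN : E.map (invNorm σ) ≤ XN ⊓ E := by
    rintro _ ⟨x, hx, rfl⟩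
    refine ⟨⟨x, rfl⟩, ?_⟩
    rw [SetLike.mem_coe, MonoidHom.mem_ker] at hx
    change π _ = 1
    rw [hπn, hx, map_one]
  have e2 : (E.map (invNorm σ)).relIndex (E ⊓ XF) = (XN ⊓ E).relIndex (XF ⊓ E) *
      (E.map (invNorm σ)).relIndex (XN ⊓ E) := by
    rw [mul_comm, Subgroup.relIndex_mul_relIndex _ _ _ hEN (inf_le_inf_right _ hXN), inf_comm]
  have e34 : (E.map (invNorm σ)).relIndex (XN ⊓ E) = (P.map (invDiff τ)).relIndex (P ⊓ IK) := by
    have hB : E ⊔ XK ≤ E.comap (invNorm σ) := by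
      refine sup_le ?_ (MonoidHom.ker_le_comap _ _)
      exact Subgroup.map_le_iff_le_comap.1 (hEN.trans inf_le_right)
    have h3 := relIndex_eq_map_of_ker_le (invNorm σ) hB le_sup_right
    rw [Subgroup.map_comap_eq, Subgroup.map_sup, (Subgroup.map_eq_bot_iff _).2 le_rfl, sup_bot_eq]
      at h3
    have h4 := relIndex_eq_map_of_ker_le π hB le_sup_left
    rw [Subgroup.map_sup, (Subgroup.map_eq_bot_iff _).2 hE.le, bot_sup_eq] at h4
    rw [← h3, h4, hPd]
    congr 1
    ext x
    constructor
    · rintro ⟨y, hy, rfl⟩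
      refine ⟨⟨y, rfl⟩, ?_⟩
      change π (invNorm σ y) = 1 at hy
      rw [hπn] at hy
      exact hy
    · rintro ⟨⟨y, rfl⟩, hy⟩
      refine ⟨y, ?_, rfl⟩
      change π (invNorm σ y) = 1
      rw [hπn]
      exact hy
  have hPJ : P ⊔ IF ≤ P.comap (invDiff τ) := by
    refine sup_le ?_ (MonoidHom.ker_le_comap _ _)
    rw [← Subgroup.map_le_iff_le_comap, hPd]
    exact Subgroup.map_le_range _ _
  have e5 : (P ⊔ IF).relIndex (P.comap (invDiff τ)) = (P.map (invDiff τ)).relIndex (P ⊓ IK) := by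
    rw [relIndex_eq_map_of_ker_le (invDiff τ) hPJ le_sup_right, Subgroup.map_comap_eq,
      Subgroup.map_sup, (Subgroup.map_eq_bot_iff _).2 hIF.le, sup_bot_eq, hIK, inf_comm]
  have hPT : P ⊔ IK ≤ (XF.map π).comap (invNorm τ) := by
    refine sup_le ?_ (MonoidHom.ker_le_comap _ _)
    rw [← Subgroup.map_le_iff_le_comap, hPn]
    exact Subgroup.map_mono hXN
  have e6 : (P ⊔ IK).relIndex ((XF.map π).comap (invNorm τ)) =
      (XN.map π).relIndex (XF.map π ⊓ IN) := by
    rw [relIndex_eq_map_of_ker_le (invNorm τ) hPT le_sup_right, Subgroup.map_comap_eq,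
      Subgroup.map_sup, (Subgroup.map_eq_bot_iff _).2 hIK'.le, sup_bot_eq, hPn, inf_comm]
  have hTT : (XF.map π).comap (invNorm τ) ≤ P.comap (invNorm τ) :=
    Subgroup.comap_mono (Subgroup.map_le_range _ _)
  have e7 := Subgroup.relIndex_mul_relIndex _ _ _ hPT hTT
  have e8 : ((XF.map π).comap (invNorm τ)).relIndex (P.comap (invNorm τ)) =
      (XF.map π ⊓ IN).relIndex (P ⊓ IN) := by
    rw [relIndex_eq_map_of_ker_le (invNorm τ) hTT (MonoidHom.ker_le_comap _ _),
      Subgroup.map_comap_eq, Subgroup.map_comap_eq, inf_comm, inf_comm P]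
  have hPN : P ⊔ IN ≤ P ⊔ IF := sup_le_sup_left hIN _
  have e9 : (P ⊔ IN).relIndex (P.comap (invDiff τ)) = (P ⊔ IK).relIndex (P.comap (invNorm τ)) := by
    have a1 := Subgroup.relIndex_mul_index (hPN.trans hPJ)
    have a2 := Subgroup.relIndex_mul_index (hPT.trans hTT)
    have a3 := Subgroup.relIndex_mul_index (le_sup_left : P ≤ P ⊔ IN)
    have a4 := Subgroup.relIndex_mul_index (le_sup_left : P ≤ P ⊔ IK)
    have a5 : (P.comap (invDiff τ)).index = P.relIndex (P ⊔ IK) := by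
      rw [Subgroup.relIndex_sup_left, Subgroup.index_comap, hIK]
    have a6 : (P.comap (invNorm τ)).index = P.relIndex (P ⊔ IN) := by
      rw [Subgroup.relIndex_sup_left, Subgroup.index_comap]
    rw [a5] at a1
    rw [a6] at a2
    have b1 : P.relIndex (P ⊔ IN) ≠ 0 := fun h => hCl (by rw [← a3, h, zero_mul])
    have b2 : P.relIndex (P ⊔ IK) ≠ 0 := fun h => hCl (by rw [← a4, h, zero_mul])
    have : (P ⊔ IN).relIndex (P.comap (invDiff τ)) * (P.relIndex (P ⊔ IK) * P.relIndex (P ⊔ IN)) =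
        (P ⊔ IK).relIndex (P.comap (invNorm τ)) *
          (P.relIndex (P ⊔ IK) * P.relIndex (P ⊔ IN)) := by
      calc _ = P.index := by rw [← a3, ← a1]; ring
        _ = _ := by rw [← a4, ← a2]; ring
    exact Nat.eq_of_mul_eq_mul_right (Nat.pos_of_ne_zero (mul_ne_zero b2 b1)) this
  have e10 := Subgroup.relIndex_mul_relIndex _ _ _ hPN hPJ
  have e11 : (P ⊔ IN).relIndex (P ⊔ IF) = (P ⊓ IF ⊔ IN).relIndex IF := by
    have : P ⊔ IF = (P ⊔ IN) ⊔ IF := by rw [sup_assoc, sup_eq_right.2 hIN]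
    rw [this, Subgroup.relIndex_sup_left, ← Subgroup.inf_relIndex_right, sup_comm P IN,
      sup_inf_assoc_of_le _ hIN, sup_comm]
  have hF1 : XF.map π ≤ P ⊓ IF := le_inf (Subgroup.map_le_range _ _) hXFI
  have e12 : (XF.map π ⊔ IN).relIndex IF =
      (XF.map π ⊔ IN).relIndex (P ⊓ IF ⊔ IN) * (P ⊓ IF ⊔ IN).relIndex IF :=
    (Subgroup.relIndex_mul_relIndex _ _ _ (sup_le_sup_right hF1 _)
      (sup_le inf_le_right hIN)).symm
  have e13 : (XF.map π).relIndex (P ⊓ IF) =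
      (XF.map π ⊔ IN).relIndex (P ⊓ IF ⊔ IN) * (XF.map π ⊓ IN).relIndex (P ⊓ IN) := by
    rw [relIndex_eq_map_mul_inf_ker (QuotientGroup.mk' IN) hF1, QuotientGroup.ker_mk',
      Subgroup.relIndex_map_map, QuotientGroup.ker_mk', inf_assoc, inf_eq_right.2 hIN]
  have e14 : (XF.map π).relIndex (P ⊓ IF) = (E.map (invDiff σ)).relIndex (E ⊓ XK) := by
    have hC : XF ⊔ E ≤ IF.comap π :=
      sup_le (Subgroup.map_le_iff_le_comap.1 hXFI) (MonoidHom.ker_le_comap _ _)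
    have h1 := relIndex_eq_map_of_ker_le π hC le_sup_right
    rw [Subgroup.map_comap_eq, Subgroup.map_sup, (Subgroup.map_eq_bot_iff _).2 hE.le,
      sup_bot_eq] at h1
    have hC' : IF.comap π = E.comap (invDiff σ) := by
      ext x
      change invDiff τ (π x) = 1 ↔ π (invDiff σ x) = 1
      rw [hπd]
    have h2 := relIndex_eq_map_of_ker_le (invDiff σ) hC le_sup_left
    rw [hC', Subgroup.map_comap_eq, Subgroup.map_sup, (Subgroup.map_eq_bot_iff _).2 hXF.le,
      bot_sup_eq, hXK, ← hC', inf_comm] at h2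
    rw [← h1, h2]
  rw [e1, e2, e12, e34, ← e14, e13]
  rw [e9, ← e7, e5, e6, e8, e11] at e10
  calc _ = ((XN.map π).relIndex (XF.map π ⊓ IN) * (XF.map π ⊓ IN).relIndex (P ⊓ IN)) *
        ((XN ⊓ E).relIndex (XF ⊓ E) * (XF.map π ⊔ IN).relIndex (P ⊓ IF ⊔ IN)) := by ring
    _ = _ := by rw [← e10]; ring

end Herbrand

section UnitIndex

theorem index_range_pow_two_of_finite (T : Type*) [CommGroup T] [Finite T] :
    (powMonoidHom 2 : T →* T).range.index = Nat.card (powMonoidHom 2 : T →* T).ker := by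
  have h1 := (powMonoidHom 2 : T →* T).range.card_mul_index
  have h2 := (powMonoidHom 2 : T →* T).ker.card_mul_index
  rw [Subgroup.index_ker] at h2
  have h3 : 0 < Nat.card (powMonoidHom 2 : T →* T).range := Nat.card_pos
  rw [← h2, mul_comm] at h1
  exact Nat.eq_of_mul_eq_mul_right h3 h1

theorem finite_additive_subgroup {A : Type*} [CommGroup A] [Module.Finite ℤ (Additive A)]
    (S : Subgroup A) : Module.Finite ℤ (Additive S) :=
  Module.Finite.of_injective (MonoidHom.toAdditive S.subtype).toIntLinearMap
    (fun a b h => Subtype.ext (by exact h))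

theorem fg_of_finite_additive {A : Type*} [CommGroup A] [Module.Finite ℤ (Additive A)] :
    Group.FG A := by
  rw [Group.fg_iff_monoid_fg, Monoid.fg_iff_add_fg, ← AddGroup.fg_iff_addMonoid_fg, ← Module.Finite.iff_addGroup_fg]
  infer_instance

theorem index_range_pow_two (A : Type*) [CommGroup A] [Module.Finite ℤ (Additive A)] :
    (powMonoidHom 2 : A →* A).range.index =
      2 ^ Module.finrank ℤ (Additive A) * Nat.card (powMonoidHom 2 : A →* A).ker := by
  let T := CommGroup.torsion A
  have hT : Finite T := by
    have := finite_additive_subgroup T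
    have : Group.FG T := fg_of_finite_additive
    exact CommGroup.finite_of_fg_isMulTorsion T (CommMonoid.torsion.isMulTorsion)
  have e := relIndex_eq_map_mul_inf_ker (QuotientGroup.mk' T)
    (H := (powMonoidHom 2 : A →* A).range) (K := ⊤) le_top
  have hfin : Module.Finite ℤ (Additive (A ⧸ T)) :=
    Module.Finite.of_surjective (MonoidHom.toAdditive (QuotientGroup.mk' T)).toIntLinearMap
      (QuotientGroup.mk'_surjective T)
  have htf : IsMulTorsionFree (A ⧸ T) := inferInstance
  have htf2 : Module.IsTorsionFree ℤ (Additive (A ⧸ T)) := inferInstance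
  have hfree : Module.Free ℤ (Additive (A ⧸ T)) := inferInstance
  have e1 : ((powMonoidHom 2 : A →* A).range.map (QuotientGroup.mk' T)).relIndex
      ((⊤ : Subgroup A).map (QuotientGroup.mk' T)) = 2 ^ Module.finrank ℤ (Additive A) := by
    have := AddSubgroup.index_range_nsmul (Additive (A ⧸ T)) 2
    have h3 : Module.finrank ℤ (Additive (A ⧸ T)) = Module.finrank ℤ (Additive A) :=
      finrank_quotient_torsion_eq (M := Additive A)
    rw [h3] at this
    rw [← this, Subgroup.map_top_of_surjective _ (QuotientGroup.mk'_surjective T),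
      Subgroup.relIndex_top_right]
    have h4 : (powMonoidHom 2 : A →* A).range.map (QuotientGroup.mk' T) =
        (powMonoidHom 2 : (A ⧸ T) →* (A ⧸ T)).range := by
      ext x
      constructor
      · rintro ⟨_, ⟨y, rfl⟩, rfl⟩
        exact ⟨(y : A ⧸ T), rfl⟩
      · rintro ⟨y, rfl⟩
        obtain ⟨y, rfl⟩ := QuotientGroup.mk'_surjective T y
        exact ⟨_, ⟨y, rfl⟩, rfl⟩
    rw [h4]
    rfl
  have e2 : ((powMonoidHom 2 : A →* A).range ⊓ (QuotientGroup.mk' T).ker).relIndex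
      (⊤ ⊓ (QuotientGroup.mk' T).ker) = Nat.card (powMonoidHom 2 : A →* A).ker := by
    rw [QuotientGroup.ker_mk', top_inf_eq]
    have h5 : (powMonoidHom 2 : A →* A).range ⊓ T = (powMonoidHom 2 : T →* T).range.map T.subtype := by
      ext x
      constructor
      · rintro ⟨⟨y, rfl⟩, hy⟩
        have : y ∈ T := by
          have hy : IsOfFinOrder (y ^ 2) := hy
          exact (isOfFinOrder_pow.1 hy).resolve_right (by norm_num)
        exact ⟨_, ⟨⟨y, this⟩, rfl⟩, rfl⟩
      · rintro ⟨_, ⟨y, rfl⟩, rfl⟩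
        exact ⟨⟨y, rfl⟩, (powMonoidHom 2 y : T).2⟩
    rw [h5, Subgroup.relIndex, Subgroup.subgroupOf, Subgroup.comap_map_eq_self_of_injective
      T.subtype_injective, index_range_pow_two_of_finite]
    refine Nat.card_congr ⟨fun x => ⟨x.1.1, ?_⟩, fun x => ⟨⟨x.1, ?_⟩, ?_⟩, fun x => rfl, fun x => rfl⟩
    · exact congrArg Subtype.val x.2
    · rw [CommGroup.mem_torsion]
      exact isOfFinOrder_iff_pow_eq_one.2 ⟨2, by norm_num, x.2⟩
    · exact Subtype.ext x.2
  rw [Subgroup.relIndex_top_right] at e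
  rw [e, e1, e2]

theorem finrank_ker_invNorm {E : Type*} [CommGroup E] [Module.Finite ℤ (Additive E)] {σ : E →* E}
    (hσ : ∀ x, σ (σ x) = x) :
    Module.finrank ℤ (Additive (invNorm σ).ker) + Module.finrank ℤ (Additive (invDiff σ).ker) =
      Module.finrank ℤ (Additive E) := by
  let D := (MonoidHom.toAdditive (invDiff σ)).toIntLinearMap
  let N := (MonoidHom.toAdditive (invNorm σ)).toIntLinearMap
  have h1 : Module.finrank ℤ D.range + Module.finrank ℤ D.ker = Module.finrank ℤ (Additive E) := by
    rw [← D.quotKerEquivRange.finrank_eq, Submodule.finrank_quotient_add_finrank]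
  have h2 : D.range ≤ N.ker := by
    rintro _ ⟨a, rfl⟩
    exact range_invDiff_le hσ ⟨a, rfl⟩
  have h3 : Module.finrank ℤ (N.ker ⧸ D.range.comap N.ker.subtype) = 0 := by
    rw [Module.finrank_eq_zero_iff_isTorsion]
    rintro x
    obtain ⟨⟨x, hx⟩, rfl⟩ := Submodule.Quotient.mk_surjective _ x
    refine ⟨⟨2, by simp⟩, ?_⟩
    change (2 : ℤ) • (Submodule.Quotient.mk _ : N.ker ⧸ D.range.comap N.ker.subtype) = 0
    rw [← Submodule.Quotient.mk_smul, Submodule.Quotient.mk_eq_zero]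
    refine ⟨x, ?_⟩
    change x.toMul / σ x.toMul = (x.toMul) ^ (2 : ℤ)
    have hx : x.toMul * σ x.toMul = 1 := hx
    rw [eq_inv_of_mul_eq_one_right hx, div_inv_eq_mul, zpow_two]
  have h4 := Submodule.finrank_quotient_add_finrank (D.range.comap N.ker.subtype)
  rw [h3, zero_add, (Submodule.comapSubtypeEquivOfLe h2).finrank_eq] at h4
  rw [h4] at h1
  exact h1

theorem relIndex_norm_units {E : Type*} [CommGroup E] [Module.Finite ℤ (Additive E)] {σ : E →* E}
    (hσ : ∀ x, σ (σ x) = x) (h2 : ∀ x : E, x ^ 2 = 1 → σ x = x) {m : ℕ}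
    (hE : Module.finrank ℤ (Additive E) = 2 * m + 1)
    (hF : Module.finrank ℤ (Additive (invDiff σ).ker) = m) :
    (invDiff σ).range.relIndex (invNorm σ).ker = 2 * (invNorm σ).range.relIndex (invDiff σ).ker ∧
      (invNorm σ).range.relIndex (invDiff σ).ker ≠ 0 := by
  let sq : E →* E := powMonoidHom 2
  have hidx : ∀ S : Subgroup E, (S.map sq).relIndex S =
      2 ^ Module.finrank ℤ (Additive S) * Nat.card (powMonoidHom 2 : S →* S).ker := by
    intro S
    have := finite_additive_subgroup S
    rw [← index_range_pow_two, Subgroup.relIndex]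
    congr 1
    ext x
    constructor
    · rintro ⟨y, hy, h⟩
      exact ⟨⟨y, hy⟩, Subtype.ext h⟩
    · rintro ⟨y, rfl⟩
      exact ⟨y, y.2, rfl⟩
  have hND : ∀ x ∈ (invNorm σ).ker, sq x = invDiff σ x := by
    intro x hx
    rw [mem_ker_invNorm] at hx
    rw [invDiff_apply, eq_inv_of_mul_eq_one_right hx, div_inv_eq_mul]
    exact pow_two x
  have hDN : ∀ x ∈ (invDiff σ).ker, sq x = invNorm σ x := by
    intro x hx
    rw [mem_ker_invDiff] at hx
    rw [invNorm_apply, hx]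
    exact pow_two x
  have hsN : (invNorm σ).ker.map sq = (invNorm σ).ker.map (invDiff σ) := by
    ext y; constructor <;> rintro ⟨x, hx, rfl⟩
    · exact ⟨x, hx, (hND x hx).symm⟩
    · exact ⟨x, hx, hND x hx⟩
  have hsD : (invDiff σ).ker.map sq = (invDiff σ).ker.map (invNorm σ) := by
    ext y; constructor <;> rintro ⟨x, hx, rfl⟩
    · exact ⟨x, hx, (hDN x hx).symm⟩
    · exact ⟨x, hx, hDN x hx⟩
  have q1 : ((invDiff σ).ker.map (invNorm σ)).relIndex (invNorm σ).range =
      ((invDiff σ).ker ⊔ (invNorm σ).ker).index := by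
    rw [MonoidHom.range_eq_map, Subgroup.relIndex_map_map, top_sup_eq, Subgroup.relIndex_top_right]
  have q2 : ((invNorm σ).ker.map (invDiff σ)).relIndex (invDiff σ).range =
      ((invDiff σ).ker ⊔ (invNorm σ).ker).index := by
    rw [MonoidHom.range_eq_map, Subgroup.relIndex_map_map, top_sup_eq, Subgroup.relIndex_top_right,
      sup_comm]
  have e1 := Subgroup.relIndex_mul_relIndex ((invDiff σ).ker.map (invNorm σ)) (invNorm σ).range
    (invDiff σ).ker (Subgroup.map_le_range _ _) (range_invNorm_le hσ)
  have e2 := Subgroup.relIndex_mul_relIndex ((invNorm σ).ker.map (invDiff σ)) (invDiff σ).range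
    (invNorm σ).ker (Subgroup.map_le_range _ _) (range_invDiff_le hσ)
  have hrk := finrank_ker_invNorm hσ
  have ht : Nat.card (powMonoidHom 2 : (invDiff σ).ker →* (invDiff σ).ker).ker =
      Nat.card (powMonoidHom 2 : (invNorm σ).ker →* (invNorm σ).ker).ker := by
    refine Nat.card_congr ⟨fun x => ⟨⟨x.1.1, ?_⟩, ?_⟩, fun x => ⟨⟨x.1.1, ?_⟩, ?_⟩, fun x => rfl,
      fun x => rfl⟩
    · have h : x.1.1 ^ 2 = 1 := congrArg Subtype.val x.2
      rw [mem_ker_invNorm, h2 _ h, ← pow_two, h]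
    · have h : x.1.1 ^ 2 = 1 := congrArg Subtype.val x.2
      exact Subtype.ext h
    · have h : x.1.1 ^ 2 = 1 := congrArg Subtype.val x.2
      rw [mem_ker_invDiff, h2 _ h]
    · have h : x.1.1 ^ 2 = 1 := congrArg Subtype.val x.2
      exact Subtype.ext h
  have ht0 : 0 < Nat.card (powMonoidHom 2 : (invDiff σ).ker →* (invDiff σ).ker).ker := by
    have := finite_additive_subgroup (invDiff σ).ker
    have h := hidx (invDiff σ).ker
    have hfin : Finite (CommGroup.torsion (invDiff σ).ker) := by
      have := finite_additive_subgroup (CommGroup.torsion (invDiff σ).ker)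
      have : Group.FG (CommGroup.torsion (invDiff σ).ker) := fg_of_finite_additive
      exact CommGroup.finite_of_fg_isMulTorsion _ (CommMonoid.torsion.isMulTorsion)
    have : Finite (powMonoidHom 2 : (invDiff σ).ker →* (invDiff σ).ker).ker := by
      refine Finite.of_injective (β := CommGroup.torsion (invDiff σ).ker) (fun x => ⟨x.1, ?_⟩) ?_
      · exact isOfFinOrder_iff_pow_eq_one.2 ⟨2, by norm_num, x.2⟩
      · intro x y h
        exact Subtype.ext (congrArg Subtype.val h :)
    exact Nat.card_pos
  rw [q1, ← hsD, hidx, hF] at e1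
  rw [q2, ← hsN, hidx, ← ht] at e2
  have hN : Module.finrank ℤ (Additive (invNorm σ).ker) = m + 1 := by omega
  rw [hN] at e2
  generalize ((invDiff σ).ker ⊔ (invNorm σ).ker).index = q at *
  generalize Nat.card (powMonoidHom 2 : (invDiff σ).ker →* (invDiff σ).ker).ker = t at *
  have hpos : 0 < 2 ^ m * t := by positivity
  have hq : 0 < q := by
    rcases Nat.eq_zero_or_pos q with h | h
    · rw [h, zero_mul] at e1; omega
    · exact h
  refine ⟨Nat.eq_of_mul_eq_mul_left hq ?_, ?_⟩
  · rw [e2, pow_succ, mul_left_comm, e1]; ring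
  · intro h
    rw [h, mul_zero] at e1; omega

end UnitIndex

section UnramifiedAction

/-- An action is unramified if inertia groups are trivial: the elements `y - g • y` generate the
unit ideal for every `g ≠ 1`. -/
def UnramifiedAction (G R : Type*) [Group G] [CommRing R] [MulSemiringAction G R] : Prop :=
  ∀ g : G, g ≠ 1 → Ideal.span (Set.range fun y : R => y - g • y) = ⊤

theorem unramifiedAction_iff_forall_isMaximal {G R : Type*} [Group G] [CommRing R]
    [MulSemiringAction G R] : UnramifiedAction G R ↔
      ∀ g : G, g ≠ 1 → ∀ M : Ideal R, M.IsMaximal → ∃ y : R, y - g • y ∉ M := by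
  refine forall₂_congr fun g _ => ?_
  constructor
  · intro h M hM
    by_contra! hc
    refine hM.ne_top (top_le_iff.1 (h ▸ Ideal.span_le.2 ?_))
    rintro _ ⟨y, rfl⟩
    exact hc y
  · intro h
    by_contra hc
    obtain ⟨M, hM, hle⟩ := Ideal.exists_le_maximal _ hc
    obtain ⟨y, hy⟩ := h M hM
    exact hy (hle (Ideal.subset_span ⟨y, rfl⟩))

/-- Dual systems for an action, in the style of Chase, Harrison and Rosenberg. -/
def IsDualSystem (G : Type*) {R : Type*} [Group G] [CommRing R] [MulSemiringAction G R] {n : ℕ}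
    (a b : Fin n → R) : Prop :=
  ∑ i, a i * b i = 1 ∧ ∀ g : G, g ≠ 1 → ∑ i, a i * g • b i = 0

open scoped TensorProduct in
theorem UnramifiedAction.exists_dual {G R : Type*} [Group G] [Finite G] [CommRing R]
    [MulSemiringAction G R] (h : UnramifiedAction G R) :
    ∃ (n : ℕ) (a b : Fin n → R), IsDualSystem G a b := by
  classical
  have := Fintype.ofFinite G
  let Φ (g : G) : R ⊗[ℤ] R →ₐ[ℤ] R := Algebra.TensorProduct.lift (AlgHom.id ℤ R)
    ((MulSemiringAction.toRingHom G R g).toIntAlgHom) (fun _ _ => Commute.all _ _)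
  have hΦ : ∀ g x y, Φ g (x ⊗ₜ y) = x * g • y := fun g x y => by simp [Φ]
  have h1 : ∀ g : G, g ≠ 1 → ∃ z : R ⊗[ℤ] R, Φ 1 z = 1 ∧ Φ g z = 0 := by
    intro g hg
    have h1 : (1 : R) ∈ Ideal.span (Set.range fun y : R => y - g • y) := by rw [h g hg]; trivial
    rw [Ideal.span, Finsupp.mem_span_range_iff_exists_finsupp] at h1
    obtain ⟨c, hc⟩ := h1
    refine ⟨1 - c.sum fun y r => (r * y) ⊗ₜ[ℤ] 1 - r ⊗ₜ[ℤ] y, ?_, ?_⟩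
    · simp [map_finsuppSum, hΦ]
    · rw [map_sub, map_one, map_finsuppSum, sub_eq_zero]
      refine hc.symm.trans ?_
      refine Finset.sum_congr rfl fun y _ => ?_
      simp only [map_sub, hΦ, smul_one, mul_one, smul_eq_mul]
      ring
  choose! z hz using h1
  obtain ⟨n, a, b, hab⟩ := TensorProduct.exists_sum_tmul_eq
    (∏ g ∈ Finset.univ.erase (1 : G), z g)
  have key : ∀ g, ∑ i, a i * g • b i = Φ g (∏ g ∈ Finset.univ.erase (1 : G), z g) := by
    intro g
    rw [hab, map_sum]
    simp [hΦ]
  refine ⟨n, a, b, ?_, fun g hg => ?_⟩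
  · have := key 1
    simp only [one_smul] at this
    rw [this, map_prod]
    exact Finset.prod_eq_one fun x hx => (hz x (Finset.ne_of_mem_erase hx)).1
  · rw [key, map_prod]
    exact Finset.prod_eq_zero (Finset.mem_erase.2 ⟨hg, Finset.mem_univ _⟩) (hz g hg).2

theorem span_sub_eq_top_of_sum {R : Type*} [CommRing R] {n : ℕ} (a b : Fin n → R) (f : R → R)
    (h1 : ∑ i, a i * b i = 1) (h2 : ∑ i, a i * f (b i) = 0) :
    Ideal.span (Set.range fun y : R => y - f y) = ⊤ := by
  rw [Ideal.eq_top_iff_one, ← sub_zero 1, ← h1, ← h2, ← Finset.sum_sub_distrib]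
  refine Ideal.sum_mem _ fun i _ => ?_
  rw [← mul_sub]
  exact Ideal.mul_mem_left _ _ (Ideal.subset_span ⟨b i, rfl⟩)

theorem UnramifiedAction.subgroup {G R : Type*} [Group G] [CommRing R] [MulSemiringAction G R]
    (h : UnramifiedAction G R) (H : Subgroup G) : UnramifiedAction H R :=
  fun g hg => h g (by simpa using hg)

section Trace

variable {G R S : Type*} [Group G] [CommRing R] [MulSemiringAction G R] [CommRing S]
  (ι : S →+* R)

/-- The trace `∑ g, g • x`. -/
def actTrace (G : Type*) {R : Type*} [Group G] [Fintype G] [CommRing R] [MulSemiringAction G R]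
    (x : R) : R := ∑ g : G, g • x

theorem smul_actTrace [Fintype G] (g : G) (x : R) : g • actTrace G x = actTrace G x := by
  rw [actTrace, Finset.smul_sum]
  simp only [smul_smul]
  exact Fintype.sum_bijective _ (Group.mulLeft_bijective g) _ _ fun _ => rfl

theorem IsDualSystem.sum_mul_actTrace [Fintype G] {n : ℕ} {a b : Fin n → R}
    (h : IsDualSystem G a b) (x : R) : ∑ i, a i * actTrace G (b i * x) = x := by
  classical
  simp only [actTrace, Finset.mul_sum, smul_mul', ← mul_assoc]
  rw [Finset.sum_comm]
  simp only [← Finset.sum_mul]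
  rw [Finset.sum_eq_single 1]
  · simp [h.1]
  · intro g _ hg
    rw [h.2 g hg, zero_mul]
  · simp

theorem UnramifiedAction.exists_actTrace_eq_one [Fintype G] (hι : Function.Injective ι)
    (hfix : ∀ x : R, (∀ g : G, g • x = x) → x ∈ ι.range) (hfix' : ∀ (g : G) x, g • ι x = ι x)
    (hint : ι.IsIntegral)
    (h : UnramifiedAction G R) : ∃ t : R, actTrace G t = 1 := by
  obtain ⟨n, a, b, hab⟩ := h.exists_dual
  let J : Ideal S :=
    { carrier := {s | ∃ x : R, ι s = actTrace G x}
      zero_mem' := ⟨0, by simp [actTrace]⟩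
      add_mem' := by
        rintro s t ⟨x, hx⟩ ⟨y, hy⟩
        exact ⟨x + y, by simp [actTrace, hx, hy, Finset.sum_add_distrib]⟩
      smul_mem' := by
        rintro s t ⟨x, hx⟩
        exact ⟨ι s * x, by simp [actTrace, hx, hfix', Finset.mul_sum]⟩ }
  have hJ : J.map ι = ⊤ := by
    rw [Ideal.eq_top_iff_one, ← hab.sum_mul_actTrace 1]
    refine Ideal.sum_mem _ fun i _ => Ideal.mul_mem_left _ _ ?_
    obtain ⟨s, hs⟩ := hfix _ fun g => smul_actTrace g (b i * 1)
    rw [← hs]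
    exact Ideal.mem_map_of_mem _ ⟨_, hs⟩
  rw [Ideal.map_eq_top_iff ι hι hint, Ideal.eq_top_iff_one] at hJ
  obtain ⟨x, hx⟩ := hJ
  exact ⟨x, by rw [← hx, map_one]⟩

/-- Unramified actions pass to quotients. -/
theorem UnramifiedAction.span_quotient [Finite G] (H : Subgroup G) (hι : Function.Injective ι)
    (hfix : ∀ x : R, (∀ g ∈ H, g • x = x) → x ∈ ι.range) (hfix' : ∀ g ∈ H, ∀ x, g • ι x = ι x)
    (hint : ι.IsIntegral) (h : UnramifiedAction G R) {g : G} (hg : g ∉ H) (f : S → S)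
    (hf : ∀ s, ι (f s) = g • ι s) : Ideal.span (Set.range fun y : S => y - f y) = ⊤ := by
  classical
  have := Fintype.ofFinite H
  obtain ⟨t, ht⟩ := UnramifiedAction.exists_actTrace_eq_one (G := H) ι hι
    (fun x hx => hfix x fun g hg => hx ⟨g, hg⟩) (fun g x => hfix' g g.2 x) hint (h.subgroup H)
  obtain ⟨n, a, b, hab⟩ := h.exists_dual
  have hα : ∀ x : R, ∃ s : S, ι s = actTrace H x := fun x =>
    hfix _ fun g hg => smul_actTrace (⟨g, hg⟩ : H) x
  choose T hT using hα
  have key : ∀ g : G, ∑ i, actTrace H (t * a i) * g • actTrace H (b i) =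
      ∑ k : H, ∑ k' : H, (k : G) • (t * ∑ i, a i * ((k : G)⁻¹ * g * k') • b i) := by
    intro g
    simp only [actTrace, Finset.smul_sum, Finset.sum_mul_sum]
    simp only [Finset.smul_sum, Finset.mul_sum]
    rw [Finset.sum_comm]
    refine Finset.sum_congr rfl fun k _ => ?_
    rw [Finset.sum_comm]
    refine Finset.sum_congr rfl fun k' _ => Finset.sum_congr rfl fun i _ => ?_
    simp only [smul_mul', ← mul_assoc, mul_smul, smul_inv_smul]
    rfl
  refine span_sub_eq_top_of_sum (fun i => T (t * a i)) (fun i => T (b i)) f ?_ ?_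
  · apply hι
    rw [map_sum, map_one]
    simp only [map_mul, hT]
    have := key 1
    simp only [one_smul] at this
    rw [this, ← ht]
    refine Finset.sum_congr rfl fun k _ => ?_
    rw [Finset.sum_eq_single k]
    · simp [hab.1]; rfl
    · intro k' _ hk
      rw [hab.2, mul_zero, smul_zero]
      intro h1
      apply hk
      rw [mul_one, inv_mul_eq_one] at h1
      exact Subtype.ext h1.symm
    · simp
  · apply hι
    rw [map_sum, map_zero]
    simp only [map_mul, hT, hf]
    rw [key]
    refine Finset.sum_eq_zero fun k _ => Finset.sum_eq_zero fun k' _ => ?_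
    rw [hab.2, mul_zero, smul_zero]
    intro h1
    apply hg
    have : g = k * (k' : G)⁻¹ := by
      rw [eq_mul_inv_iff_mul_eq, eq_comm, ← inv_mul_eq_one, ← mul_assoc, h1]
    rw [this]
    exact H.mul_mem k.2 (H.inv_mem k'.2)

end Trace
end UnramifiedAction

section GaloisIdeals

open NumberField nonZeroDivisors FractionalIdeal

/-- Fractional ideals of a number field. -/
abbrev FrId (K : Type*) [Field K] := FractionalIdeal (𝓞 K)⁰ K

/-- The action of an automorphism on fractional ideals. -/
noncomputable def galI {G K : Type*} [Field K] [NumberField K] [Group G]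
    [MulSemiringAction G K] (g : G) :
    FrId K →+* FrId K :=
  extendedHom' (f := MulSemiringAction.toRingHom G (𝓞 K) g) K
    (nonZeroDivisors_le_comap_nonZeroDivisors_of_injective _ (MulAction.injective g))

variable {G K : Type*} [Field K] [NumberField K] [Group G] [MulSemiringAction G K]

theorem coe_smul_ringOfIntegers (g : G) (x : 𝓞 K) : ((g • x : 𝓞 K) : K) = g • (x : K) :=
  algebraMap.smul' (C := K) g x

theorem mem_galI {g : G} {I : FrId K} {x : K} : x ∈ galI g I ↔ g⁻¹ • x ∈ I := by
  have hm : ∀ x, IsLocalization.map (M := (𝓞 K)⁰) K (MulSemiringAction.toRingHom G (𝓞 K) g)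
      (nonZeroDivisors_le_comap_nonZeroDivisors_of_injective _ (MulAction.injective g)) x =
      g • x := by
    intro x
    have : IsLocalization.map (M := (𝓞 K)⁰) K (MulSemiringAction.toRingHom G (𝓞 K) g)
      (nonZeroDivisors_le_comap_nonZeroDivisors_of_injective _ (MulAction.injective g)) =
      MulSemiringAction.toRingHom G K g := by
      refine IsLocalization.ringHom_ext (𝓞 K)⁰ (RingHom.ext fun y => ?_)
      simp only [RingHom.comp_apply, IsLocalization.map_eq, MulSemiringAction.toRingHom_apply]
      exact coe_smul_ringOfIntegers g y
    rw [this]; rfl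
  rw [galI, extendedHom'_apply, mem_extended_iff]
  constructor
  · intro hx
    refine Submodule.span_induction (p := fun x _ => g⁻¹ • x ∈ I) ?_ ?_ ?_ ?_ hx
    · rintro _ ⟨y, hy, rfl⟩
      rw [hm, inv_smul_smul]
      exact hy
    · rw [smul_zero]; exact I.1.zero_mem
    · intro a b _ _ ha hb
      rw [smul_add]; exact I.1.add_mem ha hb
    · intro r a _ ha
      rw [Algebra.smul_def, smul_mul', ← coe_smul_ringOfIntegers]
      have := I.1.smul_mem (g⁻¹ • r) ha
      rwa [Algebra.smul_def] at this
  · intro hx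
    refine Submodule.subset_span ⟨_, hx, ?_⟩
    rw [hm, smul_inv_smul]

theorem smul_mem_galI {g : G} {I : FrId K} {x : K} : g • x ∈ galI g I ↔ x ∈ I := by
  rw [mem_galI, inv_smul_smul]

theorem galI_mul (g h : G) (I : FrId K) : galI (g * h) I = galI g (galI h I) := by
  ext x
  rw [mem_galI, mem_galI, mem_galI, mul_inv_rev, mul_smul]

theorem galI_one (I : FrId K) : galI (1 : G) I = I := by
  ext x
  rw [mem_galI, inv_one, one_smul]

theorem galI_spanSingleton (g : G) (x : K) :
    galI g (spanSingleton (𝓞 K)⁰ x) = spanSingleton (𝓞 K)⁰ (g • x) := by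
  ext y
  rw [mem_galI, mem_spanSingleton, mem_spanSingleton]
  constructor
  · rintro ⟨z, hz⟩
    refine ⟨g • z, ?_⟩
    rw [Algebra.smul_def] at hz ⊢
    rw [← RingOfIntegers.coe_eq_algebraMap, coe_smul_ringOfIntegers, ← smul_mul', hz, smul_inv_smul]
  · rintro ⟨z, hz⟩
    refine ⟨g⁻¹ • z, ?_⟩
    rw [Algebra.smul_def] at hz ⊢
    rw [← hz, smul_mul', inv_smul_smul, ← RingOfIntegers.coe_eq_algebraMap, coe_smul_ringOfIntegers]

section Ext

variable {F K : Type*} [Field F] [NumberField F] [Field K] [NumberField K] [Algebra F K]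

/-- Extension of fractional ideals. -/
noncomputable abbrev extI (F K : Type*) [Field F] [NumberField F] [Field K] [NumberField K]
    [Algebra F K] : FrId F →+* FrId K := extendedHom K (𝓞 K)

theorem extI_spanSingleton (x : F) :
    extI F K (spanSingleton (𝓞 F)⁰ x) = spanSingleton (𝓞 K)⁰ (algebraMap F K x) := by
  rw [extendedHom_spanSingleton]
  congr 1
  have : (IsFractionRing.map (FaithfulSMul.algebraMap_injective (𝓞 F) (𝓞 K)) : F →+* K) =
      algebraMap F K := by
    refine IsLocalization.ringHom_ext (𝓞 F)⁰ (RingHom.ext fun y => ?_)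
    simp only [RingHom.comp_apply, IsFractionRing.map, IsLocalization.map_eq]
    rfl
  rw [this]

theorem algebraMap_mem_extI {I : FrId F} {x : F} (hx : x ∈ I) : algebraMap F K x ∈ extI F K I := by
  have := coe_extendedHom_eq_span K (𝓞 K) I
  rw [← mem_coe, this]
  exact Submodule.subset_span ⟨x, hx, rfl⟩

theorem extI_le {I : FrId F} {J : FrId K} : extI F K I ≤ J ↔ ∀ x ∈ I, algebraMap F K x ∈ J := by
  rw [← coe_le_coe, coe_extendedHom_eq_span K (𝓞 K) I, Submodule.span_le]
  exact ⟨fun h x hx => h ⟨x, hx, rfl⟩, by rintro h _ ⟨x, hx, rfl⟩; exact h x hx⟩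

theorem galI_le {G : Type*} [Group G] [MulSemiringAction G K] {g : G} {I J : FrId K} :
    galI g I ≤ J ↔ I ≤ galI g⁻¹ J := by
  constructor
  · intro h x hx
    rw [mem_galI, inv_inv]
    exact h (smul_mem_galI.2 hx)
  · intro h x hx
    rw [mem_galI] at hx
    have := h hx
    rwa [smul_mem_galI] at this

theorem extI_galI {G G' : Type*} [Group G] [MulSemiringAction G K] [Group G']
    [MulSemiringAction G' F] {g : G} {g' : G'}
    (h : ∀ x : F, algebraMap F K (g' • x) = g • algebraMap F K x) (I : FrId F) :
    extI F K (galI g' I) = galI g (extI F K I) := by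
  have h' : ∀ x : F, algebraMap F K (g'⁻¹ • x) = g⁻¹ • algebraMap F K x := by
    intro x
    rw [eq_inv_smul_iff, ← h, smul_inv_smul]
  apply le_antisymm
  · rw [extI_le]
    intro x hx
    rw [mem_galI] at hx ⊢
    rw [← h']
    exact algebraMap_mem_extI hx
  · rw [galI_le, extI_le]
    intro x hx
    rw [mem_galI, inv_inv, ← h]
    exact algebraMap_mem_extI (smul_mem_galI.2 hx)

theorem galI_extI (g : K ≃ₐ[F] K) (I : FrId F) : galI g (extI F K I) = extI F K I := by
  have := extI_galI (K := K) (G := K ≃ₐ[F] K) (G' := F ≃ₐ[F] F) (g := g) (g' := 1) (by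
    intro x; simp) I
  rw [← this, galI_one]

/-- `K / F` is unramified at all finite places. -/
abbrev Unram (F K : Type*) [Field F] [Field K] [Algebra F K] : Prop :=
  UnramifiedAction (K ≃ₐ[F] K) (𝓞 K)

/-- In an unramified Galois extension, invariant ideals come from the base. -/
theorem exists_extI_eq [IsGalois F K] (h : Unram F K) {I : FrId K}
    (hI : ∀ g : K ≃ₐ[F] K, galI g I = I) : ∃ J : FrId F, extI F K J = I := by
  obtain ⟨n, a, b, hab⟩ := h.exists_dual
  have hN := isNoetherian I
  obtain ⟨s, hs⟩ : I.1.FG := Module.Finite.iff_fg.1 (inferInstanceAs (Module.Finite (𝓞 K) I))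
  have htr : ∀ x : K, ∃ y : F, algebraMap F K y = ∑ g : K ≃ₐ[F] K, g • x := by
    intro x
    exact ⟨Algebra.trace F K x, by rw [trace_eq_sum_automorphisms]; rfl⟩
  choose T hT using htr
  have hdual : ∀ x : K, ∑ i, (a i : K) * algebraMap F K (T (b i * x)) = x := by
    intro x
    simp only [hT, Finset.mul_sum, smul_mul']
    rw [Finset.sum_comm]
    classical
    have hg : ∀ g : K ≃ₐ[F] K, ∑ i, (a i : K) * (g • (b i : K) * g • x) =
        ((∑ i, a i * g • b i : 𝓞 K) : K) * g • x := by
      intro g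
      rw [RingOfIntegers.coe_eq_algebraMap, map_sum, Finset.sum_mul]
      refine Finset.sum_congr rfl fun i _ => ?_
      rw [map_mul, ← RingOfIntegers.coe_eq_algebraMap, ← RingOfIntegers.coe_eq_algebraMap, coe_smul_ringOfIntegers, mul_assoc]
    simp only [hg]
    rw [Finset.sum_eq_single 1]
    · simp only [one_smul]
      rw [hab.1, RingOfIntegers.coe_eq_algebraMap, map_one, one_mul]
    · intro g _ h1
      rw [hab.2 g h1, RingOfIntegers.coe_eq_algebraMap, map_zero, zero_mul]
    · simp
  have hmem : ∀ i, ∀ x ∈ s, algebraMap F K (T (b i * x)) ∈ I := by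
    intro i x hx
    rw [hT]
    refine I.1.sum_mem fun g _ => ?_
    have h1 : (b i : K) * x ∈ I := by
      have h2 : x ∈ I.1 := hs ▸ Submodule.subset_span hx
      have := I.1.smul_mem (b i) h2
      rwa [Algebra.smul_def] at this
    have := smul_mem_galI (g := g).2 h1
    rwa [hI] at this
  refine ⟨∑ x ∈ s, ∑ i, spanSingleton (𝓞 F)⁰ (T (b i * x)), le_antisymm ?_ ?_⟩
  · rw [map_sum]
    refine Finset.sum_induction _ (· ≤ I) (fun _ _ => ?_) (zero_le I) fun x hx => ?_
    · intro h1 h2; exact sup_le h1 h2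
    · rw [map_sum]
      refine Finset.sum_induction _ (· ≤ I) (fun _ _ => ?_) (zero_le I) fun i _ => ?_
      · intro h1 h2; exact sup_le h1 h2
      · rw [extI_spanSingleton, spanSingleton_le_iff_mem]
        exact hmem i x hx
  · rw [← coe_le_coe]
    change I.1 ≤ _
    rw [← hs, Submodule.span_le]
    intro x hx
    have h1 := hdual x
    rw [← h1]
    refine Submodule.sum_mem _ fun i _ => ?_
    rw [← Algebra.smul_def]
    refine Submodule.smul_mem _ _ ?_
    have h2 : spanSingleton (𝓞 F)⁰ (T (b i * x)) ≤
        ∑ x ∈ s, ∑ i, spanSingleton (𝓞 F)⁰ (T (b i * x)) :=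
      (Finset.single_le_sum (f := fun i => spanSingleton (𝓞 F)⁰ (T (b i * x)))
        (fun _ _ => zero_le _) (Finset.mem_univ i)).trans
      (Finset.single_le_sum (f := fun x => ∑ i, spanSingleton (𝓞 F)⁰ (T (b i * x)))
        (fun _ _ => zero_le _) hx)
    exact algebraMap_mem_extI (h2 (mem_spanSingleton_self _ _))

end Ext
end GaloisIdeals

section QuadraticNorm

open NumberField nonZeroDivisors FractionalIdeal

theorem relIndex_le_two_of_forall_mul_mem {A : Type*} [CommGroup A] (S T : Subgroup A)
    (h : ∀ x ∈ T, ∀ y ∈ T, x ∉ S → y ∉ S → x * y ∈ S) :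
    S.relIndex T = 1 ∨ S.relIndex T = 2 := by
  by_cases hT : T ≤ S
  · exact Or.inl (Subgroup.relIndex_eq_one.2 hT)
  · right
    obtain ⟨a, ha, haS⟩ := SetLike.not_le_iff_exists.1 hT
    rw [Subgroup.relIndex, Subgroup.index_eq_two_iff]
    refine ⟨⟨a, ha⟩, fun b => ?_⟩
    by_cases hb : (b : A) ∈ S
    · refine Or.inr ⟨hb, fun h1 => haS ?_⟩
      have h2 : (b : A) * a ∈ S := h1
      exact (Subgroup.mul_mem_cancel_left S hb).1 h2
    · exact Or.inl ⟨h b b.2 a ha hb haS, hb⟩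

variable {F L : Type*} [Field F] [NumberField F] [Field L] [NumberField L] [Algebra F L]

/-- The action of `σ` on `Lˣ`. -/
def unitAut (σ : L ≃ₐ[F] L) : Lˣ →* Lˣ := Units.map (σ : L →* L)

/-- The action of `σ` on invertible fractional ideals. -/
noncomputable def idealAut (σ : L ≃ₐ[F] L) : (FrId L)ˣ →* (FrId L)ˣ :=
  Units.map ((galI (K := L) σ : FrId L →+* FrId L) : FrId L →* FrId L)

omit [NumberField F] [NumberField L] in
theorem unit_hilbert_ninety (σ : L ≃ₐ[F] L) (hσ : σ * σ = 1) (h1 : σ ≠ 1) :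
    (invNorm (unitAut σ)).ker ≤ (invDiff (unitAut σ)).range := by
  have hσσ : ∀ x, σ (σ x) = x := fun x => by
    have := DFunLike.congr_fun hσ x; exact this
  intro x hx
  rw [mem_ker_invNorm] at hx
  have hx : (x : L) * σ x = 1 := congrArg Units.val hx
  have key : ∃ y : Lˣ, (y : L) = x * σ y := by
    by_cases h : (x : L) = -1
    · obtain ⟨z, hz⟩ : ∃ z, σ z ≠ z := by
        by_contra! hc
        exact h1 (AlgEquiv.ext hc)
      refine ⟨Units.mk0 (z - σ z) (sub_ne_zero.2 hz.symm), ?_⟩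
      simp [h, hσσ]
    · refine ⟨Units.mk0 (1 + x) (fun h2 => h (eq_neg_of_add_eq_zero_right h2)), ?_⟩
      simp only [Units.val_mk0, map_add, map_one, mul_add, mul_one, hx]
      ring
  obtain ⟨y, hy⟩ := key
  refine ⟨y, ?_⟩
  rw [invDiff_apply, div_eq_iff_eq_mul]
  exact Units.ext hy

omit [NumberField F] in
theorem ideal_hilbert_ninety (σ : L ≃ₐ[F] L) :
    (invNorm (idealAut σ)).ker ≤ (invDiff (idealAut σ)).range := by
  intro x hx
  rw [mem_ker_invNorm] at hx
  have hx : (x : FrId L) * galI σ (x : FrId L) = 1 := congrArg Units.val hx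
  have h0 : (1 + x : FrId L) ≠ 0 := by
    intro h
    have : (1 : FrId L) ≤ 0 := h ▸ le_sup_left
    exact one_ne_zero (le_antisymm this (zero_le _))
  refine ⟨Units.mk0 _ h0, ?_⟩
  rw [invDiff_apply, div_eq_iff_eq_mul]
  apply Units.ext
  change (1 + x : FrId L) = x * galI σ (1 + x : FrId L)
  rw [map_add, map_one, mul_add, mul_one, hx, add_comm]

section Transport

variable {A B : Type*} [CommGroup A] [CommGroup B] {j : A →* B} {s : A →* A} {t : B →* B}

theorem comp_invDiff (hjs : ∀ u, j (s u) = t (j u)) (u : A) :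
    j (invDiff s u) = invDiff t (j u) := by
  rw [invDiff_apply, invDiff_apply, map_div, hjs]

theorem comp_invNorm (hjs : ∀ u, j (s u) = t (j u)) (u : A) :
    j (invNorm s u) = invNorm t (j u) := by
  rw [invNorm_apply, invNorm_apply, map_mul, hjs]

theorem map_invDiff_range (hjs : ∀ u, j (s u) = t (j u)) :
    (invDiff s).range.map j = j.range.map (invDiff t) := by
  rw [← MonoidHom.range_comp, ← MonoidHom.range_comp]
  congr 1
  exact MonoidHom.ext (comp_invDiff hjs)

theorem map_invNorm_range (hjs : ∀ u, j (s u) = t (j u)) :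
    (invNorm s).range.map j = j.range.map (invNorm t) := by
  rw [← MonoidHom.range_comp, ← MonoidHom.range_comp]
  congr 1
  exact MonoidHom.ext (comp_invNorm hjs)

theorem map_invDiff_ker (hj : Function.Injective j) (hjs : ∀ u, j (s u) = t (j u)) :
    (invDiff s).ker.map j = j.range ⊓ (invDiff t).ker := by
  ext x
  constructor
  · rintro ⟨u, hu, rfl⟩
    exact ⟨⟨u, rfl⟩, MonoidHom.mem_ker.2 (by rw [← comp_invDiff hjs, MonoidHom.mem_ker.1 hu, map_one])⟩
  · rintro ⟨⟨u, rfl⟩, hu⟩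
    exact ⟨u, hj (by rw [comp_invDiff hjs, MonoidHom.mem_ker.1 hu, map_one]), rfl⟩

theorem map_invNorm_ker (hj : Function.Injective j) (hjs : ∀ u, j (s u) = t (j u)) :
    (invNorm s).ker.map j = j.range ⊓ (invNorm t).ker := by
  ext x
  constructor
  · rintro ⟨u, hu, rfl⟩
    exact ⟨⟨u, rfl⟩, MonoidHom.mem_ker.2 (by rw [← comp_invNorm hjs, MonoidHom.mem_ker.1 hu, map_one])⟩
  · rintro ⟨⟨u, rfl⟩, hu⟩
    exact ⟨u, hj (by rw [comp_invNorm hjs, MonoidHom.mem_ker.1 hu, map_one]), rfl⟩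

end Transport

theorem mem_ker_toPrincipalIdeal {x : Lˣ} :
    x ∈ (toPrincipalIdeal (𝓞 L) L).ker ↔
      x ∈ (Units.map (algebraMap (𝓞 L) L : 𝓞 L →* L)).range := by
  rw [MonoidHom.mem_ker, toPrincipalIdeal_eq_iff, Units.val_one]
  constructor
  · intro h
    have h1 : (x : L) ∈ (1 : FrId L) := h ▸ mem_spanSingleton_self _ _
    have h2 : ((x⁻¹ : Lˣ) : L) ∈ (1 : FrId L) := by
      have h3 : spanSingleton (𝓞 L)⁰ ((x⁻¹ : Lˣ) : L) = 1 := by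
        rw [Units.val_inv_eq_inv_val, ← spanSingleton_inv, h, inv_one]
      exact h3 ▸ mem_spanSingleton_self _ _
    obtain ⟨u, hu⟩ := (mem_one_iff _).1 h1
    obtain ⟨v, hv⟩ := (mem_one_iff _).1 h2
    have huv : u * v = 1 := RingOfIntegers.ext (by
      change algebraMap (𝓞 L) L (u * v) = algebraMap (𝓞 L) L 1
      rw [map_mul, hu, hv, map_one, Units.mul_inv])
    exact ⟨⟨u, v, huv, by rw [mul_comm, huv]⟩, Units.ext hu⟩
  · rintro ⟨u, rfl⟩
    refine le_antisymm ?_ ?_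
    · rw [spanSingleton_le_iff_mem, mem_one_iff]
      exact ⟨u, rfl⟩
    · rw [FractionalIdeal.one_le]
      exact (mem_spanSingleton _).2 ⟨((u⁻¹ : (𝓞 L)ˣ) : 𝓞 L), by
        rw [Algebra.smul_def]
        change algebraMap (𝓞 L) L _ * algebraMap (𝓞 L) L u = 1
        rw [← map_mul, Units.inv_mul, map_one]⟩

theorem toPrincipalIdeal_range_index : (toPrincipalIdeal (𝓞 L) L).range.index ≠ 0 := by
  have e := ClassGroup.equiv (R := 𝓞 L) L
  have : Finite ((FrId L)ˣ ⧸ (toPrincipalIdeal (𝓞 L) L).range) := Finite.of_equiv _ e.toEquiv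
  exact Subgroup.index_ne_zero_of_finite

theorem finrank_ker_invDiff_units [IsGalois F L] (h2 : Module.finrank F L = 2) (σ : L ≃ₐ[F] L)
    (h1 : σ ≠ 1) (s : (𝓞 L)ˣ →* (𝓞 L)ˣ) (hs : ∀ u, (s u : L) = σ (u : L)) :
    Module.finrank ℤ (Additive (invDiff s).ker) = Module.finrank ℤ (Additive (𝓞 F)ˣ) := by
  have hfix : ∀ x : L, σ x = x → ∃ y : F, algebraMap F L y = x := by
    intro x hx
    have : x ∈ (⊥ : IntermediateField F L) := by
      rw [IsGalois.mem_bot_iff_fixed]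
      intro g
      obtain ⟨k, rfl⟩ : ∃ k : ℕ, σ ^ k = g := by
        have hcard : Nat.card (L ≃ₐ[F] L) = 2 := (IsGalois.card_aut_eq_finrank F L).trans h2
        have hp : Fact (Nat.card (L ≃ₐ[F] L)).Prime := by rw [hcard]; exact ⟨Nat.prime_two⟩
        have := mem_powers_of_prime_card (p := Nat.card (L ≃ₐ[F] L)) rfl h1 (g' := g)
        exact this
      induction k with
      | zero => rfl
      | succ k ih => rw [pow_succ]; change (σ ^ k) (σ x) = x; rw [hx, ih]
    exact IntermediateField.mem_bot.1 this
  let i : (𝓞 F)ˣ →* (𝓞 L)ˣ := Units.map (algebraMap (𝓞 F) (𝓞 L) : 𝓞 F →* 𝓞 L)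
  have hi : Function.Injective i :=
    Units.map_injective (FaithfulSMul.algebraMap_injective (𝓞 F) (𝓞 L))
  have hiF : ∀ u, ((i u : 𝓞 L) : L) = algebraMap F L (u : F) := fun u => rfl
  have hr : i.range = (invDiff s).ker := by
    ext u
    rw [mem_ker_invDiff]
    constructor
    · rintro ⟨v, rfl⟩
      exact Units.ext (RingOfIntegers.ext ((hs _).trans (σ.commutes _)))
    · intro hu
      have hu' : σ (u : L) = u := (hs u).symm.trans (by rw [hu])
      have hv' : σ ((u⁻¹ : (𝓞 L)ˣ) : L) = (u⁻¹ : (𝓞 L)ˣ) := (hs _).symm.trans (by rw [map_inv, hu])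
      obtain ⟨y, hy⟩ := hfix _ hu'
      obtain ⟨z, hz⟩ := hfix _ hv'
      have hyi : IsIntegral ℤ y := (isIntegral_algebraMap_iff
        (FaithfulSMul.algebraMap_injective F L)).1 (hy ▸ RingOfIntegers.isIntegral_coe _)
      have hzi : IsIntegral ℤ z := (isIntegral_algebraMap_iff
        (FaithfulSMul.algebraMap_injective F L)).1 (hz ▸ RingOfIntegers.isIntegral_coe _)
      have huv : (⟨y, hyi⟩ : 𝓞 F) * ⟨z, hzi⟩ = 1 := by
        apply RingOfIntegers.ext
        apply FaithfulSMul.algebraMap_injective F L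
        change algebraMap F L (y * z) = algebraMap F L 1
        rw [map_mul, hy, hz, map_one]
        change algebraMap (𝓞 L) L u * algebraMap (𝓞 L) L (u⁻¹ : (𝓞 L)ˣ) = 1
        rw [← map_mul, Units.mul_inv, map_one]
      exact ⟨⟨⟨y, hyi⟩, ⟨z, hzi⟩, huv, (mul_comm _ _).trans huv⟩, Units.ext (RingOfIntegers.ext hy)⟩
  have e : (𝓞 F)ˣ ≃* (invDiff s).ker :=
    (MonoidHom.ofInjective hi).trans (MulEquiv.subgroupCongr hr)
  exact (LinearEquiv.finrank_eq (MulEquiv.toAdditive e).toIntLinearEquiv).symm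

theorem units_rank_eq_of_quadratic [IsTotallyComplex F] (h2 : Module.finrank F L = 2) :
    NumberField.Units.rank L = 2 * NumberField.Units.rank F + 1 := by
  have hL := isTotallyComplex_of_algebra F L
  have h3 := Module.finrank_mul_finrank ℚ F L
  have h4 := IsTotallyComplex.finrank F
  have h5 := IsTotallyComplex.finrank L
  have h6 := InfinitePlace.card_eq_nrRealPlaces_add_nrComplexPlaces F
  have h7 := InfinitePlace.card_eq_nrRealPlaces_add_nrComplexPlaces L
  rw [IsTotallyComplex.nrRealPlaces_eq_zero] at h6 h7
  have h8 : 0 < Module.finrank ℚ F := Module.finrank_pos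
  rw [NumberField.Units.rank, NumberField.Units.rank]
  rw [h2, h4] at h3
  omega

theorem exists_norm_eq_of_index [IsGalois F L] [IsTotallyComplex F]
    (h2 : Module.finrank F L = 2) (σ : L ≃ₐ[F] L) (h1 : σ ≠ 1)
    (hidx : ∀ x ∈ (invDiff (idealAut σ)).ker, ∀ y ∈ (invDiff (idealAut σ)).ker,
      x ∉ (invDiff (unitAut σ)).ker.map (toPrincipalIdeal (𝓞 L) L) ⊔ (invNorm (idealAut σ)).range →
      y ∉ (invDiff (unitAut σ)).ker.map (toPrincipalIdeal (𝓞 L) L) ⊔ (invNorm (idealAut σ)).range →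
      x * y ∈ (invDiff (unitAut σ)).ker.map (toPrincipalIdeal (𝓞 L) L) ⊔
        (invNorm (idealAut σ)).range)
    (a : Lˣ) (ha : σ a = a) (𝔠 : (FrId L)ˣ)
    (h𝔠 : (𝔠 : FrId L) * galI σ (𝔠 : FrId L) = spanSingleton (𝓞 L)⁰ (a : L)) :
    ∃ x : Lˣ, (x : L) * σ x = a := by
  have hcard : Nat.card (L ≃ₐ[F] L) = 2 := (IsGalois.card_aut_eq_finrank F L).trans h2
  have hσ : σ * σ = 1 := by rw [← sq, ← hcard, pow_card_eq_one']
  have hσσ : ∀ x, σ (σ x) = x := fun x => by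
    have := DFunLike.congr_fun hσ x; exact this
  have hm := relIndex_norm_mul_relIndex_diff (toPrincipalIdeal (𝓞 L) L) (unitAut σ) (idealAut σ)
    (fun x => Units.ext (hσσ x)) (fun x => Units.ext (by
      change galI σ (galI σ (x : FrId L)) = x
      rw [← galI_mul, hσ, galI_one])) (fun x => Units.ext (by
      rw [coe_toPrincipalIdeal]
      change _ = galI σ ((toPrincipalIdeal (𝓞 L) L x : (FrId L)ˣ) : FrId L)
      rw [coe_toPrincipalIdeal, galI_spanSingleton]; rfl)) (unit_hilbert_ninety σ hσ h1) (ideal_hilbert_ninety σ)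
      toPrincipalIdeal_range_index
  have hc := relIndex_le_two_of_forall_mul_mem _ _ hidx
  let j : (𝓞 L)ˣ →* Lˣ := Units.map (algebraMap (𝓞 L) L : 𝓞 L →* L)
  let s : (𝓞 L)ˣ →* (𝓞 L)ˣ := Units.map (MulSemiringAction.toRingHom _ (𝓞 L) σ : 𝓞 L →* 𝓞 L)
  have hj : Function.Injective j := Units.map_injective RingOfIntegers.coe_injective
  have hjr : (toPrincipalIdeal (𝓞 L) L).ker = j.range := Subgroup.ext fun x => mem_ker_toPrincipalIdeal
  have hjs : ∀ u, j (s u) = unitAut σ (j u) := fun u => Units.ext (coe_smul_ringOfIntegers σ _)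
  have hss : ∀ u, s (s u) = u := fun u => hj (by rw [hjs, hjs]; exact Units.ext (hσσ _))
  have e1 : ((toPrincipalIdeal (𝓞 L) L).ker.map (invDiff (unitAut σ))).relIndex
      ((toPrincipalIdeal (𝓞 L) L).ker ⊓ (invNorm (unitAut σ)).ker) =
      (invDiff s).range.relIndex (invNorm s).ker := by
    rw [← Subgroup.relIndex_map_map_of_injective _ _ hj, hjr, map_invDiff_range hjs,
      map_invNorm_ker hj hjs]
  have e2 : ((toPrincipalIdeal (𝓞 L) L).ker.map (invNorm (unitAut σ))).relIndex
      ((toPrincipalIdeal (𝓞 L) L).ker ⊓ (invDiff (unitAut σ)).ker) =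
      (invNorm s).range.relIndex (invDiff s).ker := by
    rw [← Subgroup.relIndex_map_map_of_injective _ _ hj, hjr, map_invNorm_range hjs,
      map_invDiff_ker hj hjs]
  rw [e1, e2] at hm
  obtain ⟨hu1, hu2⟩ := relIndex_norm_units (m := Units.rank F) hss (by
    intro x hx
    have h3 : (x : 𝓞 L) = 1 ∨ (x : 𝓞 L) = -1 := sq_eq_one_iff.1 (congrArg Units.val hx)
    apply Units.ext
    change σ • (x : 𝓞 L) = x
    rcases h3 with h3 | h3 <;> rw [h3] <;> simp)
    (by
      rw [NumberField.Units.finrank_eq]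
      exact units_rank_eq_of_quadratic h2)
    ((finrank_ker_invDiff_units h2 σ h1 s (fun u => coe_smul_ringOfIntegers σ (u : 𝓞 L))).trans (NumberField.Units.finrank_eq F))
  rw [hu1] at hm
  have hy : (invNorm (unitAut σ)).range.relIndex ((invDiff (unitAut σ)).ker ⊓
      (invNorm (idealAut σ)).range.comap (toPrincipalIdeal (𝓞 L) L)) = 1 := by
    generalize (invNorm s).range.relIndex (invDiff s).ker = n0 at *
    generalize (invNorm (unitAut σ)).range.relIndex _ = y at *
    rcases hc with hc | hc <;> rw [hc] at hm
    · exfalso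
      have := Nat.eq_of_mul_eq_mul_left (Nat.pos_of_ne_zero hu2)
        (by rw [← hm]; ring : n0 * (y * 2) = n0 * 1)
      omega
    · have := Nat.eq_of_mul_eq_mul_left (Nat.pos_of_ne_zero hu2)
        (by rw [← hm]; ring : n0 * (y * 2) = n0 * 2)
      omega
  have := Subgroup.relIndex_eq_one.1 hy (x := a) ⟨mem_ker_invDiff.2 (Units.ext ha),
    ⟨𝔠, Units.ext (h𝔠.trans (coe_toPrincipalIdeal (R := 𝓞 L) a).symm)⟩⟩
  obtain ⟨x, hx⟩ := this
  exact ⟨x, congrArg Units.val hx⟩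

end QuadraticNorm

section UnitPartition

open NumberField NumberField.Units NumberField.Units.dirichletUnitTheorem

variable (K : Type*) [Field K] [NumberField K]

/-- Linear coordinates on logarithmic space adapted to the fundamental units and invariant under
scaling. -/
theorem exists_unit_coordinates : ∃ (y : (InfinitePlace K → ℝ) →ₗ[ℝ] (Fin (rank K) → ℝ)) (M : ℝ),
    y (fun _ => 1) = 0 ∧
    (∀ i, y (fun w => Real.log (w (fundSystem K i : K))) = Pi.single i 1) ∧
    ∀ l, (∀ i, |y l i| ≤ 1) → |∑ w : InfinitePlace K, (w.mult : ℝ) * l w| ≤ 1 → ∀ w, |l w| ≤ M := by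
  classical
  let D : ℝ := Module.finrank ℚ K
  have hD : 0 < D := Nat.cast_pos.2 Module.finrank_pos
  have hDs : ∑ w : InfinitePlace K, (w.mult : ℝ) = D := by
    rw [← Nat.cast_sum, InfinitePlace.sum_mult_eq]
  let v : (InfinitePlace K → ℝ) →ₗ[ℝ] ℝ := ∑ w : InfinitePlace K, (w.mult : ℝ) • LinearMap.proj w
  have hv : ∀ l, v l = ∑ w : InfinitePlace K, (w.mult : ℝ) * l w := fun l => by
    simp [v]
  let P : (InfinitePlace K → ℝ) →ₗ[ℝ] logSpace K := LinearMap.pi fun w =>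
    (w.1.mult : ℝ) • (LinearMap.proj w.1 - D⁻¹ • v)
  have hP : ∀ l w, P l w = (w.1.mult : ℝ) * (l w.1 - D⁻¹ * v l) := fun l w => by simp [P]
  let B := (basisUnitLattice K).ofZLatticeBasis ℝ (unitLattice K)
  let y := B.equivFun.toLinearMap ∘ₗ P
  have hy : ∀ l, y l = B.equivFun (P l) := fun _ => rfl
  have hinj : (y.prod v).ker = ⊥ := by
    rw [LinearMap.ker_eq_bot']
    intro l hl
    have hl1 : y l = 0 := congrArg Prod.fst hl
    have hl2 : v l = 0 := congrArg Prod.snd hl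
    have hl3 : P l = 0 := by
      rw [hy, map_eq_zero_iff _ B.equivFun.injective] at hl1
      exact hl1
    have h4 : ∀ w, w ≠ w₀ → l w = 0 := by
      intro w hw
      have := hP l ⟨w, hw⟩
      rw [hl3, hl2, mul_zero, sub_zero] at this
      have hm : (w.mult : ℝ) ≠ 0 := Nat.cast_ne_zero.2 InfinitePlace.mult_ne_zero
      simpa [hm] using this.symm
    funext w
    by_cases hw : w = w₀
    · rw [hv, Finset.sum_eq_single_of_mem w₀ (Finset.mem_univ _)
        (fun b _ hb => by rw [h4 b hb, mul_zero])] at hl2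
      have hm : ((w₀ : InfinitePlace K).mult : ℝ) ≠ 0 :=
        Nat.cast_ne_zero.2 InfinitePlace.mult_ne_zero
      rw [hw]
      simpa [hm] using hl2
    · exact h4 w hw
  obtain ⟨C, hC, hanti⟩ := LinearMap.exists_antilipschitzWith _ hinj
  refine ⟨y, C, ?_, ?_, ?_⟩
  · rw [hy, map_eq_zero_iff _ B.equivFun.injective]
    funext w
    rw [hP, hv]
    simp only [mul_one, hDs, inv_mul_cancel₀ hD.ne', sub_self, mul_zero]
    rfl
  · intro i
    have h1 : P (fun w => Real.log (w (fundSystem K i : K))) = B i := by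
      funext w
      rw [hP, hv, sum_mult_mul_log, mul_zero, sub_zero, Module.Basis.ofZLatticeBasis_apply,
        ← logEmbedding_fundSystem, logEmbedding_component]
    rw [hy, h1]
    funext j
    rw [Module.Basis.equivFun_apply, Module.Basis.repr_self, Finsupp.single_eq_pi_single]
  · intro l h1 h2 w
    have h3 : ‖(y.prod v) l‖ ≤ 1 := by
      rw [Prod.norm_def]
      refine max_le ((pi_norm_le_iff_of_nonneg zero_le_one).2 h1) ?_
      change |v l| ≤ 1
      rw [hv]; exact h2
    have h4 := hanti.le_mul_norm_sub l 0
    rw [map_zero, add_zero, add_zero, norm_neg, norm_neg] at h4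
    exact ((norm_le_pi_norm l w).trans h4).trans (mul_le_of_le_one_right C.2 h3)


/-- The piecewise linear bump function supported on `[-1, 1]`. -/
noncomputable def tent (u : ℝ) : ℝ := max 0 (1 - |u|)

theorem tent_nonneg (u : ℝ) : 0 ≤ tent u := le_max_left _ _

theorem tent_le_one (u : ℝ) : tent u ≤ 1 :=
  max_le zero_le_one (by linarith [abs_nonneg u])

theorem tent_eq_zero {u : ℝ} (h : 1 ≤ |u|) : tent u = 0 := max_eq_left (by linarith)

theorem abs_tent_sub_le (a b : ℝ) : |tent a - tent b| ≤ |a - b| := by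
  refine (abs_max_sub_max_le_max _ _ _ _).trans ?_
  rw [sub_self, abs_zero, max_eq_right (abs_nonneg _)]
  have : (1 - |a|) - (1 - |b|) = |b| - |a| := by ring
  rw [this, abs_sub_comm a b]
  exact abs_abs_sub_abs_le_abs_sub b a

theorem tent_fract (y : ℝ) (n : ℤ) : tent (y - n) =
    if n = ⌊y⌋ then 1 - Int.fract y else if n = ⌊y⌋ + 1 then Int.fract y else 0 := by
  have h0 := Int.fract_nonneg y
  have h1 := Int.fract_lt_one y
  have h2 := Int.floor_add_fract y
  split_ifs with h h'
  · rw [h, Int.self_sub_floor, tent, abs_of_nonneg h0, max_eq_right (by linarith)]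
  · rw [h', tent, abs_of_nonpos (by push_cast; linarith), max_eq_right (by push_cast; linarith)]
    push_cast; linarith
  · apply tent_eq_zero
    rcases lt_or_gt_of_ne h with h3 | h3
    · have : (n : ℝ) + 1 ≤ ⌊y⌋ := by exact_mod_cast h3
      rw [abs_of_nonneg (by linarith)]; linarith
    · have : (⌊y⌋ : ℝ) + 2 ≤ n := by
        have : ⌊y⌋ + 2 ≤ n := by omega
        exact_mod_cast this
      rw [abs_of_nonpos (by linarith)]; linarith

theorem exists_tent_sum (y : ℝ) : ∃ S : Finset ℤ, (∀ n ∉ S, tent (y + n) = 0) ∧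
    ∑ n ∈ S, tent (y + n) = 1 := by
  have h : ∀ n : ℤ, tent (y + n) = if -n = ⌊y⌋ then 1 - Int.fract y else
      if -n = ⌊y⌋ + 1 then Int.fract y else 0 := fun n => by
    rw [← tent_fract]; push_cast; rw [sub_neg_eq_add]
  refine ⟨{-⌊y⌋, -(⌊y⌋ + 1)}, fun n hn => ?_, ?_⟩
  · simp only [Finset.mem_insert, Finset.mem_singleton, not_or] at hn
    rw [h, if_neg (by omega), if_neg (by omega)]
  · rw [Finset.sum_pair (by omega), h, h, if_pos (by omega), if_neg (by omega), if_pos (by omega)]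
    ring

theorem exists_tent_sum_nat {y : ℝ} (hy : 0 ≤ y) : ∃ S : Finset ℕ,
    (∀ n ∉ S, tent (y - n) = 0) ∧ ∑ n ∈ S, tent (y - n) = 1 := by
  have h : ∀ n : ℕ, tent (y - n) = if n = ⌊y⌋₊ then 1 - Int.fract y else
      if n = ⌊y⌋₊ + 1 then Int.fract y else 0 := fun n => by
    have := tent_fract y n
    rw [Int.cast_natCast] at this
    rw [this]
    have h2 := Int.natCast_floor_eq_floor hy
    have e1 : ((n : ℤ) = ⌊y⌋) ↔ n = ⌊y⌋₊ := by omega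
    have e2 : ((n : ℤ) = ⌊y⌋ + 1) ↔ n = ⌊y⌋₊ + 1 := by omega
    simp only [e1, e2]
  refine ⟨{⌊y⌋₊, ⌊y⌋₊ + 1}, fun n hn => ?_, ?_⟩
  · simp only [Finset.mem_insert, Finset.mem_singleton, not_or] at hn
    rw [h, if_neg (by omega), if_neg (by omega)]
  · rw [Finset.sum_pair (by omega), h, h, if_pos rfl, if_neg (by omega), if_pos rfl]
    ring

theorem abs_prod_sub_prod_le {ι : Type*} (s : Finset ι) (a b : ι → ℝ)
    (ha : ∀ i, |a i| ≤ 1) (hb : ∀ i, |b i| ≤ 1) :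
    |∏ i ∈ s, a i - ∏ i ∈ s, b i| ≤ ∑ i ∈ s, |a i - b i| := by
  classical
  induction s using Finset.induction_on with
  | empty => simp
  | insert i s hi ih =>
    rw [Finset.prod_insert hi, Finset.prod_insert hi, Finset.sum_insert hi]
    have h1 : |∏ i ∈ s, a i| ≤ 1 := by
      rw [Finset.abs_prod]; exact Finset.prod_le_one (fun _ _ => abs_nonneg _) fun i _ => ha i
    calc |a i * ∏ i ∈ s, a i - b i * ∏ i ∈ s, b i|
        = |(a i - b i) * ∏ i ∈ s, a i + b i * (∏ i ∈ s, a i - ∏ i ∈ s, b i)| := by ring_nf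
      _ ≤ |a i - b i| * 1 + 1 * |∏ i ∈ s, a i - ∏ i ∈ s, b i| := by
        refine (abs_add_le _ _).trans ?_
        rw [abs_mul, abs_mul]
        gcongr
        exact hb i
      _ ≤ _ := by linarith

/-- The weight used to decompose `n ^ (-s)` dyadically. -/
noncomputable def dyadicWeight (s t : ℝ) : ℝ := tent t * (2 : ℝ) ^ (-(s * t))

theorem dyadicWeight_nonneg (s t : ℝ) : 0 ≤ dyadicWeight s t :=
  mul_nonneg (tent_nonneg _) (by positivity)

theorem two_rpow_le_four {s t : ℝ} (hs : s ∈ Set.Icc (1 : ℝ) 2) (ht : |t| ≤ 1) :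
    (2 : ℝ) ^ (-(s * t)) ≤ 4 := by
  have : (4 : ℝ) = 2 ^ (2 : ℝ) := by norm_num
  rw [this]
  refine Real.rpow_le_rpow_of_exponent_le one_le_two ?_
  have h1 := abs_le.1 ht
  nlinarith [hs.1, hs.2, h1.1, h1.2]

theorem dyadicWeight_le {s : ℝ} (hs : s ∈ Set.Icc (1 : ℝ) 2) (t : ℝ) :
    dyadicWeight s t ≤ 4 * tent t := by
  by_cases h : |t| ≤ 1
  · rw [dyadicWeight, mul_comm]
    exact mul_le_mul_of_nonneg_right (two_rpow_le_four hs h) (tent_nonneg _)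
  · rw [dyadicWeight, tent_eq_zero (not_le.1 h).le]; simp

theorem abs_two_rpow_sub_le {s a b : ℝ} (hs : s ∈ Set.Icc (1 : ℝ) 2) (ha : |a| ≤ 1)
    (hb : |b| ≤ 1) : |(2 : ℝ) ^ (-(s * a)) - (2 : ℝ) ^ (-(s * b))| ≤ 8 * |a - b| := by
  wlog h : a ≤ b generalizing a b
  · rw [abs_sub_comm, abs_sub_comm a]; exact this hb ha (le_of_not_ge h)
  have h1 : (2 : ℝ) ^ (-(s * b)) = 2 ^ (-(s * a)) * 2 ^ (-(s * (b - a))) := by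
    rw [← Real.rpow_add two_pos]; ring_nf
  have h2 : (1 : ℝ) - 2 * (b - a) ≤ 2 ^ (-(s * (b - a))) := by
    rw [Real.rpow_def_of_pos two_pos]
    refine le_trans ?_ (Real.add_one_le_exp _)
    have h3 : Real.log 2 ≤ 1 := by linarith [Real.log_two_lt_d9]
    have h4 : 0 ≤ Real.log 2 := Real.log_nonneg one_le_two
    have h5 : Real.log 2 * s ≤ 2 := by nlinarith [hs.1, hs.2]
    nlinarith [mul_le_mul_of_nonneg_right h5 (sub_nonneg.2 h)]
  have h3 : (2 : ℝ) ^ (-(s * (b - a))) ≤ 1 :=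
    Real.rpow_le_one_of_one_le_of_nonpos one_le_two
      (by nlinarith [hs.1, mul_nonneg (by linarith [hs.1] : 0 ≤ s) (sub_nonneg.2 h)])
  have h4 := two_rpow_le_four hs ha
  have h5 : (0 : ℝ) < 2 ^ (-(s * a)) := by positivity
  have h6 : (2 : ℝ) ^ (-(s * a)) - (2 : ℝ) ^ (-(s * b)) =
    2 ^ (-(s * a)) * (1 - 2 ^ (-(s * (b - a)))) := by rw [h1]; ring
  rw [h6, abs_of_nonneg (mul_nonneg h5.le (by linarith)), abs_sub_comm, abs_of_nonneg (by linarith)]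
  nlinarith

theorem abs_dyadicWeight_sub_le {s : ℝ} (hs : s ∈ Set.Icc (1 : ℝ) 2) (a b : ℝ) :
    |dyadicWeight s a - dyadicWeight s b| ≤ 12 * |a - b| := by
  have key : ∀ a b : ℝ, 1 ≤ |b| → |dyadicWeight s a - dyadicWeight s b| ≤ 12 * |a - b| := by
    intro a b hb
    have h1 := abs_tent_sub_le a b
    have h2 := dyadicWeight_le hs a
    rw [tent_eq_zero hb, sub_zero, abs_of_nonneg (tent_nonneg _)] at h1
    rw [dyadicWeight.eq_def s b, tent_eq_zero hb, zero_mul, sub_zero,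
      abs_of_nonneg (dyadicWeight_nonneg _ _)]
    linarith [abs_nonneg (a - b)]
  by_cases hb : 1 ≤ |b|
  · exact key a b hb
  by_cases ha : 1 ≤ |a|
  · rw [abs_sub_comm, abs_sub_comm a]; exact key b a ha
  push Not at ha hb
  have h1 := abs_tent_sub_le a b
  have h2 := abs_two_rpow_sub_le hs ha.le hb.le
  have h3 := two_rpow_le_four hs ha.le
  have h5 : (0 : ℝ) < 2 ^ (-(s * a)) := by positivity
  calc |dyadicWeight s a - dyadicWeight s b|
      = |(tent a - tent b) * 2 ^ (-(s * a)) + tent b * (2 ^ (-(s * a)) - 2 ^ (-(s * b)))| := by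
        rw [dyadicWeight, dyadicWeight]; ring_nf
    _ ≤ |a - b| * 4 + 1 * (8 * |a - b|) := by
        refine (abs_add_le _ _).trans ?_
        rw [abs_mul, abs_mul, abs_of_pos h5, abs_of_nonneg (tent_nonneg b)]
        gcongr
        exact tent_le_one b
    _ = _ := by ring

end UnitPartition

section UnitPartitionTwo

open NumberField NumberField.Units NumberField.Units.dirichletUnitTheorem

theorem abs_log_max_sub_le {η : ℝ} (hη : 0 < η) (a b : ℝ) :
    |Real.log (max a η) - Real.log (max b η)| ≤ η⁻¹ * |a - b| := by
  wlog h : b ≤ a generalizing a b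
  · rw [abs_sub_comm, abs_sub_comm a]; exact this b a (le_of_not_ge h)
  have h1 : max b η ≤ max a η := max_le_max_right η h
  have hb : η ≤ max b η := le_max_right _ _
  have hb0 : 0 < max b η := hη.trans_le hb
  have ha0 : 0 < max a η := hb0.trans_le h1
  have h2 := Real.log_le_sub_one_of_pos (div_pos ha0 hb0)
  rw [Real.log_div ha0.ne' hb0.ne'] at h2
  have h3 : max a η - max b η ≤ a - b := by
    have := abs_max_sub_max_le_abs a b η
    rwa [abs_of_nonneg (sub_nonneg.2 h1), abs_of_nonneg (sub_nonneg.2 h)] at this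
  rw [abs_of_nonneg (sub_nonneg.2 (Real.log_le_log hb0 h1)), abs_of_nonneg (sub_nonneg.2 h)]
  have h4 : max a η / max b η - 1 = (max b η)⁻¹ * (max a η - max b η) := by
    field_simp
  have h5 : (max b η)⁻¹ ≤ η⁻¹ := inv_anti₀ hη hb
  have h6 : 0 ≤ max a η - max b η := sub_nonneg.2 h1
  calc _ ≤ _ := h2
    _ = _ := h4
    _ ≤ _ := mul_le_mul h5 h3 h6 (inv_nonneg.2 hη.le)

variable (K : Type*) [Field K] [NumberField K]

theorem exists_log_bump : ∃ (H : ℝ → (InfinitePlace K → ℝ) → ℝ) (M C : ℝ), 0 ≤ M ∧ 0 ≤ C ∧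
    (∀ s l, 0 ≤ H s l) ∧
    (∀ s l, H s l ≠ 0 → ∀ w, |l w| ≤ M) ∧
    (∀ s ∈ Set.Icc (1 : ℝ) 2, ∀ l l', |H s l - H s l'| ≤ C * ‖l - l'‖) ∧
    ∀ s ∈ Set.Icc (1 : ℝ) 2, ∀ l : InfinitePlace K → ℝ,
      0 ≤ ∑ w : InfinitePlace K, (w.mult : ℝ) * l w →
      ∑' (u : (𝓞 K)ˣ), ∑' j : ℕ, ENNReal.ofReal ((2 : ℝ) ^ (-(j * s)) * H s (fun w =>
        l w + Real.log (w (u : K)) - j * Real.log 2 / Module.finrank ℚ K)) =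
      (torsionOrder K : ENNReal) *
        ENNReal.ofReal (Real.exp (-(s * ∑ w : InfinitePlace K, (w.mult : ℝ) * l w))) := by
  classical
  obtain ⟨y, M, hy1, hy2, hy3⟩ := exists_unit_coordinates K
  have hM : 0 ≤ M := (abs_nonneg _).trans (hy3 0 (by simp) (by simp) (Classical.arbitrary _))
  have hlog : 0 < Real.log 2 := Real.log_pos one_lt_two
  let v : (InfinitePlace K → ℝ) →ₗ[ℝ] ℝ :=
    ∑ w : InfinitePlace K, ((w.mult : ℝ) * (Real.log 2)⁻¹) • LinearMap.proj w
  have hv : ∀ l, v l = (∑ w : InfinitePlace K, (w.mult : ℝ) * l w) / Real.log 2 := fun l => by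
    simp [v, div_eq_mul_inv, mul_right_comm, Finset.sum_mul]
  let H : ℝ → (InfinitePlace K → ℝ) → ℝ := fun s l => (∏ i, tent (y l i)) * dyadicWeight s (v l)
  have hprod1 : ∀ l, 0 ≤ ∏ i, tent (y l i) := fun l => Finset.prod_nonneg fun i _ => tent_nonneg _
  have hprod2 : ∀ l, ∏ i, tent (y l i) ≤ 1 := fun l =>
    Finset.prod_le_one (fun i _ => tent_nonneg _) fun i _ => tent_le_one _
  let Y := LinearMap.toContinuousLinearMap y
  let V := LinearMap.toContinuousLinearMap v
  refine ⟨H, M, 4 * (rank K * ‖Y‖) + 12 * ‖V‖, hM, by positivity, fun s l =>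
    mul_nonneg (hprod1 l) (dyadicWeight_nonneg _ _), ?_, ?_, ?_⟩
  · intro s l h
    apply hy3
    · intro i
      by_contra! hc
      exact h (by
        change (∏ i, tent (y l i)) * _ = 0
        rw [Finset.prod_eq_zero (Finset.mem_univ i) (tent_eq_zero hc.le), zero_mul])
    · by_contra! hc
      refine h ?_
      change _ * (tent (v l) * _) = 0
      rw [tent_eq_zero, zero_mul, mul_zero]
      rw [hv, abs_div, abs_of_pos hlog, le_div_iff₀ hlog, one_mul]
      linarith [Real.log_two_lt_d9]
  · intro s hs l l'
    have h1 : |∏ i, tent (y l i) - ∏ i, tent (y l' i)| ≤ rank K * ‖Y‖ * ‖l - l'‖ := by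
      have habs : ∀ u, |tent u| ≤ 1 := fun u => by
        rw [abs_of_nonneg (tent_nonneg _)]; exact tent_le_one _
      refine (abs_prod_sub_prod_le _ _ _ (fun i => habs _) (fun i => habs _)).trans ?_
      refine (Finset.sum_le_card_nsmul _ _ (‖Y‖ * ‖l - l'‖) fun i _ => ?_).trans ?_
      · refine (abs_tent_sub_le _ _).trans ?_
        have : y l i - y l' i = (Y (l - l')) i := by
          change _ = y (l - l') i; rw [map_sub]; rfl
        rw [this]
        exact (norm_le_pi_norm (Y (l - l')) i).trans (Y.le_opNorm _)
      · simp [mul_assoc]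
    have h2 : |dyadicWeight s (v l) - dyadicWeight s (v l')| ≤ 12 * ‖V‖ * ‖l - l'‖ := by
      refine (abs_dyadicWeight_sub_le hs _ _).trans ?_
      rw [← map_sub, mul_assoc]
      exact mul_le_mul_of_nonneg_left (V.le_opNorm (l - l')) (by norm_num)
    have h3 : dyadicWeight s (v l) ≤ 4 := (dyadicWeight_le hs _).trans
      (by linarith [tent_le_one (v l)])
    calc |H s l - H s l'| = |(∏ i, tent (y l i) - ∏ i, tent (y l' i)) * dyadicWeight s (v l) +
          (∏ i, tent (y l' i)) * (dyadicWeight s (v l) - dyadicWeight s (v l'))| := by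
          congr 1; simp only [H]; ring
      _ ≤ (rank K * ‖Y‖ * ‖l - l'‖) * 4 + 1 * (12 * ‖V‖ * ‖l - l'‖) := by
          refine (abs_add_le _ _).trans ?_
          rw [abs_mul, abs_mul, abs_of_nonneg (dyadicWeight_nonneg s (v l)),
            abs_of_nonneg (hprod1 l')]
          gcongr
          · exact dyadicWeight_nonneg _ _
          · exact hprod2 l'
      _ = _ := by ring
  · intro s hs l hl
    set t := (∑ w : InfinitePlace K, (w.mult : ℝ) * l w) / Real.log 2 with ht
    have ht0 : 0 ≤ t := div_nonneg hl hlog.le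
    have hD : (0 : ℝ) < Module.finrank ℚ K := Nat.cast_pos.2 Module.finrank_pos
    have hDs : ∑ w : InfinitePlace K, (w.mult : ℝ) = Module.finrank ℚ K := by
      rw [← Nat.cast_sum, InfinitePlace.sum_mult_eq]
    let e : torsion K × (Fin (rank K) → ℤ) ≃ (𝓞 K)ˣ := Equiv.ofBijective
      (fun p => p.1 * ∏ i, fundSystem K i ^ p.2 i) (by
        refine Function.bijective_iff_existsUnique _ |>.2 fun x => ?_
        obtain ⟨p, hp, hp'⟩ := exist_unique_eq_mul_prod K x
        exact ⟨p, hp.symm, fun q hq => hp' q hq.symm⟩)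
    have hlogu : ∀ p, (fun w : InfinitePlace K => Real.log (w ((e p : 𝓞 K) : K))) =
        ∑ i, (p.2 i : ℝ) • fun w : InfinitePlace K => Real.log (w (fundSystem K i : K)) := by
      intro p
      funext w
      have h1 : ((e p : 𝓞 K) : K) = ((p.1 : (𝓞 K)ˣ) : K) * ∏ i, (fundSystem K i : K) ^ p.2 i := by
        let φ := Units.map (algebraMap (𝓞 K) K : 𝓞 K →* K)
        change ((φ (p.1 * ∏ i, fundSystem K i ^ p.2 i) : Kˣ) : K) = _
        rw [map_mul, map_prod, Units.val_mul, Units.coe_prod]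
        simp only [map_zpow, Units.val_zpow_eq_zpow_val]
        rfl
      have h2 : w ((p.1 : (𝓞 K)ˣ) : K) = 1 := (mem_torsion K).1 p.1.2 w
      rw [h1, map_mul, h2, one_mul, map_prod, Real.log_prod (fun i _ => (map_ne_zero w).2 (zpow_ne_zero _ (NumberField.Units.coe_ne_zero _)))]
      simp
    have hH : ∀ p (j : ℕ), H s (fun w => l w + Real.log (w ((e p : 𝓞 K) : K)) -
        j * Real.log 2 / Module.finrank ℚ K) =
        (∏ i, tent (y l i + p.2 i)) * dyadicWeight s (t - j) := by
      intro p j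
      have h1 : (fun w : InfinitePlace K => l w + Real.log (w ((e p : 𝓞 K) : K)) -
        j * Real.log 2 / Module.finrank ℚ K) = l + (fun w : InfinitePlace K =>
          Real.log (w ((e p : 𝓞 K) : K))) -
          (j * Real.log 2 / Module.finrank ℚ K) • fun _ => 1 := by
        funext w; simp
      have h2 : y (l + (fun w : InfinitePlace K => Real.log (w ((e p : 𝓞 K) : K))) -
          (j * Real.log 2 / Module.finrank ℚ K) • fun _ => 1) = fun i => y l i + p.2 i := by
        rw [map_sub, map_smul, hy1, smul_zero, sub_zero, map_add, hlogu, map_sum]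
        simp only [map_smul, hy2]
        funext i
        simp [Finset.sum_apply, Pi.single_apply]
      have h3 : v (l + (fun w : InfinitePlace K => Real.log (w ((e p : 𝓞 K) : K))) -
          (j * Real.log 2 / Module.finrank ℚ K) • fun _ => 1) = t - j := by
        rw [map_sub, map_add, map_smul, hv, hv, hv, sum_mult_mul_log]
        simp only [mul_one, hDs, zero_div, add_zero, smul_eq_mul, ht]
        field_simp
      change (∏ i, tent (y _ i)) * dyadicWeight s (v _) = _
      rw [h1, h2, h3]
    have hexp : ∀ j : ℕ, (2 : ℝ) ^ (-(j * s)) * dyadicWeight s (t - j) =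
        tent (t - j) * Real.exp (-(s * ∑ w : InfinitePlace K, (w.mult : ℝ) * l w)) := by
      intro j
      have : Real.exp (-(s * ∑ w : InfinitePlace K, (w.mult : ℝ) * l w)) = 2 ^ (-(s * t)) := by
        rw [Real.rpow_def_of_pos two_pos, ht]
        congr 1
        field_simp
      rw [this, dyadicWeight, mul_left_comm, ← Real.rpow_add two_pos]
      congr 2
      ring
    rw [← e.tsum_eq]
    set E := Real.exp (-(s * ∑ w : InfinitePlace K, (w.mult : ℝ) * l w))
    have hterm : ∀ p : torsion K × (Fin (rank K) → ℤ), ∑' j : ℕ, ENNReal.ofReal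
        ((2 : ℝ) ^ (-(j * s)) * H s (fun w =>
        l w + Real.log (w ((e p : 𝓞 K) : K)) - j * Real.log 2 / Module.finrank ℚ K)) =
        ENNReal.ofReal (∏ i, tent (y l i + p.2 i)) * ENNReal.ofReal E := by
      intro p
      obtain ⟨S, hS1, hS2⟩ := exists_tent_sum_nat ht0
      have h1 : ∀ j : ℕ, (2 : ℝ) ^ (-(j * s)) * H s (fun w =>
        l w + Real.log (w ((e p : 𝓞 K) : K)) - j * Real.log 2 / Module.finrank ℚ K) =
        tent (t - j) * ((∏ i, tent (y l i + p.2 i)) * E) := by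
        intro j
        rw [hH, mul_left_comm, hexp]; ring
      simp only [h1]
      rw [tsum_eq_sum (s := S) (fun j hj => by rw [hS1 j hj, zero_mul, ENNReal.ofReal_zero]),
        ← ENNReal.ofReal_sum_of_nonneg, ← Finset.sum_mul, hS2, one_mul, ENNReal.ofReal_mul]
      · exact Finset.prod_nonneg fun i _ => tent_nonneg _
      · intro j _
        exact mul_nonneg (tent_nonneg _) (mul_nonneg (Finset.prod_nonneg fun i _ => tent_nonneg _)
          (Real.exp_pos _).le)
    simp only [hterm]
    rw [ENNReal.tsum_prod (f := fun (_ : torsion K) (n : Fin (rank K) → ℤ) =>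
      ENNReal.ofReal (∏ i, tent (y l i + n i)) * ENNReal.ofReal E)]
    choose S hS1 hS2 using fun i => exists_tent_sum (y l i)
    have hsum : ∑' n : Fin (rank K) → ℤ, ENNReal.ofReal (∏ i, tent (y l i + n i)) = 1 := by
      rw [tsum_eq_sum (s := Fintype.piFinset S), ← ENNReal.ofReal_sum_of_nonneg,
        ← Finset.prod_univ_sum S (fun i n => tent (y l i + n)), Finset.prod_congr rfl (fun i _ => hS2 i), Finset.prod_const_one,
        ENNReal.ofReal_one]
      · exact fun n _ => Finset.prod_nonneg fun i _ => tent_nonneg _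
      · intro n hn
        rw [Fintype.mem_piFinset] at hn
        push Not at hn
        obtain ⟨i, hi⟩ := hn
        rw [Finset.prod_eq_zero (Finset.mem_univ i) (hS1 i _ hi), ENNReal.ofReal_zero]
    simp only [ENNReal.tsum_mul_right, hsum, one_mul]
    rw [ENNReal.tsum_const, ENat.card_eq_coe_natCard]
    rfl

end UnitPartitionTwo

section UnitPartitionThree

open NumberField NumberField.Units

variable (K : Type*) [Field K] [NumberField K]

theorem exists_bump : ∃ (g : ℝ → (InfinitePlace K → ℝ) → ℝ) (M C : ℝ), 0 < M ∧ 0 ≤ C ∧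
    (∀ s a, 0 ≤ g s a) ∧ (∀ s a, g s a ≠ 0 → ∀ w, a w ≤ M) ∧
    (∀ s ∈ Set.Icc (1 : ℝ) 2, ∀ a b, |g s a - g s b| ≤ C * ‖a - b‖) ∧
    (∀ s, g s 0 = 0) ∧
    ∀ s ∈ Set.Icc (1 : ℝ) 2, ∀ x : 𝓞 K, x ≠ 0 →
      ∑' (u : (𝓞 K)ˣ), ∑' j : ℕ, ENNReal.ofReal ((2 : ℝ) ^ (-(j * s)) * g s (fun w =>
        w ((u * x : 𝓞 K) : K) / 2 ^ ((j : ℝ) / Module.finrank ℚ K))) =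
      (torsionOrder K : ENNReal) *
        ENNReal.ofReal ((Ideal.absNorm (Ideal.span {x}) : ℝ) ^ (-s)) := by
  obtain ⟨H, M, C, hM, hC, h0, h1, h2, h3⟩ := exists_log_bump K
  set η : ℝ := Real.exp (-(M + 1)) with hη
  have hη0 : 0 < η := Real.exp_pos _
  have hlη : Real.log η = -(M + 1) := Real.log_exp _
  let w₀ : InfinitePlace K := Classical.arbitrary _
  have hpos : ∀ s (a : InfinitePlace K → ℝ), (∀ w, 0 < a w) →
      H s (fun w => Real.log (max (a w) η)) = H s (fun w => Real.log (a w)) := by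
    intro s a ha
    by_cases h : ∀ w, η ≤ a w
    · congr 1; funext w; rw [max_eq_left (h w)]
    · push Not at h
      obtain ⟨w, hw⟩ := h
      have e1 : H s (fun w => Real.log (max (a w) η)) = 0 := by
        by_contra h'
        have := abs_le.1 (h1 _ _ h' w)
        simp only [max_eq_right hw.le, hlη] at this
        linarith
      have e2 : H s (fun w => Real.log (a w)) = 0 := by
        by_contra h'
        have := abs_le.1 (h1 _ _ h' w)
        have h4 := Real.log_lt_log (ha w) hw
        rw [hlη] at h4
        linarith
      rw [e1, e2]
  refine ⟨fun s a => H s (fun w => Real.log (max (a w) η)), Real.exp M, C * η⁻¹,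
    Real.exp_pos _, by positivity, fun s a => h0 _ _, fun s a h w => ?_, fun s hs a b => ?_,
    fun s => ?_, fun s hs x hx => ?_⟩
  · have h4 := (abs_le.1 (h1 _ _ h w)).2
    have h5 : 0 < max (a w) η := hη0.trans_le (le_max_right _ _)
    exact (le_max_left _ _).trans ((Real.log_le_iff_le_exp h5).1 h4)
  · refine (h2 s hs _ _).trans ?_
    rw [mul_assoc]
    refine mul_le_mul_of_nonneg_left ?_ hC
    refine (pi_norm_le_iff_of_nonneg (by positivity)).2 fun w => ?_
    refine (abs_log_max_sub_le hη0 (a w) (b w)).trans ?_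
    exact mul_le_mul_of_nonneg_left (norm_le_pi_norm (a - b) w) (by positivity)
  · by_contra h'
    have := abs_le.1 (h1 _ _ h' w₀)
    simp only [Pi.zero_apply, max_eq_right hη0.le, hlη] at this
    linarith
  · have hx' : (x : K) ≠ 0 := by simpa using hx
    have hsum : ∑ w : InfinitePlace K, (w.mult : ℝ) * Real.log (w (x : K)) =
        Real.log (Ideal.absNorm (Ideal.span {x})) := by
      rw [Ideal.absNorm_span_singleton]
      have h4 := InfinitePlace.prod_eq_abs_norm (x : K)
      have h5 : ((Int.natAbs (Algebra.norm ℤ x) : ℕ) : ℝ) = ((|Algebra.norm ℚ (x : K)| : ℚ) : ℝ) := by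
        rw [← Algebra.coe_norm_int, Nat.cast_natAbs]
        push_cast; rfl
      rw [h5, ← h4, Real.log_prod (fun w _ => by simpa using hx')]
      simp [Real.log_pow]
    have hN : 0 < (Ideal.absNorm (Ideal.span {x}) : ℝ) := by
      rw [Nat.cast_pos, Nat.pos_iff_ne_zero, Ne, Ideal.absNorm_eq_zero_iff]
      simpa using hx
    have hN1 : 1 ≤ (Ideal.absNorm (Ideal.span {x}) : ℝ) := by
      exact_mod_cast hN
    have h4 := h3 s hs (fun w => Real.log (w (x : K))) (by
      rw [hsum]; exact Real.log_nonneg hN1)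
    rw [hsum] at h4
    rw [Real.rpow_def_of_pos hN, show Real.log (Ideal.absNorm (Ideal.span {x})) * -s =
      -(s * Real.log (Ideal.absNorm (Ideal.span {x}))) by ring, ← h4]
    refine tsum_congr fun u => tsum_congr fun j => ?_
    beta_reduce
    rw [hpos]
    · congr 2
      refine congrArg _ (funext fun w => ?_)
      rw [Real.log_div (by simp [hx]) (by positivity),
        show ((u * x : 𝓞 K) : K) = algebraMap (𝓞 K) K (u : 𝓞 K) * (x : K) from rfl, map_mul w,
        Real.log_mul (by simp) (by simpa using hx'), Real.log_rpow two_pos]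
      ring
    · intro w
      have : 0 < w ((u * x : 𝓞 K) : K) := InfinitePlace.pos_iff.2 (by simp [hx])
      positivity

theorem exists_card_ringOfIntegers_le : ∃ C : ℝ, 0 ≤ C ∧ ∀ T : ℝ, 1 ≤ T →
    {x : 𝓞 K | ∀ w : InfinitePlace K, w (x : K) ≤ T}.Finite ∧
    ({x : 𝓞 K | ∀ w : InfinitePlace K, w (x : K) ≤ T}.ncard : ℝ) ≤
      C * T ^ Module.finrank ℚ K := by
  classical
  obtain ⟨c, hc0, hc⟩ : ∃ c : ℝ, 0 ≤ c ∧ ∀ (α : 𝓞 K) i,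
      |((RingOfIntegers.basis K).repr α i : ℝ)| ≤ c * house (α : K) := by
    let e := equivReindex K
    have key := NumberField.house.basis_repr_norm_le_const_mul_house K
    have hex : ∃ c : ℝ, ∀ (α : 𝓞 K) i,
        ‖((((integralBasis K).reindex e.symm).repr (α : K) i : ℚ) : ℂ)‖ ≤ c * house (α : K) :=
      ⟨_, key⟩
    obtain ⟨c, hc⟩ := hex
    refine ⟨max c 0, le_max_right _ _, fun α i => ?_⟩
    have h1 := hc α (e.symm i)
    rw [Module.Basis.repr_reindex_apply, Equiv.symm_symm, Equiv.apply_symm_apply,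
      integralBasis_repr_apply] at h1
    simp only [algebraMap_int_eq, eq_intCast, Rat.cast_intCast, Complex.norm_intCast] at h1
    exact h1.trans (mul_le_mul_of_nonneg_right (le_max_left _ _) (house_nonneg _))
  have hhouse : ∀ (x : 𝓞 K) (T : ℝ), 0 ≤ T → (∀ w : InfinitePlace K, w (x : K) ≤ T) →
      house (x : K) ≤ T := by
    intro x T hT h
    refine (pi_norm_le_iff_of_nonneg hT).2 fun φ => ?_
    exact h (InfinitePlace.mk φ)
  refine ⟨(2 * c + 1) ^ Module.finrank ℚ K, by positivity, fun T hT => ?_⟩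
  set S := {x : 𝓞 K | ∀ w : InfinitePlace K, w (x : K) ≤ T} with hS
  let B : Finset (Module.Free.ChooseBasisIndex ℤ (𝓞 K) → ℤ) :=
    Fintype.piFinset fun _ => Finset.Icc (-⌊c * T⌋) ⌊c * T⌋
  have hmap : ∀ x ∈ S, (fun x => ⇑((RingOfIntegers.basis K).repr x)) x ∈ (B : Set _) := by
    intro x hx
    simp only [B, Finset.mem_coe, Fintype.mem_piFinset, Finset.mem_Icc]
    intro i
    have h1 := (hc x i).trans (mul_le_mul_of_nonneg_left
      (hhouse x T (by linarith) hx) hc0)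
    rw [← Int.cast_abs, ← Int.le_floor] at h1
    exact abs_le.1 h1
  have hinj : Set.InjOn (fun x : 𝓞 K => ⇑((RingOfIntegers.basis K).repr x)) S := by
    intro x _ y _ h
    exact (RingOfIntegers.basis K).repr.injective (DFunLike.coe_injective h)
  refine ⟨Set.Finite.of_injOn hmap hinj B.finite_toSet, ?_⟩
  have h2 : S.ncard ≤ (B : Set _).ncard := Set.ncard_le_ncard_of_injOn _ hmap hinj B.finite_toSet
  rw [Set.ncard_coe_finset, Fintype.card_piFinset, Finset.prod_const, Finset.card_univ,
    ← Module.finrank_eq_card_chooseBasisIndex, RingOfIntegers.rank, Int.card_Icc] at h2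
  have hcT : 0 ≤ ⌊c * T⌋ := Int.floor_nonneg.2 (by positivity)
  calc (S.ncard : ℝ) ≤ (((⌊c * T⌋ + 1 - -⌊c * T⌋).toNat ^ Module.finrank ℚ K : ℕ) : ℝ) := by
        exact_mod_cast h2
    _ = ((2 * ⌊c * T⌋ + 1 : ℤ) : ℝ) ^ Module.finrank ℚ K := by
        rw [Nat.cast_pow, ← Int.cast_natCast, Int.toNat_of_nonneg (by linarith)]
        congr 2; ring
    _ ≤ ((2 * c + 1) * T) ^ Module.finrank ℚ K := by
        refine pow_le_pow_left₀ (by exact_mod_cast (by linarith : (0:ℤ) ≤ 2 * ⌊c * T⌋ + 1)) ?_ _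
        push_cast
        have := Int.floor_le (c * T)
        nlinarith
    _ = _ := mul_pow _ _ _

variable {K} in
/-- The vector of archimedean absolute values of `x`, scaled by `τ`. -/
noncomputable def placeVec (x : 𝓞 K) (τ : ℝ) : InfinitePlace K → ℝ := fun w => w (x : K) / τ

theorem abs_tsum_le_of_support {ι : Type*} {f : ι → ℝ} {S : Set ι} (hS : S.Finite) {B : ℝ}
    (h0 : ∀ i, f i ≠ 0 → i ∈ S) (h1 : ∀ i, |f i| ≤ B) : |∑' i, f i| ≤ S.ncard * B := by
  rw [tsum_eq_sum (s := hS.toFinset) (fun i hi => by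
    by_contra h; exact hi (hS.mem_toFinset.2 (h0 i h)))]
  refine (Finset.abs_sum_le_sum_abs _ _).trans ?_
  refine (Finset.sum_le_card_nsmul _ _ B fun i _ => h1 i).trans ?_
  rw [nsmul_eq_mul, Set.ncard_eq_toFinset_card _ hS]

theorem exists_abs_tsum_sub_le (𝔟 : Ideal (𝓞 K)) (h𝔟 : 𝔟 ≠ ⊥) {M C : ℝ} (hM : 0 < M)
    (hC : 0 ≤ C) : ∃ C' : ℝ, 0 ≤ C' ∧ ∀ h : (InfinitePlace K → ℝ) → ℝ,
      (∀ a, h a ≠ 0 → ∀ w, a w ≤ M) → (∀ a b, |h a - h b| ≤ C * ‖a - b‖) → ∀ τ : ℝ, 1 ≤ τ →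
      (Function.support fun x : 𝓞 K => h (placeVec x τ)).Finite ∧
      |∑' x : 𝓞 K, h (placeVec x τ) - Ideal.absNorm 𝔟 * ∑' x : 𝔟, h (placeVec (x : 𝓞 K) τ)| ≤
        C' * (τ ^ Module.finrank ℚ K / τ) := by
  classical
  obtain ⟨C₀, hC₀, hcount⟩ := exists_card_ringOfIntegers_le K
  have hfin : Finite (𝓞 K ⧸ 𝔟) := Ideal.finiteQuotientOfFreeOfNeBot 𝔟 h𝔟
  let _ : Fintype (𝓞 K ⧸ 𝔟) := Fintype.ofFinite _
  have hcard : (Ideal.absNorm 𝔟 : ℝ) = Fintype.card (𝓞 K ⧸ 𝔟) := by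
    rw [Ideal.absNorm_apply, Submodule.cardQuot_apply, Nat.card_eq_fintype_card]
  let out : 𝓞 K ⧸ 𝔟 → 𝓞 K := Quotient.out
  have hout : ∀ q, Ideal.Quotient.mk 𝔟 (out q) = q := fun q => Quotient.out_eq' q
  obtain ⟨ρ, hρ⟩ : ∃ ρ : ℝ, ∀ (q : 𝓞 K ⧸ 𝔟) (w : InfinitePlace K), w (out q : K) ≤ ρ := by
    obtain ⟨ρ, h⟩ := (Set.finite_range fun i : (𝓞 K ⧸ 𝔟) × InfinitePlace K =>
      i.2 (out i.1 : K)).bddAbove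
    exact ⟨ρ, fun q w => h ⟨(q, w), rfl⟩⟩
  have hρ0 : 0 ≤ ρ := (apply_nonneg (Classical.arbitrary (InfinitePlace K)) _).trans (hρ 0 _)
  have hM1 : 1 ≤ M + ρ + 1 := by linarith
  refine ⟨Fintype.card (𝓞 K ⧸ 𝔟) * (C₀ * (M + ρ + 1) ^ Module.finrank ℚ K * (C * ρ)),
    by positivity, fun h hh1 hh2 τ hτ => ?_⟩
  have hτ0 : 0 < τ := by linarith
  set F : 𝓞 K → ℝ := fun x => h (placeVec x τ) with hF
  set S : Set (𝓞 K) := {x : 𝓞 K | ∀ w : InfinitePlace K, w (x : K) ≤ (M + ρ + 1) * τ} with hS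
  have hT : 1 ≤ (M + ρ + 1) * τ := by nlinarith
  obtain ⟨hSfin, hScard⟩ := hcount _ hT
  rw [← hS] at hSfin hScard
  have hFw : ∀ x, F x ≠ 0 → ∀ w : InfinitePlace K, w (x : K) ≤ M * τ := by
    intro x hx w
    have := hh1 _ hx w
    rwa [placeVec, div_le_iff₀ hτ0] at this
  have hFS : ∀ x, F x ≠ 0 → x ∈ S := fun x hx w => (hFw x hx w).trans (by
    gcongr; linarith)
  have hsub : Function.support F ⊆ S := hFS
  have hsuppF : (Function.support F).Finite := hSfin.subset hsub
  refine ⟨hsuppF, ?_⟩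
  -- decomposition
  let e : (𝓞 K ⧸ 𝔟) × 𝔟 ≃ 𝓞 K := Equiv.ofBijective (fun p => out p.1 + p.2) (by
    constructor
    · rintro ⟨q, b⟩ ⟨q', b'⟩ h
      have h' : out q + (b : 𝓞 K) = out q' + b' := h
      have h1 := congrArg (Ideal.Quotient.mk 𝔟) h'
      rw [map_add, map_add, hout, hout, Ideal.Quotient.eq_zero_iff_mem.2 b.2,
        Ideal.Quotient.eq_zero_iff_mem.2 b'.2, add_zero, add_zero] at h1
      subst h1
      rw [add_right_inj] at h'
      exact Prod.ext rfl (Subtype.ext h')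
    · intro x
      refine ⟨(Ideal.Quotient.mk 𝔟 x, ⟨x - out (Ideal.Quotient.mk 𝔟 x), ?_⟩), ?_⟩
      · rw [← Ideal.Quotient.eq_zero_iff_mem, map_sub, hout, sub_self]
      · simp)
  have hsq : ∀ q, (Function.support fun b : 𝔟 => F (out q + b)).Finite := fun q =>
    hsuppF.preimage (f := fun b : 𝔟 => out q + (b : 𝓞 K))
      (fun x _ y _ hxy => Subtype.ext (add_left_cancel hxy))
  have hs0 : (Function.support fun b : 𝔟 => F b).Finite :=
    hsuppF.preimage (f := fun b : 𝔟 => (b : 𝓞 K)) (fun x _ y _ hxy => Subtype.ext hxy)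
  have h1 : ∑' x, F x = ∑ q, ∑' b : 𝔟, F (out q + b) := by
    rw [← e.tsum_eq F, Summable.tsum_prod, tsum_fintype]
    · rfl
    · exact (e.summable_iff (f := F)).2 (summable_of_hasFiniteSupport hsuppF)
  have h2 : ∑' x, F x - Ideal.absNorm 𝔟 * ∑' x : 𝔟, F x =
      ∑ q, ∑' b : 𝔟, (F (out q + b) - F b) := by
    rw [h1, hcard, ← nsmul_eq_mul, ← Finset.card_univ, ← Finset.sum_const,
      ← Finset.sum_sub_distrib]
    refine Finset.sum_congr rfl fun q _ => ?_
    rw [(summable_of_hasFiniteSupport (hsq q)).tsum_sub (summable_of_hasFiniteSupport hs0)]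
  have h3 : ∀ q, |∑' b : 𝔟, (F (out q + b) - F b)| ≤
      C₀ * ((M + ρ + 1) * τ) ^ Module.finrank ℚ K * (C * (ρ / τ)) := by
    intro q
    have hS' : (Subtype.val ⁻¹' S : Set 𝔟).Finite :=
      hSfin.preimage Subtype.val_injective.injOn
    refine (abs_tsum_le_of_support hS' (B := C * (ρ / τ)) ?_ ?_).trans ?_
    · intro b hb
      by_contra hbS
      have e1 : F b = 0 := by_contra fun h => hbS (hFS _ h)
      have e2 : F (out q + b) = 0 := by
        by_contra h
        refine hbS fun w => ?_
        have h4 := hFw _ h w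
        have h5 : w ((b : 𝓞 K) : K) ≤ w ((out q + b : 𝓞 K) : K) + w (out q : K) := by
          have := (abs_le.1 (w.1.abs_abv_sub_le_abv_sub ((b : 𝓞 K) : K)
            ((out q + b : 𝓞 K) : K))).2
          have e3 : ((b : 𝓞 K) : K) - ((out q + b : 𝓞 K) : K) = -(out q : K) := by simp
          rw [e3, w.1.map_neg] at this
          have h7 := sub_le_iff_le_add'.1 this
          exact h7
        have h6 := hρ q w
        nlinarith
      exact hb (by rw [e1, e2, sub_zero])
    · intro b
      refine (hh2 _ _).trans (mul_le_mul_of_nonneg_left ?_ hC)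
      refine (pi_norm_le_iff_of_nonneg (by positivity)).2 fun w => ?_
      rw [Pi.sub_apply, placeVec, placeVec, ← sub_div, norm_div, Real.norm_of_nonneg hτ0.le]
      gcongr
      refine le_trans ?_ (hρ q w)
      have := w.1.abs_abv_sub_le_abv_sub ((out q + b : 𝓞 K) : K) ((b : 𝓞 K) : K)
      have e3 : ((out q + b : 𝓞 K) : K) - ((b : 𝓞 K) : K) = (out q : K) := by simp
      rw [e3] at this
      exact this
    · gcongr
      refine le_trans ?_ hScard
      have : (Subtype.val ⁻¹' S : Set 𝔟).ncard ≤ S.ncard :=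
        Set.ncard_le_ncard_of_injOn _ (fun a ha => ha) Subtype.val_injective.injOn hSfin
      exact_mod_cast this
  change |∑' x, F x - Ideal.absNorm 𝔟 * ∑' x : 𝔟, F x| ≤ _
  rw [h2]
  refine (Finset.abs_sum_le_sum_abs _ _).trans ((Finset.sum_le_card_nsmul _ _ _
    fun q _ => h3 q).trans (le_of_eq ?_))
  rw [nsmul_eq_mul, Finset.card_univ, mul_pow]
  ring

open nonZeroDivisors in
theorem exists_tsum_ideal_eq (𝔟 : (Ideal (𝓞 K))⁰) :
    ∃ gen : {I : (Ideal (𝓞 K))⁰ // ClassGroup.mk0 I = (ClassGroup.mk0 𝔟)⁻¹} → 𝓞 K,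
      (∀ I, gen I ≠ 0 ∧ Ideal.span {gen I} = (I : (Ideal (𝓞 K))⁰) * (𝔟 : Ideal (𝓞 K))) ∧
      ∀ F : 𝓞 K → ENNReal, F 0 = 0 →
        ∑' x : (𝔟 : Ideal (𝓞 K)), F x = ∑' I, ∑' u : (𝓞 K)ˣ, F (u * gen I) := by
  classical
  have hgen : ∀ I : {I : (Ideal (𝓞 K))⁰ // ClassGroup.mk0 I = (ClassGroup.mk0 𝔟)⁻¹},
      ∃ x : 𝓞 K, x ≠ 0 ∧ Ideal.span {x} = (I : (Ideal (𝓞 K))⁰) * (𝔟 : Ideal (𝓞 K)) := by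
    rintro ⟨I, hI⟩
    have h1 : ClassGroup.mk0 (I * 𝔟) = 1 := by rw [map_mul, hI, inv_mul_cancel]
    obtain ⟨x, hx⟩ := (ClassGroup.mk0_eq_one_iff (I * 𝔟).2).1 h1
    have hx' : Ideal.span {x} = (I : Ideal (𝓞 K)) * (𝔟 : Ideal (𝓞 K)) := hx.symm
    refine ⟨x, fun h => ?_, hx'⟩
    have h2 := nonZeroDivisors.coe_ne_zero (I * 𝔟)
    rw [Submonoid.coe_mul, ← hx', h] at h2
    simp at h2
  choose gen hg0 hg using hgen
  refine ⟨gen, fun I => ⟨hg0 I, hg I⟩, fun F hF => ?_⟩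
  have hb0 : (𝔟 : Ideal (𝓞 K)) ≠ 0 := nonZeroDivisors.coe_ne_zero 𝔟
  have hmem : ∀ I (u : (𝓞 K)ˣ), (u : 𝓞 K) * gen I ∈ (𝔟 : Ideal (𝓞 K)) := by
    intro I u
    refine Ideal.mul_mem_left _ _ ?_
    have h2 : Ideal.span {gen I} ≤ (𝔟 : Ideal (𝓞 K)) := (hg I).trans_le Ideal.mul_le_right
    exact (Ideal.span_singleton_le_iff_mem _).1 h2
  let φ : {I : (Ideal (𝓞 K))⁰ // ClassGroup.mk0 I = (ClassGroup.mk0 𝔟)⁻¹} × (𝓞 K)ˣ →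
      (𝔟 : Ideal (𝓞 K)) := fun p => ⟨p.2 * gen p.1, hmem p.1 p.2⟩
  have hφ : ∀ p, (φ p : 𝓞 K) = p.2 * gen p.1 := fun _ => rfl
  have hspan : ∀ I (u : (𝓞 K)ˣ), Ideal.span {(u : 𝓞 K) * gen I} = Ideal.span {gen I} := by
    intro I u
    rw [Ideal.span_singleton_eq_span_singleton]
    exact associated_unit_mul_left _ _ u.isUnit
  have hinj : Function.Injective φ := by
    rintro ⟨I, u⟩ ⟨J, v⟩ h
    have h1 : (u : 𝓞 K) * gen I = v * gen J := by
      rw [← hφ (I, u), ← hφ (J, v), h]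
    have h2 : (I : (Ideal (𝓞 K))⁰) * (𝔟 : Ideal (𝓞 K)) = (J : (Ideal (𝓞 K))⁰) * (𝔟 : Ideal (𝓞 K)) := by
      rw [← hg I, ← hg J, ← hspan I u, ← hspan J v, h1]
    have h3 : I = J := Subtype.ext (Subtype.ext (mul_right_cancel₀ hb0 h2))
    subst h3
    exact Prod.ext rfl (Units.ext (mul_right_cancel₀ (hg0 I) h1))
  have hsupp : Function.support (fun x : (𝔟 : Ideal (𝓞 K)) => F x) ⊆ Set.range φ := by
    rintro ⟨x, hx⟩ hFx
    have hx0 : x ≠ 0 := fun h => hFx (by simp [h, hF])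
    obtain ⟨I, hI⟩ : (𝔟 : Ideal (𝓞 K)) ∣ Ideal.span {x} := by
      rw [Ideal.dvd_iff_le, Ideal.span_singleton_le_iff_mem]; exact hx
    have hI0 : I ≠ 0 := by
      rintro rfl
      rw [mul_zero] at hI
      exact hx0 (Ideal.span_singleton_eq_bot.1 hI)
    let I' : (Ideal (𝓞 K))⁰ := ⟨I, mem_nonZeroDivisors_of_ne_zero hI0⟩
    have hI' : ClassGroup.mk0 I' = (ClassGroup.mk0 𝔟)⁻¹ := by
      rw [eq_inv_iff_mul_eq_one, ← map_mul]
      refine (ClassGroup.mk0_eq_one_iff (I' * 𝔟).2).2 ⟨x, ?_⟩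
      rw [mul_comm] at hI
      exact hI.symm
    have h1 : Ideal.span {gen ⟨I', hI'⟩} = Ideal.span {x} := by
      rw [hg, hI, mul_comm]
    obtain ⟨u, hu⟩ := Ideal.span_singleton_eq_span_singleton.1 h1
    exact ⟨(⟨I', hI'⟩, u), Subtype.ext ((hφ _).trans ((mul_comm _ _).trans hu))⟩
  rw [← hinj.tsum_eq hsupp, ENNReal.tsum_prod']

theorem tsum_two_rpow_le {s : ℝ} (hs : s ∈ Set.Ioc (1 : ℝ) 2) :
    Summable (fun j : ℕ => ((2 : ℝ) ^ (1 - s)) ^ j) ∧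
      ∑' j : ℕ, ((2 : ℝ) ^ (1 - s)) ^ j ≤ 2 / (s - 1) := by
  obtain ⟨h1, h2⟩ := hs
  have h3 : (2 : ℝ) ^ (1 - s) ≤ 1 - (s - 1) / 2 := by
    have := rpow_one_add_le_one_add_mul_self (s := (-(1/2) : ℝ)) (p := s - 1) (by norm_num)
      (by linarith) (by linarith)
    have h4 : (2 : ℝ) ^ (1 - s) = (1 + -(1/2) : ℝ) ^ (s - 1) := by
      rw [show (1 + -(1/2) : ℝ) = 2⁻¹ by norm_num, Real.inv_rpow (by norm_num),
        ← Real.rpow_neg (by norm_num)]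
      congr 1; ring
    rw [h4]; linarith
  have h5 : (0 : ℝ) ≤ 2 ^ (1 - s) := by positivity
  have h6 : (2 : ℝ) ^ (1 - s) < 1 := by linarith
  refine ⟨summable_geometric_of_lt_one h5 h6, ?_⟩
  rw [tsum_geometric_of_lt_one h5 h6, inv_eq_one_div, div_le_div_iff₀ (by linarith) (by linarith)]
  linarith

open nonZeroDivisors in
variable {K} in
/-- The partial zeta function of an ideal class. -/
noncomputable def classZeta (c : ClassGroup (𝓞 K)) (s : ℝ) : ENNReal :=
  ∑' I : {I : (Ideal (𝓞 K))⁰ // ClassGroup.mk0 I = c},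
    ENNReal.ofReal ((Ideal.absNorm (I : Ideal (𝓞 K)) : ℝ) ^ (-s))

theorem exists_classZeta_bound : ∃ (X : ℝ → ℝ) (C : ℝ), ∀ s ∈ Set.Ioc (1 : ℝ) 2,
    |X s| ≤ C / (s - 1) ∧ ∀ c : ClassGroup (𝓞 K), classZeta c s ≠ ⊤ ∧
      |(classZeta c s).toReal - X s| ≤ C := by
  classical
  obtain ⟨g, M, C, hM, hC, hg0, hg1, hg2, hg3, hg4⟩ := exists_bump K
  obtain ⟨C₀, hC₀, hcount⟩ := exists_card_ringOfIntegers_le K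
  set D := Module.finrank ℚ K with hD
  have hDpos : 0 < D := Module.finrank_pos
  let τ : ℕ → ℝ := fun j => (2 : ℝ) ^ ((j : ℝ) / D)
  have hτ1 : ∀ j, 1 ≤ τ j := fun j => Real.one_le_rpow one_le_two (by positivity)
  have hτ0 : ∀ j, 0 < τ j := fun j => by positivity
  have hτD : ∀ j, τ j ^ D = 2 ^ j := fun j => by
    rw [← Real.rpow_natCast, ← Real.rpow_mul (by norm_num),
      div_mul_cancel₀ _ (by positivity), Real.rpow_natCast]
  set r : ℝ := (2 : ℝ) ^ (-(1 / D : ℝ)) with hr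
  have hr0 : 0 < r := by positivity
  have hr1 : r < 1 := Real.rpow_lt_one_of_one_lt_of_neg one_lt_two (by
    have : (0 : ℝ) < 1 / D := by positivity
    linarith)
  have hτr : ∀ j, (τ j)⁻¹ = r ^ j := fun j => by
    rw [← Real.rpow_natCast, ← Real.rpow_mul (by norm_num), ← Real.rpow_neg (by norm_num)]
    congr 1; ring
  set W : ℝ := (torsionOrder K : ℝ) with hW
  have hW1 : 1 ≤ W := by
    have h : 1 ≤ torsionOrder K := torsionOrder_pos K
    rw [hW]; exact_mod_cast h
  let t : ℝ → ℕ → ℝ := fun s j => (2 : ℝ) ^ (-(j * s))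
  have ht0 : ∀ s j, 0 ≤ t s j := fun s j => by positivity
  have ht2 : ∀ s j, t s j * 2 ^ j = ((2 : ℝ) ^ (1 - s)) ^ j := fun s j => by
    rw [← Real.rpow_natCast, ← Real.rpow_natCast, ← Real.rpow_mul (by norm_num),
      ← Real.rpow_add (by norm_num)]
    congr 1; ring
  let b : ℝ → ℕ → ℝ := fun s j => t s j * ∑' x : 𝓞 K, g s (placeVec x (τ j))
  -- bound for the full lattice
  set C₁ : ℝ := C₀ * (M + 1) ^ D * (C * (M + 1)) with hC₁
  have hC₁0 : 0 ≤ C₁ := by positivity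
  have hb0 : ∀ s j, 0 ≤ b s j := fun s j => mul_nonneg (ht0 s j) (tsum_nonneg fun x => hg0 _ _)
  have hb1 : ∀ s ∈ Set.Ioc (1 : ℝ) 2, ∀ j, b s j ≤ C₁ * ((2 : ℝ) ^ (1 - s)) ^ j := by
    intro s hs j
    rw [← ht2, mul_left_comm]
    refine mul_le_mul_of_nonneg_left ?_ (ht0 s j)
    obtain ⟨hfin, hcard⟩ := hcount ((M + 1) * τ j) (by nlinarith [hτ1 j])
    have h1 := abs_tsum_le_of_support (f := fun x : 𝓞 K => g s (placeVec x (τ j)))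
      (B := C * (M + 1)) hfin ?_ ?_
    · rw [← hτD]
      refine (le_abs_self _).trans (h1.trans ?_)
      refine (mul_le_mul_of_nonneg_right hcard (by positivity)).trans (le_of_eq ?_)
      rw [mul_pow, hC₁]; ring
    · intro x hx w
      have h2 := hg1 s _ hx w
      rw [placeVec, div_le_iff₀ (hτ0 j)] at h2
      nlinarith [hτ0 j]
    · intro x
      by_cases hx : g s (placeVec x (τ j)) = 0
      · rw [hx, abs_zero]; positivity
      · have h2 := hg2 s ⟨hs.1.le, hs.2⟩ (placeVec x (τ j)) 0
        rw [hg3, sub_zero, sub_zero] at h2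
        refine h2.trans (mul_le_mul_of_nonneg_left ?_ hC)
        refine (pi_norm_le_iff_of_nonneg (by positivity)).2 fun w => ?_
        rw [placeVec, Real.norm_of_nonneg (div_nonneg (apply_nonneg _ _) (hτ0 j).le)]
        exact (hg1 s _ hx w).trans (by linarith)
  have hbs : ∀ s ∈ Set.Ioc (1 : ℝ) 2, Summable (b s) ∧ ∑' j, b s j ≤ C₁ * (2 / (s - 1)) := by
    intro s hs
    obtain ⟨h1, h2⟩ := tsum_two_rpow_le hs
    have h3 : Summable (b s) :=
      Summable.of_nonneg_of_le (hb0 s) (hb1 s hs) (h1.mul_left _)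
    refine ⟨h3, (h3.tsum_le_tsum (hb1 s hs) (h1.mul_left _)).trans ?_⟩
    rw [tsum_mul_left]
    exact mul_le_mul_of_nonneg_left h2 hC₁0
  have hclass : ∀ c : ClassGroup (𝓞 K), ∃ C₂ : ℝ, ∀ s ∈ Set.Ioc (1 : ℝ) 2, classZeta c s ≠ ⊤ ∧
      |(classZeta c s).toReal - (∑' j, b s j) / W| ≤ C₂ := by
    intro c
    obtain ⟨𝔟, rfl⟩ : ∃ 𝔟, (ClassGroup.mk0 𝔟)⁻¹ = c := by
      obtain ⟨𝔟, h𝔟⟩ := ClassGroup.mk0_surjective c⁻¹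
      exact ⟨𝔟, by rw [h𝔟, inv_inv]⟩
    have h𝔟0 : (𝔟 : Ideal (𝓞 K)) ≠ ⊥ := nonZeroDivisors.coe_ne_zero 𝔟
    obtain ⟨C', hC'0, hcmp⟩ := exists_abs_tsum_sub_le K 𝔟 h𝔟0 hM hC
    set N : ℝ := (Ideal.absNorm (𝔟 : Ideal (𝓞 K)) : ℝ) with hN
    have hN1 : 1 ≤ N := by
      rw [hN, Nat.one_le_cast, Nat.one_le_iff_ne_zero]
      exact Ideal.absNorm_eq_zero_iff.not.2 h𝔟0
    have hN0 : 0 < N := by linarith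
    let a : ℝ → ℕ → ℝ := fun s j =>
      t s j * ∑' x : (𝔟 : Ideal (𝓞 K)), g s (placeVec (x : 𝓞 K) (τ j))
    have ha0 : ∀ s j, 0 ≤ a s j := fun s j =>
      mul_nonneg (ht0 s j) (tsum_nonneg fun x => hg0 _ _)
    refine ⟨N * (C' * (1 - r)⁻¹) + (N - 1) * (C₁ * 2), fun s hs => ?_⟩
    have hs1 : 0 < s - 1 := by linarith [hs.1]
    have hsI : s ∈ Set.Icc (1 : ℝ) 2 := ⟨hs.1.le, hs.2⟩
    have hab : ∀ j, |b s j - N * a s j| ≤ C' * r ^ j := by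
      intro j
      have h1 := (hcmp (g s) (hg1 s) (hg2 s hsI) (τ j) (hτ1 j)).2
      rw [← hD, hτD, div_eq_mul_inv, hτr] at h1
      have h2 : b s j - N * a s j = t s j * (∑' x : 𝓞 K, g s (placeVec x (τ j)) -
          N * ∑' x : (𝔟 : Ideal (𝓞 K)), g s (placeVec (x : 𝓞 K) (τ j))) := by
        simp only [a, b]; ring
      have h3 : t s j * 2 ^ j ≤ 1 := by
        rw [ht2]
        exact pow_le_one₀ (by positivity)
          (Real.rpow_le_one_of_one_le_of_nonpos one_le_two (by linarith))
      rw [h2, abs_mul, abs_of_nonneg (ht0 s j)]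
      calc _ ≤ t s j * (C' * (2 ^ j * r ^ j)) := mul_le_mul_of_nonneg_left h1 (ht0 s j)
        _ = (t s j * 2 ^ j) * (C' * r ^ j) := by ring
        _ ≤ 1 * (C' * r ^ j) := mul_le_mul_of_nonneg_right h3 (by positivity)
        _ = _ := one_mul _
    have hrs : Summable fun j => C' * r ^ j := (summable_geometric_of_lt_one hr0.le hr1).mul_left _
    have hds : Summable fun j => b s j - N * a s j :=
      Summable.of_norm_bounded hrs hab
    have has : Summable (a s) := by
      have h1 := ((hbs s hs).1.sub hds).mul_left N⁻¹
      refine h1.congr fun j => ?_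
      field_simp
      ring
    have hE : |∑' j, b s j - N * ∑' j, a s j| ≤ C' * (1 - r)⁻¹ := by
      rw [← tsum_mul_left, ← (hbs s hs).1.tsum_sub (has.mul_left N),
        ← tsum_geometric_of_lt_one hr0.le hr1, ← tsum_mul_left]
      exact tsum_of_norm_bounded (f := fun j => b s j - N * a s j) hrs.hasSum hab
    -- the unfolding identity
    have hid : ENNReal.ofReal (W * N ^ (-s)) * classZeta (ClassGroup.mk0 𝔟)⁻¹ s = ENNReal.ofReal (∑' j, a s j) := by
      obtain ⟨gen, hgen, hsum⟩ := exists_tsum_ideal_eq K 𝔟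
      have h1 := hsum (fun x => ∑' j, ENNReal.ofReal (t s j * g s (placeVec x (τ j)))) (by
        refine ENNReal.tsum_eq_zero.2 fun j => ?_
        have : placeVec (0 : 𝓞 K) (τ j) = 0 := by funext w; simp [placeVec]
        rw [this, hg3, mul_zero, ENNReal.ofReal_zero])
      have h2 : ∀ j, ∑' x : (𝔟 : Ideal (𝓞 K)), ENNReal.ofReal (t s j * g s (placeVec (x : 𝓞 K) (τ j)))
          = ENNReal.ofReal (a s j) := by
        intro j
        have hfin : (Function.support fun x : (𝔟 : Ideal (𝓞 K)) =>
            t s j * g s (placeVec (x : 𝓞 K) (τ j))).Finite := by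
          have h3 := (hcmp (g s) (hg1 s) (hg2 s hsI) (τ j) (hτ1 j)).1
          refine (h3.preimage (f := fun x : (𝔟 : Ideal (𝓞 K)) => (x : 𝓞 K))
            (fun x _ y _ hxy => Subtype.ext hxy)).subset fun x hx => ?_
          exact right_ne_zero_of_mul hx
        rw [← ENNReal.ofReal_tsum_of_nonneg (fun x => mul_nonneg (ht0 s j) (hg0 _ _))
          (summable_of_hasFiniteSupport hfin), tsum_mul_left]
      rw [ENNReal.tsum_comm] at h1
      simp only [h2] at h1
      rw [ENNReal.ofReal_tsum_of_nonneg (ha0 s) has, h1, classZeta, ← ENNReal.tsum_mul_left]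
      refine tsum_congr fun I => ?_
      refine Eq.trans ?_ (hg4 s hsI (gen I) (hgen I).1).symm
      rw [(hgen I).2, map_mul, Nat.cast_mul, Real.mul_rpow (by positivity) (by positivity), ← hN,
        mul_comm (_ ^ (-s)), ENNReal.ofReal_mul (by positivity), ENNReal.ofReal_mul (by positivity),
        mul_assoc, hW, ENNReal.ofReal_natCast]
    have hWN : 0 < W * N ^ (-s) := by positivity
    have hne : classZeta (ClassGroup.mk0 𝔟)⁻¹ s ≠ ⊤ := by
      intro h
      rw [h, ENNReal.mul_top (by simpa using hWN)] at hid
      exact ENNReal.ofReal_ne_top hid.symm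
    refine ⟨hne, ?_⟩
    have hz := congrArg ENNReal.toReal hid
    rw [ENNReal.toReal_mul, ENNReal.toReal_ofReal hWN.le,
      ENNReal.toReal_ofReal (tsum_nonneg (ha0 s))] at hz
    set z := (classZeta (ClassGroup.mk0 𝔟)⁻¹ s).toReal with hzdef
    have hz' : z = N ^ (s - 1) * (N * ∑' j, a s j) / W := by
      rw [← hz, Real.rpow_sub_one hN0.ne', Real.rpow_neg hN0.le]
      field_simp
    have hNs : N ^ (s - 1) ≤ 1 + (s - 1) * (N - 1) := by
      have := rpow_one_add_le_one_add_mul_self (s := N - 1) (p := s - 1) (by linarith)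
        (by linarith) (by linarith [hs.2])
      rwa [add_sub_cancel] at this
    have hNs1 : 1 ≤ N ^ (s - 1) := Real.one_le_rpow hN1 hs1.le
    have hNs2 : N ^ (s - 1) ≤ N := by
      refine (Real.rpow_le_rpow_of_exponent_le hN1 (by linarith [hs.2] : s - 1 ≤ 1)).trans ?_
      rw [Real.rpow_one]
    have hb2 : 0 ≤ ∑' j, b s j := tsum_nonneg (hb0 s)
    have h5 : z - (∑' j, b s j) / W = (N ^ (s - 1) * -(∑' j, b s j - N * ∑' j, a s j) +
        (N ^ (s - 1) - 1) * ∑' j, b s j) / W := by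
      rw [hz']; ring
    rw [h5, abs_div, abs_of_pos (by linarith : 0 < W)]
    refine (div_le_self (abs_nonneg _) hW1).trans ((abs_add_le _ _).trans (add_le_add ?_ ?_))
    · rw [abs_mul, abs_neg, abs_of_nonneg (by linarith)]
      exact mul_le_mul hNs2 hE (abs_nonneg _) hN0.le
    · rw [abs_mul, abs_of_nonneg (by linarith), abs_of_nonneg hb2]
      calc _ ≤ ((s - 1) * (N - 1)) * (C₁ * (2 / (s - 1))) :=
            mul_le_mul (by linarith) (hbs s hs).2 hb2 (mul_nonneg hs1.le (by linarith))
        _ = _ := by field_simp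
  choose C₂ hC₂ using hclass
  obtain ⟨C₃, hC₃⟩ := (Set.finite_range C₂).bddAbove
  refine ⟨fun s => (∑' j, b s j) / W, max (2 * C₁) C₃, fun s hs => ⟨?_, fun c =>
    ⟨(hC₂ c s hs).1, (hC₂ c s hs).2.trans ((hC₃ ⟨c, rfl⟩).trans (le_max_right _ _))⟩⟩⟩
  have h1 : 0 ≤ ∑' j, b s j := tsum_nonneg (hb0 s)
  have hs1 : 0 < s - 1 := by linarith [hs.1]
  rw [abs_of_nonneg (by positivity)]
  calc _ ≤ ∑' j, b s j := div_le_self h1 hW1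
    _ ≤ C₁ * (2 / (s - 1)) := (hbs s hs).2
    _ = 2 * C₁ / (s - 1) := by ring
    _ ≤ _ := by gcongr; exact le_max_left _ _

end UnitPartitionThree

section EulerProduct

open IsDedekindDomain Filter Topology

theorem tendsto_prod_one_sub_mul_tsum {R : Type*} [CommRing R] [IsDedekindDomain R]
    {f : Ideal R → ℝ} (h0 : f 0 = 0) (h1 : f 1 = 1) (hmul : ∀ I J, f (I * J) = f I * f J)
    (hf : Summable f) :
    Tendsto (fun P : Finset (HeightOneSpectrum R) =>
      (∏ p ∈ P, (1 - f p.asIdeal)) * ∑' I, f I) atTop (𝓝 1) := by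
  classical
  let good : Finset (HeightOneSpectrum R) → Ideal R → Prop := fun P I =>
    ∀ p ∈ P, ¬ p.asIdeal ∣ I
  let F : Finset (HeightOneSpectrum R) → Ideal R → ℝ := fun P I => if good P I then f I else 0
  have hFle : ∀ P I, ‖F P I‖ ≤ |f I| := by
    intro P I
    simp only [F]; split_ifs
    · exact le_rfl
    · simp
  have hFs : ∀ P, Summable (F P) := fun P => Summable.of_norm_bounded hf.abs (hFle P)
  have key : ∀ P, ∑' I, F P I = (∏ p ∈ P, (1 - f p.asIdeal)) * ∑' I, f I := by
    intro P
    induction P using Finset.induction with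
    | empty => simp [F, good]
    | insert q P hq ih =>
      rw [Finset.prod_insert hq, mul_assoc, ← ih]
      have hqp : ∀ p ∈ P, ∀ J, p.asIdeal ∣ q.asIdeal * J ↔ p.asIdeal ∣ J := by
        intro p hp J
        refine ⟨fun h => (p.prime.dvd_or_dvd h).resolve_left fun h' => hq ?_, fun h => h.mul_left _⟩
        have : q.asIdeal = p.asIdeal :=
          q.isMaximal.eq_of_le p.isPrime.ne_top (Ideal.le_of_dvd h')
        rwa [HeightOneSpectrum.ext this]
      have hq0 : q.asIdeal ≠ 0 := q.ne_bot
      have hinj : Function.Injective fun J => q.asIdeal * J := mul_right_injective₀ hq0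
      have e1 : ∀ I, F P I - F (insert q P) I = if q.asIdeal ∣ I then F P I else 0 := by
        intro I
        have : good (insert q P) I ↔ ¬ q.asIdeal ∣ I ∧ good P I := by
          simp [good]
        simp only [F, this]
        split_ifs <;> simp_all
      have e2 : ∑' I, (F P I - F (insert q P) I) = f q.asIdeal * ∑' I, F P I := by
        rw [← hinj.tsum_eq]
        · rw [← tsum_mul_left]
          refine tsum_congr fun J => ?_
          rw [e1, if_pos (dvd_mul_right _ _)]
          have : good P (q.asIdeal * J) ↔ good P J :=
            forall₂_congr fun p hp => not_congr (hqp p hp J)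
          simp only [F, this, hmul, mul_ite, mul_zero]
        · intro I hI
          rw [Function.mem_support, e1] at hI
          obtain ⟨J, rfl⟩ : q.asIdeal ∣ I := by
            by_contra h
            exact hI (if_neg h)
          exact ⟨J, rfl⟩
      rw [(hFs P).tsum_sub (hFs _)] at e2
      linarith
  have hlim : ∀ I, Tendsto (fun P => F P I) atTop (𝓝 (if I = 1 then 1 else 0)) := by
    intro I
    refine tendsto_const_nhds.congr' ?_
    by_cases hI : I = 1
    · refine Eventually.of_forall fun P => ?_
      have : good P 1 := fun p _ h => p.prime.not_isUnit (isUnit_of_dvd_one h)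
      subst hI
      simp only [F]
      rw [if_pos this, h1, if_pos trivial]
    · rw [if_neg hI]
      by_cases hI0 : I = 0
      · refine Eventually.of_forall fun P => ?_
        subst hI0
        simp only [F, h0, ite_self]
      · obtain ⟨m, hm, hIm⟩ := Ideal.exists_le_maximal I (by simpa using hI)
        have hm0 : m ≠ ⊥ := by
          rintro rfl
          exact hI0 (le_bot_iff.1 hIm)
        let q : HeightOneSpectrum R := ⟨m, hm.isPrime, hm0⟩
        filter_upwards [eventually_ge_atTop {q}] with P hP
        have hqP : q ∈ P := hP (Finset.mem_singleton_self q)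
        have : ¬ good P I := fun h => h q hqP (Ideal.dvd_iff_le.2 hIm)
        simp only [F]
        rw [if_neg this]
  have := tendsto_tsum_of_dominated_convergence hf.abs hlim (Eventually.of_forall hFle)
  simpa only [key, tsum_ite_eq] using this

end EulerProduct

section ClassCharacters

open IsDedekindDomain Filter Topology NumberField nonZeroDivisors

variable {F : Type*} [Field F] [NumberField F]

open Classical in
noncomputable def charTerm (χ : ClassGroup (𝓞 F) →* ℤˣ) (s : ℝ) (I : Ideal (𝓞 F)) : ℝ :=
  if h : I = 0 then 0 else
    ((χ (ClassGroup.mk0 ⟨I, mem_nonZeroDivisors_of_ne_zero h⟩) : ℤ) : ℝ) *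
      (Ideal.absNorm I : ℝ) ^ (-s)

theorem charTerm_zero (χ : ClassGroup (𝓞 F) →* ℤˣ) (s : ℝ) : charTerm χ s 0 = 0 := dif_pos rfl

theorem charTerm_of_mem (χ : ClassGroup (𝓞 F) →* ℤˣ) (s : ℝ) (I : (Ideal (𝓞 F))⁰) :
    charTerm χ s I = ((χ (ClassGroup.mk0 I) : ℤ) : ℝ) * (Ideal.absNorm (I : Ideal (𝓞 F)) : ℝ) ^ (-s) :=
  dif_neg (nonZeroDivisors.coe_ne_zero I)

theorem charTerm_one (χ : ClassGroup (𝓞 F) →* ℤˣ) (s : ℝ) : charTerm χ s 1 = 1 := by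
  rw [← Submonoid.coe_one (Ideal (𝓞 F))⁰, charTerm_of_mem]
  rw [Submonoid.coe_one, map_one, map_one, map_one]
  simp

theorem charTerm_mul (χ : ClassGroup (𝓞 F) →* ℤˣ) (s : ℝ) (I J : Ideal (𝓞 F)) :
    charTerm χ s (I * J) = charTerm χ s I * charTerm χ s J := by
  by_cases hI : I = 0
  · rw [hI, zero_mul, charTerm_zero, zero_mul]
  by_cases hJ : J = 0
  · rw [hJ, mul_zero, charTerm_zero, mul_zero]
  lift I to (Ideal (𝓞 F))⁰ using mem_nonZeroDivisors_of_ne_zero hI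
  lift J to (Ideal (𝓞 F))⁰ using mem_nonZeroDivisors_of_ne_zero hJ
  rw [← Submonoid.coe_mul, charTerm_of_mem, charTerm_of_mem, charTerm_of_mem, Submonoid.coe_mul,
    map_mul, map_mul, map_mul, Nat.cast_mul, Real.mul_rpow (by positivity) (by positivity)]
  push_cast
  ring

theorem charTerm_one_nonneg (s : ℝ) (I : Ideal (𝓞 F)) : 0 ≤ charTerm 1 s I := by
  rw [charTerm]
  split_ifs
  · exact le_rfl
  · simp only [MonoidHom.one_apply, Units.val_one, Int.cast_one, one_mul]
    positivity

theorem abs_charTerm (χ : ClassGroup (𝓞 F) →* ℤˣ) (s : ℝ) (I : Ideal (𝓞 F)) :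
    |charTerm χ s I| = charTerm 1 s I := by
  by_cases hI : I = 0
  · rw [hI, charTerm_zero, charTerm_zero, abs_zero]
  lift I to (Ideal (𝓞 F))⁰ using mem_nonZeroDivisors_of_ne_zero hI
  rw [charTerm_of_mem, charTerm_of_mem, abs_mul, abs_of_nonneg (Real.rpow_nonneg (by positivity) _)]
  rcases Int.units_eq_one_or (χ (ClassGroup.mk0 I)) with h | h <;> simp [h]

theorem tsum_ofReal_charTerm (s : ℝ) :
    ∑' I : Ideal (𝓞 F), ENNReal.ofReal (charTerm 1 s I) =
      ∑' c : ClassGroup (𝓞 F), classZeta c s := by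
  have hinj : Function.Injective fun I : (Ideal (𝓞 F))⁰ => (I : Ideal (𝓞 F)) :=
    Subtype.val_injective
  rw [← hinj.tsum_eq]
  · rw [← ENNReal.tsum_fiberwise _ (fun I : (Ideal (𝓞 F))⁰ => ClassGroup.mk0 I)]
    refine tsum_congr fun c => tsum_congr fun I => ?_
    rw [charTerm_of_mem]
    simp
  · intro I hI
    refine ⟨⟨I, mem_nonZeroDivisors_of_ne_zero ?_⟩, rfl⟩
    rintro rfl
    exact hI (by simp only [charTerm_zero, ENNReal.ofReal_zero])

theorem summable_charTerm (χ : ClassGroup (𝓞 F) →* ℤˣ) {s : ℝ}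
    (hs : ∀ c : ClassGroup (𝓞 F), classZeta c s ≠ ⊤) : Summable (charTerm χ s) := by
  have : Summable (charTerm (F := F) 1 s) := by
    have h : ∑' I : Ideal (𝓞 F), ENNReal.ofReal (charTerm 1 s I) ≠ ⊤ := by
      rw [tsum_ofReal_charTerm, tsum_fintype]
      exact ENNReal.sum_ne_top.2 fun c _ => hs c
    refine (ENNReal.summable_toReal h).congr fun I => ?_
    rw [ENNReal.toReal_ofReal (charTerm_one_nonneg _ _)]
  refine Summable.of_norm_bounded this fun I => ?_
  rw [Real.norm_eq_abs, abs_charTerm]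

theorem tsum_charTerm (χ : ClassGroup (𝓞 F) →* ℤˣ) {s : ℝ}
    (hs : ∀ c : ClassGroup (𝓞 F), classZeta c s ≠ ⊤) :
    ∑' I, charTerm χ s I = ∑ c, ((χ c : ℤ) : ℝ) * (classZeta c s).toReal := by
  have hinj : Function.Injective fun I : (Ideal (𝓞 F))⁰ => (I : Ideal (𝓞 F)) :=
    Subtype.val_injective
  rw [← hinj.tsum_eq]
  · have hsum : Summable fun I : (Ideal (𝓞 F))⁰ => charTerm χ s (I : Ideal (𝓞 F)) :=
      (summable_charTerm χ hs).comp_injective hinj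
    let e := Equiv.sigmaFiberEquiv (fun I : (Ideal (𝓞 F))⁰ => ClassGroup.mk0 I)
    rw [← e.tsum_eq]
    have hsum' := e.summable_iff.2 hsum
    refine (hsum'.tsum_sigma).trans ?_
    rw [tsum_fintype]
    refine Finset.sum_congr rfl fun c _ => ?_
    rw [classZeta, ENNReal.tsum_toReal_eq (fun _ => ENNReal.ofReal_ne_top), ← tsum_mul_left]
    refine tsum_congr fun I => ?_
    rw [ENNReal.toReal_ofReal (by positivity)]
    change charTerm χ s ((I : (Ideal (𝓞 F))⁰) : Ideal (𝓞 F)) = _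
    rw [charTerm_of_mem, I.2]
  · intro I hI
    refine ⟨⟨I, mem_nonZeroDivisors_of_ne_zero ?_⟩, rfl⟩
    rintro rfl
    exact hI (charTerm_zero _ _)

variable (F) in
theorem exists_tsum_charTerm_bound : ∃ C : ℝ, 0 < C ∧ ∀ s ∈ Set.Ioc (1 : ℝ) 2,
    (∀ c : ClassGroup (𝓞 F), classZeta c s ≠ ⊤) ∧
    ∑' I : Ideal (𝓞 F), charTerm 1 s I ≤ C / (s - 1) ∧
    ∀ χ : ClassGroup (𝓞 F) →* ℤˣ, χ ≠ 1 → |∑' I : Ideal (𝓞 F), charTerm χ s I| ≤ C := by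
  obtain ⟨X, C, hC⟩ := exists_classZeta_bound F
  have hC0 : 0 ≤ C := (abs_nonneg _).trans ((hC 2 (by simp)).2 1).2
  set h : ℝ := (Fintype.card (ClassGroup (𝓞 F)) : ℝ) with hh
  have h0 : 0 ≤ h := by positivity
  refine ⟨2 * h * C + 1, by positivity, fun s hs => ?_⟩
  have hz := fun c => ((hC s hs).2 c).1
  have hd := fun c => ((hC s hs).2 c).2
  have hs1 : 0 < s - 1 := by linarith [hs.1]
  have hs2 : s - 1 ≤ 1 := by linarith [hs.2]
  refine ⟨hz, ?_, fun χ hχ => ?_⟩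
  · rw [tsum_charTerm 1 hz]
    simp only [MonoidHom.one_apply, Units.val_one, Int.cast_one, one_mul]
    have : ∀ c ∈ Finset.univ, (classZeta c s).toReal ≤ 2 * C / (s - 1) := fun c _ => by
      have h1 := (abs_le.1 (hd c)).2
      have h2 := (abs_le.1 (hC s hs).1).2
      have h3 : C ≤ C / (s - 1) := by rw [le_div_iff₀ hs1]; nlinarith
      have h4 : 2 * C / (s - 1) = C / (s - 1) + C / (s - 1) := by ring
      rw [h4]
      calc (classZeta c s).toReal ≤ X s + C := by linarith only [h1]
        _ ≤ _ := add_le_add h2 h3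
    refine (Finset.sum_le_card_nsmul _ _ _ this).trans ?_
    rw [nsmul_eq_mul, Finset.card_univ, ← hh, ← mul_div_assoc]
    gcongr
    linarith
  · rw [tsum_charTerm χ hz]
    have hχ0 : ∑ c, ((χ c : ℤ) : ℝ) = 0 := by
      let f : ClassGroup (𝓞 F) →* ℝ :=
        ((Int.castRingHom ℝ : ℤ →* ℝ).comp (Units.coeHom ℤ)).comp χ
      refine sum_hom_units_eq_zero f fun hf => hχ ?_
      ext c
      have : ((χ c : ℤ) : ℝ) = 1 := DFunLike.congr_fun hf c
      simpa using this
    have : ∑ c, ((χ c : ℤ) : ℝ) * (classZeta c s).toReal =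
        ∑ c, ((χ c : ℤ) : ℝ) * ((classZeta c s).toReal - X s) := by
      simp only [mul_sub, Finset.sum_sub_distrib, ← Finset.sum_mul, hχ0, zero_mul, sub_zero]
    rw [this]
    refine (Finset.abs_sum_le_sum_abs _ _).trans ?_
    have : ∀ c ∈ Finset.univ, |((χ c : ℤ) : ℝ) * ((classZeta c s).toReal - X s)| ≤ C := fun c _ => by
      rw [abs_mul]
      rcases Int.units_eq_one_or (χ c) with h | h <;> simpa [h] using hd c
    refine (Finset.sum_le_card_nsmul _ _ _ this).trans ?_
    rw [nsmul_eq_mul, Finset.card_univ, ← hh]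
    nlinarith [mul_nonneg h0 hC0]

variable (F) in
theorem exists_le_tsum_charTerm : ∃ ε : ℝ, 0 < ε ∧ ∀ᶠ s in 𝓝[>] (1 : ℝ),
    ε / (s - 1) ≤ ∑' I : Ideal (𝓞 F), charTerm 1 s I := by
  obtain ⟨C, -, hC⟩ := exists_tsum_charTerm_bound F
  have hlim := (tendsto_sub_one_mul_dedekindZeta_nhdsGT F).norm
  have hpos := dedekindZeta_residue_pos F
  have hr : ‖(dedekindZeta_residue F : ℂ)‖ = dedekindZeta_residue F := by
    rw [Complex.norm_real, Real.norm_of_nonneg hpos.le]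
  rw [hr] at hlim
  refine ⟨dedekindZeta_residue F / 2, by positivity, ?_⟩
  have hI : Set.Ioc (1 : ℝ) 2 ∈ 𝓝[>] (1 : ℝ) := Ioc_mem_nhdsGT (by norm_num)
  filter_upwards [hlim.eventually (eventually_ge_nhds (half_lt_self hpos)), hI] with s h1 hs
  have hs1 : 0 < s - 1 := by linarith [hs.1]
  have hz := (hC s hs).1
  rw [div_le_iff₀ hs1, mul_comm]
  refine h1.trans ?_
  rw [norm_mul]
  have : ‖((s : ℂ) - 1)‖ = s - 1 := by
    rw [← Complex.ofReal_one, ← Complex.ofReal_sub, Complex.norm_real, Real.norm_of_nonneg hs1.le]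
  rw [this]
  refine mul_le_mul_of_nonneg_left ?_ hs1.le
  have hnn : 0 ≤ ∑' I : Ideal (𝓞 F), charTerm 1 s I := tsum_nonneg (charTerm_one_nonneg s)
  rw [← ENNReal.ofReal_le_ofReal_iff hnn, ofReal_norm,
    ENNReal.ofReal_tsum_of_nonneg (charTerm_one_nonneg s) (summable_charTerm 1 hz), dedekindZeta,
    LSeries]
  refine enorm_tsum_le_tsum_enorm.trans ?_
  rw [← ENNReal.tsum_fiberwise _ (fun I : Ideal (𝓞 F) => Ideal.absNorm I)]
  refine ENNReal.tsum_le_tsum fun n => ?_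
  rw [LSeries.term]
  split_ifs with hn
  · simp
  have hn0 : (0 : ℝ) < n := by positivity
  have hfib : ∀ I : (fun I : Ideal (𝓞 F) => Ideal.absNorm I) ⁻¹' {n},
      ENNReal.ofReal (charTerm 1 s (I : Ideal (𝓞 F))) = ENNReal.ofReal ((n : ℝ) ^ (-s)) := by
    rintro ⟨I, hI⟩
    have hI' : Ideal.absNorm I = n := hI
    have hI0 : I ≠ 0 := by
      rintro rfl
      exact hn (by rw [← hI']; exact Ideal.absNorm_bot)
    rw [charTerm, dif_neg hI0, hI']
    simp
  rw [tsum_congr hfib, ENNReal.tsum_const]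
  have e1 : ‖((Nat.card {I : Ideal (𝓞 F) // Ideal.absNorm I = n} : ℕ) : ℂ) / (n : ℂ) ^ (s : ℂ)‖ₑ =
      (Nat.card {I : Ideal (𝓞 F) // Ideal.absNorm I = n} : ENNReal) *
        ENNReal.ofReal ((n : ℝ) ^ (-s)) := by
    rw [← ofReal_norm, norm_div, Complex.norm_natCast,
      Complex.norm_natCast_cpow_of_pos (by omega), Complex.ofReal_re, div_eq_mul_inv,
      ← Real.rpow_neg hn0.le, ENNReal.ofReal_mul (by positivity), ENNReal.ofReal_natCast]
  rw [e1]
  refine mul_le_mul_left ?_ _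
  rw [← ENat.toENNReal_coe]
  exact ENat.toENNReal_le.2 (ENat.natCast_toNat_le_self _)

end ClassCharacters

section SplitCharacters

open IsDedekindDomain Filter Topology NumberField
open scoped Pointwise

variable {F L : Type*} [Field F] [NumberField F] [Field L] [NumberField L] [Algebra F L]

theorem absNorm_under_le (P : HeightOneSpectrum (𝓞 L)) :
    Ideal.absNorm (P.under (𝓞 F)).asIdeal ≤ Ideal.absNorm P.asIdeal := by
  have : P.asIdeal.LiesOver (P.under (𝓞 F)).asIdeal := ⟨rfl⟩
  rw [← Ideal.absNorm_pow_inertiaDeg (P.under (𝓞 F)).asIdeal P.asIdeal]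
  exact Nat.le_self_pow (Ideal.inertiaDeg_pos _ _).ne' _

theorem sq_absNorm_under_le (hU : Unram F L) {σ : L ≃ₐ[F] L} (hσ : σ ≠ 1)
    {P : HeightOneSpectrum (𝓞 L)} (hP : σ • P.asIdeal = P.asIdeal) :
    Ideal.absNorm (P.under (𝓞 F)).asIdeal ^ 2 ≤ Ideal.absNorm P.asIdeal := by
  have hlies : P.asIdeal.LiesOver (P.under (𝓞 F)).asIdeal := ⟨rfl⟩
  have hN := Ideal.absNorm_pow_inertiaDeg (P.under (𝓞 F)).asIdeal P.asIdeal
  have h1 : 0 < Ideal.absNorm (P.under (𝓞 F)).asIdeal :=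
    Nat.pos_of_ne_zero fun h => (P.under (𝓞 F)).ne_bot (Ideal.absNorm_eq_zero_iff.1 h)
  rw [← hN]
  refine Nat.pow_le_pow_right h1 ?_
  by_contra hlt
  have hd : P.asIdeal.inertiaDeg (𝓞 F) = 1 := by
    have := Ideal.inertiaDeg_pos P.asIdeal (𝓞 F)
    omega
  rw [hd, pow_one, Ideal.absNorm_apply, Ideal.absNorm_apply, Submodule.cardQuot_apply,
    Submodule.cardQuot_apply] at hN
  have hfin : Finite (𝓞 L ⧸ P.asIdeal) := Ideal.finiteQuotientOfFreeOfNeBot _ P.ne_bot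
  have hsurj := (Function.Injective.bijective_of_nat_card_le
    (Ideal.algebraMap_quotient_injective (I := P.asIdeal) (R := 𝓞 F)) hN.ge).2
  obtain ⟨y, hy⟩ := unramifiedAction_iff_forall_isMaximal.1 hU σ hσ P.asIdeal P.isMaximal
  refine hy ?_
  obtain ⟨x, hx⟩ := hsurj (Ideal.Quotient.mk _ y)
  obtain ⟨x, rfl⟩ := Ideal.Quotient.mk_surjective x
  have h2 : algebraMap (𝓞 F) (𝓞 L) x - y ∈ P.asIdeal := Ideal.Quotient.eq.1 hx
  have h3 : σ • (algebraMap (𝓞 F) (𝓞 L) x - y) ∈ P.asIdeal := by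
    rw [← hP]
    exact Ideal.smul_mem_pointwise_smul _ _ _ h2
  have h4 : σ • algebraMap (𝓞 F) (𝓞 L) x = algebraMap (𝓞 F) (𝓞 L) x :=
    RingOfIntegers.ext (by rw [coe_smul_ringOfIntegers]; exact σ.commutes (x : F))
  rw [smul_sub, h4] at h3
  have := P.asIdeal.sub_mem h3 h2
  rwa [sub_sub_sub_cancel_left] at this

theorem charTerm_one_heightOne (s : ℝ) (P : HeightOneSpectrum (𝓞 F)) :
    charTerm 1 s P.asIdeal = (Ideal.absNorm P.asIdeal : ℝ) ^ (-s) := by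
  rw [charTerm, dif_neg (by exact P.ne_bot)]
  simp

theorem charTerm_heightOne (χ : ClassGroup (𝓞 F) →* ℤˣ) (s : ℝ) (P : HeightOneSpectrum (𝓞 F)) :
    charTerm χ s P.asIdeal =
      ((χ (ClassGroup.mk0 ⟨P.asIdeal, mem_nonZeroDivisors_of_ne_zero P.ne_bot⟩) : ℤ) : ℝ) *
        charTerm 1 s P.asIdeal := by
  rw [charTerm, dif_neg (by exact P.ne_bot), charTerm_one_heightOne]

theorem charTerm_mul_heightOne (χ ψ : ClassGroup (𝓞 F) →* ℤˣ) (s : ℝ)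
    (P : HeightOneSpectrum (𝓞 F)) :
    charTerm (χ * ψ) s P.asIdeal =
      ((χ (ClassGroup.mk0 ⟨P.asIdeal, mem_nonZeroDivisors_of_ne_zero P.ne_bot⟩) : ℤ) : ℝ) *
      ((ψ (ClassGroup.mk0 ⟨P.asIdeal, mem_nonZeroDivisors_of_ne_zero P.ne_bot⟩) : ℤ) : ℝ) *
        charTerm 1 s P.asIdeal := by
  rw [charTerm_heightOne]
  simp

theorem one_lt_absNorm_heightOne (P : HeightOneSpectrum (𝓞 F)) : 1 < Ideal.absNorm P.asIdeal := by
  have h1 : Ideal.absNorm P.asIdeal ≠ 0 := fun h => P.ne_bot (Ideal.absNorm_eq_zero_iff.1 h)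
  have h2 : Ideal.absNorm P.asIdeal ≠ 1 := fun h => P.isPrime.ne_top (Ideal.absNorm_eq_one_iff.1 h)
  omega

/-- The local factor at `P` of the product of the four `L`-functions of the group generated by two
quadratic characters. -/
noncomputable def fourFactor (χ ψ : ClassGroup (𝓞 F) →* ℤˣ) (s : ℝ) (P : HeightOneSpectrum (𝓞 F)) :
    ℝ :=
  (1 - charTerm 1 s P.asIdeal) * (1 - charTerm χ s P.asIdeal) * (1 - charTerm ψ s P.asIdeal) *
    (1 - charTerm (χ * ψ) s P.asIdeal)

theorem charTerm_heightOne_mem {s : ℝ} (hs : 1 < s) (P : HeightOneSpectrum (𝓞 F)) :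
    charTerm 1 s P.asIdeal ∈ Set.Ioo (0 : ℝ) 1 := by
  rw [charTerm_one_heightOne]
  have := one_lt_absNorm_heightOne P
  have h1 : (1 : ℝ) < Ideal.absNorm P.asIdeal := by exact_mod_cast this
  exact ⟨by positivity, Real.rpow_lt_one_of_one_lt_of_neg h1 (by linarith)⟩

theorem fourFactor_bounds (χ ψ : ClassGroup (𝓞 F) →* ℤˣ) {s : ℝ} (hs : 1 < s)
    (P : HeightOneSpectrum (𝓞 F)) :
    0 < fourFactor χ ψ s P ∧ fourFactor χ ψ s P ≤ (1 - (charTerm 1 s P.asIdeal) ^ 2) ^ 2 := by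
  obtain ⟨h0, h1⟩ := charTerm_heightOne_mem hs P
  rw [fourFactor, charTerm_mul_heightOne, charTerm_heightOne χ, charTerm_heightOne ψ]
  set x := charTerm 1 s P.asIdeal
  have hx : 0 < 1 - x := by linarith
  have hx' : 0 < 1 + x := by linarith
  have e : (1 - x ^ 2) ^ 2 = (1 - x) ^ 2 * (1 + x) ^ 2 := by ring
  have e4 : (1 - x) ^ 2 ≤ (1 + x) ^ 2 := by nlinarith
  rcases Int.units_eq_one_or (χ (ClassGroup.mk0 ⟨P.asIdeal,
    mem_nonZeroDivisors_of_ne_zero P.ne_bot⟩)) with h | h <;>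
  rcases Int.units_eq_one_or (ψ (ClassGroup.mk0 ⟨P.asIdeal,
    mem_nonZeroDivisors_of_ne_zero P.ne_bot⟩)) with h' | h' <;>
  rw [h, h', e] <;> push_cast
  · have e2 : (1 - x) * (1 - 1 * x) * (1 - 1 * x) * (1 - 1 * 1 * x) = (1 - x) ^ 2 * (1 - x) ^ 2 := by
      ring
    rw [e2]
    exact ⟨by positivity, by gcongr⟩
  all_goals
    constructor
    · simp only [one_mul, mul_one, neg_mul, mul_neg, neg_neg, sub_neg_eq_add]
      positivity
    · apply le_of_eq
      ring

theorem fourFactor_of_eq_one {χ ψ : ClassGroup (𝓞 F) →* ℤˣ} {s : ℝ}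
    {P : HeightOneSpectrum (𝓞 F)}
    (hχ : χ (ClassGroup.mk0 ⟨P.asIdeal, mem_nonZeroDivisors_of_ne_zero P.ne_bot⟩) = 1)
    (hψ : ψ (ClassGroup.mk0 ⟨P.asIdeal, mem_nonZeroDivisors_of_ne_zero P.ne_bot⟩) = 1) :
    fourFactor χ ψ s P = (1 - charTerm 1 s P.asIdeal) ^ 4 := by
  rw [fourFactor, charTerm_mul_heightOne, charTerm_heightOne χ, charTerm_heightOne ψ, hχ, hψ]
  push_cast
  ring

theorem heightOne_fiber [IsGalois F L] {σ : L ≃ₐ[F] L} (hσ : ∀ g : L ≃ₐ[F] L, g = 1 ∨ g = σ)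
    {P Q : HeightOneSpectrum (𝓞 L)} (h : P.under (𝓞 F) = Q.under (𝓞 F)) :
    Q = P ∨ Q.asIdeal = σ • P.asIdeal := by
  have h' : P.asIdeal.under (𝓞 F) = Q.asIdeal.under (𝓞 F) := congrArg HeightOneSpectrum.asIdeal h
  obtain ⟨g, hg⟩ := Algebra.IsInvariant.exists_smul_of_under_eq (𝓞 F) (𝓞 L) (L ≃ₐ[F] L) _ _ h'
  rcases hσ g with rfl | rfl
  · left
    rw [one_smul] at hg
    exact HeightOneSpectrum.ext hg
  · exact Or.inr hg

open Classical in
theorem prod_fourFactor_le [IsGalois F L] (hU : Unram F L) {σ : L ≃ₐ[F] L} (hσ1 : σ ≠ 1)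
    (hσ : ∀ g : L ≃ₐ[F] L, g = 1 ∨ g = σ) {χ ψ : ClassGroup (𝓞 F) →* ℤˣ}
    (hχ : ∀ P : HeightOneSpectrum (𝓞 L), σ • P.asIdeal ≠ P.asIdeal →
      χ (ClassGroup.mk0 ⟨(P.under (𝓞 F)).asIdeal,
        mem_nonZeroDivisors_of_ne_zero (P.under (𝓞 F)).ne_bot⟩) = 1)
    (hψ : ∀ P : HeightOneSpectrum (𝓞 L), σ • P.asIdeal ≠ P.asIdeal →
      ψ (ClassGroup.mk0 ⟨(P.under (𝓞 F)).asIdeal,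
        mem_nonZeroDivisors_of_ne_zero (P.under (𝓞 F)).ne_bot⟩) = 1)
    {s : ℝ} (hs : 1 < s) (Q : Finset (HeightOneSpectrum (𝓞 L))) :
    ∏ p ∈ Q.image (HeightOneSpectrum.under (𝓞 F)), fourFactor χ ψ s p ≤
      (∏ P ∈ Q, (1 - charTerm 1 s P.asIdeal)) ^ 2 := by
  rw [← Finset.prod_pow, ← Finset.prod_fiberwise_of_maps_to
    (fun P hP => Finset.mem_image_of_mem (HeightOneSpectrum.under (𝓞 F)) hP)
    (fun P => (1 - charTerm 1 s P.asIdeal) ^ 2)]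
  refine Finset.prod_le_prod (fun p _ => (fourFactor_bounds χ ψ hs p).1.le) fun p hp => ?_
  obtain ⟨P, hP, rfl⟩ := Finset.mem_image.1 hp
  have hanti : ∀ {a b : ℝ}, 0 < a → a ≤ b → b ^ (-s) ≤ a ^ (-s) := fun ha hab =>
    Real.rpow_le_rpow_of_nonpos ha hab (by linarith)
  have hpos : (0 : ℝ) < Ideal.absNorm (P.under (𝓞 F)).asIdeal := by
    exact_mod_cast (zero_lt_one.trans (one_lt_absNorm_heightOne _))
  obtain ⟨hx0, hx1⟩ := charTerm_heightOne_mem hs (P.under (𝓞 F))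
  by_cases hfix : σ • P.asIdeal = P.asIdeal
  · have : Q.filter (fun R => R.under (𝓞 F) = P.under (𝓞 F)) = {P} := by
      ext R
      rw [Finset.mem_filter, Finset.mem_singleton]
      constructor
      · rintro ⟨-, h⟩
        rcases heightOne_fiber hσ h.symm with h | h
        · exact h
        · exact HeightOneSpectrum.ext (h.trans hfix)
      · rintro rfl
        exact ⟨hP, rfl⟩
    rw [this, Finset.prod_singleton]
    refine (fourFactor_bounds χ ψ hs _).2.trans ?_
    have hle : charTerm 1 s P.asIdeal ≤ charTerm 1 s (P.under (𝓞 F)).asIdeal ^ 2 := by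
      rw [charTerm_one_heightOne, charTerm_one_heightOne, ← Real.rpow_natCast, ← Real.rpow_mul
        hpos.le, mul_comm, Real.rpow_mul hpos.le]
      refine hanti (by positivity) ?_
      rw [Real.rpow_natCast]
      exact_mod_cast sq_absNorm_under_le hU hσ1 hfix
    have : charTerm 1 s (P.under (𝓞 F)).asIdeal ^ 2 ≤ 1 := pow_le_one₀ hx0.le hx1.le
    exact pow_le_pow_left₀ (by linarith) (by linarith) 2
  · rw [fourFactor_of_eq_one (hχ P hfix) (hψ P hfix)]
    have hfac : ∀ R ∈ Q.filter (fun R => R.under (𝓞 F) = P.under (𝓞 F)),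
        (1 - charTerm 1 s (P.under (𝓞 F)).asIdeal) ^ 2 ≤ (1 - charTerm 1 s R.asIdeal) ^ 2 := by
      intro R hR
      have hR := (Finset.mem_filter.1 hR).2
      refine pow_le_pow_left₀ (by linarith) ?_ 2
      rw [← hR, charTerm_one_heightOne, charTerm_one_heightOne]
      refine sub_le_sub_left (hanti ?_ ?_) 1
      · rw [hR]; exact hpos
      · exact_mod_cast absNorm_under_le R
    have hcard : (Q.filter (fun R => R.under (𝓞 F) = P.under (𝓞 F))).card ≤ 2 := by
      by_contra! hlt
      obtain ⟨a, b, c, ha, hb, hc, hab, hac, hbc⟩ := Finset.two_lt_card_iff.1 hlt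
      have hb' := heightOne_fiber hσ (((Finset.mem_filter.1 ha).2).trans (Finset.mem_filter.1 hb).2.symm)
      have hc' := heightOne_fiber hσ (((Finset.mem_filter.1 ha).2).trans (Finset.mem_filter.1 hc).2.symm)
      exact hbc (HeightOneSpectrum.ext ((hb'.resolve_left hab.symm).trans
        (hc'.resolve_left hac.symm).symm))
    have hx2 : (1 - charTerm 1 s (P.under (𝓞 F)).asIdeal) ^ 2 ≤ 1 :=
      pow_le_one₀ (by linarith) (by linarith)
    calc _ = ((1 - charTerm 1 s (P.under (𝓞 F)).asIdeal) ^ 2) ^ 2 := by ring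
      _ ≤ ((1 - charTerm 1 s (P.under (𝓞 F)).asIdeal) ^ 2) ^
          (Q.filter (fun R => R.under (𝓞 F) = P.under (𝓞 F))).card :=
        pow_le_pow_of_le_one (by positivity) hx2 hcard
      _ = ∏ R ∈ Q.filter (fun R => R.under (𝓞 F) = P.under (𝓞 F)),
          (1 - charTerm 1 s (P.under (𝓞 F)).asIdeal) ^ 2 := by rw [Finset.prod_const]
      _ ≤ _ := Finset.prod_le_prod (fun _ _ => by positivity) hfac

/-- In an unramified quadratic extension, the group of quadratic class group characters that are
trivial on split primes has order at most two. -/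
theorem eq_one_of_trivial_on_split [IsGalois F L] (hU : Unram F L) {σ : L ≃ₐ[F] L} (hσ1 : σ ≠ 1)
    (hσ : ∀ g : L ≃ₐ[F] L, g = 1 ∨ g = σ) {χ ψ : ClassGroup (𝓞 F) →* ℤˣ}
    (hχ : ∀ P : HeightOneSpectrum (𝓞 L), σ • P.asIdeal ≠ P.asIdeal →
      χ (ClassGroup.mk0 ⟨(P.under (𝓞 F)).asIdeal,
        mem_nonZeroDivisors_of_ne_zero (P.under (𝓞 F)).ne_bot⟩) = 1)
    (hψ : ∀ P : HeightOneSpectrum (𝓞 L), σ • P.asIdeal ≠ P.asIdeal →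
      ψ (ClassGroup.mk0 ⟨(P.under (𝓞 F)).asIdeal,
        mem_nonZeroDivisors_of_ne_zero (P.under (𝓞 F)).ne_bot⟩) = 1)
    (hχ1 : χ ≠ 1) (hψ1 : ψ ≠ 1) (hχψ : χ * ψ ≠ 1) : False := by
  classical
  obtain ⟨C, hC0, hC⟩ := exists_tsum_charTerm_bound F
  obtain ⟨C', -, hC'⟩ := exists_tsum_charTerm_bound L
  obtain ⟨ε, hε, hlow⟩ := exists_le_tsum_charTerm L
  have hI : Set.Ioc (1 : ℝ) 2 ∈ 𝓝[>] (1 : ℝ) := Ioc_mem_nhdsGT (by norm_num)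
  have key : ∀ᶠ s in 𝓝[>] (1 : ℝ), ε ^ 2 ≤ C ^ 4 * (s - 1) := by
    filter_upwards [hlow, hI] with s hlow hs
    obtain ⟨hz, hb1, hb⟩ := hC s hs
    have hzL := (hC' s hs).1
    have hs1 : 0 < s - 1 := by linarith [hs.1]
    have hlim : ∀ χ : ClassGroup (𝓞 F) →* ℤˣ, _ := fun χ => tendsto_prod_one_sub_mul_tsum
      (charTerm_zero χ s) (charTerm_one χ s) (charTerm_mul χ s) (summable_charTerm χ hz)
    have hlimL := tendsto_prod_one_sub_mul_tsum
      (charTerm_zero (F := L) 1 s) (charTerm_one 1 s) (charTerm_mul 1 s) (summable_charTerm 1 hzL)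
    set Z := ∑' I : Ideal (𝓞 L), charTerm 1 s I
    set Λ : (ClassGroup (𝓞 F) →* ℤˣ) → ℝ := fun χ => ∑' I : Ideal (𝓞 F), charTerm χ s I
    let M : ℝ := Λ 1 * Λ χ * Λ ψ * Λ (χ * ψ)
    have hM : Tendsto (fun P : Finset (HeightOneSpectrum (𝓞 F)) =>
        (∏ p ∈ P, fourFactor χ ψ s p) * M) atTop (𝓝 1) := by
      have := (((hlim 1).mul (hlim χ)).mul (hlim ψ)).mul (hlim (χ * ψ))
      rw [one_mul, one_mul, one_mul] at this
      refine this.congr fun P => ?_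
      simp only [fourFactor, Finset.prod_mul_distrib, M, Λ]
      ring
    have hpos : ∀ P : Finset (HeightOneSpectrum (𝓞 F)), 0 < ∏ p ∈ P, fourFactor χ ψ s p :=
      fun P => Finset.prod_pos fun p _ => (fourFactor_bounds χ ψ hs.1 p).1
    have hM0 : 0 < M := by
      by_contra! hM0
      have := le_of_tendsto hM (Eventually.of_forall fun P =>
        mul_nonpos_of_nonneg_of_nonpos (hpos P).le hM0)
      linarith
    have hfac1 : ∀ p, fourFactor χ ψ s p ≤ 1 := fun p => by
      obtain ⟨hx0, hx1⟩ := charTerm_heightOne_mem hs.1 p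
      refine (fourFactor_bounds χ ψ hs.1 p).2.trans (pow_le_one₀ ?_ ?_)
      · linarith [pow_le_one₀ (n := 2) hx0.le hx1.le]
      · linarith [pow_nonneg hx0.le 2]
    have hge : ∀ P : Finset (HeightOneSpectrum (𝓞 F)), 1 ≤ (∏ p ∈ P, fourFactor χ ψ s p) * M := by
      intro P
      refine le_of_tendsto hM ?_
      filter_upwards [eventually_ge_atTop P] with P' hP'
      refine mul_le_mul_of_nonneg_right ?_ hM0.le
      rw [← Finset.prod_sdiff hP']
      exact mul_le_of_le_one_left (hpos P).le (Finset.prod_le_one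
        (fun p _ => (fourFactor_bounds χ ψ hs.1 p).1.le) (fun p _ => hfac1 p))
    have hZM : Z ^ 2 ≤ M := by
      have h1 := (hlimL.pow 2).mul_const M
      rw [one_pow, one_mul] at h1
      refine ge_of_tendsto h1 (Eventually.of_forall fun Q => ?_)
      have h2 := prod_fourFactor_le hU hσ1 hσ hχ hψ hs.1 Q
      have h3 := hge (Q.image (HeightOneSpectrum.under (𝓞 F)))
      have h4 : 1 ≤ (∏ P ∈ Q, (1 - charTerm 1 s P.asIdeal)) ^ 2 * M :=
        h3.trans (mul_le_mul_of_nonneg_right h2 hM0.le)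
      rw [mul_pow]
      nlinarith [mul_le_mul_of_nonneg_left h4 (sq_nonneg Z)]
    have hMle : M ≤ C / (s - 1) * C * C * C := by
      have hΛ1 : |Λ 1| ≤ C / (s - 1) := by
        rw [abs_of_nonneg (tsum_nonneg (charTerm_one_nonneg s))]
        exact hb1
      refine (le_abs_self M).trans ?_
      simp only [M, abs_mul]
      have := hb χ hχ1
      have := hb ψ hψ1
      have := hb _ hχψ
      gcongr
    have h5 : (ε / (s - 1)) ^ 2 ≤ C / (s - 1) * C * C * C :=
      ((pow_le_pow_left₀ (by positivity) hlow 2).trans hZM).trans hMle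
    have h6 : (ε / (s - 1)) ^ 2 * (s - 1) ^ 2 ≤ (C / (s - 1) * C * C * C) * (s - 1) ^ 2 :=
      mul_le_mul_of_nonneg_right h5 (by positivity)
    have e1 : (ε / (s - 1)) ^ 2 * (s - 1) ^ 2 = ε ^ 2 := by field_simp
    have e2 : (C / (s - 1) * C * C * C) * (s - 1) ^ 2 = C ^ 4 * (s - 1) := by field_simp
    rwa [e1, e2] at h6
  have hlim0 : Tendsto (fun s : ℝ => C ^ 4 * (s - 1)) (𝓝[>] 1) (𝓝 0) := by
    have : Tendsto (fun s : ℝ => C ^ 4 * (s - 1)) (𝓝 1) (𝓝 (C ^ 4 * (1 - 1))) :=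
      (continuous_const.mul (continuous_id.sub continuous_const)).tendsto 1
    rw [sub_self, mul_zero] at this
    exact this.mono_left nhdsWithin_le_nhds
  have := ge_of_tendsto hlim0 key
  have : 0 < ε ^ 2 := by positivity
  linarith

end SplitCharacters

section QuadraticNormTheorem

open IsDedekindDomain NumberField nonZeroDivisors FractionalIdeal
open scoped Pointwise

variable {F L : Type*} [Field F] [NumberField F] [Field L] [NumberField L] [Algebra F L]

theorem galI_coeIdeal {G : Type*} [Group G] [MulSemiringAction G L] (g : G) (P : Ideal (𝓞 L)) :
    galI g (P : FrId L) = ((g • P : Ideal (𝓞 L)) : FrId L) := by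
  ext x
  rw [mem_galI, mem_coeIdeal, mem_coeIdeal]
  constructor
  · rintro ⟨y, hy, hyx⟩
    refine ⟨g • y, Ideal.smul_mem_pointwise_smul _ _ _ hy, ?_⟩
    change ((g • y : 𝓞 L) : L) = x
    rw [coe_smul_ringOfIntegers]
    exact (congrArg (g • ·) hyx).trans (smul_inv_smul g x)
  · rintro ⟨y, hy, rfl⟩
    refine ⟨g⁻¹ • y, Ideal.mem_pointwise_smul_iff_inv_smul_mem.1 hy, ?_⟩
    exact coe_smul_ringOfIntegers _ _

theorem extI_under_of_smul_ne [IsGalois F L] (hU : Unram F L) {σ : L ≃ₐ[F] L} (hσ1 : σ ≠ 1)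
    (hσ : ∀ g : L ≃ₐ[F] L, g = 1 ∨ g = σ) {P : HeightOneSpectrum (𝓞 L)}
    (hP : σ • P.asIdeal ≠ P.asIdeal) :
    extI F L ((P.under (𝓞 F)).asIdeal : FrId F) =
      (P.asIdeal : FrId L) * galI σ (P.asIdeal : FrId L) := by
  have hσσ : σ * σ = 1 := (hσ _).resolve_right fun h => hσ1 (mul_eq_left.1 h)
  have hinv : ∀ g : L ≃ₐ[F] L, galI g ((P.asIdeal : FrId L) * galI σ (P.asIdeal : FrId L)) =
      (P.asIdeal : FrId L) * galI σ (P.asIdeal : FrId L) := by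
    intro g
    rcases hσ g with rfl | rfl
    · rw [galI_one]
    · rw [map_mul, ← galI_mul, hσσ, galI_one, mul_comm]
  obtain ⟨J, hJ⟩ := exists_extI_eq hU hinv
  rw [galI_coeIdeal] at hJ ⊢
  have hmax : (σ • P.asIdeal).IsMaximal := by
    have := P.isMaximal
    exact Ideal.map_isMaximal_of_equiv (MulSemiringAction.toRingEquiv _ (𝓞 L) σ)
  have hcop : P.asIdeal * (σ • P.asIdeal) = P.asIdeal ⊓ (σ • P.asIdeal) := by
    refine Ideal.mul_eq_inf_of_coprime ?_
    exact Ideal.isCoprime_iff_sup_eq.1 (Ideal.isCoprime_of_isMaximal hP.symm)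
  rw [← coeIdeal_mul] at hJ ⊢
  refine le_antisymm ?_ ?_
  · rw [extI_le]
    rintro _ ⟨x, hx, rfl⟩
    refine ⟨algebraMap (𝓞 F) (𝓞 L) x, ?_, rfl⟩
    have hx' : algebraMap (𝓞 F) (𝓞 L) x ∈ P.asIdeal := hx
    change algebraMap (𝓞 F) (𝓞 L) x ∈ P.asIdeal * (σ • P.asIdeal)
    rw [hcop]
    refine ⟨hx', Ideal.mem_pointwise_smul_iff_inv_smul_mem.2 ?_⟩
    have h4 : σ⁻¹ • algebraMap (𝓞 F) (𝓞 L) x = algebraMap (𝓞 F) (𝓞 L) x :=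
      RingOfIntegers.ext (by rw [coe_smul_ringOfIntegers]; exact (σ⁻¹).commutes (x : F))
    rwa [h4]
  · rw [← hJ, extI_le]
    intro x hx
    have h1 := algebraMap_mem_extI (K := L) hx
    rw [hJ] at h1
    obtain ⟨y, hy, hyx⟩ := h1
    have hy' : y ∈ P.asIdeal * (σ • P.asIdeal) := hy
    rw [hcop] at hy'
    have hint : IsIntegral ℤ x := by
      rw [← isIntegral_algebraMap_iff (FaithfulSMul.algebraMap_injective F L), ← hyx]
      exact y.2
    refine algebraMap_mem_extI ⟨⟨x, hint⟩, ?_, rfl⟩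
    change algebraMap (𝓞 F) (𝓞 L) ⟨x, hint⟩ ∈ P.asIdeal
    have : algebraMap (𝓞 F) (𝓞 L) ⟨x, hint⟩ = y := RingOfIntegers.ext hyx.symm
    rw [this]
    exact hy'.1

theorem exists_hom_units_ne_one {V : Type*} [CommGroup V] [Finite V] (h2 : ∀ v : V, v ^ 2 = 1)
    {v : V} (hv : v ≠ 1) : ∃ χ : V →* ℤˣ, χ v ≠ 1 := by
  have h : HasEnoughRootsOfUnity ℤ 2 := ⟨⟨-1, IsPrimitiveRoot.neg_one 0 (by norm_num)⟩, inferInstance⟩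
  have : HasEnoughRootsOfUnity ℤ (Monoid.exponent V) :=
    HasEnoughRootsOfUnity.of_dvd ℤ (Monoid.exponent_dvd_of_forall_pow_eq_one h2)
  exact CommGroup.exists_apply_ne_one_of_hasEnoughRootsOfUnity V ℤ hv

theorem exists_hom_units_pair {V : Type*} [CommGroup V] [Finite V] (h2 : ∀ v : V, v ^ 2 = 1)
    {u v : V} (hu : u ≠ 1) (hv : v ≠ 1) (huv : u * v ≠ 1) :
    ∃ χ ψ : V →* ℤˣ, χ ≠ 1 ∧ ψ ≠ 1 ∧ χ * ψ ≠ 1 := by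
  have aux : ∀ u v : V, u ≠ 1 → v ≠ 1 → u * v ≠ 1 → ∃ χ : V →* ℤˣ, χ u ≠ 1 ∧ χ v = 1 := by
    intro u v hu hv huv
    have hne : (QuotientGroup.mk' (Subgroup.zpowers v)) u ≠ 1 := by
      intro h
      rw [← MonoidHom.mem_ker, QuotientGroup.ker_mk', Subgroup.mem_zpowers_iff] at h
      obtain ⟨k, hk⟩ := h
      rcases Int.even_or_odd' k with ⟨m, rfl | rfl⟩
      · rw [zpow_mul, zpow_two, ← pow_two, h2, one_zpow] at hk
        exact hu hk.symm
      · rw [zpow_add, zpow_mul, zpow_two, ← pow_two, h2, one_zpow, one_mul, zpow_one] at hk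
        rw [← hk, ← pow_two, h2] at huv
        exact huv rfl
    obtain ⟨χ, hχ⟩ := exists_hom_units_ne_one (V := V ⧸ Subgroup.zpowers v) (fun w => by
      obtain ⟨w, rfl⟩ := QuotientGroup.mk'_surjective _ w
      rw [← map_pow, h2, map_one]) hne
    refine ⟨χ.comp (QuotientGroup.mk' _), hχ, ?_⟩
    have hv0 : QuotientGroup.mk' (Subgroup.zpowers v) v = 1 := by
      rw [← MonoidHom.mem_ker, QuotientGroup.ker_mk']
      exact Subgroup.mem_zpowers v
    rw [MonoidHom.comp_apply, hv0, map_one]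
  obtain ⟨χ, h1, h2⟩ := aux u v hu hv huv
  obtain ⟨ψ, h3, h4⟩ := aux v u hv hu (by rwa [mul_comm])
  refine ⟨χ, ψ, fun h => h1 (by rw [h]; rfl), fun h => h3 (by rw [h]; rfl), fun h => h1 ?_⟩
  have := DFunLike.congr_fun h u
  rwa [MonoidHom.mul_apply, h4, mul_one] at this

/-- In an unramified quadratic extension of a totally complex number field, an element whose ideal
is a norm of an ideal is a norm of an element. -/
theorem exists_norm_eq_of_unram [IsGalois F L] [IsTotallyComplex F] (hU : Unram F L)
    (hrank : Module.finrank F L = 2) {σ : L ≃ₐ[F] L} (hσ1 : σ ≠ 1) (a : Lˣ) (ha : σ a = a)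
    (𝔠 : (FrId L)ˣ) (h𝔠 : (𝔠 : FrId L) * galI σ (𝔠 : FrId L) = spanSingleton (𝓞 L)⁰ (a : L)) :
    ∃ x : Lˣ, (x : L) * σ x = a := by
  have hσ : ∀ g : L ≃ₐ[F] L, g = 1 ∨ g = σ := by
    have hc : Nat.card (L ≃ₐ[F] L) = 2 := by rw [IsGalois.card_aut_eq_finrank, hrank]
    obtain ⟨x, y, hxy, hu⟩ := Nat.card_eq_two_iff.1 hc
    intro g
    have h1 : ∀ z : L ≃ₐ[F] L, z = x ∨ z = y := fun z => by
      have : z ∈ ({x, y} : Set _) := by rw [hu]; trivial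
      simpa using this
    rcases h1 g with rfl | rfl <;> rcases h1 σ with rfl | rfl <;> rcases h1 1 with h | h <;>
      simp_all
  refine exists_norm_eq_of_index hrank σ hσ1 ?_ a ha 𝔠 h𝔠
  intro x hx y hy hxS hyS
  by_contra hxy
  set S := Subgroup.map (toPrincipalIdeal (𝓞 L) L) (invDiff (unitAut σ)).ker ⊔
    (invNorm (idealAut σ)).range with hS
  let E : (FrId F)ˣ →* (FrId L)ˣ := Units.map (extI F L : FrId F →* FrId L)
  have hE : ∀ z ∈ (invDiff (idealAut σ)).ker, ∃ J, E J = z := by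
    intro z hz
    have hz' : galI σ (z : FrId L) = z := congrArg Units.val (mem_ker_invDiff.1 hz)
    obtain ⟨J, hJ⟩ := exists_extI_eq hU (I := (z : FrId L)) (fun g => by
      rcases hσ g with rfl | rfl
      · rw [galI_one]
      · exact hz')
    have hJ0 : J ≠ 0 := by
      rintro rfl
      rw [map_zero] at hJ
      exact z.ne_zero hJ.symm
    exact ⟨Units.mk0 J hJ0, Units.ext hJ⟩
  obtain ⟨Jx, rfl⟩ := hE x hx
  obtain ⟨Jy, rfl⟩ := hE y hy
  let T : Subgroup (FrId F)ˣ := S.comap E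
  have hTprin : (toPrincipalIdeal (𝓞 F) F).range ≤ T := by
    rintro _ ⟨b, rfl⟩
    refine Subgroup.mem_sup_left ⟨Units.map (algebraMap F L : F →* L) b, ?_, ?_⟩
    · exact mem_ker_invDiff.2 (Units.ext (σ.commutes (b : F)))
    · refine Units.ext ?_
      rw [coe_toPrincipalIdeal]
      change _ = extI F L (toPrincipalIdeal (𝓞 F) F b : FrId F)
      rw [coe_toPrincipalIdeal, extI_spanSingleton]
      rfl
  have hTsq : ∀ J : (FrId F)ˣ, J ^ 2 ∈ T := fun J => by
    refine Subgroup.mem_sup_right ⟨E J, ?_⟩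
    rw [invNorm_apply, map_pow, pow_two]
    congr 1
    exact Units.ext (galI_extI σ (J : FrId F))
  have hTsplit : ∀ P : HeightOneSpectrum (𝓞 L), σ • P.asIdeal ≠ P.asIdeal →
      FractionalIdeal.mk0 F ⟨(P.under (𝓞 F)).asIdeal,
        mem_nonZeroDivisors_of_ne_zero (P.under (𝓞 F)).ne_bot⟩ ∈ T := fun P hP => by
    refine Subgroup.mem_sup_right ⟨FractionalIdeal.mk0 L ⟨P.asIdeal,
      mem_nonZeroDivisors_of_ne_zero P.ne_bot⟩, ?_⟩
    rw [invNorm_apply]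
    exact Units.ext (extI_under_of_smul_ne hU hσ1 hσ hP).symm
  let q := QuotientGroup.mk' T
  let ρ : ClassGroup (𝓞 F) →* (FrId F)ˣ ⧸ T :=
    (QuotientGroup.lift _ q (fun z hz => by
      rw [QuotientGroup.ker_mk']; exact hTprin hz)).comp
      (ClassGroup.equiv F).toMonoidHom
  have hρ0 : ∀ I : (Ideal (𝓞 F))⁰, ρ (ClassGroup.mk0 I) = q (FractionalIdeal.mk0 F I) := fun I => by
    simp only [ρ, MonoidHom.comp_apply, MulEquiv.coe_toMonoidHom, ClassGroup.equiv_mk0]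
    rfl
  have hρs : Function.Surjective ρ := by
    intro w
    obtain ⟨J, rfl⟩ := QuotientGroup.mk'_surjective _ w
    refine ⟨(ClassGroup.equiv F).symm (QuotientGroup.mk' _ J), ?_⟩
    simp only [ρ, MonoidHom.comp_apply, MulEquiv.coe_toMonoidHom, MulEquiv.apply_symm_apply]
    rfl
  have hfin : Finite ((FrId F)ˣ ⧸ T) := Finite.of_surjective ρ hρs
  have hq : ∀ J, E J ∉ S → q J ≠ 1 := fun J hJ h => by
    rw [← MonoidHom.mem_ker, QuotientGroup.ker_mk'] at h
    exact hJ h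
  obtain ⟨χ, ψ, h1, h2, h3⟩ := exists_hom_units_pair (V := (FrId F)ˣ ⧸ T) (u := q Jx) (v := q Jy)
    (fun w => by
      obtain ⟨J, rfl⟩ := QuotientGroup.mk'_surjective _ w
      rw [← map_pow, ← MonoidHom.mem_ker, QuotientGroup.ker_mk']
      exact hTsq J) (hq _ hxS) (hq _ hyS) (by
      rw [← map_mul]
      exact hq _ (by rwa [map_mul]))
  have hne : ∀ χ : (FrId F)ˣ ⧸ T →* ℤˣ, χ ≠ 1 → χ.comp ρ ≠ 1 := fun χ hχ h => hχ <| by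
    refine MonoidHom.ext fun w => ?_
    obtain ⟨w, rfl⟩ := hρs w
    exact DFunLike.congr_fun h w
  have htriv : ∀ χ : (FrId F)ˣ ⧸ T →* ℤˣ, ∀ P : HeightOneSpectrum (𝓞 L),
      σ • P.asIdeal ≠ P.asIdeal → (χ.comp ρ) (ClassGroup.mk0 ⟨(P.under (𝓞 F)).asIdeal,
        mem_nonZeroDivisors_of_ne_zero (P.under (𝓞 F)).ne_bot⟩) = 1 := fun χ P hP => by
    rw [MonoidHom.comp_apply, hρ0]
    have := hTsplit P hP
    rw [← QuotientGroup.ker_mk' T, MonoidHom.mem_ker] at this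
    rw [this, map_one]
  refine eq_one_of_trivial_on_split hU hσ1 hσ (htriv χ) (htriv ψ) (hne _ h1) (hne _ h2) ?_
  have := hne _ h3
  rwa [MonoidHom.mul_comp] at this

end QuadraticNormTheorem

section ExtendCocycle

theorem exists_extend_cocycle {Γ G M : Type*} [Group Γ] [Group G] [CommGroup M]
    [MulDistribMulAction G M] (π : Γ →* G) {Γ' : Subgroup Γ} (hidx : Γ'.index = 2) {c' : Γ → M}
    (hc' : ∀ γ ∈ Γ', ∀ δ ∈ Γ', c' (γ * δ) = c' γ * π γ • c' δ) {s : Γ} (hs : s ∉ Γ') {z : M}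
    (h1 : ∀ γ ∈ Γ', z * π s • c' γ = c' (s * γ * s⁻¹) * π (s * γ * s⁻¹) • z)
    (h2 : z * π s • z = c' (s * s)) :
    ∃ c : Γ → M, (∀ γ δ, c (γ * δ) = c γ * π γ • c δ) ∧ ∀ γ ∈ Γ', c γ = c' γ := by
  classical
  have hn : Γ'.Normal := Subgroup.normal_of_index_eq_two hidx
  have hmem : ∀ {a b : Γ}, a * b ∈ Γ' ↔ (a ∈ Γ' ↔ b ∈ Γ') := fun {a b} =>
    Subgroup.mul_mem_iff_of_index_two hidx
  let c : Γ → M := fun γ => if γ ∈ Γ' then c' γ else c' (γ * s⁻¹) * π (γ * s⁻¹) • z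
  have hc0 : ∀ γ ∈ Γ', c γ = c' γ := fun γ h => if_pos h
  have hc1 : ∀ γ ∈ Γ', c (γ * s) = c' γ * π γ • z := fun γ h => by
    have : γ * s ∉ Γ' := fun h' => hs ((hmem.1 h').1 h)
    simp only [c]
    rw [if_neg this, mul_inv_cancel_right]
  have hdec : ∀ γ, γ ∉ Γ' → ∃ γ' ∈ Γ', γ = γ' * s := fun γ h => by
    refine ⟨γ * s⁻¹, hmem.2 ⟨fun h' => absurd h' h, fun h' => absurd (Γ'.inv_mem_iff.1 h') hs⟩, ?_⟩
    rw [inv_mul_cancel_right]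
  refine ⟨c, fun γ δ => ?_, hc0⟩
  by_cases hγ : γ ∈ Γ' <;> by_cases hδ : δ ∈ Γ'
  · rw [hc0 _ (Γ'.mul_mem hγ hδ), hc0 _ hγ, hc0 _ hδ, hc' _ hγ _ hδ]
  · obtain ⟨δ', hδ', rfl⟩ := hdec δ hδ
    rw [← mul_assoc, hc1 _ (Γ'.mul_mem hγ hδ'), hc0 _ hγ, hc1 _ hδ', hc' _ hγ _ hδ', map_mul,
      mul_smul, smul_mul', mul_assoc]
  · obtain ⟨γ', hγ', rfl⟩ := hdec γ hγ
    have hδs := hn.conj_mem δ hδ s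
    have e : γ' * s * δ = γ' * (s * δ * s⁻¹) * s := by group
    rw [e, hc1 _ (Γ'.mul_mem hγ' hδs), hc1 _ hγ', hc0 _ hδ, hc' _ hγ' _ hδs, map_mul, mul_smul,
      mul_assoc, ← smul_mul', ← h1 _ hδ, smul_mul', map_mul, mul_smul, mul_assoc]
  · obtain ⟨γ', hγ', rfl⟩ := hdec γ hγ
    obtain ⟨δ', hδ', rfl⟩ := hdec δ hδ
    have hδs := hn.conj_mem δ' hδ' s
    have hss : s * s ∈ Γ' := hmem.2 Iff.rfl
    have e : γ' * s * (δ' * s) = γ' * (s * δ' * s⁻¹ * (s * s)) := by group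
    have e2 : π s * π δ' = π (s * δ' * s⁻¹) * π s := by
      rw [← map_mul, ← map_mul, inv_mul_cancel_right]
    have e3 : z * (π s * π δ') • z * π s • c' δ' =
        c' (s * δ' * s⁻¹) * π (s * δ' * s⁻¹) • c' (s * s) := by
      rw [mul_right_comm, h1 _ hδ', e2, mul_smul, mul_assoc, ← smul_mul', h2]
    rw [e, hc0 _ (Γ'.mul_mem hγ' (Γ'.mul_mem hδs hss)), hc' _ hγ' _ (Γ'.mul_mem hδs hss),
      hc' _ hδs _ hss, hc1 _ hγ', hc1 _ hδ', ← e3, map_mul, mul_smul (π γ') (π s), mul_assoc,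
      smul_mul' (π γ') z, smul_mul' (π s), mul_smul (π s), mul_comm (π s • c' δ'), mul_assoc]

end ExtendCocycle

section CocycleDescent

open NumberField nonZeroDivisors FractionalIdeal

variable {Λ F K : Type*} [Group Λ] [Field F] [NumberField F] [Field K] [NumberField K] [Algebra F K]

/-- **Hilbert 90** for cocycles on an extension of the Galois group which are trivial on the
kernel. -/
theorem exists_eq_smul_div_of_trivial_on_ker {ρ : Λ →* (K ≃ₐ[F] K)} (hρ : Function.Surjective ρ)
    {B : Λ → Kˣ} (hB : ∀ γ δ, B (γ * δ) = B γ * ρ γ • B δ) (hB1 : ∀ v ∈ ρ.ker, B v = 1) :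
    ∃ x : Kˣ, ∀ γ, B γ = ρ γ • x / x := by
  choose r hr using hρ
  have hBr : ∀ γ, B (r (ρ γ)) = B γ := fun γ => by
    obtain ⟨v, hv, h⟩ : ∃ v ∈ ρ.ker, r (ρ γ) = γ * v :=
      ⟨γ⁻¹ * r (ρ γ), by rw [MonoidHom.mem_ker, map_mul, hr, map_inv, inv_mul_cancel], by group⟩
    rw [h, hB, hB1 _ hv, smul_one,
      mul_one]
  obtain ⟨x, hx⟩ := groupCohomology.isMulCoboundary₁_of_isMulCocycle₁_of_aut_to_units
    (fun g => B (r g)) (fun g h => by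
      have := hBr (r g * r h)
      rw [map_mul, hr, hr] at this
      simp only [this, hB, hr]
      rw [mul_comm])
  exact ⟨x, fun γ => by rw [← hBr γ, hx]⟩

theorem exists_mul_galI_eq_of_cocycle {ρ : Λ →* (K ≃ₐ[F] K)} (hρ : Function.Surjective ρ)
    {D : Λ → FrId K} (hD : ∀ γ δ, D (γ * δ) = D γ * galI (ρ γ) (D δ))
    (hD0 : ∀ γ, D γ ≠ 0) (hD1 : ∀ v ∈ ρ.ker, D v = 1) :
    ∃ 𝔟 : FrId K, 𝔟 ≠ 0 ∧ ∀ γ, D γ * galI (ρ γ) 𝔟 = 𝔟 := by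
  classical
  have : Fintype (K ≃ₐ[F] K) := Fintype.ofFinite _
  choose r hr using hρ
  have hDr : ∀ γ, D (r (ρ γ)) = D γ := fun γ => by
    obtain ⟨v, hv, h⟩ : ∃ v ∈ ρ.ker, r (ρ γ) = γ * v :=
      ⟨γ⁻¹ * r (ρ γ), by rw [MonoidHom.mem_ker, map_mul, hr, map_inv, inv_mul_cancel], by group⟩
    rw [h, hD, hD1 _ hv, map_one,
      mul_one]
  refine ⟨∑ g, D (r g), fun h => ?_, fun γ => ?_⟩
  · exact hD0 (r 1) (Finset.sum_eq_zero_iff.1 h 1 (Finset.mem_univ _))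
  · rw [map_sum, Finset.mul_sum]
    refine Fintype.sum_equiv (Equiv.mulLeft (ρ γ)) _ _ fun g => ?_
    have := hDr (γ * r g)
    rw [map_mul, hr] at this
    rw [Equiv.coe_mulLeft, this, hD]

end CocycleDescent

section CocycleStep

open NumberField nonZeroDivisors FractionalIdeal

theorem div_eq_div_of_mul_eq_mul_of_mul_eq_mul {M : Type*} [CommGroup M] {x c cs A z sz gz gsz : M}
    (h1 : x * cs = c * A) (h2 : A * z * sz = cs * gz * gsz) : x / (gz * gsz) = c / (z * sz) := by
  have key : ∀ {N : Type _} [AddCommGroup N] {x c cs A z sz gz gsz : N} (_ : x + cs = c + A)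
    (_ : A + z + sz = cs + gz + gsz), x - (gz + gsz) = c - (z + sz) := by
    intro N _ x c cs A z sz gz gsz h1 h2
    have e : (x - (gz + gsz)) - (c - (z + sz)) =
        (x + cs - (c + A)) + (A + z + sz - (cs + gz + gsz)) := by abel
    rwa [h1, h2, sub_self, sub_self, add_zero, sub_eq_zero] at e
  exact key (N := Additive M) h1 h2

/-- Extending a cocycle from a subgroup of index two, using the norm theorem for the quadratic
unramified extension below. -/
theorem exists_cocycle_of_index_two {F L K Γ : Type*} [Field F] [NumberField F] [Field L]
    [NumberField L] [Field K] [NumberField K] [Algebra F L] [Algebra L K] [Algebra F K]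
    [IsScalarTower F L K] [IsGalois F L] [IsGalois L K] [IsTotallyComplex F]
    (hLK : Unram L K) (hFL : Unram F L) (hrank : Module.finrank F L = 2) [Group Γ]
    (π : Γ →* (K ≃ₐ[F] K)) (hc : ∀ v ∈ π.ker, ∀ γ, v * γ = γ * v) {Γ' : Subgroup Γ}
    (hidx : Γ'.index = 2) (π' : Γ' →* (K ≃ₐ[L] K)) (hπ' : Function.Surjective π')
    (hππ' : ∀ γ : Γ', (π' γ).restrictScalars F = π γ)
    (hΓ' : ∀ γ, (∀ x : L, π γ (algebraMap L K x) = algebraMap L K x) → γ ∈ Γ')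
    {c' : Γ → Kˣ} (hc' : ∀ γ ∈ Γ', ∀ δ ∈ Γ', c' (γ * δ) = c' γ * π γ • c' δ)
    (hc1 : ∀ v ∈ π.ker, c' v = 1 ∨ c' v = -1) :
    ∃ c : Γ → Kˣ, (∀ γ δ, c (γ * δ) = c γ * π γ • c δ) ∧ ∀ γ ∈ Γ', c γ = c' γ := by
  have hn : Γ'.Normal := Subgroup.normal_of_index_eq_two hidx
  have hfixL : ∀ γ ∈ Γ', ∀ x : L, π γ (algebraMap L K x) = algebraMap L K x := fun γ hγ x => by
    rw [← hππ' ⟨γ, hγ⟩]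
    exact (π' ⟨γ, hγ⟩).commutes x
  have hker : ∀ v ∈ π.ker, v ∈ Γ' := fun v hv => hΓ' v fun x => by
    rw [MonoidHom.mem_ker.1 hv]; rfl
  have hker' : ∀ v ∈ π'.ker, (v : Γ) ∈ π.ker := fun v hv => by
    rw [MonoidHom.mem_ker, ← hππ', MonoidHom.mem_ker.1 hv]; rfl
  have hfixker : ∀ v ∈ π.ker, ∀ g : K ≃ₐ[F] K, g • c' v = c' v := fun v hv g => by
    rcases hc1 v hv with h | h <;> rw [h]
    · exact smul_one _
    · exact Units.ext (by
      change g ((-1 : Kˣ) : K) = _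
      rw [Units.val_neg, Units.val_one, map_neg, map_one])
  obtain ⟨s, hs⟩ : ∃ s, s ∉ Γ' := by
    by_contra! h
    rw [(Subgroup.eq_top_iff' Γ').2 h, Subgroup.index_top] at hidx
    omega
  have hss : s * s ∈ Γ' := (Subgroup.mul_mem_iff_of_index_two hidx).2 Iff.rfl
  have hconj : ∀ γ ∈ Γ', s⁻¹ * γ * s ∈ Γ' := fun γ h => by
    simpa using hn.conj_mem γ h s⁻¹
  have hsγ : ∀ γ, π γ * π s = π s * π (s⁻¹ * γ * s) := fun γ => by
    rw [← map_mul, ← map_mul]; congr 1; group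
  -- Hilbert 90
  obtain ⟨z₀, hz₀⟩ := exists_eq_smul_div_of_trivial_on_ker hπ'
    (B := fun γ => π s • c' (s⁻¹ * γ * s) / c' γ) (fun γ δ => by
      have e : s⁻¹ * (γ * δ : Γ) * s = (s⁻¹ * γ * s) * (s⁻¹ * δ * s) := by group
      simp only [Subgroup.coe_mul]
      rw [e, hc' _ (hconj _ γ.2) _ (hconj _ δ.2), hc' _ γ.2 _ δ.2, smul_mul', ← mul_smul, ← hsγ,
        mul_smul]
      change _ = _ * π' γ • (_ / _)
      have e2 : ∀ x : Kˣ, π' γ • x = π γ • x := fun x => by rw [← hππ']; rfl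
      rw [e2, smul_div', div_mul_div_comm]) (fun v hv => by
      have hv' := hker' v hv
      have e : s⁻¹ * (v : Γ) * s = v := by rw [mul_assoc, hc _ hv', inv_mul_cancel_left]
      rw [e, hfixker _ hv', div_self'])
  have e2 : ∀ γ (hγ : γ ∈ Γ') (x : Kˣ), π' ⟨γ, hγ⟩ • x = π γ • x := fun γ hγ x => by
    rw [← hππ' ⟨γ, hγ⟩]; rfl
  have hz1 : ∀ γ ∈ Γ', π s • c' (s⁻¹ * γ * s) * z₀ = c' γ * π γ • z₀ := fun γ hγ => by
    have := hz₀ ⟨γ, hγ⟩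
    rw [div_eq_div_iff_mul_eq_mul, e2] at this
    rw [this, mul_comm]
  have hz2 : ∀ γ ∈ Γ', z₀ * π s • c' γ = c' (s * γ * s⁻¹) * π (s * γ * s⁻¹) • z₀ := fun γ hγ => by
    have := hz1 _ (hn.conj_mem γ hγ s)
    rwa [show s⁻¹ * (s * γ * s⁻¹) * s = γ by group, mul_comm] at this
  -- the element to be a norm
  set a : Kˣ := c' (s * s) / (z₀ * π s • z₀) with ha
  have haS : π s • a = a := by
    have h := hz2 _ hss
    rw [show s * (s * s) * s⁻¹ = s * s by group] at h
    rw [ha, smul_div', smul_mul', ← mul_smul, ← map_mul, div_eq_div_iff_mul_eq_mul, ← mul_assoc,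
      mul_comm _ z₀, h]
    rw [mul_assoc, mul_comm (π s • z₀)]
  have haΓ : ∀ γ ∈ Γ', π γ • a = a := fun γ hγ => by
    have hγ1 := hconj _ hγ
    have hγ2 := hconj _ hγ1
    have h3 := hz1 _ hγ
    have h4 := congrArg (π s • ·) (hz1 _ hγ1)
    simp only [smul_mul'] at h4
    have h5 : π γ • c' (s * s) * c' γ =
        c' (s * s) * π (s * s) • c' (s⁻¹ * (s⁻¹ * γ * s) * s) := by
      rw [← hc' _ hss _ hγ2, mul_comm, ← hc' _ hγ _ hss]
      congr 1; group
    rw [ha, smul_div', smul_mul']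
    refine div_eq_div_of_mul_eq_mul_of_mul_eq_mul h5 ?_
    rw [← mul_smul (π γ) (π s), hsγ, mul_smul (π s), ← h3, mul_right_comm, map_mul, mul_smul (π s)]
    rw [h4, mul_right_comm]
  -- the ideal
  obtain ⟨𝔟, h𝔟0, h𝔟⟩ := exists_mul_galI_eq_of_cocycle hπ'
    (D := fun γ => spanSingleton (𝓞 K)⁰ (c' γ : K)) (fun γ δ => by
      simp only [Subgroup.coe_mul]
      rw [hc' _ γ.2 _ δ.2, Units.val_mul, ← spanSingleton_mul_spanSingleton, galI_spanSingleton]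
      congr 2
      rw [← hππ']; rfl) (fun γ => by
      rw [Ne, spanSingleton_eq_zero_iff]; exact Units.ne_zero _) (fun v hv => by
      rcases hc1 _ (hker' v hv) with h | h <;> simp only [h]
      · rw [Units.val_one, spanSingleton_one]
      · refine le_antisymm ?_ ?_
        · rw [spanSingleton_le_iff_mem, mem_one_iff]
          exact ⟨-1, by rw [map_neg, map_one, Units.val_neg, Units.val_one]⟩
        · rw [← spanSingleton_one, spanSingleton_le_iff_mem, mem_spanSingleton]
          exact ⟨-1, by rw [Units.val_neg, Units.val_one, neg_smul, one_smul, neg_neg]⟩)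
  have e3 : ∀ γ (hγ : γ ∈ Γ') (I : FrId K), galI (π' ⟨γ, hγ⟩) I = galI (π γ) I := fun γ hγ I => by
    rw [← hππ' ⟨γ, hγ⟩]; rfl
  have hb : ∀ γ ∈ Γ', galI (π γ) 𝔟 = 𝔟 / spanSingleton (𝓞 K)⁰ (c' γ : K) := fun γ hγ => by
    have h := h𝔟 ⟨γ, hγ⟩
    rw [e3] at h
    rw [eq_div_iff (by rw [Ne, spanSingleton_eq_zero_iff]; exact Units.ne_zero _), mul_comm, h]
  have hS0 : galI (π s) 𝔟 ≠ 0 := fun h => h𝔟0 <| by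
    rw [← galI_one (G := K ≃ₐ[F] K) 𝔟, ← inv_mul_cancel (π s), galI_mul, h, map_zero]
  have hz0 : ∀ x : Kˣ, spanSingleton (𝓞 K)⁰ (x : K) ≠ 0 := fun x => by
    rw [Ne, spanSingleton_eq_zero_iff]; exact Units.ne_zero _
  set 𝔠 : FrId K := 𝔟 / (galI (π s) 𝔟 * spanSingleton (𝓞 K)⁰ (z₀ : K)) with h𝔠
  have h𝔠0 : 𝔠 ≠ 0 := div_ne_zero h𝔟0 (mul_ne_zero hS0 (hz0 _))
  have hsp : ∀ x y : Kˣ, spanSingleton (𝓞 K)⁰ (x : K) * spanSingleton (𝓞 K)⁰ (y : K) =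
      spanSingleton (𝓞 K)⁰ ((x * y : Kˣ) : K) := fun x y => by
    rw [spanSingleton_mul_spanSingleton, Units.val_mul]
  have hsg : ∀ (g : K ≃ₐ[F] K) (x : Kˣ), galI g (spanSingleton (𝓞 K)⁰ (x : K)) =
      spanSingleton (𝓞 K)⁰ ((g • x : Kˣ) : K) := fun g x => galI_spanSingleton g _
  have h𝔠Γ : ∀ γ ∈ Γ', galI (π γ) 𝔠 = 𝔠 := fun γ hγ => by
    have h : galI (π γ) (galI (π s) 𝔟) = galI (π s) 𝔟 /
        spanSingleton (𝓞 K)⁰ ((π s • c' (s⁻¹ * γ * s) : Kˣ) : K) := by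
      rw [← galI_mul, hsγ, galI_mul, hb _ (hconj _ hγ), map_div₀, hsg]
    rw [h𝔠, map_div₀, map_mul, h, hb _ hγ, hsg, div_mul_eq_mul_div, div_div_div_eq,
      div_eq_div_iff (mul_ne_zero (hz0 _) (mul_ne_zero hS0 (hz0 _))) (mul_ne_zero hS0 (hz0 _)),
      mul_assoc, mul_left_comm _ (galI (π s) 𝔟), hsp, hz1 _ hγ, ← hsp]
    ring
  have h𝔠S : 𝔠 * galI (π s) 𝔠 = spanSingleton (𝓞 K)⁰ (a : K) := by
    have h := hb _ hss
    rw [map_mul, galI_mul] at h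
    have h6 : spanSingleton (𝓞 K)⁰ (a : K) * spanSingleton (𝓞 K)⁰ (z₀ : K) *
        spanSingleton (𝓞 K)⁰ ((π s • z₀ : Kˣ) : K) = spanSingleton (𝓞 K)⁰ (c' (s * s) : K) := by
      rw [mul_assoc, hsp, hsp, ha, div_mul_cancel]
    rw [h𝔠, map_div₀, map_mul, h, hsg, ← h6]
    have := hz0 z₀
    have := hz0 (π s • z₀)
    have := hz0 a
    field_simp
  -- descent to `L`
  obtain ⟨J, hJ⟩ := exists_extI_eq hLK (I := 𝔠) fun g => by
    obtain ⟨⟨γ, hγ⟩, rfl⟩ := hπ' g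
    rw [e3, h𝔠Γ _ hγ]
  obtain ⟨a₀, ha₀⟩ := (IsGalois.mem_range_algebraMap_iff_fixed (F := L) (a : K)).2 fun g => by
    obtain ⟨⟨γ, hγ⟩, rfl⟩ := hπ' g
    have := congrArg Units.val (haΓ γ hγ)
    rw [← e2 γ hγ] at this
    exact this
  have ha₀0 : a₀ ≠ 0 := by
    rintro rfl
    rw [map_zero] at ha₀
    exact a.ne_zero ha₀.symm
  have hJ0 : J ≠ 0 := by
    rintro rfl
    rw [map_zero] at hJ
    exact h𝔠0 hJ.symm
  set σ : L ≃ₐ[F] L := (π s).restrictNormal L with hσ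
  have hσc : ∀ x : L, algebraMap L K (σ x) = π s (algebraMap L K x) := fun x =>
    AlgEquiv.restrictNormal_commutes (π s) L x
  obtain ⟨x, hx⟩ := exists_norm_eq_of_unram hFL hrank (σ := σ) (fun h => hs (hΓ' s fun x => by
      rw [← hσc, h]; rfl)) (Units.mk0 a₀ ha₀0) (by
      refine (algebraMap L K).injective ?_
      rw [hσc, Units.val_mk0, ha₀]
      exact congrArg Units.val haS) (Units.mk0 J hJ0) (by
      refine FractionalIdeal.extendedHom_injective (𝓞 L) L K (𝓞 K) ?_
      change extI L K _ = extI L K _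
      rw [map_mul, Units.val_mk0, extI_galI (g := π s) hσc, hJ, h𝔠S, extI_spanSingleton,
        Units.val_mk0, ha₀])
  set x' : Kˣ := Units.map (algebraMap L K : L →* K) x with hx'
  have hx'fix : ∀ γ ∈ Γ', π γ • x' = x' := fun γ hγ => Units.ext (hfixL γ hγ x)
  have hx'a : x' * π s • x' = a := Units.ext <| by
    rw [Units.val_mul]
    change algebraMap L K x * π s (algebraMap L K x) = a
    rw [← hσc, ← map_mul, hx, Units.val_mk0, ha₀]
  refine exists_extend_cocycle π hidx hc' hs (z := z₀ * x') (fun γ hγ => ?_) ?_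
  · rw [smul_mul', hx'fix _ (hn.conj_mem γ hγ s), ← mul_assoc, ← hz2 _ hγ, mul_right_comm]
  · rw [smul_mul', mul_mul_mul_comm, hx'a, ha, mul_div_cancel]

end CocycleStep

section CocycleTheorem

open NumberField nonZeroDivisors FractionalIdeal

theorem Unram.restrictScalars {F L K : Type*} [Field F] [NumberField F] [Field L]
    [NumberField L] [Field K] [NumberField K] [Algebra F L] [Algebra L K] [Algebra F K]
    [IsScalarTower F L K] (h : Unram F K) : Unram L K := fun g hg =>
  h (g.restrictScalars F) fun h' => hg (AlgEquiv.ext fun x => DFunLike.congr_fun h' x)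

theorem Unram.quotient {F L K : Type*} [Field F] [NumberField F] [Field L]
    [NumberField L] [Field K] [NumberField K] [Algebra F L] [Algebra L K] [Algebra F K]
    [IsScalarTower F L K] [IsGalois F K] [IsGalois L K] [Normal F L] (h : Unram F K) :
    Unram F L := by
  intro σ hσ
  obtain ⟨g, rfl⟩ := AlgEquiv.restrictNormalHom_surjective (F := F) (K₁ := L) K σ
  have hinj : Function.Injective (algebraMap (𝓞 L) (𝓞 K)) := FaithfulSMul.algebraMap_injective _ _
  have hcomm : ∀ (g : K ≃ₐ[F] K) (s : 𝓞 L), algebraMap (𝓞 L) (𝓞 K) (AlgEquiv.restrictNormalHom L g • s) =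
      g • algebraMap (𝓞 L) (𝓞 K) s := fun g s => by
    refine RingOfIntegers.ext ?_
    exact AlgEquiv.restrictNormal_commutes g L (s : L)
  refine UnramifiedAction.span_quotient (algebraMap (𝓞 L) (𝓞 K))
    (AlgEquiv.restrictNormalHom (F := F) (K₁ := K) L).ker hinj ?_ ?_
    (algebraMap_isIntegral_iff.2 inferInstance) h (g := g) hσ _ (hcomm g)
  · intro x hx
    obtain ⟨y, hy⟩ := (IsGalois.mem_range_algebraMap_iff_fixed (F := L) (x : K)).2 fun g => by
      refine congrArg (algebraMap (𝓞 K) K) (hx (g.restrictScalars F) ?_)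
      refine AlgEquiv.ext fun z => (algebraMap L K).injective ?_
      exact (AlgEquiv.restrictNormal_commutes (g.restrictScalars F) L z).trans (g.commutes z)
    have hyi : IsIntegral ℤ y := by
      rw [← isIntegral_algebraMap_iff (algebraMap L K).injective, hy]
      exact x.isIntegral_coe
    exact ⟨⟨y, hyi⟩, RingOfIntegers.ext hy⟩
  · intro g hg x
    rw [← hcomm, MonoidHom.mem_ker.1 hg, one_smul]

/-- **Cocycle theorem.** In an unramified Galois `2`-extension of a totally complex number field,
any character of order two of the kernel of a central extension of the Galois group
extends to a multiplicative cocycle. -/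
theorem exists_cocycle (n : ℕ) : ∀ {F K : Type} [Field F] [NumberField F] [IsTotallyComplex F]
    [Field K] [NumberField K] [Algebra F K] [IsGalois F K] (_ : Unram F K)
    (_ : Nat.card (K ≃ₐ[F] K) = 2 ^ n) {Γ : Type} [Group Γ] (π : Γ →* (K ≃ₐ[F] K))
    (_ : Function.Surjective π) (_ : ∀ v ∈ π.ker, ∀ γ, v * γ = γ * v) (f : Γ → ℤˣ)
    (_ : ∀ v ∈ π.ker, ∀ w ∈ π.ker, f (v * w) = f v * f w),
    ∃ c : Γ → Kˣ, (∀ γ δ, c (γ * δ) = c γ * π γ • c δ) ∧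
      ∀ v ∈ π.ker, c v = Units.map (Int.castRingHom K : ℤ →* K) (f v) := by
  induction n with
  | zero =>
    intro F K _ _ _ _ _ _ _ hU hn Γ _ π hπ hc f hf
    have hs : Subsingleton (K ≃ₐ[F] K) := (Nat.card_eq_one_iff_unique.1 hn).1
    have hk : ∀ γ, γ ∈ π.ker := fun γ => Subsingleton.elim _ _
    refine ⟨fun γ => Units.map (Int.castRingHom K : ℤ →* K) (f γ), fun γ δ => ?_, fun _ _ => rfl⟩
    dsimp only
    rw [hf _ (hk _) _ (hk _), map_mul, Subsingleton.elim (π γ) 1, one_smul]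
  | succ n ih =>
    intro F K _ _ _ _ _ _ _ hU hn Γ _ π hπ hc f hf
    obtain ⟨H, hH⟩ := Sylow.exists_subgroup_card_pow_prime (G := K ≃ₐ[F] K) 2 (n := n)
      (by rw [hn]; exact pow_dvd_pow _ (Nat.le_succ n))
    have hHi : H.index = 2 := by
      have := H.card_mul_index
      rw [hH, hn, pow_succ] at this
      exact Nat.eq_of_mul_eq_mul_left (by positivity) this
    have hHn : H.Normal := Subgroup.normal_of_index_eq_two hHi
    let L := IntermediateField.fixedField H
    have hGal : IsGalois F L := IsGalois.of_fixedField_normal_subgroup H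
    have hfix : L.fixingSubgroup = H := IntermediateField.fixingSubgroup_fixedField H
    let e : H ≃* (K ≃ₐ[L] K) :=
      (MulEquiv.subgroupCongr hfix.symm).trans (IntermediateField.fixingSubgroupEquiv L)
    have he : ∀ h : H, (e h).restrictScalars F = h := fun h => rfl
    let π' : H.comap π →* (K ≃ₐ[L] K) := e.toMonoidHom.comp (π.subgroupComap H)
    have hππ' : ∀ γ, (π' γ).restrictScalars F = π γ := fun γ => he _
    have hπ' : Function.Surjective π' := by
      refine e.surjective.comp ?_
      rintro ⟨h, hh⟩
      obtain ⟨γ, rfl⟩ := hπ h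
      exact ⟨⟨γ, hh⟩, rfl⟩
    have hker : ∀ v : H.comap π, v ∈ π'.ker ↔ (v : Γ) ∈ π.ker := fun v => by
      rw [MonoidHom.mem_ker, MonoidHom.mem_ker, ← hππ']
      constructor
      · intro h; rw [h]; rfl
      · intro h
        exact AlgEquiv.ext fun x => DFunLike.congr_fun h x
    have hcard : Nat.card (K ≃ₐ[L] K) = 2 ^ n := by rw [← hH]; exact (Nat.card_congr e.toEquiv).symm
    have hTC : IsTotallyComplex L := isTotallyComplex_of_algebra F L
    obtain ⟨c'', h1, h2⟩ := ih (F := L) (K := K) hU.restrictScalars hcard π' hπ'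
      (fun v hv γ => Subtype.ext (hc v ((hker v).1 hv) γ)) (fun γ => f γ)
      (fun v hv w hw => hf _ ((hker v).1 hv) _ ((hker w).1 hw))
    classical
    let c' : Γ → Kˣ := fun γ => if h : γ ∈ H.comap π then c'' ⟨γ, h⟩ else 1
    have hc'' : ∀ γ (h : γ ∈ H.comap π), c' γ = c'' ⟨γ, h⟩ := fun γ h => dif_pos h
    have hkerle : ∀ v ∈ π.ker, v ∈ H.comap π := fun v hv => by
      rw [Subgroup.mem_comap, MonoidHom.mem_ker.1 hv]; exact H.one_mem
    have hker1 : ∀ v ∈ π.ker, c' v = Units.map (Int.castRingHom K : ℤ →* K) (f v) := fun v hv => by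
      rw [hc'' v (hkerle v hv), h2 _ ((hker _).2 hv)]
    have hrank : Module.finrank F L = 2 := by
      have h3 := Module.finrank_mul_finrank F L K
      rw [← IsGalois.card_aut_eq_finrank L K, ← IsGalois.card_aut_eq_finrank F K, hcard, hn,
        pow_succ'] at h3
      exact Nat.eq_of_mul_eq_mul_right (by positivity) h3
    obtain ⟨c, h4, h5⟩ := exists_cocycle_of_index_two (F := F) (L := L) (K := K)
      hU.restrictScalars hU.quotient hrank π hc (Γ' := H.comap π)
      (by rw [Subgroup.index_comap_of_surjective _ hπ, hHi]) π' hπ' hππ'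
      (fun γ h => by
        rw [Subgroup.mem_comap, ← hfix]
        exact fun x => h x) (c' := c') (fun γ hγ δ hδ => by
        rw [hc'' _ hγ, hc'' _ hδ, hc'' _ (Subgroup.mul_mem _ hγ hδ)]
        refine (h1 ⟨γ, hγ⟩ ⟨δ, hδ⟩).trans ?_
        rw [← hππ' ⟨γ, hγ⟩]; rfl) (fun v hv => by
        rw [hker1 v hv]
        rcases Int.units_eq_one_or (f v) with h | h <;> rw [h]
        · left; rw [map_one]
        · right
          refine Units.ext ?_
          simp)
    exact ⟨c, h4, fun v hv => by rw [h5 v (hkerle v hv), hker1 v hv]⟩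

end CocycleTheorem

section AdjoinSquareRoots

open NumberField IntermediateField

theorem isGalois_adjoin_of_sq {K L ι : Type*} [Field K] [CharZero K] [IsGalois ℚ K] [Field L]
    [Algebra K L] [CharZero L] [Normal ℚ L] {w : ι → K} {θ : ι → L}
    (hθ : ∀ i, θ i ^ 2 = algebraMap K L (w i))
    (hg : ∀ (g : K ≃ₐ[ℚ] K) i, ∃ j c, g (w i) = w j * c ^ 2) :
    IsGalois ℚ (adjoin K (Set.range θ)) := by
  let E : IntermediateField ℚ L := (adjoin K (Set.range θ)).restrictScalars ℚ
  have hK : ∀ x : K, algebraMap K L x ∈ E := fun x =>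
    (adjoin K (Set.range θ)).algebraMap_mem x
  have hmem : ∀ i, θ i ∈ E := fun i => subset_adjoin K _ ⟨i, rfl⟩
  have hN : Normal ℚ E := by
    refine normal_iff_forall_map_le.2 fun σ => ?_
    rw [map_le_iff_le_comap]
    intro x hx
    change x ∈ adjoin K (Set.range θ) at hx
    change σ x ∈ E
    have hKσ : ∀ x : K, σ (algebraMap K L x) =
        algebraMap K L (σ.restrictNormal K x) := fun x =>
      (AlgHom.restrictNormal_commutes σ K x).symm
    have hθσ : ∀ i, σ (θ i) ∈ E := fun i => by
      obtain ⟨j, c, h⟩ := hg (AlgEquiv.ofBijective (σ.restrictNormal K)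
        (AlgHom.normal_bijective ℚ K K _)) i
      have h2 : σ (θ i) ^ 2 = (θ j * algebraMap K L c) ^ 2 := by
        rw [← map_pow, hθ, hKσ, mul_pow, hθ, ← map_pow, ← map_mul]
        exact congrArg _ h
      rcases sq_eq_sq_iff_eq_or_eq_neg.1 h2 with h3 | h3 <;> rw [h3]
      · exact E.mul_mem (hmem j) (hK c)
      · exact E.neg_mem (E.mul_mem (hmem j) (hK c))
    induction hx using adjoin_induction with
    | mem x hx => obtain ⟨i, rfl⟩ := hx; exact hθσ i
    | algebraMap x => rw [hKσ]; exact hK _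
    | add x y _ _ hx hy => rw [map_add]; exact E.add_mem hx hy
    | inv x _ hx => rw [map_inv₀]; exact E.inv_mem hx
    | mul x y _ _ hx hy => rw [map_mul]; exact E.mul_mem hx hy
  have : IsGalois ℚ E := ⟨⟩
  exact this

theorem exists_adjoin_sqrt {K : Type} [Field K] [NumberField K] [IsGalois ℚ K] {w : Bool → K}
    (hg : ∀ (g : K ≃ₐ[ℚ] K) i, ∃ j c, g (w i) = w j * c ^ 2) :
    ∃ (K' : Type) (_ : Field K') (_ : NumberField K') (_ : Algebra K K') (θ : Bool → K'),
      IsGalois ℚ K' ∧ (∀ i, θ i ^ 2 = algebraMap K K' (w i)) ∧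
      (∀ g : K' ≃ₐ[K] K', (∀ i, g (θ i) = θ i) → g = 1) ∧
      ∃ m ≤ 2, Module.finrank K K' = 2 ^ m := by
  let L := AlgebraicClosure K
  have hL : Algebra.IsAlgebraic ℚ L := Algebra.IsAlgebraic.trans ℚ K L
  have hcl : IsAlgClosure ℚ L := ⟨inferInstance, hL⟩
  have hN : Normal ℚ L := IsAlgClosure.normal ℚ L
  have hroot : ∀ i, ∃ t : L, t ^ 2 = algebraMap K L (w i) := fun i =>
    IsAlgClosed.exists_pow_nat_eq _ two_pos
  choose t ht using hroot
  have hGal := isGalois_adjoin_of_sq ht hg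
  set K' := adjoin K (Set.range t) with hK'
  have hfd : FiniteDimensional K K' := by
    refine finiteDimensional_adjoin fun x _ => ?_
    exact (Algebra.IsAlgebraic.isAlgebraic x).isIntegral
  have hfdQ : FiniteDimensional ℚ K' := FiniteDimensional.trans ℚ K K'
  have hNF : NumberField K' := ⟨⟩
  have hGK : IsGalois K K' := IsGalois.tower_top_of_isGalois ℚ K K'
  let θ : Bool → K' := fun i => ⟨t i, subset_adjoin K _ ⟨i, rfl⟩⟩
  have hθ : ∀ i, θ i ^ 2 = algebraMap K K' (w i) := fun i => Subtype.ext (ht i)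
  have hone : ∀ g : K' ≃ₐ[K] K', (∀ i, g (θ i) = θ i) → g = 1 := fun g h => by
    refine AlgEquiv.ext fun x => Subtype.ext ?_
    obtain ⟨x, hx⟩ := x
    change ((g ⟨x, hx⟩ : K') : L) = x
    induction hx using adjoin_induction with
    | mem x hx => obtain ⟨i, rfl⟩ := hx; exact congrArg Subtype.val (h i)
    | algebraMap x => exact congrArg Subtype.val (g.commutes x)
    | add x y hx hy h1 h2 =>
      exact (congrArg Subtype.val (map_add g ⟨x, hx⟩ ⟨y, hy⟩)).trans
        (congrArg₂ (fun a b : L => a + b) h1 h2)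
    | inv x hx h1 =>
      exact (congrArg Subtype.val (map_inv₀ g ⟨x, hx⟩)).trans
        (congrArg (fun a : L => a⁻¹) h1)
    | mul x y hx hy h1 h2 =>
      exact (congrArg Subtype.val (map_mul g ⟨x, hx⟩ ⟨y, hy⟩)).trans
        (congrArg₂ (fun a b : L => a * b) h1 h2)
  refine ⟨K', inferInstance, hNF, inferInstance, θ, hGal, hθ, hone, ?_⟩
  have hpm : ∀ (g : K' ≃ₐ[K] K') i, g (θ i) = θ i ∨ g (θ i) = -θ i := fun g i => by
    refine sq_eq_sq_iff_eq_or_eq_neg.1 ?_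
    rw [← map_pow, hθ, g.commutes]
  have hsq : ∀ g : K' ≃ₐ[K] K', g ^ 2 = 1 := fun g => hone _ fun i => by
    rw [pow_two, AlgEquiv.mul_apply]
    rcases hpm g i with h | h <;> simp [h]
  have hp : IsPGroup 2 (K' ≃ₐ[K] K') := fun g => ⟨1, by rw [pow_one, hsq]⟩
  obtain ⟨m, hm⟩ := IsPGroup.iff_card.1 hp
  classical
  have hle : Nat.card (K' ≃ₐ[K] K') ≤ 2 ^ 2 := by
    have : Function.Injective fun (g : K' ≃ₐ[K] K') (i : Bool) => decide (g (θ i) = θ i) := by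
      intro g h hgh
      have h1 : ∀ i, g (θ i) = h (θ i) := fun i => by
        have h2 := congrFun hgh i
        simp only [decide_eq_decide] at h2
        rcases hpm g i with h3 | h3
        · rw [h3, h2.1 h3]
        · rcases hpm h i with h4 | h4
          · rw [h4, h2.2 h4]
          · rw [h3, h4]
      have := hone (h⁻¹ * g) fun i => by
        rw [AlgEquiv.mul_apply, h1]
        exact h.symm_apply_apply _
      exact (inv_mul_eq_one.1 this).symm
    have h3 := Nat.card_le_card_of_injective _ this
    rw [Nat.card_eq_fintype_card (α := Bool → Bool)] at h3
    simpa using h3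
  rw [hm] at hle
  exact ⟨m, (Nat.pow_le_pow_iff_right one_lt_two).1 hle, by
    rw [← IsGalois.card_aut_eq_finrank, hm]⟩

end AdjoinSquareRoots

section SqrtUnramified

open NumberField nonZeroDivisors FractionalIdeal

/-- A condition on an integer of a number field which ensures that the extension generated by its
square root is unramified. -/
def SqrtUnram {K : Type*} [Field K] [NumberField K] (W : 𝓞 K) : Prop :=
  (∃ I : FrId K, I * I * spanSingleton (𝓞 K)⁰ (W : K) = 1) ∧ (∃ s : 𝓞 K, 4 ∣ W - s ^ 2) ∧
    IsCoprime W 2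

theorem SqrtUnram.ne_zero {K : Type*} [Field K] [NumberField K] {W : 𝓞 K} (h : SqrtUnram W) :
    W ≠ 0 := by
  rintro rfl
  obtain ⟨⟨I, hI⟩, -⟩ := h
  simp at hI

theorem SqrtUnram.smul {K G : Type*} [Field K] [NumberField K] [Group G] [MulSemiringAction G K]
    {W : 𝓞 K} (h : SqrtUnram W) (g : G) : SqrtUnram (g • W) := by
  obtain ⟨⟨I, hI⟩, ⟨s, t, ht⟩, u, v, huv⟩ := h
  have h4 : ∀ n : ℕ, g • (n : 𝓞 K) = n := fun n =>
    map_natCast (MulSemiringAction.toRingHom G (𝓞 K) g) n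
  refine ⟨⟨galI g I, ?_⟩, ⟨g • s, g • t, ?_⟩, g • u, g • v, ?_⟩
  · rw [coe_smul_ringOfIntegers, ← galI_spanSingleton, ← map_mul, ← map_mul, hI, map_one]
  · rw [← smul_pow', ← smul_sub, ht, smul_mul']
    congr 1
    exact h4 4
  · have := congrArg (g • ·) huv
    simp only [smul_add, smul_mul', smul_one] at this
    rw [← this]
    congr 2
    exact (h4 2).symm

theorem not_forall_sub_mem_of_sqrt {K K' : Type*} [Field K] [NumberField K] [Field K']
    [NumberField K'] [Algebra K K'] {W : 𝓞 K} (hW : SqrtUnram W) {θ : K'}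
    (hθ : θ ^ 2 = algebraMap K K' W) (g : K' ≃ₐ[K] K') (hg : g θ = -θ) (P : Ideal (𝓞 K'))
    [P.IsPrime] : ∃ y, y - g • y ∉ P := by
  by_contra! hP
  obtain ⟨⟨I, hI⟩, ⟨s, t, ht⟩, u, v, huv⟩ := hW
  have hcomm : ∀ x : K, g (algebraMap K K' x) = algebraMap K K' x := g.commutes
  let ι : 𝓞 K →+* K' := algebraMap (𝓞 K) K'
  have hι : ∀ x : 𝓞 K, algebraMap K K' x = ι x := fun x => rfl
  have hι' : ∀ x : 𝓞 K, ((algebraMap (𝓞 K) (𝓞 K') x : 𝓞 K') : K') = ι x := fun x => rfl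
  by_cases h2 : (2 : 𝓞 K') ∈ P
  · have hint : IsIntegral (𝓞 K) ((ι s + θ) / 2) := by
      refine ⟨Polynomial.X ^ 2 - Polynomial.C s * Polynomial.X - Polynomial.C t, ?_, ?_⟩
      · monicity!
      · have e := congrArg ι ht
        rw [map_sub, map_pow, map_mul, map_ofNat] at e
        rw [hι] at hθ
        simp only [Polynomial.eval₂_sub, Polynomial.eval₂_pow, Polynomial.eval₂_X,
          Polynomial.eval₂_mul, Polynomial.eval₂_C]
        change _ ^ 2 - ι s * _ - ι t = 0
        field_simp
        linear_combination hθ + e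
    have hint' : IsIntegral ℤ ((ι s + θ) / 2) := isIntegral_trans (A := 𝓞 K) _ hint
    have h3 := hP ⟨_, hint'⟩
    set z : 𝓞 K' := ⟨_, hint'⟩ - g • ⟨_, hint'⟩ with hz
    have hzθ : (z : K') = θ := by
      have e : (z : K') = (ι s + θ) / 2 - g ((ι s + θ) / 2) := rfl
      rw [e, map_div₀, map_add, hg, ← hι, hcomm, map_ofNat]
      ring
    have hWP : algebraMap (𝓞 K) (𝓞 K') W ∈ P := by
      have : algebraMap (𝓞 K) (𝓞 K') W = z * z := RingOfIntegers.ext <| by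
        change ι W = (z : K') * (z : K')
        rw [hzθ, ← hι, ← hθ, pow_two]
      rw [this]
      exact P.mul_mem_left _ h3
    refine ‹P.IsPrime›.ne_top ((Ideal.eq_top_iff_one _).2 ?_)
    have h1 := congrArg (algebraMap (𝓞 K) (𝓞 K')) huv
    rw [map_one, map_add, map_mul, map_mul, map_ofNat] at h1
    rw [← h1]
    exact P.add_mem (P.mul_mem_left _ hWP) (P.mul_mem_left _ h2)
  · have hint : ∀ x ∈ I, IsIntegral ℤ (algebraMap K K' x * θ) := fun x hx => by
      have h1 : x * x * W ∈ (1 : FrId K) := by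
        rw [← hI]
        exact mul_mem_mul (mul_mem_mul hx hx) (mem_spanSingleton_self _ _)
      obtain ⟨y, hy⟩ := (mem_one_iff _).1 h1
      refine IsIntegral.of_pow two_pos ?_
      rw [mul_pow, hθ, ← map_pow, ← map_mul, pow_two, ← hy]
      exact y.isIntegral_coe.map (algebraMap K K').toIntAlgHom
    have hmem : ∀ x (hx : x ∈ I), (⟨_, hint x hx⟩ : 𝓞 K') ∈ P := fun x hx => by
      have h3 := hP ⟨_, hint x hx⟩
      have e : (⟨_, hint x hx⟩ - g • ⟨_, hint x hx⟩ : 𝓞 K') = 2 * ⟨_, hint x hx⟩ :=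
        RingOfIntegers.ext <| by
          change algebraMap K K' x * θ - g (algebraMap K K' x * θ) =
            2 * (algebraMap K K' x * θ)
          rw [map_mul, hg, hcomm]
          ring
      rw [e] at h3
      exact (‹P.IsPrime›.mem_or_mem h3).resolve_left h2
    have key : ∀ x ∈ I * I, ∃ z ∈ P, (z : K') = algebraMap K K' (x * W) := fun x hx => by
      refine FractionalIdeal.mul_induction_on hx (fun i hi j hj => ?_) (fun x y hx hy => ?_)
      · refine ⟨_, P.mul_mem_left ⟨_, hint i hi⟩ (hmem j hj), ?_⟩
        change algebraMap K K' i * θ * (algebraMap K K' j * θ) = _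
        rw [map_mul, map_mul, ← hθ]
        ring
      · obtain ⟨a, ha, ha'⟩ := hx
        obtain ⟨b, hb, hb'⟩ := hy
        exact ⟨a + b, P.add_mem ha hb, by
          change (a : K') + (b : K') = _
          rw [ha', hb', add_mul, map_add]⟩
    have h1 : (1 : K) ∈ I * I * spanSingleton (𝓞 K)⁰ (W : K) := by
      rw [hI]; exact one_mem_one _
    rw [mul_comm, mem_singleton_mul] at h1
    obtain ⟨x, hx, hx1⟩ := h1
    obtain ⟨z, hz, hz1⟩ := key x hx
    refine ‹P.IsPrime›.ne_top ((Ideal.eq_top_iff_one _).2 ?_)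
    convert hz
    refine RingOfIntegers.ext ?_
    rw [hz1, mul_comm x, ← hx1, map_one]
    rfl

theorem Unram.of_sqrt {k K K' ι : Type*} [Field k] [NumberField k] [Field K] [NumberField K]
    [Field K'] [NumberField K'] [Algebra k K] [Algebra K K'] [Algebra k K'] [IsScalarTower k K K']
    [Normal k K] (hU : Unram k K) {θ : ι → K'} {W : ι → 𝓞 K} (hW : ∀ i, SqrtUnram (W i))
    (hθ : ∀ i, θ i ^ 2 = algebraMap K K' (W i))
    (hone : ∀ g : K' ≃ₐ[K] K', (∀ i, g (θ i) = θ i) → g = 1) : Unram k K' := by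
  refine unramifiedAction_iff_forall_isMaximal.2 fun g hg P hP => ?_
  by_cases h1 : g.restrictNormal K = 1
  · let g' : K' ≃ₐ[K] K' := AlgEquiv.ofRingEquiv (f := (g : K' ≃+* K')) fun x => by
      have := AlgEquiv.restrictNormal_commutes g K x
      rw [h1] at this
      exact this.symm
    have hg' : g' ≠ 1 := fun h => hg (AlgEquiv.ext fun x => DFunLike.congr_fun h x)
    obtain ⟨i, hi⟩ : ∃ i, g' (θ i) ≠ θ i := by
      by_contra! h
      exact hg' (hone g' h)
    exact not_forall_sub_mem_of_sqrt (hW i) (hθ i) g'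
      ((sq_eq_sq_iff_eq_or_eq_neg.1 (by rw [← map_pow, hθ, g'.commutes])).resolve_left hi) P
  · by_contra! h
    have h2 := hU _ h1
    refine hP.ne_top ((Ideal.eq_top_iff_one _).2 ?_)
    have h3 : (1 : 𝓞 K) ∈ P.comap (algebraMap (𝓞 K) (𝓞 K')) := by
      have : Ideal.span (Set.range fun y : 𝓞 K => y - g.restrictNormal K • y) ≤
          P.comap (algebraMap (𝓞 K) (𝓞 K')) := by
        rw [Ideal.span_le]
        rintro _ ⟨y, rfl⟩
        change algebraMap (𝓞 K) (𝓞 K') (y - g.restrictNormal K • y) ∈ P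
        convert h (algebraMap (𝓞 K) (𝓞 K') y)
        rw [map_sub]
        congr 1
        exact RingOfIntegers.ext (AlgEquiv.restrictNormal_commutes g K (y : K))
      rw [h2] at this
      exact this trivial
    rwa [Ideal.mem_comap, map_one] at h3

end SqrtUnramified

section Layers

open NumberField

theorem exists_ringHom_extend {R S Ω : Type*} [CommRing R] [CommRing S] [Algebra R S]
    [Algebra.IsIntegral R S] (hinj : Function.Injective (algebraMap R S)) [Field Ω]
    [IsAlgClosed Ω] (ψ : R →+* Ω) : ∃ ψ' : S →+* Ω, ∀ x, ψ' (algebraMap R S x) = ψ x := by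
  have : (RingHom.ker ψ).IsPrime := RingHom.ker_isPrime ψ
  obtain ⟨Q, -, hQ, hQP⟩ := Ideal.exists_ideal_over_prime_of_isIntegral (S := S)
    (RingHom.ker ψ) ⊥ (by
      rw [← RingHom.ker_eq_comap_bot, (RingHom.injective_iff_ker_eq_bot _).1 hinj]
      exact bot_le)
  let f : R ⧸ RingHom.ker ψ →+* S ⧸ Q := Ideal.quotientMap Q (algebraMap R S) hQP.ge
  let : Algebra (R ⧸ RingHom.ker ψ) (S ⧸ Q) := f.toAlgebra
  let : Algebra (R ⧸ RingHom.ker ψ) Ω := (RingHom.kerLift ψ).toAlgebra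
  have h1 : Function.Injective f := Ideal.quotientMap_injective' hQP.le
  have h2 : Function.Injective (RingHom.kerLift ψ) := RingHom.kerLift_injective ψ
  have : Module.IsTorsionFree (R ⧸ RingHom.ker ψ) (S ⧸ Q) :=
    Module.isTorsionFree_iff_algebraMap_injective.2 h1
  have : Module.IsTorsionFree (R ⧸ RingHom.ker ψ) Ω :=
    Module.isTorsionFree_iff_algebraMap_injective.2 h2
  have : Algebra.IsIntegral (R ⧸ RingHom.ker ψ) (S ⧸ Q) := ⟨fun x => by
    obtain ⟨x, rfl⟩ := Ideal.Quotient.mk_surjective x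
    obtain ⟨q, hq, hx⟩ := Algebra.IsIntegral.isIntegral (R := R) x
    refine ⟨q.map (Ideal.Quotient.mk _), hq.map _, ?_⟩
    rw [Polynomial.eval₂_map]
    have := congrArg (Ideal.Quotient.mk Q) hx
    rw [Polynomial.hom_eval₂, map_zero] at this
    exact this⟩
  let F : S ⧸ Q →ₐ[R ⧸ RingHom.ker ψ] Ω := IsAlgClosed.lift
  refine ⟨F.toRingHom.comp (Ideal.Quotient.mk Q), fun x => ?_⟩
  exact F.commutes (Ideal.Quotient.mk _ x)

theorem exists_frobenius {p : ℕ} [Fact p.Prime] {K : Type*} [Field K] [NumberField K]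
    [IsGalois ℚ K] (ψ : 𝓞 K →+* AlgebraicClosure (ZMod p)) :
    ∃ g : K ≃ₐ[ℚ] K, ∀ y, ψ (g • y) = ψ y ^ p := by
  have : (RingHom.ker ψ).IsPrime := RingHom.ker_isPrime ψ
  have hp : (p : 𝓞 K) ∈ RingHom.ker ψ := by
    rw [RingHom.mem_ker, map_natCast, CharP.cast_eq_zero]
  have hne : RingHom.ker ψ ≠ ⊥ := fun h => by
    rw [h, Ideal.mem_bot, Nat.cast_eq_zero] at hp
    exact (Fact.out : p.Prime).ne_zero hp
  have : Finite (𝓞 K ⧸ RingHom.ker ψ) := Ideal.finiteQuotientOfFreeOfNeBot _ hne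
  obtain ⟨g, hg⟩ := IsArithFrobAt.exists_of_isInvariant ℤ (K ≃ₐ[ℚ] K) (RingHom.ker ψ)
  refine ⟨g, fun y => ?_⟩
  have h1 := hg y
  have h2 : Ideal.under ℤ (RingHom.ker ψ) = Ideal.span {(p : ℤ)} := by
    have hmax : (Ideal.span {(p : ℤ)}).IsMaximal :=
      PrincipalIdealRing.isMaximal_of_irreducible
        (Nat.prime_iff_prime_int.1 Fact.out).irreducible
    refine (hmax.eq_of_le (Ideal.IsPrime.ne_top inferInstance) ?_).symm
    rw [Ideal.span_singleton_le_iff_mem]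
    simp [hp]
  rw [h2, Nat.card_congr (Int.quotientSpanNatEquivZMod p).toEquiv, Nat.card_zmod,
    RingHom.mem_ker, map_sub, map_pow, sub_eq_zero] at h1
  exact h1

/-- `K` is Galois over `ℚ`, unramified of `2`-power degree over `k`, with a reduction map `ψ` to
characteristic `p` whose Frobenius element `g` is an involution. -/
structure IsLayer (p : ℕ) [Fact p.Prime] (k K : Type) [Field k] [Field K] [NumberField K]
    [Algebra k K] (ψ : 𝓞 K →+* AlgebraicClosure (ZMod p)) (g : K ≃ₐ[ℚ] K) : Prop where
  isGalois : IsGalois ℚ K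
  unram : Unram k K
  card : ∃ n, Nat.card (K ≃ₐ[k] K) = 2 ^ n
  sq : g * g = 1
  frob : ∀ y, ψ (g • y) = ψ y ^ p

theorem IsLayer.pow_sq {p : ℕ} [Fact p.Prime] {k K : Type} [Field k] [Field K] [NumberField K]
    [Algebra k K] {ψ : 𝓞 K →+* AlgebraicClosure (ZMod p)} {g : K ≃ₐ[ℚ] K}
    (h : IsLayer p k K ψ g) (y : 𝓞 K) : ψ y ^ (p ^ 2) = ψ y := by
  rw [pow_two p, pow_mul, ← h.frob, ← h.frob, ← mul_smul, h.sq, one_smul]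

theorem exists_isLayer_self {p : ℕ} [Fact p.Prime] {k : Type} [Field k] [NumberField k]
    (hk : Module.finrank ℚ k = 2) : ∃ ψ g, IsLayer p k k ψ g := by
  have : Algebra.IsQuadraticExtension ℚ k := ⟨hk⟩
  have : IsGalois ℚ k := ⟨⟩
  obtain ⟨ψ, -⟩ := exists_ringHom_extend (S := 𝓞 k) (algebraMap ℤ (𝓞 k)).injective_int
    (Int.castRingHom (AlgebraicClosure (ZMod p)))
  obtain ⟨g, hg⟩ := exists_frobenius ψ
  have hone : ∀ h : k ≃ₐ[k] k, h = 1 := fun h => AlgEquiv.ext h.commutes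
  refine ⟨ψ, g, inferInstance, fun h hh => (hh (hone h)).elim, ⟨0, ?_⟩, ?_, hg⟩
  · rw [pow_zero, Nat.card_eq_one_iff_unique]
    exact ⟨⟨fun a b => by rw [hone a, hone b]⟩, ⟨1⟩⟩
  · have := pow_card_eq_one' (x := g)
    rwa [IsGalois.card_aut_eq_finrank, hk, pow_two] at this

end Layers

section LayerStep

open NumberField

theorem exists_algEquiv_of_fix {k K : Type*} [Field k] [Field K] [Algebra k K] [CharZero K]
    (σ : K ≃ₐ[ℚ] K) (h : ∀ x : k, σ (algebraMap k K x) = algebraMap k K x) :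
    ∃ γ : K ≃ₐ[k] K, ∀ y, γ y = σ y :=
  ⟨AlgEquiv.ofRingEquiv (f := (σ : K ≃+* K)) h, fun _ => rfl⟩

theorem eq_one_or_eq_of_card_two {G : Type*} [Group G] (hG : Nat.card G = 2) {a : G} (ha : a ≠ 1)
    (x : G) : x = 1 ∨ x = a := by
  have : Finite G := Nat.finite_of_card_ne_zero (by omega)
  by_contra! h
  have h3 : ({1, a, x} : Set G).ncard = 3 := Set.ncard_eq_three.2
    ⟨1, a, x, ha.symm, h.1.symm, h.2.symm, rfl⟩
  have := Set.ncard_le_card ({1, a, x} : Set G)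
  omega

theorem mul_self_of_card_two {G : Type*} [Group G] (hG : Nat.card G = 2) (x : G) : x * x = 1 := by
  rw [← pow_two, ← hG, pow_card_eq_one']

theorem exists_smul_eq_of_conj {k K : Type} [Field k] [NumberField k] [Field K] [NumberField K]
    [Algebra k K] [IsGalois ℚ K] (hk : Module.finrank ℚ k = 2) {W : 𝓞 K}
    (hγ : ∀ γ : K ≃ₐ[k] K, ∃ c : K, γ W = W * c ^ 2) {τ : K ≃ₐ[ℚ] K}
    (hτ : ∃ x : k, τ (algebraMap k K x) ≠ algebraMap k K x) (σ : K ≃ₐ[ℚ] K) :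
    (∃ c : K, σ W = W * c ^ 2) ∨ ∃ c : K, σ W = τ W * c ^ 2 := by
  have : Algebra.IsQuadraticExtension ℚ k := ⟨hk⟩
  have hcard : Nat.card (k ≃ₐ[ℚ] k) = 2 := (IsGalois.card_aut_eq_finrank ℚ k).trans hk
  let φ : (K ≃ₐ[ℚ] K) →* (k ≃ₐ[ℚ] k) := AlgEquiv.restrictNormalHom k
  have hφ : ∀ (ρ : K ≃ₐ[ℚ] K) (x : k), ρ (algebraMap k K x) = algebraMap k K (φ ρ x) := fun ρ x =>
    (AlgEquiv.restrictNormal_commutes ρ k x).symm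
  have hone : ∀ ρ : K ≃ₐ[ℚ] K, φ ρ = 1 → ∃ c : K, ρ W = W * c ^ 2 := fun ρ hρ => by
    obtain ⟨γ, h⟩ := exists_algEquiv_of_fix (k := k) ρ fun x => by rw [hφ, hρ, AlgEquiv.one_apply]
    rw [← h]
    exact hγ γ
  have hτ1 : φ τ ≠ 1 := fun h => by
    obtain ⟨x, hx⟩ := hτ
    rw [hφ, h, AlgEquiv.one_apply] at hx
    exact hx rfl
  rcases eq_one_or_eq_of_card_two hcard hτ1 (φ σ) with h | h
  · exact Or.inl (hone σ h)
  · obtain ⟨c, hc⟩ := hone (τ⁻¹ * σ) (by rw [map_mul, map_inv, h, inv_mul_cancel])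
    refine Or.inr ⟨τ c, ?_⟩
    rw [← map_pow, ← map_mul, ← hc, ← AlgEquiv.mul_apply, mul_inv_cancel_left]

theorem IsLayer.exists_step {p : ℕ} [Fact p.Prime] (hp2 : p ≠ 2) {k K : Type} [Field k]
    [NumberField k] (hk : Module.finrank ℚ k = 2) [Field K] [NumberField K] [Algebra k K]
    {ψ : 𝓞 K →+* AlgebraicClosure (ZMod p)} {g : K ≃ₐ[ℚ] K} (h : IsLayer p k K ψ g) {W : 𝓞 K}
    (hW : SqrtUnram W) (hγ : ∀ γ : K ≃ₐ[k] K, ∃ c : K, γ W = W * c ^ 2) {τ : K ≃ₐ[ℚ] K}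
    (hτ : ∃ x : k, τ (algebraMap k K x) ≠ algebraMap k K x)
    (h1 : ψ W ^ ((p ^ 2 - 1) / 2) = 1) (h2 : ψ (τ • W) ^ ((p ^ 2 - 1) / 2) = 1) :
    ∃ (K' : Type) (_ : Field K') (_ : NumberField K') (_ : Algebra k K') (_ : Algebra K K')
      (_ : IsScalarTower k K K') (ψ' : 𝓞 K' →+* AlgebraicClosure (ZMod p)) (g' : K' ≃ₐ[ℚ] K'),
      IsLayer p k K' ψ' g' ∧ IsSquare (algebraMap K K' W) ∧
      ∃ m ≤ 2, Module.finrank K K' = 2 ^ m := by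
  have := h.isGalois
  have hk' : Algebra.IsQuadraticExtension ℚ k := ⟨hk⟩
  have hcard : Nat.card (k ≃ₐ[ℚ] k) = 2 := (IsGalois.card_aut_eq_finrank ℚ k).trans hk
  have hGk : IsGalois k K := IsGalois.tower_top_of_isGalois ℚ k K
  let V : Bool → 𝓞 K := fun i => cond i W (τ • W)
  have hV : ∀ i, SqrtUnram (V i) := fun i => by
    cases i
    exacts [hW.smul τ, hW]
  have hψV : ∀ i, ψ (V i) ^ ((p ^ 2 - 1) / 2) = 1 := fun i => by
    cases i
    exacts [h2, h1]
  obtain ⟨K', hF, hN, hA, θ, hG', hθ, hone, m, hm, hdim⟩ :=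
    exists_adjoin_sqrt (K := K) (w := fun i => (V i : K)) fun σ i => by
      have hc := fun ρ => exists_smul_eq_of_conj hk hγ hτ ρ
      cases i
      · rcases hc (σ * τ) with ⟨c, hc⟩ | ⟨c, hc⟩
        exacts [⟨true, c, hc⟩, ⟨false, c, hc⟩]
      · rcases hc σ with ⟨c, hc⟩ | ⟨c, hc⟩
        exacts [⟨true, c, hc⟩, ⟨false, c, hc⟩]
  let : Algebra k K' := ((algebraMap K K').comp (algebraMap k K)).toAlgebra
  have hst : IsScalarTower k K K' := IsScalarTower.of_algebraMap_eq fun _ => rfl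
  have hGk' : IsGalois k K' := IsGalois.tower_top_of_isGalois ℚ k K'
  have hU : Unram k K' := Unram.of_sqrt h.unram hV hθ hone
  obtain ⟨ψ', hψ'⟩ := exists_ringHom_extend (S := 𝓞 K')
    (FaithfulSMul.algebraMap_injective (𝓞 K) (𝓞 K')) ψ
  obtain ⟨g', hg'⟩ := exists_frobenius ψ'
  refine ⟨K', hF, hN, inferInstance, hA, hst, ψ', g', ⟨hG', hU, ?_, ?_, hg'⟩,
    ⟨θ true, by rw [← pow_two]; exact (hθ true).symm⟩, m, hm, hdim⟩
  · obtain ⟨n, hn⟩ := h.card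
    refine ⟨n + m, ?_⟩
    rw [IsGalois.card_aut_eq_finrank] at hn ⊢
    rw [← Module.finrank_mul_finrank k K K', hn, hdim, pow_add]
  · have hs : ∀ y, ψ' ((g' * g') • y) = ψ' y ^ (p ^ 2) := fun y => by
      rw [mul_smul, hg', hg', ← pow_mul, pow_two]
    obtain ⟨s, hs1⟩ := exists_algEquiv_of_fix (k := k) (g' * g') fun x => by
      have := AlgEquiv.restrictNormal_commutes (g' * g') k x
      rw [← this]
      have h3 : (g' * g').restrictNormal k = 1 := by
        have := map_mul (AlgEquiv.restrictNormalHom (F := ℚ) (K₁ := K') k) g' g'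
        rw [mul_self_of_card_two hcard] at this
        exact this
      rw [h3, AlgEquiv.one_apply]
    have hs2 : s.restrictNormal K = 1 := by
      by_contra hne
      have h4 := h.unram _ hne
      have h5 : Ideal.span (Set.range fun y : 𝓞 K => y - s.restrictNormal K • y) ≤
          RingHom.ker ψ := by
        rw [Ideal.span_le]
        rintro _ ⟨y, rfl⟩
        change ψ (y - s.restrictNormal K • y) = 0
        rw [map_sub, sub_eq_zero, ← hψ' (s.restrictNormal K • y), ← h.pow_sq, ← hψ', ← hs]
        congr 1
        refine RingOfIntegers.ext ?_
        change (g' * g') (algebraMap K K' y) = algebraMap K K' (s.restrictNormal K y)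
        rw [← hs1, AlgEquiv.restrictNormal_commutes]
      rw [h4] at h5
      have h6 : (1 : 𝓞 K) ∈ RingHom.ker ψ := h5 trivial
      rw [RingHom.mem_ker, map_one] at h6
      exact one_ne_zero h6
    obtain ⟨t, ht⟩ := exists_algEquiv_of_fix (k := K) (g' * g') fun x => by
      rw [← hs1, ← AlgEquiv.restrictNormal_commutes, hs2, AlgEquiv.one_apply]
    have ht1 : t = 1 := hone t fun i => by
      have hint : IsIntegral ℤ (θ i) := IsIntegral.of_pow two_pos (by
        rw [hθ]; exact (V i).isIntegral_coe.map (algebraMap K K').toIntAlgHom)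
      let ϑ : 𝓞 K' := ⟨θ i, hint⟩
      have hϑ : ψ' ϑ ^ 2 = ψ (V i) := by
        rw [← hψ', ← map_pow]
        congr 1
        exact RingOfIntegers.ext (hθ i)
      have hne : ψ' ϑ ≠ 0 := fun h0 => by
        have h3 := hψV i
        have h4 : 2 ≤ p := (Fact.out : p.Prime).two_le
        have h5 : 0 < (p ^ 2 - 1) / 2 := by
          have : 2 ^ 2 ≤ p ^ 2 := Nat.pow_le_pow_left h4 2
          omega
        rw [← hϑ, h0, zero_pow two_ne_zero, zero_pow h5.ne'] at h3
        exact zero_ne_one h3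
      have hpow : ψ' ((g' * g') • ϑ) = ψ' ϑ := by
        have hodd : p ^ 2 = 2 * ((p ^ 2 - 1) / 2) + 1 := by
          have h6 : Odd (p ^ 2) := ((Fact.out : p.Prime).odd_of_ne_two hp2).pow
          obtain ⟨j, hj⟩ := h6
          omega
        rw [hs, hodd, pow_succ, pow_mul, hϑ, hψV, one_mul]
      have hsq : t (θ i) ^ 2 = θ i ^ 2 := by rw [← map_pow, hθ, t.commutes]
      refine (sq_eq_sq_iff_eq_or_eq_neg.1 hsq).resolve_right fun hneg => ?_
      have h7 : (g' * g') • ϑ = -ϑ := RingOfIntegers.ext (by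
        change (g' * g') (θ i) = - θ i
        rw [← ht, hneg])
      rw [h7, map_neg] at hpow
      have h8 : (2 : AlgebraicClosure (ZMod p)) * ψ' ϑ = 0 := by linear_combination -hpow
      rcases mul_eq_zero.1 h8 with h9 | h9
      · have h10 : ((2 : ℕ) : AlgebraicClosure (ZMod p)) = 0 := by exact_mod_cast h9
        rw [CharP.cast_eq_zero_iff _ p] at h10
        exact hp2 ((Nat.prime_dvd_prime_iff_eq Fact.out Nat.prime_two).1 h10)
      · exact hne h9
    refine AlgEquiv.ext fun y => ?_
    rw [← ht, ht1]
    rfl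

end LayerStep

section KummerData

open NumberField nonZeroDivisors FractionalIdeal

variable {Γ k K : Type} [Group Γ] [Field k] [NumberField k] [Field K] [NumberField K] [Algebra k K]

/-- The unit `u` generates, up to squares, a fractional ideal coming from `J`, and its Kummer
cocycle lifts to a cocycle `c` on `Γ` which is given by `f` on the kernel of `π`. -/
def KummerDatum (π : Γ →* (K ≃ₐ[k] K)) (f : π.ker →* ℤˣ) (u : Kˣ) (J : (FrId k)ˣ) : Prop :=
  (∃ b : (FrId K)ˣ, b ^ 2 * toPrincipalIdeal (𝓞 K) K u =
    Units.map (extI k K : FrId k →* FrId K) J) ∧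
  ∃ c : Γ → Kˣ, (∀ γ δ, c (γ * δ) = c γ * π γ • c δ) ∧
    (∀ v : π.ker, c v = Units.map (Int.castRingHom K : ℤ →* K) (f v)) ∧
    ∀ γ, π γ • u = u * c γ ^ 2

variable {π : Γ →* (K ≃ₐ[k] K)} {f f' : π.ker →* ℤˣ} {u u' : Kˣ} {J J' : (FrId k)ˣ}

theorem KummerDatum.mul (h : KummerDatum π f u J) (h' : KummerDatum π f' u' J') :
    KummerDatum π (f * f') (u * u') (J * J') := by
  obtain ⟨⟨b, hb⟩, c, hc, hcv, hcu⟩ := h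
  obtain ⟨⟨b', hb'⟩, c', hc', hcv', hcu'⟩ := h'
  refine ⟨⟨b * b', ?_⟩, fun γ => c γ * c' γ, fun γ δ => ?_, fun v => ?_, fun γ => ?_⟩
  · rw [map_mul, map_mul, ← hb, ← hb', mul_pow]
    exact mul_mul_mul_comm _ _ _ _
  · beta_reduce
    rw [hc, hc', smul_mul']
    exact mul_mul_mul_comm _ _ _ _
  · beta_reduce
    rw [hcv, hcv', MonoidHom.mul_apply, map_mul]
  · rw [smul_mul', hcu, hcu', mul_pow]
    exact mul_mul_mul_comm _ _ _ _

theorem KummerDatum.inv (h : KummerDatum π f u J) : KummerDatum π f⁻¹ u⁻¹ J⁻¹ := by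
  obtain ⟨⟨b, hb⟩, c, hc, hcv, hcu⟩ := h
  refine ⟨⟨b⁻¹, ?_⟩, fun γ => (c γ)⁻¹, fun γ δ => ?_, fun v => ?_, fun γ => ?_⟩
  · rw [map_inv, map_inv, ← hb, mul_inv, inv_pow]
  · beta_reduce
    rw [hc, mul_inv, smul_inv']
  · beta_reduce
    rw [hcv, MonoidHom.inv_apply, map_inv]
  · rw [smul_inv', hcu, mul_inv, inv_pow]

theorem kummerDatum_map (y : kˣ) :
    KummerDatum π 1 (Units.map (algebraMap k K : k →* K) y) (toPrincipalIdeal (𝓞 k) k y) := by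
  refine ⟨⟨1, ?_⟩, fun _ => 1, fun γ δ => ?_, fun v => ?_, fun γ => ?_⟩
  · rw [one_pow, one_mul]
    ext1
    rw [coe_toPrincipalIdeal, Units.coe_map, Units.coe_map, coe_toPrincipalIdeal]
    exact (extI_spanSingleton _).symm
  · rw [smul_one, one_mul]
  · rw [MonoidHom.one_apply, map_one]
  · rw [one_pow, mul_one]
    exact Units.ext ((π γ).commutes y)

theorem KummerDatum.mul_sq (h : KummerDatum π f u J) (z : Kˣ) : KummerDatum π f (u * z ^ 2) J := by
  obtain ⟨⟨b, hb⟩, c, hc, hcv, hcu⟩ := h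
  refine ⟨⟨b * (toPrincipalIdeal (𝓞 K) K z)⁻¹, ?_⟩, fun γ => c γ * (π γ • z / z), fun γ δ => ?_,
    fun v => ?_, fun γ => ?_⟩
  · rw [← hb, map_mul, map_pow, mul_pow, inv_pow]
    rw [mul_mul_mul_comm, mul_comm _ (_ ^ 2), mul_inv_cancel, mul_one]
  · beta_reduce
    rw [hc, smul_mul', smul_div', map_mul, mul_smul, mul_mul_mul_comm]
    congr 1
    rw [mul_comm, div_mul_div_cancel]
  · beta_reduce
    rw [hcv, MonoidHom.mem_ker.1 v.2, one_smul, div_self', mul_one]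
  · rw [smul_mul', hcu, mul_pow, div_pow, smul_pow', mul_mul_mul_comm u (z ^ 2), mul_div_cancel]

theorem KummerDatum.not_sq (h1 : ∀ (h : Γ →* ℤˣ), ∀ v ∈ π.ker, h v = 1) {z : Kˣ}
    (h : KummerDatum π f (z ^ 2) J) : f = 1 := by
  obtain ⟨-, c, hc, hcv, hcu⟩ := h
  let ι : ℤˣ →* Kˣ := Units.map (Int.castRingHom K : ℤ →* K)
  have hι : Function.Injective ι := Units.map_injective (Int.castRingHom K).injective_int
  have key : ∀ γ, ∃ e : ℤˣ, ι e = c γ * (z / π γ • z) := fun γ => by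
    have h2 : (c γ * (z / π γ • z)) ^ 2 = 1 := by
      rw [mul_pow, div_pow, ← smul_pow', hcu, mul_comm, div_mul_eq_mul_div, div_self']
    have h3 := congrArg Units.val h2
    rw [Units.val_pow_eq_pow_val, Units.val_one, ← one_pow 2] at h3
    rcases sq_eq_sq_iff_eq_or_eq_neg.1 h3 with h4 | h4
    · exact ⟨1, by rw [map_one]; exact (Units.ext h4).symm⟩
    · refine ⟨-1, Units.ext ?_⟩
      rw [h4]
      simp [ι]
  choose e he using key
  let F : Γ →* ℤˣ := MonoidHom.mk' e fun γ δ => hι (by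
    have hfix : π γ • ι (e δ) = ι (e δ) := by
      refine Units.ext ?_
      change π γ (((e δ : ℤ) : K)) = ((e δ : ℤ) : K)
      exact map_intCast _ _
    rw [map_mul, ← hfix, he, he, he, hc, map_mul, mul_smul, smul_mul', smul_div',
      mul_mul_mul_comm]
    congr 1
    rw [div_mul_div_cancel])
  ext1 v
  refine hι ?_
  have h3 := h1 F v v.2
  change ι (f v) = _
  rw [← hcv, MonoidHom.one_apply, map_one]
  have h4 := he v
  rw [show e v = 1 from h3, MonoidHom.mem_ker.1 v.2, one_smul, div_self', mul_one, map_one] at h4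
  exact h4.symm

/-- Every character of the kernel comes from a Kummer datum. -/
theorem exists_kummerDatum [IsTotallyComplex k] [IsGalois k K] (hU : Unram k K) {n : ℕ}
    (hn : Nat.card (K ≃ₐ[k] K) = 2 ^ n) (hπ : Function.Surjective π)
    (hcen : ∀ v ∈ π.ker, ∀ γ, v * γ = γ * v) (f : π.ker →* ℤˣ) :
    ∃ u J, KummerDatum π f u J := by
  classical
  obtain ⟨c, hc, hcv⟩ := exists_cocycle n hU hn π hπ hcen
    (fun γ => if h : γ ∈ π.ker then f ⟨γ, h⟩ else 1) (fun v hv w hw => by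
      rw [dif_pos hv, dif_pos hw, dif_pos (mul_mem hv hw), ← map_mul]
      rfl)
  have hcv' : ∀ v : π.ker, c v = Units.map (Int.castRingHom K : ℤ →* K) (f v) := fun v => by
    rw [hcv v v.2, dif_pos v.2]
  have hsq : ∀ v ∈ π.ker, c v ^ 2 = 1 := fun v hv => by
    rw [hcv' ⟨v, hv⟩, ← map_pow, Int.units_sq, map_one]
  obtain ⟨u, hu⟩ := exists_eq_smul_div_of_trivial_on_ker hπ (B := fun γ => c γ ^ 2)
    (fun γ δ => by rw [hc, mul_pow, smul_pow']) hsq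
  have hu' : ∀ γ, π γ • u = u * c γ ^ 2 := fun γ => by rw [hu, mul_div_cancel]
  obtain ⟨b, hb0, hb⟩ := exists_mul_galI_eq_of_cocycle hπ
    (D := fun γ => spanSingleton (𝓞 K)⁰ (c γ : K)) (fun γ δ => by
      rw [hc, Units.val_mul, ← spanSingleton_mul_spanSingleton, galI_spanSingleton]
      rfl) (fun γ => by
      rw [Ne, spanSingleton_eq_zero_iff]; exact Units.ne_zero _) (fun v hv => by
      have h1 := congrArg Units.val (hsq v hv)
      rw [Units.val_pow_eq_pow_val, Units.val_one, ← one_pow 2] at h1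
      rcases sq_eq_sq_iff_eq_or_eq_neg.1 h1 with h | h <;> rw [h]
      · rw [spanSingleton_one]
      · refine le_antisymm ?_ ?_
        · rw [spanSingleton_le_iff_mem, mem_one_iff]
          exact ⟨-1, by rw [map_neg, map_one]⟩
        · rw [← spanSingleton_one, spanSingleton_le_iff_mem, mem_spanSingleton]
          exact ⟨-1, by rw [neg_smul, one_smul, neg_neg]⟩)
  have hinv : ∀ g : K ≃ₐ[k] K, galI g (b ^ 2 * spanSingleton (𝓞 K)⁰ (u : K)) =
      b ^ 2 * spanSingleton (𝓞 K)⁰ (u : K) := fun g => by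
    obtain ⟨γ, rfl⟩ := hπ g
    have h1 : (π γ • (u : K)) = u * (c γ : K) ^ 2 := congrArg Units.val (hu' γ)
    rw [map_mul, map_pow, galI_spanSingleton, h1, ← spanSingleton_mul_spanSingleton,
      ← spanSingleton_pow]
    nth_rewrite 2 [← hb γ]
    ring
  obtain ⟨J, hJ⟩ := exists_extI_eq hU hinv
  have hu0 : spanSingleton (𝓞 K)⁰ (u : K) ≠ 0 := by
    rw [Ne, spanSingleton_eq_zero_iff]; exact Units.ne_zero _
  have hJ0 : J ≠ 0 := by
    rintro rfl
    rw [map_zero] at hJ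
    exact mul_ne_zero (pow_ne_zero 2 hb0) hu0 hJ.symm
  refine ⟨u, Units.mk0 J hJ0, ⟨Units.mk0 b hb0, ?_⟩, c, hc, hcv', hu'⟩
  ext1
  rw [Units.val_mul, coe_toPrincipalIdeal, Units.coe_map]
  exact hJ.symm

end KummerData

section ModFour

open NumberField nonZeroDivisors FractionalIdeal

/-- The ring of integers is reduced modulo two. -/
def TwoReduced (K : Type*) [Field K] : Prop := ∀ x : 𝓞 K, 2 ∣ x ^ 2 → 2 ∣ x

section Extension

variable {k K : Type*} [Field k] [NumberField k] [Field K] [NumberField K] [Algebra k K]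

theorem exists_algebraMap_eq_of_fix [IsGalois k K] {x : 𝓞 K}
    (hx : ∀ g : K ≃ₐ[k] K, g • x = x) : ∃ y : 𝓞 k, algebraMap (𝓞 k) (𝓞 K) y = x := by
  obtain ⟨y, hy⟩ := (IsGalois.mem_range_algebraMap_iff_fixed (F := k) (x : K)).2 fun g =>
    congrArg (algebraMap (𝓞 K) K) (hx g)
  have hyi : IsIntegral ℤ y := by
    rw [← isIntegral_algebraMap_iff (algebraMap k K).injective, hy]
    exact x.isIntegral_coe
  exact ⟨⟨y, hyi⟩, RingOfIntegers.ext hy⟩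

theorem two_dvd_of_dvd_algebraMap {x : 𝓞 k} (h : (2 : 𝓞 K) ∣ algebraMap (𝓞 k) (𝓞 K) x) :
    2 ∣ x := by
  obtain ⟨y, hy⟩ := h
  have hyi : IsIntegral ℤ ((x : k) / 2) := by
    rw [← isIntegral_algebraMap_iff (algebraMap k K).injective]
    have : algebraMap k K ((x : k) / 2) = y := by
      have h1 : algebraMap k K x = 2 * (y : K) := congrArg (algebraMap (𝓞 K) K) hy
      rw [map_div₀, h1, map_ofNat]
      field_simp
    rw [this]
    exact y.isIntegral_coe
  refine ⟨⟨_, hyi⟩, RingOfIntegers.ext ?_⟩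
  change (x : k) = 2 * (x / 2)
  field_simp

theorem smul_two_mul {G : Type*} [Group G] [MulSemiringAction G K] (g : G) (x : 𝓞 K) :
    g • (2 * x) = 2 * g • x := by
  rw [smul_mul']
  congr 1
  exact map_ofNat (MulSemiringAction.toRingHom G (𝓞 K) g) 2

theorem TwoReduced.of_unram [IsGalois k K] (hU : Unram k K) (h : TwoReduced k) :
    TwoReduced K := by
  classical
  have : Fintype (K ≃ₐ[k] K) := Fintype.ofFinite _
  intro x hx
  obtain ⟨n, a, b, hab⟩ := UnramifiedAction.exists_dual hU
  rw [← hab.sum_mul_actTrace x]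
  refine Finset.dvd_sum fun i _ => Dvd.dvd.mul_left ?_ _
  obtain ⟨y, hy⟩ := exists_algebraMap_eq_of_fix (k := k)
    fun g => smul_actTrace g (b i * x)
  rw [← hy]
  refine (h y (two_dvd_of_dvd_algebraMap (K := K) ?_)).elim fun z hz =>
    ⟨algebraMap _ _ z, by rw [hz, map_mul, map_ofNat]⟩
  rw [map_pow, hy]
  have key : ∀ (s : Finset (K ≃ₐ[k] K)), (2 : 𝓞 K) ∣ (∑ g ∈ s, g • (b i * x)) ^ 2 := fun s => by
    induction s using Finset.induction_on with
    | empty => simp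
    | insert g s hg ih =>
      rw [Finset.sum_insert hg, add_sq]
      refine (Dvd.dvd.add ?_ ?_).add ih
      · obtain ⟨y, hy⟩ := hx
        exact ⟨g • (b i ^ 2 * y), by rw [← smul_two_mul, ← smul_pow', mul_pow, hy]; ring_nf⟩
      · exact ⟨_, mul_assoc _ _ _⟩
  exact key _

theorem TwoReduced.exists_sq_sub (h : TwoReduced K) (W : 𝓞 K) : ∃ s : 𝓞 K, 2 ∣ W - s ^ 2 := by
  have : Finite (𝓞 K ⧸ Ideal.span {(2 : 𝓞 K)}) := Ideal.finiteQuotientOfFreeOfNeBot _ (by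
    rw [Ne, Ideal.span_singleton_eq_bot]; exact two_ne_zero)
  have hsurj : Function.Surjective fun x : 𝓞 K ⧸ Ideal.span {(2 : 𝓞 K)} => x ^ 2 := by
    refine Finite.surjective_of_injective fun x y hxy => ?_
    obtain ⟨x, rfl⟩ := Ideal.Quotient.mk_surjective x
    obtain ⟨y, rfl⟩ := Ideal.Quotient.mk_surjective y
    rw [← map_pow, ← map_pow, Ideal.Quotient.eq, Ideal.mem_span_singleton] at hxy
    rw [Ideal.Quotient.eq, Ideal.mem_span_singleton]
    refine h _ ?_
    have : (x - y) ^ 2 = (x ^ 2 - y ^ 2) - 2 * (y * (x - y)) := by ring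
    rw [this]
    exact dvd_sub hxy ⟨_, rfl⟩
  obtain ⟨s, hs⟩ := hsurj (Ideal.Quotient.mk _ W)
  obtain ⟨s, rfl⟩ := Ideal.Quotient.mk_surjective s
  refine ⟨s, ?_⟩
  beta_reduce at hs
  rw [← map_pow, eq_comm, Ideal.Quotient.eq, Ideal.mem_span_singleton] at hs
  exact hs

/-- An integer prime to two whose class modulo squares is Galois invariant is, up to squares,
congruent modulo four to an integer of the base field. -/
theorem exists_four_dvd_sub [IsGalois k K] (hU : Unram k K) (h : TwoReduced k) {W : 𝓞 K}
    (h2 : IsCoprime W 2) (hW : ∀ γ : K ≃ₐ[k] K, ∃ c : K, γ W = W * c ^ 2) :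
    ∃ (s : 𝓞 K) (z : 𝓞 k), 4 ∣ W - s ^ 2 * (1 + 2 * algebraMap (𝓞 k) (𝓞 K) z) := by
  classical
  have : Fintype (K ≃ₐ[k] K) := Fintype.ofFinite _
  have hK : TwoReduced K := h.of_unram hU
  obtain ⟨s, t, ht⟩ := hK.exists_sq_sub W
  obtain ⟨u, v, huv⟩ := h2
  have hu : u * s ^ 2 + 2 * (v + u * t) = 1 := by linear_combination huv - u * ht
  obtain ⟨z, q₀, hWz⟩ : ∃ z q₀, W = s ^ 2 * (1 + 2 * z) + 4 * q₀ :=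
    ⟨u * t, t * (v + u * t), by linear_combination ht + (-2 * t) * hu⟩
  have hinv : ∀ γ : K ≃ₐ[k] K, 2 ∣ z - γ • z := fun γ => by
    obtain ⟨c, hc⟩ := hW γ
    have hce : IsIntegral ℤ (c * W) := IsIntegral.of_pow two_pos (by
      have : (c * W) ^ 2 = ((W * γ • W : 𝓞 K) : K) := by
        change _ = (W : K) * γ W
        rw [hc]; ring
      rw [this]
      exact RingOfIntegers.isIntegral_coe _)
    let e : 𝓞 K := ⟨_, hce⟩
    have he : e ^ 2 = W * γ • W := RingOfIntegers.ext (by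
      change (c * W) ^ 2 = (W : K) * γ W
      rw [hc]; ring)
    have hgu : γ • u * (γ • s) ^ 2 + 2 * γ • (v + u * t) = 1 := by
      rw [← smul_two_mul, ← smul_pow', ← smul_mul', ← smul_add, hu, smul_one]
    have h4 : ∀ x : 𝓞 K, γ • (4 * x) = 4 * γ • x := fun x => by
      rw [smul_mul']
      exact congrArg (· * _) (map_ofNat (MulSemiringAction.toRingHom _ (𝓞 K) γ) 4)
    have hgW : γ • W = (γ • s) ^ 2 * (1 + 2 * γ • z) + 4 * γ • q₀ := by
      conv_lhs => rw [hWz]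
      rw [smul_add, smul_mul', smul_pow', smul_add, smul_two_mul, smul_one, h4]
    generalize γ • s = s', γ • z = z', γ • q₀ = q₀', γ • u = u', γ • (v + u * t) = v' at *
    rw [hgW] at he
    obtain ⟨q, hq⟩ : 2 ∣ e - s * s' := hK _
      ⟨s ^ 2 * s' ^ 2 * (1 + z + z' + 2 * z * z') + 2 * (s ^ 2 * (1 + 2 * z) * q₀' +
        q₀ * (s' ^ 2 * (1 + 2 * z') + 4 * q₀')) - s * s' * e, by
        linear_combination he + (s' ^ 2 * (1 + 2 * z') + 4 * q₀') * hWz⟩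
    have h3 : s ^ 2 * s' ^ 2 * (z + z') = 2 * (s * s' * q + q ^ 2 - s ^ 2 * s' ^ 2 * z * z' -
        (s ^ 2 * (1 + 2 * z) * q₀' + q₀ * (s' ^ 2 * (1 + 2 * z') + 4 * q₀'))) := by
      refine mul_left_cancel₀ (two_ne_zero' (𝓞 K)) ?_
      linear_combination -he - (s' ^ 2 * (1 + 2 * z') + 4 * q₀') * hWz +
        (e + s * s' + 2 * q) * hq
    obtain ⟨d, hd⟩ : ∃ d, d = s * s' * q + q ^ 2 - s ^ 2 * s' ^ 2 * z * z' -
        (s ^ 2 * (1 + 2 * z) * q₀' + q₀ * (s' ^ 2 * (1 + 2 * z') + 4 * q₀')) := ⟨_, rfl⟩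
    rw [← hd] at h3
    exact ⟨u * u' * d + v' * (z + z') + u' * s' ^ 2 * (v + u * t) * (z + z') - z', by
      linear_combination u * u' * h3 - (z + z') * hgu - u' * s' ^ 2 * (z + z') * hu⟩
  obtain ⟨r, hr⟩ := UnramifiedAction.exists_actTrace_eq_one (G := K ≃ₐ[k] K)
    (algebraMap (𝓞 k) (𝓞 K)) (FaithfulSMul.algebraMap_injective _ _)
    (fun x hx => exists_algebraMap_eq_of_fix hx)
    (fun g x => RingOfIntegers.ext (g.commutes (x : k)))
    (algebraMap_isIntegral_iff.2 inferInstance) hU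
  obtain ⟨y, hy⟩ := exists_algebraMap_eq_of_fix (k := k) fun g => smul_actTrace g (r * z)
  obtain ⟨q, hq⟩ : 2 ∣ z - algebraMap (𝓞 k) (𝓞 K) y := by
    have : z - algebraMap (𝓞 k) (𝓞 K) y = ∑ γ : K ≃ₐ[k] K, γ • r * (z - γ • z) := by
      simp only [mul_sub, Finset.sum_sub_distrib, ← Finset.sum_mul, ← smul_mul']
      rw [hy, actTrace]
      rw [actTrace] at hr
      rw [hr, one_mul]
    rw [this]
    exact Finset.dvd_sum fun γ _ => (hinv γ).mul_left _
  exact ⟨s, y, s ^ 2 * q + q₀, by linear_combination hWz + 2 * s ^ 2 * hq⟩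

theorem exists_four_dvd_mul_sub {W W' s s' : 𝓞 K} {z z' : 𝓞 k}
    (h : 4 ∣ W - s ^ 2 * (1 + 2 * algebraMap (𝓞 k) (𝓞 K) z))
    (h' : 4 ∣ W' - s' ^ 2 * (1 + 2 * algebraMap (𝓞 k) (𝓞 K) z')) (hz : 2 ∣ z - z') :
    ∃ S : 𝓞 K, 4 ∣ W * W' - S ^ 2 := by
  obtain ⟨a, ha⟩ := h
  obtain ⟨a', ha'⟩ := h'
  obtain ⟨q, hq⟩ := hz
  set y := algebraMap (𝓞 k) (𝓞 K) z
  set y' := algebraMap (𝓞 k) (𝓞 K) z'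
  have hq' : y = y' + 2 * algebraMap (𝓞 k) (𝓞 K) q := by
    rw [← map_ofNat (algebraMap (𝓞 k) (𝓞 K)), ← map_mul, ← hq, map_sub]; ring
  refine ⟨s * s', a * W' + s ^ 2 * (1 + 2 * y) * a' + s ^ 2 * s' ^ 2 *
    (y' + algebraMap (𝓞 k) (𝓞 K) q + y' * y), ?_⟩
  linear_combination W' * ha + s ^ 2 * (1 + 2 * y) * ha' + 2 * s ^ 2 * s' ^ 2 * hq'

end Extension

variable {K : Type*} [Field K] [NumberField K]

/-- A fractional ideal is generated by one element modulo any nonzero integer multiple. -/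
theorem exists_eq_add_spanSingleton {b : FrId K} (hb : b ≠ 0) {n : 𝓞 K} (hn : n ≠ 0) :
    ∃ x : K, b = spanSingleton (𝓞 K)⁰ (n : K) * b + spanSingleton (𝓞 K)⁰ x := by
  obtain ⟨a, I, ha, hI⟩ := exists_eq_spanSingleton_mul b
  have hI0 : I ≠ ⊥ := by
    rintro rfl
    rw [coeIdeal_bot, mul_zero] at hI
    exact hb hI
  obtain ⟨α, hα⟩ := IsDedekindDomain.exists_sup_span_eq (I := Ideal.span {n} * I) (J := I)
    Ideal.mul_le_right (mul_ne_zero (by rwa [Ne, Ideal.zero_eq_bot, Ideal.span_singleton_eq_bot])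
      hI0)
  refine ⟨(algebraMap _ K a)⁻¹ * α, ?_⟩
  conv_lhs => rw [hI, ← hα]
  rw [hI, coeIdeal_sup, coeIdeal_mul, coeIdeal_span_singleton, coeIdeal_span_singleton,
    ← spanSingleton_mul_spanSingleton]
  ring

/-- Virtual units can be scaled by squares to become integral and prime to a given integer. -/
theorem exists_integral_mul_sq {b : FrId K} {w : K} (h : b ^ 2 * spanSingleton (𝓞 K)⁰ w = 1)
    {n : 𝓞 K} (hn : n ≠ 0) : ∃ (W : 𝓞 K) (x : K), (W : K) = w * x ^ 2 ∧ IsCoprime W n := by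
  have hb : b ≠ 0 := by
    rintro rfl
    simp at h
  obtain ⟨x, hx⟩ := exists_eq_add_spanSingleton hb hn
  have hxb : spanSingleton (𝓞 K)⁰ x ≤ b := by
    conv_rhs => rw [hx]
    exact le_add_left le_rfl
  have hle : ∀ I ≤ b, spanSingleton (𝓞 K)⁰ x * I * spanSingleton (𝓞 K)⁰ w ≤ 1 := fun I hI => by
    rw [← h, pow_two]
    exact mul_le_mul_left (mul_le_mul' hxb hI) _
  obtain ⟨W, hW⟩ : ∃ W : 𝓞 K, (W : K) = w * x ^ 2 := by
    have h1 := hle _ hxb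
    rw [spanSingleton_mul_spanSingleton, spanSingleton_mul_spanSingleton,
      spanSingleton_le_iff_mem, mem_one_iff] at h1
    obtain ⟨W, hW⟩ := h1
    exact ⟨W, hW.trans (by ring)⟩
  refine ⟨W, x, hW, ?_⟩
  rw [← Ideal.isCoprime_span_singleton_iff, Ideal.isCoprime_iff_sup_eq, eq_top_iff,
    ← coeIdeal_le_coeIdeal K, coeIdeal_sup, coeIdeal_top, coeIdeal_span_singleton,
    coeIdeal_span_singleton]
  rw [pow_two] at h
  have hW' : spanSingleton (𝓞 K)⁰ (W : K) = spanSingleton (𝓞 K)⁰ x *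
      spanSingleton (𝓞 K)⁰ x * spanSingleton (𝓞 K)⁰ w := by
    rw [hW, spanSingleton_mul_spanSingleton, spanSingleton_mul_spanSingleton]
    congr 1
    ring
  have h1 : (1 : FrId K) = spanSingleton (𝓞 K)⁰ (n : K) * 1 +
      spanSingleton (𝓞 K)⁰ x * b * spanSingleton (𝓞 K)⁰ w := by
    conv_lhs => rw [← h, hx]
    conv_rhs => rw [← h]
    rw [← hx]
    conv_lhs => rw [mul_assoc]; lhs; rw [hx]
    ring
  have h2 : spanSingleton (𝓞 K)⁰ x * b * spanSingleton (𝓞 K)⁰ w =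
      spanSingleton (𝓞 K)⁰ (n : K) * (spanSingleton (𝓞 K)⁰ x * b * spanSingleton (𝓞 K)⁰ w) +
      spanSingleton (𝓞 K)⁰ (W : K) := by
    conv_lhs => rw [hx]
    rw [hW']
    ring
  calc (1 : FrId K) = _ := h1
    _ ≤ _ := by
      rw [h2, ← sup_eq_add, ← sup_eq_add, ← sup_eq_add]
      refine sup_le ?_ (sup_le ?_ le_sup_left)
      · rw [mul_one]
        exact le_sup_right
      · refine le_trans (mul_le_mul_right (hle _ le_rfl) _) ?_
        rw [mul_one]
        exact le_sup_right

end ModFour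

section NextLayer

open NumberField nonZeroDivisors FractionalIdeal

section Kummer

variable {Γ k K : Type} [Group Γ] [Field k] [NumberField k] [Field K] [NumberField K] [Algebra k K]
  {π : Γ →* (K ≃ₐ[k] K)} {f f' : π.ker →* ℤˣ} {u u' : Kˣ} {J J' : (FrId k)ˣ}

theorem KummerDatum.exists_mul_mul_spanSingleton (h : KummerDatum π f u 1) :
    ∃ b : FrId K, b * b * spanSingleton (𝓞 K)⁰ (u : K) = 1 := by
  obtain ⟨⟨b, hb⟩, -⟩ := h
  refine ⟨b, ?_⟩
  have h1 := congrArg Units.val hb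
  rwa [map_one, Units.val_one, Units.val_mul, coe_toPrincipalIdeal, Units.val_pow_eq_pow_val,
    pow_two] at h1

theorem KummerDatum.exists_integral (h : KummerDatum π f u 1) {n : 𝓞 K} (hn : n ≠ 0)
    (hn' : ¬ IsUnit n) :
    ∃ (W : 𝓞 K) (u' : Kˣ), KummerDatum π f u' 1 ∧ (W : K) = u' ∧ IsCoprime W n := by
  obtain ⟨b, hb⟩ := h.exists_mul_mul_spanSingleton
  rw [← pow_two] at hb
  obtain ⟨W, x, hW, hWn⟩ := exists_integral_mul_sq hb hn
  have hx : x ≠ 0 := fun hx => by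
    rw [hx, zero_pow two_ne_zero, mul_zero] at hW
    have hW0 : W = 0 := RingOfIntegers.ext hW
    rw [hW0, isCoprime_zero_left] at hWn
    exact hn' hWn
  exact ⟨W, u * (Units.mk0 x hx) ^ 2, h.mul_sq _, by rw [hW]; simp, hWn⟩

theorem KummerDatum.exists_apply_eq (h : KummerDatum π f u J) (hπ : Function.Surjective π)
    (γ : K ≃ₐ[k] K) : ∃ c : K, γ u = u * c ^ 2 := by
  obtain ⟨-, c, -, -, hc⟩ := h
  obtain ⟨δ, rfl⟩ := hπ γ
  exact ⟨c δ, congrArg Units.val (hc δ)⟩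

end Kummer

/-- A monoid homomorphism to a group of exponent two: equality of two elements can be tested on
their product. -/
theorem eq_of_mul_eq_one_of_int_units {M : Type*} [Monoid M] {f f' : M →* ℤˣ} (h : f * f' = 1) :
    f = f' := by
  ext x : 1
  have h1 : f x * f' x = 1 := DFunLike.congr_fun h x
  rw [← Int.units_inv_eq_self (f' x)]
  exact eq_inv_of_mul_eq_one_left h1

theorem reduction_ne_zero_of_isCoprime {p : ℕ} {R F : Type*} [CommRing R] [Field F] [CharP F p]
    (ψ : R →+* F) {W : R} (hW : IsCoprime W p) : ψ W ≠ 0 := by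
  intro h0
  obtain ⟨a, b, hab⟩ := hW
  have h1 := congrArg ψ hab
  rw [map_add, map_mul, map_mul, h0, map_natCast, CharP.cast_eq_zero, mul_zero, mul_zero,
    add_zero, map_one] at h1
  exact zero_ne_one h1

theorem IsLayer.pow_eq_one_or {p : ℕ} [Fact p.Prime] (hp2 : p ≠ 2) {k K : Type} [Field k]
    [Field K] [NumberField K] [Algebra k K] {ψ : 𝓞 K →+* AlgebraicClosure (ZMod p)}
    {g : K ≃ₐ[ℚ] K} (h : IsLayer p k K ψ g) {W : 𝓞 K} (hW : IsCoprime W p) :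
    ψ W ^ ((p ^ 2 - 1) / 2) = 1 ∨ ψ W ^ ((p ^ 2 - 1) / 2) = -1 := by
  have h0 := reduction_ne_zero_of_isCoprime ψ hW
  have hp : Odd p := (Fact.out : p.Prime).odd_of_ne_two hp2
  have hd : (p ^ 2 - 1) / 2 * 2 = p ^ 2 - 1 :=
    Nat.div_mul_cancel (Nat.Odd.sub_odd hp.pow odd_one).two_dvd
  rw [← sq_eq_one_iff, ← pow_mul, hd]
  refine mul_left_cancel₀ h0 ?_
  rw [mul_one, ← pow_succ', Nat.sub_add_cancel (Nat.one_le_pow _ _ (Fact.out : p.Prime).pos),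
    h.pow_sq]

/-- A quadratic field is moved by some automorphism of any Galois extension. -/
theorem exists_algEquiv_ne {k K : Type*} [Field k] [NumberField k] [Field K] [NumberField K]
    [Algebra k K] [IsGalois ℚ K] (hk : Module.finrank ℚ k ≠ 1) :
    ∃ (τ : K ≃ₐ[ℚ] K) (x : k), τ (algebraMap k K x) ≠ algebraMap k K x := by
  by_contra! hτ
  refine hk ?_
  rw [← Subalgebra.bot_eq_top_iff_finrank_eq_one, eq_top_iff]
  rintro x -
  obtain ⟨y, hy⟩ := (IsGalois.mem_range_algebraMap_iff_fixed (F := ℚ) (algebraMap k K x)).2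
    fun τ => hτ τ x
  refine ⟨y, (algebraMap k K).injective ?_⟩
  rw [← hy]
  exact (IsScalarTower.algebraMap_apply ℚ k K y).symm

theorem card_quotient_two {k : Type*} [Field k] [NumberField k] :
    Nat.card (𝓞 k ⧸ Ideal.span {(2 : 𝓞 k)}) = 2 ^ Module.finrank ℚ k := by
  rw [← Submodule.cardQuot_apply, ← Ideal.absNorm_apply, Ideal.absNorm_span_singleton]
  have : (2 : 𝓞 k) = algebraMap ℤ (𝓞 k) 2 := by simp
  rw [this, Algebra.norm_algebraMap, RingOfIntegers.rank]
  simp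

section Pigeonhole

theorem exists_lt_card_fiber {α β : Type*} [Finite α] [Finite β] (f : α → β) {n : ℕ}
    (h : Nat.card β * n < Nat.card α) : ∃ y, n < Nat.card {x // f x = y} := by
  classical
  have := Fintype.ofFinite α
  have := Fintype.ofFinite β
  rw [Nat.card_eq_fintype_card, Nat.card_eq_fintype_card] at h
  obtain ⟨y, hy⟩ := Fintype.exists_lt_card_fiber_of_mul_lt_card f h
  refine ⟨y, ?_⟩
  rw [Nat.card_eq_fintype_card, Fintype.card_subtype]
  exact hy

theorem exists_ne_map_eq {α β : Type*} [Finite α] [Finite β] (f : α → β)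
    (h : Nat.card β < Nat.card α) : ∃ x y, x ≠ y ∧ f x = f y := by
  by_contra! hf
  exact h.not_ge (Nat.card_le_card_of_injective f fun x y hxy => by_contra fun hne => hf x y hne hxy)

end Pigeonhole

/-- Over a layer with enough independent quadratic characters there is a further quadratic or
biquadratic unramified layer. -/
theorem IsLayer.exists_next {p : ℕ} [Fact p.Prime] (hp2 : p ≠ 2) {k K : Type} [Field k]
    [NumberField k] [IsTotallyComplex k] (hk : Module.finrank ℚ k = 2) (hred : TwoReduced k)
    [Field K] [NumberField K] [Algebra k K] {ψ : 𝓞 K →+* AlgebraicClosure (ZMod p)}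
    {g : K ≃ₐ[ℚ] K} (h : IsLayer p k K ψ g) {t : ℕ} (ht : 2 ≤ t)
    (hcl : ∀ r, t ^ 2 < 4 * r → classNumber k * 16 < 2 ^ r)
    (θ : (K ≃ₐ[k] K) →* Multiplicative (Fin t → ZMod 2)) (hθ : Function.Surjective θ) :
    ∃ (K' : Type) (_ : Field K') (_ : NumberField K') (_ : Algebra k K')
      (ψ' : 𝓞 K' →+* AlgebraicClosure (ZMod p)) (g' : K' ≃ₐ[ℚ] K')
      (θ' : (K' ≃ₐ[k] K') →* Multiplicative (Fin t → ZMod 2)),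
      IsLayer p k K' ψ' g' ∧ Function.Surjective θ' ∧
      ∃ m, 1 ≤ m ∧ m ≤ 2 ∧ Module.finrank k K' = Module.finrank k K * 2 ^ m := by
  classical
  have := h.isGalois
  have hGk : IsGalois k K := IsGalois.tower_top_of_isGalois ℚ k K
  obtain ⟨n, hn⟩ := h.card
  obtain ⟨Γ, _, _, π, r, hπ, hcen, htr, hr, hker⟩ :=
    exists_central_extension ht (IsPGroup.of_card hn) θ hθ
  have hXfin : Finite (π.ker →* ℤˣ) := inferInstance
  choose u J huJ using exists_kummerDatum (k := k) (K := K) h.unram hn hπ hcen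
  have hcard : Nat.card ((FrId k)ˣ ⧸ (toPrincipalIdeal (𝓞 k) k).range) = classNumber k := by
    rw [← Nat.card_congr (ClassGroup.equiv (R := 𝓞 k) k).toEquiv, Nat.card_eq_fintype_card]
    rfl
  have : Finite ((FrId k)ˣ ⧸ (toPrincipalIdeal (𝓞 k) k).range) :=
    Finite.of_equiv _ (ClassGroup.equiv (R := 𝓞 k) k).toEquiv
  obtain ⟨y, hy⟩ := exists_lt_card_fiber (fun f => (QuotientGroup.mk (J f) :
    (FrId k)ˣ ⧸ (toPrincipalIdeal (𝓞 k) k).range)) (n := 16) (by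
      rw [hcard]; exact (hcl r htr).trans_le hr)
  set F := {f // (QuotientGroup.mk (J f) : (FrId k)ˣ ⧸ (toPrincipalIdeal (𝓞 k) k).range) = y}
  obtain ⟨f₀⟩ : Nonempty F := (Nat.card_pos_iff.1 (Nat.zero_lt_of_lt hy)).1
  have hp0 : (2 * p : 𝓞 K) ≠ 0 := mul_ne_zero two_ne_zero
    (Nat.cast_ne_zero.2 (Fact.out : p.Prime).ne_zero)
  have hpu : ¬ IsUnit (2 * p : 𝓞 K) := fun hu => by
    have h1 := (isUnit_of_mul_isUnit_right hu).map ψ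
    rw [map_natCast, CharP.cast_eq_zero] at h1
    exact not_isUnit_zero h1
  have hW : ∀ f : F, ∃ (W : 𝓞 K) (u' : Kˣ), KummerDatum π (f.1 * f₀.1⁻¹) u' 1 ∧ (W : K) = u' ∧
      IsCoprime W (2 * p : 𝓞 K) := fun f => by
    obtain ⟨z, hz⟩ := QuotientGroup.eq.1 (f.2.trans f₀.2.symm)
    have h1 := ((huJ f).mul (huJ f₀).inv).mul (kummerDatum_map (π := π) z)
    have hJ : J f * (J f₀)⁻¹ * ((J f)⁻¹ * J f₀) = 1 := by
      rw [mul_mul_mul_comm, mul_inv_cancel, inv_mul_cancel, mul_one]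
    rw [hz, mul_one, hJ] at h1
    exact h1.exists_integral hp0 hpu
  choose W u' hWd hWu hWc using hW
  have hW2 : ∀ f, IsCoprime (W f) 2 := fun f => (hWc f).of_mul_right_left
  have hWp : ∀ f, IsCoprime (W f) (p : 𝓞 K) := fun f => (hWc f).of_mul_right_right
  choose s z hsz using fun f => exists_four_dvd_sub h.unram hred (hW2 f) (by
    rw [hWu]; exact (hWd f).exists_apply_eq hπ)
  obtain ⟨τ, hτ⟩ := exists_algEquiv_ne (k := k) (K := K) (by rw [hk]; decide)
  have hτp : ∀ f, IsCoprime (τ • W f) (p : 𝓞 K) := fun f => by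
    obtain ⟨a, b, hab⟩ := hWp f
    refine ⟨τ • a, τ • b, ?_⟩
    have h1 : τ • (p : 𝓞 K) = p := map_natCast (MulSemiringAction.toRingHom _ (𝓞 K) τ) p
    rw [← smul_one τ, ← hab, smul_add, smul_mul', smul_mul', h1]
  have hsgn : ∀ V V' : 𝓞 K, IsCoprime V p → IsCoprime V' p →
      (ψ V ^ ((p ^ 2 - 1) / 2) = 1 ↔ ψ V' ^ ((p ^ 2 - 1) / 2) = 1) →
      ψ (V * V') ^ ((p ^ 2 - 1) / 2) = 1 := fun V V' hV hV' hVV' => by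
    rw [map_mul, mul_pow]
    rcases h.pow_eq_one_or hp2 hV with h1 | h1
    · rw [h1, hVV'.1 h1, one_mul]
    · rcases h.pow_eq_one_or hp2 hV' with h2 | h2
      · rw [h2, hVV'.2 h2, one_mul]
      · rw [h1, h2, neg_mul_neg, one_mul]
  have hfin2 : Finite (𝓞 k ⧸ Ideal.span {(2 : 𝓞 k)}) := Ideal.finiteQuotientOfFreeOfNeBot _ (by
    rw [Ne, Ideal.span_singleton_eq_bot]; exact two_ne_zero)
  obtain ⟨f, f', hne, heq⟩ := exists_ne_map_eq (fun f : F =>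
    ((Ideal.Quotient.mk (Ideal.span {(2 : 𝓞 k)}) (z f),
      ψ (W f) ^ ((p ^ 2 - 1) / 2) = 1, ψ (τ • W f) ^ ((p ^ 2 - 1) / 2) = 1) :
      (𝓞 k ⧸ Ideal.span {(2 : 𝓞 k)}) × Prop × Prop)) (by
        rw [Nat.card_prod, card_quotient_two, hk, Nat.card_prod, Nat.card_eq_fintype_card,
          Fintype.card_prop]
        exact hy)
  obtain ⟨hz, h1, h2⟩ : _ = _ ∧ _ = _ ∧ _ = _ :=
    ⟨congrArg Prod.fst heq, congrArg (fun x => x.2.1) heq, congrArg (fun x => x.2.2) heq⟩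
  beta_reduce at hz h1 h2
  rw [Ideal.Quotient.eq, Ideal.mem_span_singleton] at hz
  have hd := (hWd f).mul (hWd f')
  rw [mul_one] at hd
  have hWW : ((W f * W f' : 𝓞 K) : K) = (u' f * u' f' : Kˣ) := by
    rw [Units.val_mul, ← hWu, ← hWu]
    exact map_mul (algebraMap (𝓞 K) K) _ _
  have hsq : SqrtUnram (W f * W f') := by
    refine ⟨?_, exists_four_dvd_mul_sub (hsz f) (hsz f') hz, (hW2 f).mul_left (hW2 f')⟩
    rw [hWW]
    exact hd.exists_mul_mul_spanSingleton
  obtain ⟨K', _, _, _, _, _, ψ', g', hL, ⟨q, hq⟩, m, hm, hmK⟩ := h.exists_step hp2 hk hsq (by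
    rw [hWW]; exact hd.exists_apply_eq hπ) hτ (hsgn _ _ (hWp f) (hWp f') (iff_of_eq h1)) (by
      rw [smul_mul']; exact hsgn _ _ (hτp f) (hτp f') (iff_of_eq h2))
  refine ⟨K', inferInstance, inferInstance, inferInstance, ψ', g',
    θ.comp (AlgEquiv.restrictNormalHom K), hL, ?_, m, ?_, hm, ?_⟩
  · have := hL.isGalois
    have : IsGalois k K' := IsGalois.tower_top_of_isGalois ℚ k K'
    exact hθ.comp (AlgEquiv.restrictNormalHom_surjective K')
  · rw [Nat.one_le_iff_ne_zero]
    rintro rfl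
    rw [pow_zero, ← Subalgebra.bot_eq_top_iff_finrank_eq_one, eq_top_iff] at hmK
    obtain ⟨q', rfl⟩ := hmK (x := q) trivial
    rw [hWW] at hq
    have hq' : ((u' f * u' f' : Kˣ) : K) = q' * q' := by
      refine (algebraMap K K').injective (hq.trans ?_)
      rw [map_mul]
      rfl
    have hq0 : q' ≠ 0 := by
      rintro rfl
      exact Units.ne_zero _ (hq'.trans (mul_zero 0))
    have hu : u' f * u' f' = (Units.mk0 q' hq0) ^ 2 := Units.ext (by
      rw [hq', pow_two]; rfl)
    rw [hu] at hd
    have hf := hd.not_sq hker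
    refine hne (Subtype.ext (eq_of_mul_eq_one_of_int_units ?_))
    rw [mul_mul_mul_comm] at hf
    have h0 : f₀.1⁻¹ * f₀.1⁻¹ = 1 := by
      ext v : 1
      exact Int.units_mul_self _
    rwa [h0, mul_one] at hf
  · rw [← Module.finrank_mul_finrank k K K', hmK]

end NextLayer

section QuadraticField

open NumberField nonZeroDivisors FractionalIdeal

theorem exists_int_of_isIntegral {K : Type*} [Field K] [CharZero K] {q : ℚ}
    (h : IsIntegral ℤ (q : K)) : ∃ n : ℤ, q = n := by
  have h1 : IsIntegral ℤ q := by
    rw [← isIntegral_algebraMap_iff (algebraMap ℚ K).injective]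
    simpa using h
  obtain ⟨n, hn⟩ := IsIntegrallyClosed.isIntegral_iff.1 h1
  exact ⟨n, hn.symm⟩

theorem even_of_two_dvd {K : Type*} [Field K] [NumberField K] {n : ℤ} (h : (2 : 𝓞 K) ∣ n) :
    2 ∣ n := by
  obtain ⟨x, hx⟩ := h
  have h1 : ((n / 2 : ℚ) : K) = x := by
    have := congrArg (algebraMap (𝓞 K) K) hx
    rw [map_intCast, map_mul, map_ofNat] at this
    push_cast
    rw [this]
    field_simp
  obtain ⟨m, hm⟩ := exists_int_of_isIntegral (K := K) (by rw [h1]; exact x.isIntegral_coe)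
  refine ⟨m, ?_⟩
  have : (n : ℚ) = 2 * m := by rw [← hm]; field_simp
  exact_mod_cast this

variable {k : Type} [Field k] [NumberField k] {a : ℤ} {s : k}

theorem exists_rat_add_mul (hk : Module.finrank ℚ k = 2) (hs : s ^ 2 = a) (ha : a < 0) (x : k) :
    ∃ u v : ℚ, x = u + v * s := by
  have hli : LinearIndependent ℚ ![1, s] := by
    rw [LinearIndependent.pair_iff' one_ne_zero]
    intro q hq
    rw [← hq, Algebra.smul_def, mul_one] at hs
    have h1 : q ^ 2 = a := by
      refine (algebraMap ℚ k).injective ?_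
      rw [map_pow, hs]; simp
    have h2 : (a : ℚ) < 0 := by exact_mod_cast ha
    nlinarith [sq_nonneg q]
  have hsp := hli.span_eq_top_of_card_eq_finrank' (by rw [Fintype.card_fin, hk])
  have hx : x ∈ Submodule.span ℚ (Set.range ![1, s]) := hsp ▸ trivial
  rw [Matrix.range_cons, Matrix.range_cons, Matrix.range_empty, Set.union_empty,
    ← Set.insert_eq, Submodule.mem_span_pair] at hx
  obtain ⟨u, v, rfl⟩ := hx
  exact ⟨u, v, by simp [Algebra.smul_def]⟩

theorem exists_conj (hk : Module.finrank ℚ k = 2) (hs : s ^ 2 = a) (ha : a < 0) :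
    ∃ σ : k ≃ₐ[ℚ] k, σ s = -s ∧ ∀ τ, τ = 1 ∨ τ = σ := by
  have hk' : Algebra.IsQuadraticExtension ℚ k := ⟨hk⟩
  have hcard : Nat.card (k ≃ₐ[ℚ] k) = 2 := (IsGalois.card_aut_eq_finrank ℚ k).trans hk
  obtain ⟨σ, hσ, hall⟩ := (Nat.card_eq_two_iff' (1 : k ≃ₐ[ℚ] k)).1 hcard
  refine ⟨σ, ?_, fun τ => or_iff_not_imp_left.2 fun h => hall τ h⟩
  have h1 : σ s ^ 2 = s ^ 2 := by rw [← map_pow, hs, map_intCast]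
  refine (sq_eq_sq_iff_eq_or_eq_neg.1 h1).resolve_left fun h2 => hσ ?_
  ext x
  obtain ⟨u, v, rfl⟩ := exists_rat_add_mul hk hs ha x
  rw [map_add, map_mul, h2, map_ratCast, map_ratCast]
  rfl

theorem exists_two_mul_eq (hk : Module.finrank ℚ k = 2) (hs : s ^ 2 = a) (ha : a < 0) (x : 𝓞 k) :
    ∃ m l : ℤ, 2 * a * (x : k) = m * a + l * s := by
  obtain ⟨σ, hσ, -⟩ := exists_conj hk hs ha
  obtain ⟨u, v, hx⟩ := exists_rat_add_mul hk hs ha (x : k)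
  have hsi : IsIntegral ℤ s := IsIntegral.of_pow two_pos (by rw [hs]; exact isIntegral_algebraMap)
  have hxi : IsIntegral ℤ (x : k) := x.isIntegral_coe
  obtain ⟨m, hm⟩ := exists_int_of_isIntegral (K := k) (q := 2 * u) (by
    have : ((2 * u : ℚ) : k) = x + σ x := by
      rw [hx, map_add, map_mul, hσ, map_ratCast, map_ratCast]; push_cast; ring
    rw [this]
    exact hxi.add (hxi.map (σ.toAlgHom.restrictScalars ℤ)))
  obtain ⟨l, hl⟩ := exists_int_of_isIntegral (K := k) (q := 2 * v * a) (by
    have : ((2 * v * a : ℚ) : k) = s * x + σ (s * x) := by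
      rw [hx, map_mul, map_add, map_mul, hσ, map_ratCast, map_ratCast]; push_cast
      rw [← hs]; ring
    rw [this]
    exact (hsi.mul hxi).add ((hsi.mul hxi).map (σ.toAlgHom.restrictScalars ℤ)))
  refine ⟨m, l, ?_⟩
  have hm' : (m : k) = 2 * u := by exact_mod_cast congrArg (Rat.cast (K := k)) hm.symm
  have hl' : (l : k) = 2 * v * a := by exact_mod_cast congrArg (Rat.cast (K := k)) hl.symm
  rw [hm', hl', hx]
  ring

theorem twoReduced_of_sq (hk : Module.finrank ℚ k = 2) (hs : s ^ 2 = a) (ha : a < 0)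
    (ha4 : a % 4 = 1) : TwoReduced k := by
  intro x hx
  have hsi : IsIntegral ℤ s := IsIntegral.of_pow two_pos (by rw [hs]; exact isIntegral_algebraMap)
  obtain ⟨b, hb⟩ : ∃ b, a = 4 * b + 1 := ⟨a / 4, by omega⟩
  let S : 𝓞 k := ⟨s, hsi⟩
  have hS : S ^ 2 = a := RingOfIntegers.ext (by
    change s ^ 2 = algebraMap (𝓞 k) k a
    rw [map_intCast, hs])
  have hωi : IsIntegral ℤ ((1 + s) / 2) := by
    refine ⟨Polynomial.X ^ 2 - Polynomial.X - Polynomial.C b, by monicity!, ?_⟩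
    rw [hb] at hs
    push_cast at hs
    simp only [Polynomial.eval₂_sub, Polynomial.eval₂_X_pow, Polynomial.eval₂_X,
      Polynomial.eval₂_C, algebraMap_int_eq, Int.coe_castRingHom]
    field_simp
    linear_combination hs
  let ω : 𝓞 k := ⟨_, hωi⟩
  have hω : 2 * ω = 1 + S := RingOfIntegers.ext (by
    change 2 * ((1 + s) / 2) = 1 + s
    field_simp)
  obtain ⟨m, l, hml⟩ := exists_two_mul_eq hk hs ha x
  have hml' : 2 * (a * x) = m * a + l * S := RingOfIntegers.ext (by
    simp only [map_mul, map_add, map_intCast, map_ofNat]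
    rw [← mul_assoc, hml]
    rfl)
  suffices h2 : 2 ∣ (a * x : 𝓞 k) by
    have : x = a * x - 2 * (2 * b * x) := by rw [hb]; push_cast; ring
    rw [this]
    exact dvd_sub h2 ⟨_, rfl⟩
  have hy : 2 ∣ (a * x : 𝓞 k) ^ 2 := by rw [mul_pow]; exact hx.mul_left _
  generalize (a * x : 𝓞 k) = y at *
  obtain ⟨w, hw⟩ := hy
  obtain ⟨N, hN⟩ := exists_int_of_isIntegral (K := k) (q := (m ^ 2 * a ^ 2 - l ^ 2 * a) / 4) (by
    have : (((m ^ 2 * a ^ 2 - l ^ 2 * a) / 4 : ℚ) : k) = ((m * a * y - y ^ 2 : 𝓞 k) : k) := by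
      have h1 : 2 * (y : k) = m * a + l * s := by
        have := congrArg (algebraMap (𝓞 k) k) hml'
        simp only [map_mul, map_add, map_intCast, map_ofNat] at this
        exact this
      simp only [map_sub, map_mul, map_pow, map_intCast]
      push_cast
      field_simp
      linear_combination (2 * (y : k) - m * a + l * s) * h1 + l ^ 2 * hs
    rw [this]
    exact RingOfIntegers.isIntegral_coe _)
  have hN' : 4 * N = m ^ 2 * a ^ 2 - l ^ 2 * a := by
    have : (4 * N : ℚ) = m ^ 2 * a ^ 2 - l ^ 2 * a := by rw [← hN]; field_simp
    exact_mod_cast this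
  have hyN : y ^ 2 = m * a * y - N := by
    have h1 : (4 : 𝓞 k) * (y ^ 2 - (m * a * y - N)) = 0 := by
      have h2 := congrArg (Int.cast (R := 𝓞 k)) hN'
      push_cast at h2
      linear_combination h2 + (2 * y - m * a + l * S) * hml' + l ^ 2 * hS
    have h2 := (mul_eq_zero.1 h1).resolve_left (by norm_num)
    linear_combination h2
  have hNe : 2 ∣ N := by
    have h1 : (2 : 𝓞 k) ∣ ((N ^ 2 : ℤ) : 𝓞 k) := by
      refine ⟨m ^ 2 * a ^ 2 * w - 2 * w ^ 2 - 2 * w * N, ?_⟩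
      push_cast
      linear_combination (N + y ^ 2 + m * a * y) * hyN +
        (m ^ 2 * a ^ 2 - 2 * N - y ^ 2 - 2 * w) * hw
    exact Int.prime_two.dvd_of_dvd_pow (even_of_two_dvd h1)
  obtain ⟨N', rfl⟩ := hNe
  rcases Int.even_or_odd' m with ⟨m', rfl | rfl⟩
  · have hl : 2 ∣ l := by
      have h1 : 2 ∣ l ^ 2 := ⟨2 * m' ^ 2 * a ^ 2 - 4 * N' - 2 * b * l ^ 2, by
        linear_combination hN' - l ^ 2 * hb⟩
      exact Int.prime_two.dvd_of_dvd_pow h1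
    obtain ⟨l', rfl⟩ := hl
    obtain ⟨c, hc⟩ : 2 ∣ m' * a - l' := by
      have h1 : 2 ∣ (m' * a - l') ^ 2 := ⟨N' - m' * a * l' + l' ^ 2 + 2 * b * l' ^ 2, by
        have : 4 * (m' * a - l') ^ 2 = 4 * (2 * (N' - m' * a * l' + l' ^ 2 + 2 * b * l' ^ 2)) := by
          linear_combination -hN' + 4 * l' ^ 2 * hb
        omega⟩
      exact Int.prime_two.dvd_of_dvd_pow h1
    refine ⟨c + l' * ω, ?_⟩
    have h1 : 2 * (y - (2 * (c + l' * ω))) = 0 := by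
      have h2 := congrArg (Int.cast (R := 𝓞 k)) hc
      push_cast at h2 hml'
      linear_combination hml' + 2 * h2 - 2 * l' * hω
    exact sub_eq_zero.1 ((mul_eq_zero.1 h1).resolve_left two_ne_zero)
  · refine ⟨w + N' - (m' * a + 2 * b) * y, ?_⟩
    have h2 := congrArg (Int.cast (R := 𝓞 k)) hb
    push_cast at h2 hyN
    linear_combination hw - hyN - y * h2

end QuadraticField

section ClassNumberBound

open NumberField nonZeroDivisors

variable {k : Type} [Field k] [NumberField k]

theorem classNumber_le_pow {B : ℕ} (hk : Module.finrank ℚ k = 2)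
    (hB : ∀ C : ClassGroup (𝓞 k), ∃ I : (Ideal (𝓞 k))⁰, ClassGroup.mk0 I = C ∧
      Ideal.absNorm (I : Ideal (𝓞 k)) ≤ B) : classNumber k ≤ B ^ 3 := by
  have hne : ∀ m : Fin B, (((m + 1 : ℕ) : 𝓞 k)) ≠ 0 := fun m => Nat.cast_ne_zero.2 (by omega)
  have hfin : ∀ m : Fin B, Finite (𝓞 k ⧸ Ideal.span {(((m + 1 : ℕ) : 𝓞 k))}) := fun m =>
    Ideal.finiteQuotientOfFreeOfNeBot _ (by rw [Ne, Ideal.span_singleton_eq_bot]; exact hne m)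
  have hcard : ∀ m : Fin B, Nat.card (𝓞 k ⧸ Ideal.span {(((m + 1 : ℕ) : 𝓞 k))}) ≤ B ^ 2 :=
      fun m => by
    rw [← Submodule.cardQuot_apply, ← Ideal.absNorm_apply, Ideal.absNorm_span_singleton]
    have : (((m + 1 : ℕ) : 𝓞 k)) = algebraMap ℤ (𝓞 k) ((m + 1 : ℕ) : ℤ) := by simp
    rw [this, Algebra.norm_algebraMap, RingOfIntegers.rank, hk, Int.natAbs_pow, Int.natAbs_natCast]
    exact Nat.pow_le_pow_left (by omega) 2
  let F : (Σ m : Fin B, 𝓞 k ⧸ Ideal.span {(((m + 1 : ℕ) : 𝓞 k))}) → ClassGroup (𝓞 k) :=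
    fun x => ClassGroup.mk0 ⟨Ideal.span {(((x.1 + 1 : ℕ) : 𝓞 k))} ⊔ Ideal.span {x.2.out},
      mem_nonZeroDivisors_of_ne_zero fun h => hne x.1 (by
        rw [Ideal.zero_eq_bot, sup_eq_bot_iff, Ideal.span_singleton_eq_bot] at h
        exact h.1)⟩
  have hF : Function.Surjective F := fun C => by
    obtain ⟨I, hIC, hIB⟩ := hB C
    have hn0 : Ideal.absNorm (I : Ideal (𝓞 k)) ≠ 0 :=
      Ideal.absNorm_ne_zero_iff_mem_nonZeroDivisors.2 I.2
    obtain ⟨m, hm⟩ := Nat.exists_eq_succ_of_ne_zero hn0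
    rw [Nat.succ_eq_add_one] at hm
    have hmB : m < B := by omega
    have hmem : ((m + 1 : ℕ) : 𝓞 k) ∈ (I : Ideal (𝓞 k)) := hm ▸ Ideal.absNorm_mem _
    obtain ⟨α, hα⟩ := IsDedekindDomain.exists_sup_span_eq
      (I := Ideal.span {((m + 1 : ℕ) : 𝓞 k)}) (J := I)
      ((Ideal.span_singleton_le_iff_mem _).2 hmem)
      (by rw [Ne, Ideal.zero_eq_bot, Ideal.span_singleton_eq_bot]; exact hne ⟨m, hmB⟩)
    refine ⟨⟨⟨m, hmB⟩, Ideal.Quotient.mk _ α⟩, ?_⟩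
    rw [← hIC]
    refine congrArg ClassGroup.mk0 (Subtype.ext ?_)
    change Ideal.span {((m + 1 : ℕ) : 𝓞 k)} ⊔ Ideal.span {(Ideal.Quotient.mk
      (Ideal.span {((m + 1 : ℕ) : 𝓞 k)}) α).out} = _
    rw [← hα]
    have h1 : (Ideal.Quotient.mk (Ideal.span {((m + 1 : ℕ) : 𝓞 k)}) α).out - α ∈
        Ideal.span {((m + 1 : ℕ) : 𝓞 k)} := by
      rw [← Ideal.Quotient.eq]
      exact Quotient.out_eq _
    generalize (Ideal.Quotient.mk (Ideal.span {((m + 1 : ℕ) : 𝓞 k)}) α).out = β at h1 ⊢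
    refine le_antisymm (sup_le le_sup_left ?_) (sup_le le_sup_left ?_)
    · rw [Ideal.span_singleton_le_iff_mem, ← sub_add_cancel β α]
      exact add_mem (Ideal.mem_sup_left h1) (Ideal.mem_sup_right (Ideal.mem_span_singleton_self _))
    · rw [Ideal.span_singleton_le_iff_mem, ← sub_sub_self β α]
      exact sub_mem (Ideal.mem_sup_right (Ideal.mem_span_singleton_self _)) (Ideal.mem_sup_left h1)
  calc classNumber k = Nat.card (ClassGroup (𝓞 k)) := Nat.card_eq_fintype_card.symm
    _ ≤ Nat.card (Σ m : Fin B, 𝓞 k ⧸ Ideal.span {(((m + 1 : ℕ) : 𝓞 k))}) :=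
      Nat.card_le_card_of_surjective F hF
    _ = ∑ m : Fin B, Nat.card (𝓞 k ⧸ Ideal.span {(((m + 1 : ℕ) : 𝓞 k))}) := Nat.card_sigma
    _ ≤ ∑ m : Fin B, B ^ 2 := Finset.sum_le_sum fun m _ => hcard m
    _ = B ^ 3 := by simp; ring

variable {a : ℤ} {s : k}

theorem abs_discr_le_of_sq (hk : Module.finrank ℚ k = 2) (hs : s ^ 2 = a) (ha : a < 0) :
    |discr k| ≤ -4 * a := by
  obtain ⟨σ, hσ, -⟩ := exists_conj hk hs ha
  have hsi : IsIntegral ℤ s := IsIntegral.of_pow two_pos (by rw [hs]; exact isIntegral_algebraMap)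
  let S : 𝓞 k := ⟨s, hsi⟩
  have hS : S * S = algebraMap ℤ (𝓞 k) a := RingOfIntegers.ext (by
    change s * s = algebraMap (𝓞 k) k (algebraMap ℤ (𝓞 k) a)
    rw [← pow_two, hs]; simp)
  have htr : ∀ n : ℤ, Algebra.trace ℤ (𝓞 k) (algebraMap ℤ (𝓞 k) n) = 2 * n := fun n => by
    rw [Algebra.trace_algebraMap, RingOfIntegers.rank, hk]
    simp
  have htS : Algebra.trace ℤ (𝓞 k) S = 0 := by
    have h1 := Algebra.trace_eq_of_algEquiv σ s
    rw [hσ, map_neg] at h1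
    have h2 : Algebra.trace ℚ k s = 0 := by linarith
    have h3 := Algebra.coe_trace_int S
    have h4 : ((S : 𝓞 k) : k) = s := rfl
    rw [h4, h2] at h3
    exact_mod_cast h3
  let e : Module.Free.ChooseBasisIndex ℤ (𝓞 k) ≃ Fin 2 := Fintype.equivOfCardEq (by
    rw [← Module.finrank_eq_card_chooseBasisIndex, RingOfIntegers.rank, hk, Fintype.card_fin])
  let b := (RingOfIntegers.basis k).reindex e
  have hd := Algebra.discr_of_matrix_vecMul b (b.toMatrix ![1, S])
  rw [Module.Basis.toMatrix_map_vecMul, discr_eq_discr] at hd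
  have hB : Algebra.discr ℤ ![1, S] = 4 * a := by
    rw [Algebra.discr_def, Matrix.det_fin_two]
    simp only [Algebra.traceMatrix_apply, Algebra.traceForm_apply, Matrix.cons_val_zero,
      Matrix.cons_val_one, mul_one, one_mul]
    rw [hS, htr, htS, ← map_one (algebraMap ℤ (𝓞 k)), htr]
    ring
  rw [hB] at hd
  have h1 : 1 ≤ (b.toMatrix ![1, S]).det ^ 2 := by
    rcases (sq_nonneg (b.toMatrix ![1, S]).det).eq_or_lt with h | h
    · rw [← h, zero_mul] at hd
      omega
    · exact h
  have h2 : discr k < 0 := by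
    by_contra h
    have := mul_nonneg (sq_nonneg (b.toMatrix ![1, S]).det) (not_lt.1 h)
    omega
  rw [abs_of_neg h2]
  nlinarith

theorem classNumber_sq_le [IsTotallyComplex k] (hk : Module.finrank ℚ k = 2) (hs : s ^ 2 = a)
    (ha : a < 0) : (classNumber k : ℤ) ^ 2 ≤ (-4 * a) ^ 3 := by
  have hc : InfinitePlace.nrComplexPlaces k = 1 := by
    have := IsTotallyComplex.finrank (K := k)
    omega
  have hM : (4 / Real.pi) ^ InfinitePlace.nrComplexPlaces k * ((Module.finrank ℚ k).factorial /
      (Module.finrank ℚ k) ^ (Module.finrank ℚ k) * √|discr k|) ≤ √(-4 * a : ℤ) := by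
    rw [hc, hk]
    have h1 : √|(discr k : ℝ)| ≤ √(-4 * a : ℤ) := Real.sqrt_le_sqrt (by
      exact_mod_cast abs_discr_le_of_sq hk hs ha)
    have h2 : 4 / Real.pi ≤ 2 := by
      rw [div_le_iff₀ Real.pi_pos]; linarith [Real.pi_gt_three]
    have h3 : 0 ≤ √|(discr k : ℝ)| := Real.sqrt_nonneg _
    norm_num [Nat.factorial]
    push_cast at h1
    norm_num at h1
    nlinarith
  have h := classNumber_le_pow (k := k) (B := ⌊√(-4 * a : ℤ)⌋₊) hk fun C => by
    obtain ⟨I, hI, hIM⟩ := exists_ideal_in_class_of_norm_le C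
    exact ⟨I, hI, Nat.le_floor (hIM.trans hM)⟩
  have hB : ((⌊√(-4 * a : ℤ)⌋₊ : ℕ) : ℤ) ^ 2 ≤ -4 * a := by
    have h1 : (⌊√(-4 * a : ℤ)⌋₊ : ℝ) ^ 2 ≤ (-4 * a : ℤ) := by
      refine (pow_le_pow_left₀ (Nat.cast_nonneg _) (Nat.floor_le (Real.sqrt_nonneg _)) 2).trans ?_
      rw [Real.sq_sqrt]
      exact_mod_cast (by omega : 0 ≤ -4 * a)
    exact_mod_cast h1
  have h' : (classNumber k : ℤ) ≤ ((⌊√(-4 * a : ℤ)⌋₊ : ℕ) : ℤ) ^ 3 := by exact_mod_cast h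
  calc (classNumber k : ℤ) ^ 2 ≤ (((⌊√(-4 * a : ℤ)⌋₊ : ℕ) : ℤ) ^ 3) ^ 2 := by gcongr
    _ = (((⌊√(-4 * a : ℤ)⌋₊ : ℕ) : ℤ) ^ 2) ^ 3 := by ring
    _ ≤ _ := by gcongr

end ClassNumberBound

section BaseField

open NumberField nonZeroDivisors FractionalIdeal

theorem exists_imag_quadratic {a : ℤ} (ha : a < 0) :
    ∃ (k : Type) (_ : Field k) (_ : NumberField k) (_ : IsTotallyComplex k) (s : k),
      Module.finrank ℚ k = 2 ∧ s ^ 2 = a := by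
  have hirr : Irreducible (Polynomial.X ^ 2 - Polynomial.C (a : ℚ)) := by
    refine X_pow_sub_C_irreducible_of_prime Nat.prime_two fun b hb => ?_
    have : (a : ℚ) < 0 := by exact_mod_cast ha
    nlinarith [sq_nonneg b]
  have hne : Polynomial.X ^ 2 - Polynomial.C (a : ℚ) ≠ 0 := hirr.ne_zero
  let k := AdjoinRoot (Polynomial.X ^ 2 - Polynomial.C (a : ℚ))
  have : Fact (Irreducible (Polynomial.X ^ 2 - Polynomial.C (a : ℚ))) := ⟨hirr⟩
  have hfin : Module.Finite ℚ k := (AdjoinRoot.powerBasis hne).finite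
  have hz : CharZero k := charZero_of_injective_algebraMap (algebraMap ℚ k).injective
  have hnf : NumberField k := ⟨⟩
  have hs : (AdjoinRoot.root (Polynomial.X ^ 2 - Polynomial.C (a : ℚ)) : k) ^ 2 = a := by
    have := AdjoinRoot.eval₂_root (Polynomial.X ^ 2 - Polynomial.C (a : ℚ))
    rw [Polynomial.eval₂_sub, Polynomial.eval₂_X_pow, Polynomial.eval₂_C, sub_eq_zero] at this
    exact this.trans (map_intCast (algebraMap ℚ k) a)
  refine ⟨k, inferInstance, hnf, ⟨fun v => ?_⟩, _, ?_, hs⟩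
  · rw [← InfinitePlace.not_isReal_iff_isComplex]
    intro hv
    have h1 := congrArg (InfinitePlace.embedding_of_isReal hv) hs
    have h1 := h1.trans (map_intCast _ a)
    rw [map_pow] at h1
    have : (a : ℝ) < 0 := by exact_mod_cast ha
    nlinarith [sq_nonneg (InfinitePlace.embedding_of_isReal hv
      (AdjoinRoot.root (Polynomial.X ^ 2 - Polynomial.C (a : ℚ))))]
  · rw [(AdjoinRoot.powerBasis hne).finrank, AdjoinRoot.powerBasis_dim,
      Polynomial.natDegree_X_pow_sub_C]

theorem sqrtUnram_of_sq_eq_mul {K : Type*} [Field K] [NumberField K] {q : ℤ} (hq : q % 4 = 1)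
    {b : ℤ} (hb : IsCoprime q b) {S : 𝓞 K} (hS : S ^ 2 = q * b) : SqrtUnram (q : 𝓞 K) := by
  have hq0 : q ≠ 0 := by omega
  have hqK : ((q : 𝓞 K) : K) ≠ 0 := by
    rw [show ((q : 𝓞 K) : K) = q from map_intCast (algebraMap (𝓞 K) K) q]
    exact_mod_cast hq0
  refine ⟨?_, ⟨1, ?_⟩, ?_⟩
  · let J : Ideal (𝓞 K) := Ideal.span {(q : 𝓞 K), S}
    have hJ : J * J = Ideal.span {(q : 𝓞 K)} := by
      refine le_antisymm ?_ ?_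
      · rw [Ideal.span_pair_mul_span_pair, Ideal.span_le]
        rintro x (rfl | rfl | rfl | rfl) <;> rw [SetLike.mem_coe, Ideal.mem_span_singleton]
        · exact Dvd.intro _ rfl
        · exact Dvd.intro _ rfl
        · exact Dvd.intro_left _ rfl
        · rw [← pow_two, hS]
          exact Dvd.intro _ rfl
      · obtain ⟨u, v, huv⟩ := hb
        rw [Ideal.span_singleton_le_iff_mem]
        have h1 : (q : 𝓞 K) = u * (q * q) + v * (S * S) := by
          rw [← pow_two S, hS]
          have := congrArg (fun x : ℤ => ((q * x : ℤ) : 𝓞 K)) huv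
          push_cast at this
          linear_combination -this
        have hqJ : (q : 𝓞 K) ∈ J := Ideal.subset_span (Set.mem_insert _ _)
        have hSJ : S ∈ J := Ideal.subset_span (Set.mem_insert_of_mem _ rfl)
        rw [h1]
        exact add_mem (Ideal.mul_mem_left _ _ (Ideal.mul_mem_mul hqJ hqJ))
          (Ideal.mul_mem_left _ _ (Ideal.mul_mem_mul hSJ hSJ))
    have hJ' : (J : FrId K) * J = spanSingleton (𝓞 K)⁰ ((q : 𝓞 K) : K) := by
      rw [← coeIdeal_mul, hJ, coeIdeal_span_singleton]
    refine ⟨(J : FrId K)⁻¹, ?_⟩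
    have hne : (J : FrId K) ≠ 0 := fun h => by
      rw [h, zero_mul, eq_comm, spanSingleton_eq_zero_iff] at hJ'
      exact hqK hJ'
    rw [← hJ']
    field_simp
  · obtain ⟨m, hm⟩ : (4 : ℤ) ∣ q - 1 := by omega
    refine ⟨m, ?_⟩
    rw [one_pow]
    exact_mod_cast congrArg (Int.cast : ℤ → 𝓞 K) hm
  · have : IsCoprime q 2 := ⟨1, -(q / 2), by omega⟩
    simpa using this.map (Int.castRingHom (𝓞 K))

theorem pow_half_eq_one {p : ℕ} [Fact p.Prime] (hp2 : p ≠ 2) {q : ℤ} (hq : (q : ZMod p) ≠ 0) :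
    (q : AlgebraicClosure (ZMod p)) ^ ((p ^ 2 - 1) / 2) = 1 := by
  have hodd := (Fact.out : p.Prime).eq_two_or_odd'.resolve_left hp2
  obtain ⟨m, hm⟩ := hodd
  have h1 : (p ^ 2 - 1) / 2 = (p - 1) * (m + 1) := by
    have : p ^ 2 - 1 = 2 * ((p - 1) * (m + 1)) := by
      have h2 : p - 1 = 2 * m := by omega
      have h3 : p ^ 2 = 4 * m ^ 2 + 4 * m + 1 := by rw [hm]; ring
      rw [h2, h3, Nat.add_sub_cancel]; ring
    omega
  have h2 := congrArg (algebraMap (ZMod p) (AlgebraicClosure (ZMod p)))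
    (ZMod.pow_card_sub_one_eq_one hq)
  rw [map_pow, map_intCast, map_one] at h2
  rw [h1, pow_mul, h2, one_pow]

theorem exists_isLayer_sqrt {p : ℕ} [Fact p.Prime] (hp2 : p ≠ 2) {k : Type} [Field k]
    [NumberField k] (hk : Module.finrank ℚ k = 2) (S : Finset ℕ)
    (hS : ∀ q ∈ S, q % 4 = 1 ∧ ∃ (b : ℤ) (x : 𝓞 k), IsCoprime (q : ℤ) b ∧ x ^ 2 = (q : ℤ) * b)
    (hp : ∀ q ∈ S, ((q : ℤ) : ZMod p) ≠ 0) :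
    ∃ (K : Type) (_ : Field K) (_ : NumberField K) (_ : Algebra k K) (ψ : _) (g : _),
      IsLayer p k K ψ g ∧ (∀ q ∈ S, IsSquare (q : K)) ∧
      ∃ n ≤ 2 * S.card, Module.finrank k K = 2 ^ n := by
  classical
  induction S using Finset.induction_on with
  | empty =>
    obtain ⟨ψ, g, h⟩ := exists_isLayer_self (p := p) hk
    exact ⟨k, inferInstance, inferInstance, inferInstance, ψ, g, h, by simp, 0, by simp, by simp⟩
  | insert q S hq ih =>
    obtain ⟨K, _, _, _, ψ, g, h, hsq, n, hn, hnK⟩ := ih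
      (fun q hq => hS q (Finset.mem_insert_of_mem hq))
      (fun q hq => hp q (Finset.mem_insert_of_mem hq))
    have := h.isGalois
    obtain ⟨τ, x, hτ⟩ := exists_algEquiv_ne (k := k) (K := K) (by omega)
    have hsurj : SqrtUnram ((q : ℤ) : 𝓞 K) := by
      obtain ⟨hq4, b, x, hb, hx⟩ := hS q (Finset.mem_insert_self _ _)
      refine sqrtUnram_of_sq_eq_mul (by omega) hb (S := algebraMap (𝓞 k) (𝓞 K) x) ?_
      rw [← map_pow, hx, map_mul, map_intCast, map_intCast]
    have hone := pow_half_eq_one hp2 (hp q (Finset.mem_insert_self _ _))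
    have hcoe : (((q : ℤ) : 𝓞 K) : K) = (q : K) := by
      rw [Int.cast_natCast]; exact map_natCast (algebraMap (𝓞 K) K) q
    obtain ⟨K', _, _, _, _, _, ψ', g', h', hs, m, hm, hmK⟩ := h.exists_step hp2 hk hsurj
      (fun γ => ⟨1, by rw [hcoe, map_natCast, one_pow, mul_one]⟩) ⟨x, hτ⟩
      (by rw [map_intCast]; exact hone)
      (by rw [show τ • ((q : ℤ) : 𝓞 K) = ((q : ℤ) : 𝓞 K) from
            map_intCast (MulSemiringAction.toRingHom (K ≃ₐ[ℚ] K) (𝓞 K) τ) _, map_intCast]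
          exact hone)
    refine ⟨K', _, _, _, ψ', g', h', fun r hr => ?_, n + m, ?_, ?_⟩
    · rcases Finset.mem_insert.1 hr with rfl | hr
      · rw [hcoe, map_natCast] at hs
        exact hs
      · have := (hsq r hr).map (algebraMap K K')
        rwa [map_natCast] at this
    · rw [Finset.card_insert_of_notMem hq]; omega
    · rw [← Module.finrank_mul_finrank k K K', hnK, hmK, pow_add]

theorem exists_hom_sqrt_surjective {k K ι : Type*} [Field k] [Field K] [CharZero K] [Algebra k K]
    [FiniteDimensional k K] [IsGalois k K] [Fintype ι] {r : ι → K} {q : ι → ℕ} (hr : ∀ i, r i ^ 2 = q i)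
    (hq : ∀ i, q i ≠ 0) (hS : ∀ T : Finset ι, T.Nonempty → ∀ x : k, x ^ 2 ≠ ∏ i ∈ T, q i) :
    ∃ θ : (K ≃ₐ[k] K) →* Multiplicative (ι → ZMod 2), Function.Surjective θ := by
  classical
  have hr0 : ∀ i, r i ≠ 0 := fun i h => by
    have := hr i
    rw [h, zero_pow two_ne_zero] at this
    exact hq i (by exact_mod_cast this.symm)
  have hne : ∀ i, -r i ≠ r i := fun i h => hr0 i (self_eq_neg.1 h.symm)
  have hσ : ∀ (σ : K ≃ₐ[k] K) i, σ (r i) = r i ∨ σ (r i) = -r i := fun σ i =>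
    sq_eq_sq_iff_eq_or_eq_neg.1 (by rw [← map_pow, hr, map_natCast])
  let χ : (K ≃ₐ[k] K) → ι → ZMod 2 := fun σ i => if σ (r i) = r i then 0 else 1
  have hχ : ∀ σ i, σ (r i) = (-1) ^ (χ σ i).val * r i := fun σ i => by
    rcases hσ σ i with h | h
    · simp [χ, h]
    · simp [χ, h, hne i, ZMod.val_one]
  have hmul : ∀ σ τ, χ (σ * τ) = χ σ + χ τ := fun σ τ => by
    ext i
    rcases hσ σ i with h | h <;> rcases hσ τ i with h' | h' <;>
      simp [χ, h, h', hne i, AlgEquiv.mul_apply]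
    decide
  let θ : (K ≃ₐ[k] K) →* Multiplicative (ι → ZMod 2) := MonoidHom.mk'
    (fun σ => Multiplicative.ofAdd (χ σ)) fun σ τ => congrArg Multiplicative.ofAdd (hmul σ τ)
  refine ⟨θ, ?_⟩
  let V : Submodule (ZMod 2) (ι → ZMod 2) := AddSubgroup.toZModSubmodule 2
    (MonoidHom.toAdditiveLeft θ).range
  have hV : V = ⊤ := by
    by_contra hV
    obtain ⟨φ, hφ, hle⟩ := Submodule.exists_le_ker_of_lt_top V (lt_top_iff_ne_top.2 hV)
    let T : Finset ι := {i | φ (Pi.single i 1) = 1}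
    have hφT : ∀ x, φ x = ∑ i ∈ T, x i := fun x => by
      rw [LinearMap.pi_apply_eq_sum_univ φ x, Finset.sum_filter]
      refine Finset.sum_congr rfl fun i _ => ?_
      have h2 : ∀ z : ZMod 2, z = 0 ∨ z = 1 := by decide
      have h3 : (fun j => if i = j then (1 : ZMod 2) else 0) = Pi.single i 1 := by
        ext j; simp [Pi.single_apply, eq_comm]
      rw [h3]
      rcases h2 (φ (Pi.single i 1)) with h | h <;> simp [h]
    have hT : T.Nonempty := by
      by_contra h
      rw [Finset.not_nonempty_iff_eq_empty] at h
      exact hφ (LinearMap.ext fun x => by rw [hφT, h]; rfl)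
    have hfix : ∀ σ : K ≃ₐ[k] K, σ (∏ i ∈ T, r i) = ∏ i ∈ T, r i := fun σ => by
      have h0 : ∑ i ∈ T, χ σ i = 0 := by
        rw [← hφT]
        exact hle ⟨Additive.ofMul σ, rfl⟩
      rw [map_prod, Finset.prod_congr rfl fun i _ => hχ σ i, Finset.prod_mul_distrib,
        Finset.prod_pow_eq_pow_sum, Even.neg_one_pow, one_mul]
      rw [even_iff_two_dvd, ← ZMod.natCast_eq_zero_iff, Nat.cast_sum]
      simpa using h0
    obtain ⟨x, hx⟩ := (IsGalois.mem_range_algebraMap_iff_fixed (F := k) _).2 hfix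
    refine hS T hT x ((algebraMap k K).injective ?_)
    rw [map_pow, hx, ← Finset.prod_pow, map_natCast, Nat.cast_prod]
    exact Finset.prod_congr rfl fun i _ => hr i
  intro y
  have hy : Multiplicative.toAdd y ∈ V := hV ▸ Submodule.mem_top
  obtain ⟨σ, hσ⟩ := hy
  exact ⟨σ.toMul, hσ⟩

theorem sq_ne_prod_primes {k : Type} {ι : Type*} [Field k] [NumberField k] {a : ℤ} {s : k}
    (hk : Module.finrank ℚ k = 2) (hs : s ^ 2 = a) (ha : a < 0) {q : ι → ℕ}
    (hq : ∀ i, (q i).Prime) (hinj : Function.Injective q) {T : Finset ι} (hT : T.Nonempty) (x : k) :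
    x ^ 2 ≠ (∏ i ∈ T, q i : ℕ) := by
  intro hx
  have hpos : (0 : ℚ) < (∏ i ∈ T, q i : ℕ) := by
    exact_mod_cast Finset.prod_pos fun i _ => (hq i).pos
  have ha' : (a : ℚ) < 0 := by exact_mod_cast ha
  obtain ⟨σ, hσ, -⟩ := exists_conj hk hs ha
  obtain ⟨u, v, rfl⟩ := exists_rat_add_mul hk hs ha x
  have h1 := congrArg σ hx
  rw [map_pow, map_natCast, ← hx, map_add, map_mul, hσ, map_ratCast, map_ratCast] at h1
  have hs0 : s ≠ 0 := by
    rintro rfl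
    rw [zero_pow two_ne_zero] at hs
    exact ha.ne (by exact_mod_cast hs.symm)
  have h2 : (u : k) * v = 0 := by
    have : (u * v : k) * (4 * s) = 0 := by linear_combination -h1
    exact (mul_eq_zero.1 this).resolve_right (mul_ne_zero (by norm_num) hs0)
  have h3 : u ^ 2 + v ^ 2 * a = (∏ i ∈ T, q i : ℕ) := by
    have : ((u ^ 2 + v ^ 2 * a : ℚ) : k) = ((∏ i ∈ T, q i : ℕ) : ℚ) := by
      rw [Rat.cast_natCast, ← hx]
      push_cast
      linear_combination -(2 * s) * h2 - (v : k) ^ 2 * hs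
    exact_mod_cast this
  rcases mul_eq_zero.1 h2 with h | h
  · rw [Rat.cast_eq_zero.1 h] at h3
    nlinarith [sq_nonneg v]
  · rw [Rat.cast_eq_zero.1 h] at h3
    have h4 : IsSquare (∏ i ∈ T, q i) := by
      rw [← Rat.isSquare_natCast_iff, ← h3]
      exact ⟨u, by ring⟩
    have h5 : Squarefree (∏ i ∈ T, q i) :=
      Finset.squarefree_prod_of_pairwise_isCoprime (fun i _ j _ hij =>
        Nat.coprime_iff_isRelPrime.1 ((Nat.coprime_primes (hq i) (hq j)).2 (hinj.ne hij)))
        fun i _ => (hq i).prime.squarefree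
    obtain ⟨i, hi⟩ := hT
    obtain ⟨w, hw⟩ := h4
    have h6 : IsUnit w := h5 w (hw ▸ dvd_rfl)
    rw [Nat.isUnit_iff.1 h6] at hw
    have := Finset.dvd_prod_of_mem q hi
    rw [hw] at this
    exact (hq i).one_lt.ne' (Nat.dvd_one.1 this)

end BaseField

section BaseLayer

open NumberField

/-- The ramified odd primes of the base field, apart from `3`. -/
def splitPrimes : Finset ℕ := {q ∈ Finset.range 640 | q.Prime ∧ q % 4 = 1}

theorem card_splitPrimes : splitPrimes.card = 54 := by decide +kernel

theorem prod_splitPrimes_mod_four : (∏ q ∈ splitPrimes, q) % 4 = 1 := by decide +kernel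

theorem prod_splitPrimes_lt : 256 * (4 * (3 * ∏ q ∈ splitPrimes, q)) ^ 3 < 4 ^ 730 := by
  decide +kernel

theorem exists_base_layer :
    ∃ (t : ℕ) (k : Type) (_ : Field k) (_ : NumberField k) (_ : IsTotallyComplex k),
      2 ≤ t ∧ Module.finrank ℚ k = 2 ∧ TwoReduced k ∧
      (∀ r, t ^ 2 < 4 * r → classNumber k * 16 < 2 ^ r) ∧
      ∃ p₀ : ℕ, ∀ (p : ℕ) [Fact p.Prime], p₀ ≤ p →
        ∃ (K : Type) (_ : Field K) (_ : NumberField K) (_ : Algebra k K) (ψ : _) (g : _),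
          IsLayer p k K ψ g ∧ (∃ n ≤ 2 * t, Module.finrank k K = 2 ^ n) ∧
          ∃ θ : (K ≃ₐ[k] K) →* Multiplicative (Fin t → ZMod 2), Function.Surjective θ := by
  have hpr : ∀ q ∈ splitPrimes, q.Prime ∧ q % 4 = 1 := fun q hq => (Finset.mem_filter.1 hq).2
  have hlt : ∀ q ∈ splitPrimes, q < 640 := fun q hq =>
    Finset.mem_range.1 (Finset.mem_filter.1 hq).1
  obtain ⟨P, hP⟩ : ∃ P, P = ∏ q ∈ splitPrimes, q := ⟨_, rfl⟩
  have hP4 := prod_splitPrimes_mod_four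
  have hPlt := prod_splitPrimes_lt
  rw [← hP] at hP4 hPlt
  obtain ⟨a, ha⟩ : ∃ a : ℤ, a = -(3 * P) := ⟨_, rfl⟩
  have ha0 : a < 0 := by omega
  obtain ⟨k, _, _, _, s, hk, hs⟩ := exists_imag_quadratic ha0
  have hsint : IsIntegral ℤ s := IsIntegral.of_pow two_pos (hs ▸ isIntegral_algebraMap (x := a))
  let s' : 𝓞 k := ⟨s, hsint⟩
  have hs' : s' ^ 2 = (a : ℤ) := RingOfIntegers.ext hs
  refine ⟨54, k, inferInstance, inferInstance, inferInstance, by norm_num, hk,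
    twoReduced_of_sq hk hs ha0 (by omega), fun r hr => ?_, 641, fun p _ hp => ?_⟩
  · have h1 := classNumber_sq_le hk hs ha0
    have h2 : classNumber k ^ 2 ≤ (4 * (3 * P)) ^ 3 := by
      rw [ha] at h1
      have : ((-4 * -(3 * P) : ℤ)) = ((4 * (3 * P) : ℕ) : ℤ) := by push_cast; ring
      rw [this] at h1
      exact_mod_cast h1
    refine lt_of_pow_lt_pow_left₀ 2 (Nat.zero_le _) ?_
    calc (classNumber k * 16) ^ 2 = 256 * classNumber k ^ 2 := by ring
      _ ≤ 256 * (4 * (3 * P)) ^ 3 := by gcongr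
      _ < 4 ^ 730 := hPlt
      _ ≤ 4 ^ r := Nat.pow_le_pow_right (by norm_num) (by omega)
      _ = (2 ^ r) ^ 2 := by rw [← pow_mul, mul_comm, pow_mul]; norm_num
  · have hp2 : p ≠ 2 := by omega
    have hS : ∀ q ∈ splitPrimes, q % 4 = 1 ∧
        ∃ (b : ℤ) (x : 𝓞 k), IsCoprime (q : ℤ) b ∧ x ^ 2 = (q : ℤ) * b := fun q hq => by
      refine ⟨(hpr q hq).2, -(3 * ∏ r ∈ splitPrimes.erase q, r : ℕ), s', ?_, ?_⟩
      · rw [IsCoprime.neg_right_iff, Nat.isCoprime_iff_coprime]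
        refine Nat.Coprime.mul_right ?_ (Nat.Coprime.prod_right fun r hr => ?_)
        · refine (Nat.coprime_primes (hpr q hq).1 Nat.prime_three).2 ?_
          rintro rfl
          exact absurd (hpr 3 hq).2 (by norm_num)
        · exact (Nat.coprime_primes (hpr q hq).1 (hpr r (Finset.mem_of_mem_erase hr)).1).2
            (Finset.ne_of_mem_erase hr).symm
      · rw [hs', ha, hP, ← Finset.mul_prod_erase _ _ hq]
        push_cast
        ring
    have hp0 : ∀ q ∈ splitPrimes, ((q : ℤ) : ZMod p) ≠ 0 := fun q hq h => by
      rw [Int.cast_natCast, ZMod.natCast_eq_zero_iff] at h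
      have := Nat.le_of_dvd (hpr q hq).1.pos h
      have := hlt q hq
      omega
    obtain ⟨K, _, _, _, ψ, g, h, hsq, n, hn, hnK⟩ := exists_isLayer_sqrt hp2 hk splitPrimes hS hp0
    refine ⟨K, _, _, _, ψ, g, h, ⟨n, by rwa [card_splitPrimes] at hn, hnK⟩, ?_⟩
    choose r hr using fun q : splitPrimes => hsq q q.2
    have := h.isGalois
    have hG : IsGalois k K := IsGalois.tower_top_of_isGalois ℚ k K
    have e : Fin 54 ≃ splitPrimes := (finCongr card_splitPrimes.symm).trans
      splitPrimes.equivFin.symm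
    refine exists_hom_sqrt_surjective (r := fun i => r (e i)) (q := fun i => (e i : ℕ))
      (fun i => by rw [pow_two, ← hr]) (fun i => (hpr _ (e i).2).1.ne_zero) fun T hT x => ?_
    exact sq_ne_prod_primes hk hs ha0 (q := fun i => (e i : ℕ)) (fun i => (hpr _ (e i).2).1)
      (Subtype.val_injective.comp e.injective) hT x

end BaseLayer

section SplitFields

open NumberField nonZeroDivisors FractionalIdeal

theorem Unram.dual_one_le {k K : Type*} [Field k] [NumberField k] [Field K] [NumberField K]
    [Algebra k K] [IsGalois k K] (h : Unram k K) {x : K}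
    (hx : x ∈ dual (𝓞 k) k (1 : FrId K)) : x ∈ (1 : FrId K) := by
  classical
  rw [mem_dual (one_ne_zero (α := FrId K))] at hx
  obtain ⟨n, a, b, hab⟩ := UnramifiedAction.exists_dual h
  have hab' : IsDualSystem (K ≃ₐ[k] K) (fun i => (a i : K)) (fun i => (b i : K)) := by
    refine ⟨?_, fun g hg => ?_⟩
    · have := congrArg (algebraMap (𝓞 K) K) hab.1
      rwa [map_sum, map_one, Finset.sum_congr rfl fun i _ => map_mul _ _ _] at this
    · have := congrArg (algebraMap (𝓞 K) K) (hab.2 g hg)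
      rwa [map_sum, map_zero, Finset.sum_congr rfl fun i _ => map_mul _ _ _] at this
  have htr : ∀ y : K, actTrace (K ≃ₐ[k] K) y = algebraMap k K (Algebra.trace k K y) := fun y => by
    rw [trace_eq_sum_automorphisms]
    rfl
  rw [mem_one_iff, ← hab'.sum_mul_actTrace x]
  have : ∀ i, ∃ c : 𝓞 k, algebraMap (𝓞 k) k c = Algebra.trace k K (b i * x) := fun i => by
    obtain ⟨c, hc⟩ := hx (b i) ((mem_one_iff _).2 ⟨b i, rfl⟩)
    exact ⟨c, by rw [hc, Algebra.traceForm_apply, mul_comm]⟩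
  choose c hc using this
  refine ⟨∑ i, a i * algebraMap (𝓞 k) (𝓞 K) (c i), ?_⟩
  rw [map_sum]
  refine Finset.sum_congr rfl fun i _ => ?_
  rw [map_mul, htr, ← hc]
  rfl

theorem Unram.natAbs_discr {k K : Type*} [Field k] [NumberField k] [Field K] [NumberField K]
    [Algebra k K] [IsGalois k K] (h : Unram k K) :
    (discr K).natAbs = (discr k).natAbs ^ Module.finrank k K := by
  have h1 : dual (𝓞 k) k (1 : FrId K) = 1 :=
    le_antisymm (fun x hx => h.dual_one_le hx) (one_le_dual_one _ _)
  have h2 : differentIdeal (𝓞 k) (𝓞 K) = ⊤ := by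
    have := coeIdeal_differentIdeal (𝓞 k) k K (𝓞 K)
    rw [h1, inv_one, ← coeIdeal_top] at this
    exact coeIdeal_injective this
  rw [natAbs_discr_eq_absNorm_differentIdeal_mul_natAbs_discr_pow k (𝓞 k) K (𝓞 K), h2,
    Ideal.absNorm_top, one_mul]

theorem exists_ringHom_zmod {p : ℕ} [Fact p.Prime] {R Ω : Type*} [CommRing R] [Field Ω]
    [Algebra (ZMod p) Ω] (ψ : R →+* Ω) (h : ∀ y, ψ y ^ p = ψ y) : Nonempty (R →+* ZMod p) := by
  have hC : CharP Ω p := charP_of_injective_algebraMap (algebraMap (ZMod p) Ω).injective p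
  have h1 : ∀ y, ψ y ∈ (algebraMap (ZMod p) Ω).range := fun y => by
    have h2 := (Subfield.mem_bot_iff_pow_eq_self Ω p).2 (h y)
    rw [_root_.mem_bot_iff_intCast p] at h2
    obtain ⟨n, hn⟩ := h2
    exact ⟨n, by rw [← hn, map_intCast]⟩
  exact ⟨((RingEquiv.ofBijective (algebraMap (ZMod p) Ω).rangeRestrict
    ⟨(algebraMap (ZMod p) Ω).rangeRestrict.injective, RingHom.rangeRestrict_surjective _⟩).symm : _ →+* ZMod p).comp
        (ψ.codRestrict (algebraMap (ZMod p) Ω).range h1)⟩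

theorem IsLayer.exists_split {p : ℕ} [Fact p.Prime] {k K : Type} [Field k] [NumberField k]
    [Field K] [NumberField K] [Algebra k K] {ψ : 𝓞 K →+* AlgebraicClosure (ZMod p)}
    {g : K ≃ₐ[ℚ] K} (h : IsLayer p k K ψ g) :
    ∃ (Z : Type) (_ : Field Z) (_ : NumberField Z), Nonempty (𝓞 Z →+* ZMod p) ∧
      Module.finrank ℚ Z ≤ Module.finrank ℚ K ∧ Module.finrank ℚ K ≤ 2 * Module.finrank ℚ Z ∧
      (discr Z).natAbs ≤ (discr k).natAbs ^ Module.finrank ℚ Z := by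
  have := h.isGalois
  have hG : IsGalois k K := IsGalois.tower_top_of_isGalois ℚ k K
  let Z : IntermediateField ℚ K := IntermediateField.fixedField (Subgroup.zpowers g)
  have h1 : Module.finrank ℚ Z * Module.finrank Z K = Module.finrank ℚ K :=
    Module.finrank_mul_finrank ℚ Z K
  have h2 : Module.finrank Z K = orderOf g := by
    rw [IntermediateField.finrank_fixedField_eq_card, Nat.card_zpowers]
  have h3 : Module.finrank Z K ≤ 2 := by
    rw [h2]
    exact Nat.le_of_dvd two_pos (orderOf_dvd_of_pow_eq_one (by rw [pow_two, h.sq]))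
  have h4 : 0 < Module.finrank Z K := Module.finrank_pos
  refine ⟨Z, inferInstance, inferInstance,
    exists_ringHom_zmod (ψ.comp (algebraMap (𝓞 Z) (𝓞 K))) fun y => ?_, by nlinarith, by nlinarith, ?_⟩
  · rw [RingHom.comp_apply, ← h.frob]
    congr 1
    refine RingOfIntegers.ext ?_
    exact (y : Z).2 ⟨g, Subgroup.mem_zpowers g⟩
  · have h5 := natAbs_discr_eq_absNorm_differentIdeal_mul_natAbs_discr_pow Z (𝓞 Z) K (𝓞 K)
    have h6 := h.unram.natAbs_discr
    have h7 : Module.finrank ℚ k * Module.finrank k K = Module.finrank ℚ K :=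
      Module.finrank_mul_finrank ℚ k K
    have h8 : 0 < Ideal.absNorm (differentIdeal (𝓞 Z) (𝓞 K)) := by
      refine Nat.pos_of_ne_zero fun h => ?_
      rw [h, zero_mul] at h5
      exact discr_ne_zero K (Int.natAbs_eq_zero.1 h5)
    have h9 : 0 < (discr k).natAbs := Int.natAbs_pos.2 (discr_ne_zero k)
    have h10 : 0 < Module.finrank ℚ k := Module.finrank_pos
    refine le_of_pow_le_pow_left₀ h4.ne' (Nat.zero_le _) ?_
    calc (discr Z).natAbs ^ Module.finrank Z K ≤ (discr K).natAbs := by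
          rw [h5]; exact Nat.le_mul_of_pos_left _ h8
      _ = (discr k).natAbs ^ Module.finrank k K := h6
      _ ≤ (discr k).natAbs ^ Module.finrank ℚ K := Nat.pow_le_pow_right h9 (by nlinarith)
      _ = _ := by rw [← h1, pow_mul]

theorem exists_split_field : ∃ D N₀ p₀ : ℕ, ∀ (p : ℕ) [Fact p.Prime], p₀ ≤ p → ∀ N, N₀ ≤ N →
    ∃ (Z : Type) (_ : Field Z) (_ : NumberField Z), Nonempty (𝓞 Z →+* ZMod p) ∧
      2 ^ N ≤ Module.finrank ℚ Z ∧ Module.finrank ℚ Z ≤ 2 ^ (N + 2) ∧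
      (discr Z).natAbs ≤ D ^ Module.finrank ℚ Z := by
  obtain ⟨t, k, _, _, _, ht, hk, hred, hcl, p₀, hp₀⟩ := exists_base_layer
  refine ⟨(discr k).natAbs, 2 * t, p₀ + 3, fun p _ hp N hN => ?_⟩
  have key : ∀ N, ∃ (K : Type) (_ : Field K) (_ : NumberField K) (_ : Algebra k K) (ψ : _) (g : _)
      (θ : (K ≃ₐ[k] K) →* Multiplicative (Fin t → ZMod 2)),
      IsLayer p k K ψ g ∧ Function.Surjective θ ∧
      ∃ n, N ≤ n ∧ n ≤ max (2 * t) (N + 1) ∧ Module.finrank k K = 2 ^ n := fun N => by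
    induction N with
    | zero =>
      obtain ⟨K, _, _, _, ψ, g, h, ⟨n, hn, hnK⟩, θ, hθ⟩ := hp₀ p (by omega)
      exact ⟨K, _, _, _, ψ, g, θ, h, hθ, n, Nat.zero_le _, hn.trans (le_max_left _ _), hnK⟩
    | succ N ih =>
      obtain ⟨K, _, _, _, ψ, g, θ, h, hθ, n, hn, hn', hnK⟩ := ih
      rcases hn.lt_or_eq with hlt | rfl
      · exact ⟨K, _, _, _, ψ, g, θ, h, hθ, n, hlt, by omega, hnK⟩
      · obtain ⟨K', _, _, _, ψ', g', θ', h', hθ', m, hm, hm', hmK⟩ :=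
          h.exists_next (by omega) hk hred ht hcl θ hθ
        exact ⟨K', _, _, _, ψ', g', θ', h', hθ', N + m, by omega, by omega,
          by rw [hmK, hnK, pow_add]⟩
  obtain ⟨K, _, _, _, ψ, g, θ, h, -, n, hn, hn', hnK⟩ := key N
  obtain ⟨Z, _, _, hφ, h1, h2, h3⟩ := h.exists_split
  have h4 : Module.finrank ℚ K = 2 ^ (n + 1) := by
    rw [← Module.finrank_mul_finrank ℚ k K, hk, hnK, pow_succ']
  have h5 : 2 ^ N ≤ 2 ^ n := Nat.pow_le_pow_right two_pos hn
  have h6 : 2 ^ (n + 1) ≤ 2 ^ (N + 2) := Nat.pow_le_pow_right two_pos (by omega)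
  rw [h4] at h1 h2
  rw [pow_succ'] at h2
  exact ⟨Z, _, _, hφ, by omega, h1.trans h6, h3⟩

end SplitFields

section Boxes

open NumberField InfinitePlace mixedEmbedding MeasureTheory Module
open scoped NNReal ENNReal Pointwise

variable (K : Type*) [Field K] [NumberField K]

/-- Integers bounded by prescribed constants at all infinite places. -/
def intBox (f : InfinitePlace K → ℝ≥0) : Set (𝓞 K) := {a | ∀ w : InfinitePlace K, w (a : K) ≤ f w}

variable {K}

theorem intBox_finite (f : InfinitePlace K → ℝ≥0) : (intBox K f).Finite := by
  have h := Embeddings.finite_of_norm_le K ℂ ((∑ w, f w : ℝ≥0) : ℝ)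
  refine (h.preimage (f := fun a : 𝓞 K => (a : K))
    RingOfIntegers.coe_injective.injOn).subset fun a ha => ⟨a.2, fun φ => ?_⟩
  rw [← InfinitePlace.apply]
  exact (ha (InfinitePlace.mk φ)).trans
    (NNReal.coe_le_coe.2 (Finset.single_le_sum (fun w _ => zero_le) (Finset.mem_univ _)))

theorem one_le_prod_place {a : 𝓞 K} (ha : a ≠ 0) : 1 ≤ ∏ w : InfinitePlace K, w (a : K) ^ mult w := by
  rw [InfinitePlace.prod_eq_abs_norm]
  have h : Algebra.norm ℤ a ≠ 0 := Algebra.norm_ne_zero_iff.2 ha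
  rw [← Algebra.coe_norm_int]
  exact_mod_cast Int.one_le_abs h

open scoped Classical in
theorem prod_scale (f : InfinitePlace K → ℝ≥0) (c : ℝ≥0) :
    ∏ w, (c * f w) ^ mult w = c ^ finrank ℚ K * ∏ w, f w ^ mult w := by
  simp_rw [mul_pow]
  rw [Finset.prod_mul_distrib, Finset.prod_pow_eq_pow_sum, InfinitePlace.sum_mult_eq]

omit [NumberField K] in
theorem mem_convexBodyLT_iff {f : InfinitePlace K → ℝ≥0} {x : mixedSpace K} :
    x ∈ convexBodyLT K f ↔ ∀ w, normAtPlace w x < f w := by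
  simp only [Set.mem_prod, Set.mem_pi, Set.mem_univ, forall_true_left, mem_ball_zero_iff]
  refine ⟨fun h w => ?_, fun h => ⟨fun w => ?_, fun w => ?_⟩⟩
  · rcases isReal_or_isComplex w with hw | hw
    · rw [normAtPlace_apply_of_isReal hw]
      exact h.1 ⟨w, hw⟩
    · rw [normAtPlace_apply_of_isComplex hw]
      exact h.2 ⟨w, hw⟩
  · rw [← normAtPlace_apply_of_isReal w.2]
    exact h w
  · rw [← normAtPlace_apply_of_isComplex w.2]
    exact h w

theorem measurableSet_convexBodyLT (f : InfinitePlace K → ℝ≥0) :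
    MeasurableSet (convexBodyLT K f) :=
  (MeasurableSet.univ_pi fun _ => measurableSet_ball).prod
    (MeasurableSet.univ_pi fun _ => measurableSet_ball)

/-- Packing bound for the number of integers in a box. -/
theorem ncard_intBox_le {f : InfinitePlace K → ℝ≥0} (hf : ∀ w, 0 < f w) {c : ℝ≥0} (hc : 1 ≤ c)
    (h : ∏ w, f w ^ mult w ≤ c ^ finrank ℚ K) :
    ((intBox K f).ncard : ℝ≥0) ≤ (3 * c) ^ finrank ℚ K := by
  classical
  have hc0 : 0 < c := zero_lt_one.trans_le hc
  set b : ℝ≥0 := (2 * c)⁻¹ with hb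
  have hb0 : 0 < b := by positivity
  set S := convexBodyLT K fun w => b * f w
  set s := (intBox_finite f).toFinset
  have hs : ∀ a ∈ s, ∀ w : InfinitePlace K, w (a : K) ≤ f w := fun a ha => by
    simpa [s, intBox] using ha
  let T : 𝓞 K → Set (mixedSpace K) := fun a => (fun x => x - mixedEmbedding K (a : K)) ⁻¹' S
  have hT : ∀ a x, x ∈ T a ↔ ∀ w, normAtPlace w (x - mixedEmbedding K (a : K)) < b * f w :=
    fun a x => by
      simp only [T, S, Set.mem_preimage, mem_convexBodyLT_iff, NNReal.coe_mul]
  have hd : (s : Set (𝓞 K)).PairwiseDisjoint T := by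
    intro x hx y hy hxy
    refine Set.disjoint_left.2 fun u hu hu' => ?_
    rw [hT] at hu hu'
    have hlt : ∀ w : InfinitePlace K, w ((x - y : 𝓞 K) : K) < ((c⁻¹ * f w : ℝ≥0) : ℝ) := fun w => by
      have h1 := normAtPlace_add_le w (u - mixedEmbedding K (y : K))
        (-(u - mixedEmbedding K (x : K)))
      rw [normAtPlace_neg, show u - mixedEmbedding K (y : K) + -(u - mixedEmbedding K (x : K)) =
        mixedEmbedding K ((x - y : 𝓞 K) : K) by
          rw [show ((x - y : 𝓞 K) : K) = (x : K) - y from rfl, map_sub]; abel,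
        normAtPlace_apply] at h1
      have h2 : (c⁻¹ : ℝ) = b + b := by
        rw [hb]
        push_cast
        field_simp
        norm_num
      rw [NNReal.coe_mul, NNReal.coe_inv, h2, add_mul]
      linarith [hu w, hu' w]
    have hne : x - y ≠ 0 := sub_ne_zero.2 hxy
    have h1 := one_le_prod_place hne
    have h2 : ∏ w : InfinitePlace K, w ((x - y : 𝓞 K) : K) ^ mult w <
        ∏ w : InfinitePlace K, ((c⁻¹ * f w : ℝ≥0) : ℝ) ^ mult w := by
      refine Finset.prod_lt_prod_of_nonempty (fun w _ => pow_pos (pos_iff.2 ?_) _)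
        (fun w _ => pow_lt_pow_left₀ (hlt w) (apply_nonneg _ _) mult_ne_zero)
        Finset.univ_nonempty
      exact RingOfIntegers.coe_ne_zero_iff.2 hne
    have h3 : ∏ w : InfinitePlace K, (c⁻¹ * f w) ^ mult w ≤ 1 := by
      rw [prod_scale, inv_pow]
      exact (mul_le_mul_right h _).trans_eq (inv_mul_cancel₀ (by positivity))
    have h4 : ∏ w : InfinitePlace K, ((c⁻¹ * f w : ℝ≥0) : ℝ) ^ mult w ≤ 1 := by
      exact_mod_cast h3
    linarith
  have hsub : (⋃ a ∈ s, T a) ⊆ convexBodyLT K fun w => (1 + b) * f w := by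
    refine Set.iUnion₂_subset fun a ha x hx => mem_convexBodyLT_iff.2 fun w => ?_
    have h1 := normAtPlace_add_le w (x - mixedEmbedding K (a : K)) (mixedEmbedding K (a : K))
    rw [sub_add_cancel, normAtPlace_apply] at h1
    push_cast
    linarith [(hT a x).1 hx w, hs a ha w]
  have hvol : ∀ a, volume (T a) = volume S := fun a => by
    simp only [T, sub_eq_add_neg]
    exact measure_preimage_add_right volume _ S
  have hle := measure_mono (μ := volume) hsub
  rw [measure_biUnion_finset hd fun a _ =>
    (measurableSet_convexBodyLT _).preimage (measurable_sub_const _),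
    Finset.sum_congr rfl fun a _ => hvol a, Finset.sum_const, nsmul_eq_mul, convexBodyLT_volume,
    convexBodyLT_volume, prod_scale, prod_scale] at hle
  norm_cast at hle
  have hP : 0 < ∏ w, f w ^ mult w := Finset.prod_pos fun w _ => pow_pos (hf w) _
  have hF := pos_iff_ne_zero.2 (convexBodyLTFactor_ne_zero K)
  have hle' : (s.card : ℝ≥0) * b ^ finrank ℚ K ≤ (1 + b) ^ finrank ℚ K := by
    refine le_of_mul_le_mul_right ?_ (mul_pos hF hP)
    calc _ = _ := ?_
      _ ≤ _ := hle
      _ = _ := ?_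
    all_goals ring
  rw [Set.ncard_eq_toFinset_card _ (intBox_finite f)]
  refine le_of_mul_le_mul_right (hle'.trans ?_) (pow_pos hb0 (finrank ℚ K))
  rw [← mul_pow]
  refine pow_le_pow_left₀ zero_le ?_ _
  have h3 : c * b = 1 / 2 := by
    rw [hb]
    field_simp
  have h4 : b ≤ 1 / 2 := by
    rw [← h3]
    exact le_mul_of_one_le_left zero_le hc
  rw [mul_assoc, h3]
  calc 1 + b ≤ 1 + 1 / 2 := by gcongr
    _ = 3 * (1 / 2) := by norm_num

/-- Blichfeldt's counting bound for the number of integers in a box. -/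
theorem le_ncard_intBox (f : InfinitePlace K → ℝ≥0) {D : ℝ≥0} (hD : 1 ≤ D)
    (hdisc : ((discr K).natAbs : ℝ≥0) ≤ D ^ finrank ℚ K) :
    ∏ w, f w ^ mult w ≤ (2 * D) ^ finrank ℚ K * ((intBox K f).ncard : ℝ≥0) := by
  classical
  let S := convexBodyLT K fun w => 2⁻¹ * f w
  let L := mixedEmbedding.integerLattice K
  let F := ZSpan.fundamentalDomain (latticeBasis K)
  have : VAddInvariantMeasure L (mixedSpace K) volume :=
    ⟨fun g s _ => measure_preimage_add volume (g : mixedSpace K) s⟩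
  have hSm : MeasurableSet S := measurableSet_convexBodyLT _
  have hcount : ∀ x : mixedSpace K,
      ∑' g : L, (g +ᵥ S).indicator (1 : mixedSpace K → ℝ≥0∞) x ≤ (intBox K f).ncard := by
    intro x
    rw [ENNReal.tsum_eq_iSup_sum]
    refine iSup_le fun t => ?_
    simp_rw [Set.indicator_apply, Pi.one_apply]
    rw [Finset.sum_boole]
    have hL : ∀ g : L, ∃ a : 𝓞 K, mixedEmbedding K (a : K) = g := fun g => by
      obtain ⟨a, ha⟩ := g.2
      exact ⟨a, ha⟩
    choose a ha using hL
    have hmem : ∀ g : L, x ∈ g +ᵥ S → ∀ w, normAtPlace w (x - mixedEmbedding K (a g : K)) <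
        2⁻¹ * f w := by
      rintro g ⟨y, hy, rfl⟩ w
      have h1 := mem_convexBodyLT_iff.1 hy w
      rw [NNReal.coe_mul, NNReal.coe_inv] at h1
      rw [ha g]
      change normAtPlace w ((g : mixedSpace K) + y - g) < _
      rwa [add_sub_cancel_left]
    rcases (t.filter fun g => x ∈ g +ᵥ S).eq_empty_or_nonempty with h0 | ⟨g₀, hg₀⟩
    · rw [h0, Finset.card_empty, Nat.cast_zero]
      exact zero_le
    rw [Set.ncard_eq_toFinset_card _ (intBox_finite f)]
    refine Nat.cast_le.2 (Finset.card_le_card_of_injOn (fun g => a g - a g₀) (fun g hg => ?_)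
      fun g _ g' _ h => ?_)
    · have h1 := hmem g₀ (Finset.mem_filter.1 hg₀).2
      have h2 := hmem g (Finset.mem_filter.1 hg).2
      refine Set.Finite.mem_toFinset (intBox_finite f) |>.2 fun w => ?_
      have h3 := normAtPlace_add_le w (x - mixedEmbedding K (a g₀ : K))
        (-(x - mixedEmbedding K (a g : K)))
      rw [normAtPlace_neg, show x - mixedEmbedding K (a g₀ : K) +
        -(x - mixedEmbedding K (a g : K)) = mixedEmbedding K ((a g - a g₀ : 𝓞 K) : K) by
          rw [show ((a g - a g₀ : 𝓞 K) : K) = (a g : K) - a g₀ from rfl, map_sub]; abel,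
        normAtPlace_apply] at h3
      linarith [h1 w, h2 w]
    · have h1 : a g = a g' := sub_left_injective h
      exact Subtype.ext (by rw [← ha g, ← ha g', h1])
  have hvol : volume S ≤ (intBox K f).ncard * volume F := by
    rw [(fundamentalDomain_integerLattice K).measure_eq_tsum S]
    calc ∑' g : L, volume ((g +ᵥ S) ∩ F)
        = ∑' g : L, ∫⁻ x in F, (g +ᵥ S).indicator 1 x := tsum_congr fun g => by
          rw [lintegral_indicator_one (hSm.const_vadd g), Measure.restrict_apply (hSm.const_vadd g)]
      _ = ∫⁻ x in F, ∑' g : L, (g +ᵥ S).indicator 1 x := by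
          rw [lintegral_tsum fun g => (measurable_one.indicator (hSm.const_vadd g)).aemeasurable]
      _ ≤ ∫⁻ x in F, (intBox K f).ncard := lintegral_mono hcount
      _ = _ := by rw [setLIntegral_const]
  rw [convexBodyLT_volume, prod_scale, volume_fundamentalDomain_latticeBasis] at hvol
  have h1 : ((2⁻¹ : ℝ≥0) ^ finrank ℚ K * ∏ w, f w ^ mult w) ≤
      (intBox K f).ncard * D ^ finrank ℚ K := by
    have h2 : (convexBodyLTFactor K : ℝ≥0∞) * ((2⁻¹ : ℝ≥0) ^ finrank ℚ K * ∏ w, f w ^ mult w : ℝ≥0) ≤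
        ((intBox K f).ncard * ((2 : ℝ≥0)⁻¹ ^ nrComplexPlaces K * NNReal.sqrt ‖discr K‖₊) : ℝ≥0) := by
      refine hvol.trans_eq ?_
      rw [ENNReal.coe_mul, ENNReal.coe_mul, ENNReal.coe_pow, ENNReal.coe_inv two_ne_zero]
      rfl
    rw [← ENNReal.coe_mul, ENNReal.coe_le_coe] at h2
    refine (le_mul_of_one_le_left zero_le (one_le_convexBodyLTFactor K)).trans (h2.trans ?_)
    gcongr
    have h3 : (2 : ℝ≥0)⁻¹ ^ nrComplexPlaces K ≤ 1 :=
      pow_le_one₀ zero_le (inv_le_one_of_one_le₀ one_le_two)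
    have h4 : ‖discr K‖₊ ≤ D ^ finrank ℚ K := by
      refine le_trans (le_of_eq ?_) hdisc
      rw [← NNReal.natCast_natAbs]
    refine (mul_le_of_le_one_left zero_le h3).trans ?_
    rw [NNReal.sqrt_le_iff_le_sq, sq]
    exact h4.trans (le_mul_of_one_le_left zero_le (one_le_pow₀ hD))
  rw [inv_pow, inv_mul_le_iff₀ (by positivity)] at h1
  refine h1.trans_eq ?_
  rw [mul_pow]
  ring

end Boxes

section MultiplicityCount

open Finset
open scoped NNReal

variable {ι : Type*} [Fintype ι] [DecidableEq ι]

theorem card_piAntidiag_univ (n : ℕ) :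
    #(piAntidiag (univ : Finset ι) n) = (Fintype.card ι + n - 1).choose n := by
  rw [← map_sym_eq_piAntidiag, card_map, sym_univ, card_univ, Sym.card_sym_eq_choose]

theorem mem_piAntidiag_univ {n : ℕ} {e : ι → ℕ} :
    e ∈ piAntidiag (univ : Finset ι) n ↔ ∑ i, e i = n := by
  simp

theorem card_biUnion_piAntidiag_le {n : ℕ} (h : Fintype.card ι ≤ n) :
    #((range (n + 1)).biUnion fun k => piAntidiag (univ : Finset ι) k) ≤ 4 ^ n := by
  have h1 : ∀ k, #(piAntidiag (univ : Finset ι) k) * 2 ≤ 2 ^ n * 2 ^ k ∨ k = 0 := fun k => by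
    rcases k with - | k
    · exact Or.inr rfl
    · left
      rw [card_piAntidiag_univ]
      calc _ ≤ 2 ^ (Fintype.card ι + (k + 1) - 1) * 2 :=
            Nat.mul_le_mul_right _ (Nat.choose_le_two_pow _ _)
        _ = 2 ^ (Fintype.card ι + (k + 1)) := by
            rw [← pow_succ]
            congr 1
        _ ≤ 2 ^ n * 2 ^ (k + 1) := by
            rw [← pow_add]
            exact Nat.pow_le_pow_right two_pos (by omega)
  have h2 : ∀ j, (∑ k ∈ range (j + 1), #(piAntidiag (univ : Finset ι) k)) ≤ 2 ^ n * 2 ^ j := by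
    intro j
    induction j with
    | zero =>
      rw [zero_add, sum_range_one, card_piAntidiag_univ, Nat.choose_zero_right, pow_zero, mul_one]
      exact Nat.one_le_two_pow
    | succ j ih =>
      rw [sum_range_succ]
      have := (h1 (j + 1)).resolve_right (Nat.succ_ne_zero j)
      rw [pow_succ, ← mul_assoc] at this ⊢
      omega
  refine card_biUnion_le.trans ((h2 n).trans_eq ?_)
  rw [← mul_pow, show 2 * 2 = 4 from rfl]

omit [DecidableEq ι] in
theorem exists_le_sum_eq (g : ι → ℕ) {n : ℕ} (h : n ≤ ∑ i, g i) : ∃ d ≤ g, ∑ i, d i = n := by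
  classical
  induction n with
  | zero => exact ⟨0, fun i => Nat.zero_le _, by simp⟩
  | succ n ih =>
    obtain ⟨d, hd, hn⟩ := ih (Nat.le_of_succ_le h)
    obtain ⟨i, -, hi⟩ := exists_lt_of_sum_lt (s := univ) (hn.trans_lt h)
    refine ⟨d + Pi.single i 1, fun j => ?_, ?_⟩
    · by_cases hj : j = i
      · subst hj
        simpa using hi
      · simpa [hj] using hd j
    · simp [sum_add_distrib, hn]

/-- If the sets `B e` decrease rapidly, their union over all `e` of given sum is large. -/
theorem card_piAntidiag_mul_le {α : Type*} [DecidableEq α] {n M : ℕ} (hι : Fintype.card ι ≤ n)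
    (B : (ι → ℕ) → Finset α) (hanti : Antitone B) (hinf : ∀ e e', B e ∩ B e' ⊆ B (e ⊔ e'))
    {x y : ℝ≥0} (hx : ∀ e, ∑ i, e i = M → x + 4 ^ n * y ≤ #(B e))
    (hy : ∀ e, ∑ i, e i = M + n → (#(B e) : ℝ≥0) ≤ y) :
    #(piAntidiag (univ : Finset ι) M) * x ≤
      16 ^ n * #((piAntidiag (univ : Finset ι) M).biUnion B) := by
  classical
  let T := (range (n + 1)).biUnion fun k => piAntidiag (univ : Finset ι) k
  have hT : #T ≤ 4 ^ n := card_biUnion_piAntidiag_le hι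
  have hmT : ∀ d : ι → ℕ, ∑ i, d i ≤ n → d ∈ T := fun d hd => by
    simp only [T, mem_biUnion, mem_piAntidiag_univ, mem_range]
    exact ⟨_, Nat.lt_succ_of_le hd, rfl⟩
  let U : (ι → ℕ) → Finset α := fun e =>
    (piAntidiag (univ : Finset ι) n).biUnion fun d => B (e + d)
  let r : (ι → ℕ) → α → Prop := fun e a => a ∈ B e \ U e
  have key := card_nsmul_le_card_nsmul (s := piAntidiag (univ : Finset ι) M)
    (t := (piAntidiag (univ : Finset ι) M).biUnion B) r (m := x) (n := (16 : ℝ≥0) ^ n) ?_ ?_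
  · rw [nsmul_eq_mul, nsmul_eq_mul] at key
    rwa [mul_comm (16 ^ n)]
  · intro e he
    have hU : (#(U e) : ℝ≥0) ≤ 4 ^ n * y := by
      have h1 : (#(U e) : ℝ≥0) ≤ ∑ d ∈ piAntidiag (univ : Finset ι) n, (#(B (e + d)) : ℝ≥0) := by
        exact_mod_cast card_biUnion_le
      refine h1.trans ((sum_le_card_nsmul _ _ y fun d hd => hy _ ?_).trans ?_)
      · simp only [Pi.add_apply]
        rw [sum_add_distrib, mem_piAntidiag_univ.1 he, mem_piAntidiag_univ.1 hd]
      · rw [nsmul_eq_mul]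
        refine mul_le_mul_left ?_ y
        have h2 : #(piAntidiag (univ : Finset ι) n) ≤ 4 ^ n :=
          (card_le_card fun d hd => hmT d (mem_piAntidiag_univ.1 hd).le).trans hT
        exact_mod_cast h2
    have h3 : (#(B e) : ℝ≥0) ≤ #(B e \ U e) + #(U e) := by
      exact_mod_cast (card_le_card_sdiff_add_card (s := B e) (t := U e))
    have h4 : x ≤ #(B e \ U e) := by
      refine le_of_add_le_add_right (a := 4 ^ n * y) ?_
      exact (hx e (mem_piAntidiag_univ.1 he)).trans (h3.trans (by gcongr))
    refine h4.trans (Nat.cast_le.2 (card_le_card fun a ha => ?_))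
    rw [mem_bipartiteAbove]
    exact ⟨mem_biUnion.2 ⟨e, he, (mem_sdiff.1 ha).1⟩, ha⟩
  · intro a ha
    rcases (bipartiteBelow r (piAntidiag (univ : Finset ι) M) a).eq_empty_or_nonempty with h0 | ⟨e, he⟩
    · rw [h0, card_empty, Nat.cast_zero]
      exact zero_le
    have he' := (mem_bipartiteBelow _).1 he
    have hes := mem_piAntidiag_univ.1 he'.1
    have hea := mem_sdiff.1 he'.2
    suffices h : #(bipartiteBelow r (piAntidiag (univ : Finset ι) M) a) ≤ #(T ×ˢ T) by
      have h16 : #(T ×ˢ T) ≤ 16 ^ n := by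
        rw [card_product, show 16 = 4 * 4 from rfl, mul_pow]
        exact Nat.mul_le_mul hT hT
      exact_mod_cast h.trans h16
    refine card_le_card_of_injOn (fun e₂ => (e₂ - e, e - e₂)) (fun e₂ h₂ => ?_)
      fun e₂ _ e₃ _ h => ?_
    · have h₂' := (mem_bipartiteBelow _).1 h₂
      have h₂s := mem_piAntidiag_univ.1 h₂'.1
      have hlt : ∑ i, (e₂ - e) i < n := by
        by_contra! hge
        obtain ⟨d, hd, hdn⟩ := exists_le_sum_eq _ hge
        refine hea.2 (mem_biUnion.2 ⟨d, mem_piAntidiag_univ.2 hdn, ?_⟩)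
        refine hanti (a := e + d) (b := e ⊔ e₂) (fun i => ?_)
          (hinf _ _ (mem_inter.2 ⟨hea.1, (mem_sdiff.1 h₂'.2).1⟩))
        have := hd i
        simp only [Pi.add_apply, Pi.sup_apply, Pi.sub_apply] at this ⊢
        omega
      have heq : ∑ i, (e - e₂) i + ∑ i, e₂ i = ∑ i, (e₂ - e) i + ∑ i, e i := by
        rw [← sum_add_distrib, ← sum_add_distrib]
        refine sum_congr rfl fun i _ => ?_
        simp only [Pi.sub_apply]
        omega
      refine mem_product.2 ⟨hmT _ hlt.le, hmT _ ?_⟩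
      rw [hes, h₂s] at heq
      exact (Nat.add_right_cancel heq).trans_le hlt.le
    · rw [Prod.mk.injEq] at h
      funext i
      have h1 := congrFun h.1 i
      have h2 := congrFun h.2 i
      simp only [Pi.sub_apply] at h1 h2
      omega

theorem pow_mul_choose_le (k s M : ℕ) (h : 2 * k * s ≤ M) :
    k ^ s * (s + 2 * M).choose (2 * M) ≤ (s + M).choose M ^ 2 := by
  have hc : ∀ a, (s + a).choose a * s.factorial = ∏ i ∈ range s, (a + 1 + i) := fun a => by
    rw [← Nat.ascFactorial_eq_prod_range, Nat.ascFactorial_eq_factorial_mul_choose, mul_comm,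
      ← Nat.choose_symm_add, add_comm s a]
  refine Nat.le_of_mul_le_mul_right ?_ (pow_pos s.factorial_pos 2)
  rw [← mul_pow, hc]
  calc k ^ s * (s + 2 * M).choose (2 * M) * s.factorial ^ 2
      = k ^ s * s.factorial * ((s + 2 * M).choose (2 * M) * s.factorial) := by ring
    _ ≤ k ^ s * s ^ s * ∏ i ∈ range s, (2 * M + 1 + i) := by
        rw [hc]
        gcongr
        exact Nat.factorial_le_pow s
    _ = ∏ i ∈ range s, (k * s * (2 * M + 1 + i)) := by
        rw [prod_mul_distrib, prod_const, card_range, mul_pow]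
    _ ≤ ∏ i ∈ range s, (M + 1 + i) ^ 2 := prod_le_prod' fun i _ => by nlinarith
    _ = _ := prod_pow _ _ _

end MultiplicityCount

section BoxFamily

open NumberField InfinitePlace Module
open scoped NNReal Pointwise

variable {K : Type*} [Field K] [NumberField K]

omit [NumberField K] in
theorem mult_eq_one_or_two (w : InfinitePlace K) : mult w = 1 ∨ mult w = 2 := by
  unfold mult
  split_ifs
  exacts [Or.inl rfl, Or.inr rfl]

/-- The shape `e` rescaled so that `∏ w, boxFn R q e w ^ mult w = R ^ n * q ^ (-2 * ∑ w, e w)`. -/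
noncomputable def boxFn (R q : ℝ≥0) (e : InfinitePlace K → ℕ) (w : InfinitePlace K) : ℝ≥0 :=
  R * q⁻¹ ^ ((3 - mult w) * e w)

theorem prod_boxFn (R q : ℝ≥0) (e : InfinitePlace K → ℕ) :
    ∏ w, boxFn R q e w ^ mult w = R ^ finrank ℚ K * q⁻¹ ^ (2 * ∑ w, e w) := by
  unfold boxFn
  rw [prod_scale, Finset.mul_sum, ← Finset.prod_pow_eq_pow_sum]
  refine congrArg _ (Finset.prod_congr rfl fun w _ => ?_)
  rw [← pow_mul]
  congr 1
  rcases mult_eq_one_or_two w with h | h <;> rw [h] <;> ring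

theorem prod_boxFn_eq {v q : ℝ≥0} (hq : q ≠ 0) {m : ℕ} {e : InfinitePlace K → ℕ}
    {j : ℕ} (he : ∑ w, e w = m * finrank ℚ K + j) :
    ∏ w, boxFn (v * q ^ (2 * m)) q e w ^ mult w = v ^ finrank ℚ K * q⁻¹ ^ (2 * j) := by
  rw [prod_boxFn, he, mul_pow, mul_add, pow_add, ← pow_mul, ← mul_assoc 2, mul_assoc (v ^ _),
    ← mul_assoc (q ^ _), ← mul_pow, mul_inv_cancel₀ hq, one_pow, one_mul]

omit [NumberField K] in
theorem boxFn_anti (R : ℝ≥0) {q : ℝ≥0} (hq : 1 ≤ q) (w : InfinitePlace K)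
    {e e' : InfinitePlace K → ℕ} (h : e w ≤ e' w) : boxFn R q e' w ≤ boxFn R q e w := by
  unfold boxFn
  gcongr R * ?_
  exact pow_le_pow_of_le_one zero_le (inv_le_one_of_one_le₀ hq) (Nat.mul_le_mul_left _ h)

omit [NumberField K] in
theorem intBox_mono {f g : InfinitePlace K → ℝ≥0} (h : ∀ w, f w ≤ g w) : intBox K f ⊆ intBox K g :=
  fun _ ha w => (ha w).trans (NNReal.coe_le_coe.2 (h w))

theorem card_infinitePlace_bounds :
    Fintype.card (InfinitePlace K) ≤ finrank ℚ K ∧ finrank ℚ K ≤ 2 * Fintype.card (InfinitePlace K) := by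
  rw [← InfinitePlace.sum_mult_eq, Fintype.card_eq_sum_ones, Finset.mul_sum]
  constructor <;> refine Finset.sum_le_sum fun w _ => ?_ <;>
    rcases mult_eq_one_or_two w with h | h <;> omega

set_option maxHeartbeats 1000000 in
/-- In number fields of bounded root discriminant there are finite sets of integers, bounded at all
infinite places, with few sums and few products. -/
theorem exists_set_few_sums_products {D : ℕ} (hD : 1 ≤ D) : ∃ R : ℕ, 1 ≤ R ∧
    ∀ (K : Type) [Field K] [NumberField K], 4 ≤ finrank ℚ K →
      (discr K).natAbs ≤ D ^ finrank ℚ K → ∃ A : Set (𝓞 K), A ⊆ intBox K (fun _ => R) ∧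
        2 ^ finrank ℚ K ≤ A.ncard ∧ 2 ^ finrank ℚ K * (A + A).ncard ≤ A.ncard ^ 2 ∧
        2 ^ finrank ℚ K * (A * A).ncard ≤ A.ncard ^ 2 := by
  classical
  obtain ⟨q, hq⟩ : ∃ q : ℕ, q = 48 * D := ⟨_, rfl⟩
  obtain ⟨k, hk⟩ : ∃ k : ℕ, k = (11 * q ^ 2) ^ 4 := ⟨_, rfl⟩
  obtain ⟨t, ht⟩ : ∃ t : ℕ, t = 22 * q ^ (2 * (2 * k)) := ⟨_, rfl⟩
  obtain ⟨R, hR⟩ : ∃ R : ℕ, R = q ^ 2 * t * q ^ (2 * (2 * k)) := ⟨_, rfl⟩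
  have hq1 : 1 ≤ q := by omega
  have hQ1 : 1 ≤ q ^ (2 * (2 * k)) := Nat.one_le_pow _ _ hq1
  have ht1 : 22 ≤ t := by omega
  have ht0 : 0 < t := by omega
  have hR1 : 1 ≤ R := by
    rw [hR]
    exact Nat.succ_le_of_lt (by positivity)
  refine ⟨R, hR1, fun K _ _ hn hdisc => ?_⟩
  set n := finrank ℚ K with hndef
  obtain ⟨hr₁, hr₂⟩ := card_infinitePlace_bounds (K := K)
  obtain ⟨s, hs⟩ : ∃ s, Fintype.card (InfinitePlace K) = s + 1 := ⟨_, (Nat.succ_pred_eq_of_pos Fintype.card_pos).symm⟩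
  have hqN : (1 : ℝ≥0) ≤ q := by exact_mod_cast hq1
  have hq0 : (q : ℝ≥0) ≠ 0 := (zero_lt_one.trans_le hqN).ne'
  have hRN : (R : ℝ≥0) = ((q : ℝ≥0) ^ 2 * t) * q ^ (2 * (2 * k)) := by
    rw [hR]
    push_cast
    rfl
  have hpos : ∀ {R' : ℝ≥0}, 0 < R' → ∀ e (w : InfinitePlace K), 0 < boxFn R' q e w :=
    fun hR' e w => mul_pos hR' (pow_pos (inv_pos.2 (zero_lt_one.trans_le hqN)) _)
  have hR0 : (0 : ℝ≥0) < R := by exact_mod_cast hR1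
  let B : (InfinitePlace K → ℕ) → Finset (𝓞 K) := fun e => (intBox_finite (boxFn R q e)).toFinset
  have hB : ∀ {e a}, a ∈ B e ↔ a ∈ intBox K (boxFn R q e) := by simp [B]
  have hBc : ∀ e, (B e).card = (intBox K (boxFn R q e)).ncard := fun e =>
    (Set.ncard_eq_toFinset_card _ (intBox_finite _)).symm
  set E := Finset.piAntidiag (Finset.univ : Finset (InfinitePlace K)) (2 * k * n)
  have hlow := card_piAntidiag_mul_le hr₁ B (M := 2 * k * n) (x := ((12 * q * t : ℕ) : ℝ≥0) ^ n)
    (y := (3 * (t : ℝ≥0)) ^ n)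
    (fun e e' h a ha => hB.2 (intBox_mono (fun w => boxFn_anti _ hqN w (h w)) (hB.1 ha)))
    (fun e e' a ha => hB.2 fun w => by
      rcases le_total (e w) (e' w) with h | h
      · rw [show boxFn (R : ℝ≥0) q (e ⊔ e') w = boxFn R q e' w by
          simp [boxFn, sup_eq_right.2 h]]
        exact hB.1 (Finset.mem_inter.1 ha).2 w
      · rw [show boxFn (R : ℝ≥0) q (e ⊔ e') w = boxFn R q e w by
          simp [boxFn, sup_eq_left.2 h]]
        exact hB.1 (Finset.mem_inter.1 ha).1 w) ?_ ?_
  rotate_left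
  · intro e he
    have h1 := le_ncard_intBox (boxFn (R : ℝ≥0) q e) (D := D) (by exact_mod_cast hD)
      (by exact_mod_cast hdisc)
    rw [hRN, prod_boxFn_eq hq0 (he.trans (add_zero _).symm), ← hRN, mul_zero, pow_zero, mul_one,
      ← hBc, ← hndef] at h1
    norm_cast at h1 ⊢
    refine Nat.le_of_mul_le_mul_left (h1.trans' ?_) (by positivity : 0 < (2 * D) ^ n)
    calc (2 * D) ^ n * ((12 * q * t) ^ n + 4 ^ n * (3 * t) ^ n)
        ≤ (2 * D) ^ n * ((12 * q * t) ^ n + (12 * q * t) ^ n) := by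
          rw [← mul_pow 4]
          refine Nat.mul_le_mul_left _ (Nat.add_le_add_left (Nat.pow_le_pow_left ?_ n) _)
          calc 4 * (3 * t) = 12 * 1 * t := by ring
            _ ≤ 12 * q * t := by gcongr
      _ = (2 * D) ^ n * (2 ^ 1 * (12 * q * t) ^ n) := by ring
      _ ≤ (2 * D) ^ n * (2 ^ n * (12 * q * t) ^ n) := by gcongr <;> omega
      _ = (q ^ 2 * t) ^ n := by
          rw [← mul_pow, ← mul_pow, hq]
          congr 1
          ring
  · intro e he
    rw [hBc]
    refine ncard_intBox_le (hpos hR0 e) (by exact_mod_cast (by omega : 1 ≤ t)) ?_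
    rw [hRN, prod_boxFn_eq hq0 he, ← hndef, pow_mul, ← mul_pow]
    refine pow_le_pow_left₀ zero_le (le_of_eq ?_) _
    rw [inv_pow]
    field_simp
  set A := E.biUnion B with hA
  have hlow' : E.card * (12 * q * t) ^ n ≤ 16 ^ n * A.card := by exact_mod_cast hlow
  have hE1 : 1 ≤ E.card := by
    rw [card_piAntidiag_univ]
    exact Nat.choose_pos (by omega)
  have hAR : ∀ a ∈ A, a ∈ intBox K fun _ => (R : ℝ≥0) := fun a ha => by
    obtain ⟨e, -, ha⟩ := Finset.mem_biUnion.1 ha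
    refine intBox_mono (fun w => ?_) (hB.1 ha)
    have := boxFn_anti (R : ℝ≥0) hqN w (e := 0) (e' := e) (Nat.zero_le _)
    rwa [show boxFn (R : ℝ≥0) q 0 w = R by simp [boxFn]] at this
  have hA1 : (12 * q * t) ^ n ≤ 16 ^ n * A.card :=
    (Nat.le_mul_of_pos_left _ hE1).trans hlow'
  have hA2 : ((12 * q * t) ^ 2) ^ n ≤ 256 ^ n * A.card ^ 2 := by
    calc _ = ((12 * q * t) ^ n) ^ 2 := pow_right_comm _ _ _
      _ ≤ (16 ^ n * A.card) ^ 2 := Nat.pow_le_pow_left hA1 2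
      _ = _ := by rw [mul_pow, ← pow_mul, mul_comm n, pow_mul]; norm_num
  refine ⟨A, hAR, ?_, ?_, ?_⟩
  · rw [Set.ncard_coe_finset]
    refine Nat.le_of_mul_le_mul_left (hA1.trans' ?_) (by positivity : 0 < 16 ^ n)
    rw [← mul_pow]
    refine Nat.pow_le_pow_left ?_ n
    calc 16 * 2 ≤ 12 * 1 * 22 := by norm_num
      _ ≤ 12 * q * t := by gcongr
  · have hsub : (A + A : Set (𝓞 K)) ⊆ intBox K fun _ => 2 * (R : ℝ≥0) := by
      rintro _ ⟨a, ha, b, hb, rfl⟩ w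
      refine (w.1.add_le (a : K) b).trans ((add_le_add (hAR a ha w) (hAR b hb w)).trans_eq ?_)
      push_cast
      ring
    have hle := ncard_intBox_le (K := K) (f := fun _ => 2 * (R : ℝ≥0)) (c := 2 * (R : ℝ≥0))
      (fun _ => by positivity) (by exact_mod_cast (by omega : 1 ≤ 2 * R)) (by
        rw [Finset.prod_pow_eq_pow_sum, InfinitePlace.sum_mult_eq])
    have hle' : (A + A : Set (𝓞 K)).ncard ≤ (3 * (2 * R)) ^ n :=
      (Set.ncard_le_ncard hsub (intBox_finite _)).trans (by exact_mod_cast hle)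
    rw [Set.ncard_coe_finset]
    refine Nat.le_of_mul_le_mul_left (hA2.trans' ?_) (by positivity : 0 < 256 ^ n)
    calc _ ≤ 256 ^ n * (2 ^ n * (3 * (2 * R)) ^ n) := by gcongr
      _ = (256 * (2 * (3 * (2 * R)))) ^ n := by rw [← mul_pow, ← mul_pow]
      _ ≤ _ := Nat.pow_le_pow_left ?_ n
    rw [hR]
    calc _ = 3072 * (q ^ 2 * t * q ^ (2 * (2 * k))) := by ring
      _ ≤ 3168 * (q ^ 2 * t * q ^ (2 * (2 * k))) := Nat.mul_le_mul_right _ (by norm_num)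
      _ = 144 * q ^ 2 * t * (22 * q ^ (2 * (2 * k))) := by ring
      _ = _ := by rw [← ht]; ring
  · set E₂ := Finset.piAntidiag (Finset.univ : Finset (InfinitePlace K)) (2 * (2 * k * n))
    let B₂ : (InfinitePlace K → ℕ) → Finset (𝓞 K) := fun e =>
      (intBox_finite (boxFn (R ^ 2 : ℝ≥0) q e)).toFinset
    have hsub : (A * A : Set (𝓞 K)) ⊆ (E₂.biUnion B₂ : Finset (𝓞 K)) := by
      rintro _ ⟨a, ha, b, hb, rfl⟩
      obtain ⟨e, he, ha⟩ := Finset.mem_biUnion.1 ha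
      obtain ⟨e', he', hb⟩ := Finset.mem_biUnion.1 hb
      refine Finset.mem_biUnion.2 ⟨e + e', ?_, ?_⟩
      · rw [mem_piAntidiag_univ] at he he' ⊢
        simp only [Pi.add_apply]
        rw [Finset.sum_add_distrib, he, he', ← two_mul]
      · refine (Set.Finite.mem_toFinset _).2 fun w => ?_
        have h1 := hB.1 ha w
        have h2 := hB.1 hb w
        have h3 : boxFn (R ^ 2 : ℝ≥0) q (e + e') w = boxFn R q e w * boxFn R q e' w := by
          simp only [boxFn, Pi.add_apply]
          ring
        rw [h3, NNReal.coe_mul]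
        refine (map_mul w (a : K) b).trans_le ?_
        exact mul_le_mul h1 h2 (apply_nonneg _ _) NNReal.zero_le_coe
    have hB₂ : ∀ e ∈ E₂, (B₂ e).card ≤ (3 * (q ^ 2 * t) ^ 2) ^ n := fun e he => by
      rw [← Set.ncard_eq_toFinset_card _ (intBox_finite _)]
      have h1 := ncard_intBox_le (hpos (pow_pos hR0 2) e) (c := ((q : ℝ≥0) ^ 2 * t) ^ 2)
        (by exact_mod_cast Nat.one_le_pow _ _ (by positivity)) (by
          have hR2 : (R : ℝ≥0) ^ 2 = ((q : ℝ≥0) ^ 2 * t) ^ 2 * q ^ (2 * (2 * (2 * k))) := by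
            rw [hRN]
            ring
          rw [hR2, prod_boxFn_eq hq0 (j := 0) (by
            rw [mem_piAntidiag_univ.1 he, ← hndef]; ring)]
          simp)
      exact_mod_cast h1
    have hAA : (A * A : Set (𝓞 K)).ncard ≤ E₂.card * (3 * (q ^ 2 * t) ^ 2) ^ n := by
      refine (Set.ncard_le_ncard hsub (Finset.finite_toSet _)).trans ?_
      rw [Set.ncard_coe_finset]
      exact Finset.card_biUnion_le_card_mul _ _ _ hB₂
    have hEE : k ^ s * E₂.card ≤ E.card ^ 2 := by
      rw [card_piAntidiag_univ, card_piAntidiag_univ, hs,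
        show s + 1 + 2 * (2 * k * n) - 1 = s + 2 * (2 * k * n) by omega,
        show s + 1 + 2 * k * n - 1 = s + 2 * k * n by omega]
      refine pow_mul_choose_le k s _ ?_
      gcongr
      omega
    have hks : (11 * q ^ 2) ^ n ≤ k ^ s := by
      rw [hk, ← pow_mul]
      exact Nat.pow_le_pow_right (by positivity) (by omega)
    rw [Set.ncard_coe_finset]
    refine Nat.le_of_mul_le_mul_left ?_ (by positivity : 0 < 256 ^ n)
    calc 256 ^ n * (2 ^ n * (A * A : Set (𝓞 K)).ncard)
        ≤ 256 ^ n * (2 ^ n * (E₂.card * (3 * (q ^ 2 * t) ^ 2) ^ n)) := by gcongr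
      _ = (256 * (2 * (3 * (q ^ 2 * t) ^ 2))) ^ n * E₂.card := by
          rw [mul_pow 256, mul_pow 2]
          ring
      _ ≤ ((11 * q ^ 2) * (12 * q * t) ^ 2) ^ n * E₂.card := by
          refine Nat.mul_le_mul_right _ (Nat.pow_le_pow_left ?_ n)
          calc _ = 1536 * (q ^ 4 * t ^ 2) := by ring
            _ ≤ 1584 * (q ^ 4 * t ^ 2) := Nat.mul_le_mul_right _ (by norm_num)
            _ = _ := by ring
      _ = (11 * q ^ 2) ^ n * E₂.card * ((12 * q * t) ^ n) ^ 2 := by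
          rw [mul_pow, ← pow_mul, ← pow_mul, mul_comm 2 n]
          ring
      _ ≤ E.card ^ 2 * ((12 * q * t) ^ n) ^ 2 := by
          gcongr
          exact (Nat.mul_le_mul_right _ hks).trans hEE
      _ = (E.card * (12 * q * t) ^ n) ^ 2 := (mul_pow _ _ _).symm
      _ ≤ (16 ^ n * A.card) ^ 2 := Nat.pow_le_pow_left hlow' 2
      _ = 256 ^ n * A.card ^ 2 := by
          rw [mul_pow, ← pow_mul, mul_comm n, pow_mul]
          norm_num

end BoxFamily

section Transfer

open NumberField InfinitePlace Module
open scoped NNReal Pointwise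

theorem injOn_of_intBox {K : Type*} [Field K] [NumberField K] {p R : ℕ} [Fact p.Prime]
    (φ : 𝓞 K →+* ZMod p) (h : (2 * R) ^ finrank ℚ K < p) : Set.InjOn φ (intBox K fun _ => R) := by
  intro a ha b hb hab
  by_contra hne
  have h0 : φ ((Algebra.norm ℤ (a - b)).natAbs : 𝓞 K) = 0 := by
    have h1 := Ideal.absNorm_mem (Ideal.span {a - b})
    rw [Ideal.absNorm_span_singleton] at h1
    obtain ⟨c, hc⟩ := Ideal.mem_span_singleton.1 h1
    rw [hc, map_mul, map_sub, hab, sub_self, zero_mul]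
  rw [map_natCast, ZMod.natCast_eq_zero_iff] at h0
  have h1 : (Algebra.norm ℤ (a - b)).natAbs ≠ 0 :=
    Int.natAbs_ne_zero.2 (Algebra.norm_ne_zero_iff.2 (sub_ne_zero.2 hne))
  have h2 : (((Algebra.norm ℤ (a - b)).natAbs : ℚ) : ℝ) ≤ (2 * R) ^ finrank ℚ K := by
    rw [Nat.cast_natAbs, Int.cast_abs, Algebra.coe_norm_int, ← InfinitePlace.prod_eq_abs_norm,
      ← InfinitePlace.sum_mult_eq, ← Finset.prod_pow_eq_pow_sum]
    refine Finset.prod_le_prod (fun w _ => pow_nonneg (apply_nonneg _ _) _) fun w _ =>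
      pow_le_pow_left₀ (apply_nonneg _ _) ?_ _
    have h3 := ha w
    have h4 := hb w
    rw [NNReal.coe_natCast] at h3 h4
    refine (map_sub_le_add w.1 (a : K) b).trans ((add_le_add h3 h4).trans_eq (two_mul _).symm)
  have h3 : (Algebra.norm ℤ (a - b)).natAbs ≤ (2 * R) ^ finrank ℚ K := by exact_mod_cast h2
  exact absurd (Nat.le_of_dvd (Nat.pos_of_ne_zero h1) h0) (by omega)

/-- The sets of `exists_set_few_sums_products`, reduced modulo a prime of degree one. -/
theorem exists_zmod_set : ∃ X N₀ p₀ : ℕ, 3 ≤ X ∧ ∀ (p : ℕ) [Fact p.Prime], p₀ ≤ p → ∀ N, N₀ ≤ N →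
    X ^ 2 ^ (N + 2) < p → ∃ (n : ℕ) (A : Set (ZMod p)), 2 ^ N ≤ n ∧ n ≤ 2 ^ (N + 2) ∧
      2 ^ n ≤ A.ncard ∧ A.ncard ≤ X ^ n ∧ 2 ^ n * (A + A).ncard ≤ A.ncard ^ 2 ∧
      2 ^ n * (A * A).ncard ≤ A.ncard ^ 2 := by
  obtain ⟨D, N₀, p₀, h⟩ := exists_split_field
  obtain ⟨R, hR, hK⟩ := exists_set_few_sums_products (Nat.succ_pos D)
  refine ⟨3 * R, max N₀ 2, p₀, by omega, fun p _ hp N hN hXp => ?_⟩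
  obtain ⟨K, _, _, ⟨φ⟩, h1, h2, h3⟩ := h p hp N (le_of_max_le_left hN)
  have hn4 : 4 ≤ finrank ℚ K :=
    (Nat.pow_le_pow_right two_pos (le_of_max_le_right hN)).trans h1
  obtain ⟨A, hA, hA1, hA2, hA3⟩ := hK K hn4 (h3.trans (Nat.pow_le_pow_left (Nat.le_succ D) _))
  have hfin : A.Finite := (intBox_finite _).subset hA
  have hinj : Set.InjOn φ A := (injOn_of_intBox φ (lt_of_le_of_lt ?_ hXp)).mono hA
  · refine ⟨finrank ℚ K, φ '' A, h1, h2, ?_⟩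
    rw [hinj.ncard_image, ← Set.image_add, ← Set.image_mul]
    refine ⟨hA1, ?_, (Nat.mul_le_mul_left _ (Set.ncard_image_le (hfin.add hfin))).trans hA2,
      (Nat.mul_le_mul_left _ (Set.ncard_image_le (hfin.mul hfin))).trans hA3⟩
    have hle := ncard_intBox_le (K := K) (f := fun _ => (R : ℝ≥0)) (c := R)
      (fun _ => by exact_mod_cast hR) (by exact_mod_cast hR) (by
        rw [Finset.prod_pow_eq_pow_sum, InfinitePlace.sum_mult_eq])
    exact (Set.ncard_le_ncard hA (intBox_finite _)).trans (by exact_mod_cast hle)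
  · exact (Nat.pow_le_pow_left (by omega) _).trans (Nat.pow_le_pow_right (by omega) h2)

theorem exists_pow_two_pow_between {X y : ℝ} (hX : 1 < X) {N₁ : ℕ} (h : X ^ 2 ^ (N₁ + 2) < y) :
    ∃ N, N₁ ≤ N ∧ X ^ 2 ^ (N + 2) < y ∧ y ≤ X ^ 2 ^ (N + 3) := by
  classical
  have hex : ∃ j, y ≤ X ^ 2 ^ (N₁ + j + 3) := by
    obtain ⟨j, hj⟩ := pow_unbounded_of_one_lt y hX
    exact ⟨j, hj.le.trans (pow_le_pow_right₀ hX.le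
      ((by omega : j ≤ N₁ + j + 3).trans Nat.lt_two_pow_self.le))⟩
  refine ⟨N₁ + Nat.find hex, Nat.le_add_right _ _, ?_, Nat.find_spec hex⟩
  rcases hj : Nat.find hex with - | j
  · exact h
  · exact not_le.1 (Nat.find_min hex (m := j) (by omega))

end Transfer

/-- There exist constants `c > 0` and `f < 1` such that for each `δ ∈ (0,1)`, for each
prime `p` sufficiently large depending on `δ`, there exists `A ⊆ 𝔽_p` with
`p^{fδ} < |A| < p^δ` and `max(|A+A|, |AA|) ≤ |A|^{2-c}`. -/
theorem statement8 :
    ∃ c f : ℝ, 0 < c ∧ 0 < f ∧ f < 1 ∧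
      ∀ δ : ℝ, 0 < δ → δ < 1 →
        ∃ p₀ : ℕ, ∀ p : ℕ, p.Prime → p₀ ≤ p →
          ∃ A : Set (ZMod p),
            (p : ℝ) ^ (f * δ) < (A.ncard : ℝ) ∧ (A.ncard : ℝ) < (p : ℝ) ^ δ ∧
            max ((A + A).ncard : ℝ) ((A * A).ncard : ℝ) ≤ (A.ncard : ℝ) ^ ((2 : ℝ) - c) := by
  obtain ⟨X, N₀, p₀, hX, h⟩ := exists_zmod_set
  have hX3 : (3 : ℝ) ≤ X := by exact_mod_cast hX
  have hX0 : (0 : ℝ) < X := by linarith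
  have hX1 : (1 : ℝ) < X := by linarith
  have hl : 0 < Real.log X := Real.log_pos hX1
  obtain ⟨c, hc⟩ : ∃ c, c = Real.log 2 / Real.log X := ⟨_, rfl⟩
  have hc0 : 0 < c := hc ▸ div_pos (Real.log_pos one_lt_two) hl
  have hc1 : c < 1 := by
    rw [hc, div_lt_one hl]
    exact Real.log_lt_log two_pos (by linarith)
  have hXc : (X : ℝ) ^ c = 2 := by
    rw [Real.rpow_def_of_pos hX0, hc, mul_div_cancel₀ _ hl.ne', Real.exp_log two_pos]
  refine ⟨c, c / 9, hc0, by positivity, by linarith, fun δ hδ0 hδ1 => ?_⟩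
  obtain ⟨p₁, hp₁⟩ := Filter.eventually_atTop.1
    (((tendsto_rpow_atTop hδ0).comp tendsto_natCast_atTop_atTop).eventually_gt_atTop
      ((X : ℝ) ^ 2 ^ (N₀ + 2)))
  refine ⟨max p₀ p₁, fun p hp hpp => ?_⟩
  have := Fact.mk hp
  obtain ⟨y, hy⟩ : ∃ y, y = (p : ℝ) ^ δ := ⟨_, rfl⟩
  obtain ⟨N, hN, hlt, hle⟩ := exists_pow_two_pow_between hX1 (hp₁ p (le_of_max_le_right hpp))
  simp only [Function.comp_apply, ← hy] at hlt hle
  have hp1 : (1 : ℝ) < p := by exact_mod_cast hp.one_lt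
  have hy1 : 1 < y := hy ▸ Real.one_lt_rpow hp1 hδ0
  have hyp : y ≤ p := by
    rw [hy]
    exact (Real.rpow_le_rpow_of_exponent_le hp1.le hδ1.le).trans_eq (Real.rpow_one _)
  obtain ⟨n, A, hn1, hn2, hA1, hA2, hA3, hA4⟩ := h p (le_of_max_le_left hpp) N hN
    (by exact_mod_cast hlt.trans_le hyp)
  have hA1' : (2 : ℝ) ^ n ≤ A.ncard := by exact_mod_cast hA1
  have hA2' : (A.ncard : ℝ) ≤ X ^ n := by exact_mod_cast hA2
  have ha0 : (0 : ℝ) < A.ncard := (by positivity : (0 : ℝ) < 2 ^ n).trans_le hA1'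
  have hac : (A.ncard : ℝ) ^ c ≤ 2 ^ n := by
    refine (Real.rpow_le_rpow ha0.le hA2' hc0.le).trans_eq ?_
    rw [← Real.rpow_natCast, ← Real.rpow_mul hX0.le, mul_comm, Real.rpow_mul hX0.le, hXc,
      Real.rpow_natCast]
  have hfin : ∀ S : ℕ, 2 ^ n * S ≤ A.ncard ^ 2 → (S : ℝ) ≤ (A.ncard : ℝ) ^ (2 - c) := by
    intro S hS
    rw [Real.rpow_sub ha0, le_div_iff₀ (Real.rpow_pos_of_pos ha0 c), Real.rpow_two]
    have hS' : (2 : ℝ) ^ n * S ≤ (A.ncard : ℝ) ^ 2 := by exact_mod_cast hS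
    exact (mul_le_mul_of_nonneg_left hac S.cast_nonneg).trans ((mul_comm _ _).trans_le hS')
  refine ⟨A, ?_, ?_, max_le (hfin _ hA3) (hfin _ hA4)⟩
  · calc (p : ℝ) ^ (c / 9 * δ) = y ^ (c / 9) := by
          rw [hy, ← Real.rpow_mul (by linarith), mul_comm]
      _ < y ^ (c / 8) := Real.rpow_lt_rpow_of_exponent_lt hy1 (by linarith)
      _ ≤ ((X : ℝ) ^ 2 ^ (N + 3)) ^ (c / 8) :=
          Real.rpow_le_rpow (by linarith) hle (by positivity)
      _ = 2 ^ 2 ^ N := by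
          rw [← Real.rpow_natCast, ← Real.rpow_mul hX0.le,
            show ((2 ^ (N + 3) : ℕ) : ℝ) * (c / 8) = c * (2 ^ N : ℕ) by push_cast; ring,
            Real.rpow_mul hX0.le, hXc, Real.rpow_natCast]
      _ ≤ 2 ^ n := pow_le_pow_right₀ one_le_two hn1
      _ ≤ A.ncard := hA1'
  · rw [← hy]
    exact (hA2'.trans (pow_le_pow_right₀ hX1.le hn2)).trans_lt hlt
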